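/- Let n, m ≥ 1 be integers, p, q ∈ ℂ with 0 < |p| < 1, 0 < |q| < 1, let s ∈ ℂ satisfy s² = pq, and let t₁, …, t_{2n+2m+4} ∈ ℂ satisfy |pq|^{1/2} < |t_j| < 1 for all j and ∏_{j=1}^{2n+2m+4} t_j = (pq)^{m+1}. Then I_n^{(m)}(t₁, …, t_{2n+2m+4}) = ∏_{1≤r<s'≤2n+2m+4} Γ(t_r t_{s'};p,q) · I_m^{(n)}(s/t₁, …, s/t_{2n+2m+4}). -/

import Mathlib

open scoped BigOperators

/-- The infinite q-Pochhammer symbol `(x;p)_∞ = ∏_{j≥0} (1 - x p^j)`. -/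
noncomputable def pochInf (x p : ℂ) : ℂ := ∏' j : ℕ, (1 - x * p ^ j)

/-- The elliptic gamma function `Γ(z;p,q)`. -/
noncomputable def ellGamma (z p q : ℂ) : ℂ :=
  ∏' jk : ℕ × ℕ, (1 - z⁻¹ * p ^ (jk.1 + 1) * q ^ (jk.2 + 1)) / (1 - z * p ^ jk.1 * q ^ jk.2)

/-- The contour integral `(2πi)⁻¹ ∮_{𝕋} f(z) dz/z` over the positively oriented
unit circle. -/
noncomputable def circleInt (f : ℂ → ℂ) : ℂ :=
  (2 * (Real.pi : ℂ) * Complex.I)⁻¹ * ∮ z in C(0, 1), f z / z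

/-- The iterated contour integral `∫_{𝕋^n} f ∏_{j=1}^n dz_j/(2πi z_j)`. -/
noncomputable def torusInt : (n : ℕ) → ((Fin n → ℂ) → ℂ) → ℂ
  | 0, f => f Fin.elim0
  | n + 1, f => circleInt fun z => torusInt n fun w => f (Fin.cons z w)

/-- The type I `BC_n` elliptic hypergeometric kernel `Δ_n(z;t;p,q)`. -/
noncomputable def deltaBC (p q : ℂ) {n L : ℕ} (t : Fin L → ℂ) (z : Fin n → ℂ) : ℂ :=
  (∏ ij ∈ Finset.univ.filter (fun ij : Fin n × Fin n => ij.1 < ij.2),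
      (ellGamma (z ij.1 * z ij.2) p q * ellGamma (z ij.1 * (z ij.2)⁻¹) p q *
        ellGamma ((z ij.1)⁻¹ * z ij.2) p q * ellGamma ((z ij.1)⁻¹ * (z ij.2)⁻¹) p q)⁻¹) *
  ∏ j, (∏ i, ellGamma (t i * z j) p q * ellGamma (t i * (z j)⁻¹) p q) /
      (ellGamma (z j ^ 2) p q * ellGamma ((z j)⁻¹ ^ 2) p q)

/-- The type I `BC_n` elliptic hypergeometric integral `I_n^{(m)}(t)`, where the
superscript is encoded in the number `L` of parameters. -/
noncomputable def rainsI (p q : ℂ) (n : ℕ) {L : ℕ} (t : Fin L → ℂ) : ℂ :=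
  pochInf p p ^ n * pochInf q q ^ n / (2 ^ n * (n.factorial : ℂ)) *
    torusInt n (deltaBC p q t)

namespace Rains
open Filter Topology Set

/-- Double product `∏ (1 - z p^j q^k)`. -/
noncomputable def EE (p q z : ℂ) : ℂ := ∏' jk : ℕ × ℕ, (1 - z * p ^ jk.1 * q ^ jk.2)

lemma summable_pq {p q : ℂ} (hp : ‖p‖ < 1) (hq : ‖q‖ < 1) (z : ℂ) :
    Summable (fun jk : ℕ × ℕ => ‖-(z * p ^ jk.1 * q ^ jk.2)‖) := by
  have h1 : Summable (fun j : ℕ => ‖p‖ ^ j) := summable_geometric_of_lt_one (norm_nonneg _) hp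
  have h2 : Summable (fun j : ℕ => ‖q‖ ^ j) := summable_geometric_of_lt_one (norm_nonneg _) hq
  have h3 := (h1.mul_of_nonneg h2 (fun j => by positivity) (fun j => by positivity)).mul_left ‖z‖
  refine h3.congr (fun x => ?_)
  simp [mul_assoc]

lemma EE_multipliable {p q : ℂ} (hp : ‖p‖ < 1) (hq : ‖q‖ < 1) (z : ℂ) :
    Multipliable (fun jk : ℕ × ℕ => (1 - z * p ^ jk.1 * q ^ jk.2)) := by
  have := multipliable_one_add_of_summable (summable_pq hp hq z)
  simpa [sub_eq_add_neg] using this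

lemma EE_ne_zero {p q : ℂ} (hp : ‖p‖ < 1) (hq : ‖q‖ < 1) {z : ℂ}
    (h : ∀ j k : ℕ, z * p ^ j * q ^ k ≠ 1) : EE p q z ≠ 0 := by
  have := tprod_one_add_ne_zero_of_summable (f := fun jk : ℕ × ℕ => -(z * p ^ jk.1 * q ^ jk.2))
    (fun i => by
      have := h i.1 i.2
      intro h0
      apply this
      linear_combination -h0) (summable_pq hp hq z)
  simpa [EE, sub_eq_add_neg] using this

lemma EE_eq_zero {p q z : ℂ} {j k : ℕ} (h : z * p ^ j * q ^ k = 1) : EE p q z = 0 := by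
  apply tprod_of_exists_eq_zero
  exact ⟨(j, k), by simp [h]⟩

lemma EE_comm (p q z : ℂ) : EE p q z = EE q p z := by
  unfold EE
  rw [← (Equiv.prodComm ℕ ℕ).tprod_eq]
  apply tprod_congr
  intro b
  simp only [Equiv.prodComm_apply, Prod.fst_swap, Prod.snd_swap]
  ring

lemma norm_mul_pow_lt {p q z : ℂ} (hp : ‖p‖ < 1) (hq : ‖q‖ < 1) (hz : ‖z‖ < 1) (j k : ℕ) :
    ‖z * p ^ j * q ^ k‖ < 1 := by
  rw [norm_mul, norm_mul, norm_pow, norm_pow]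
  have h1 : ‖p‖ ^ j ≤ 1 := pow_le_one₀ (norm_nonneg _) hp.le
  have h2 : ‖q‖ ^ k ≤ 1 := pow_le_one₀ (norm_nonneg _) hq.le
  calc ‖z‖ * ‖p‖ ^ j * ‖q‖ ^ k ≤ ‖z‖ * 1 * 1 := by gcongr
    _ < 1 := by simpa using hz

lemma EE_ne_zero_of_lt {p q : ℂ} (hp : ‖p‖ < 1) (hq : ‖q‖ < 1) {z : ℂ} (hz : ‖z‖ < 1) :
    EE p q z ≠ 0 := by
  apply EE_ne_zero hp hq
  intro j k h
  have := norm_mul_pow_lt hp hq hz j k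
  rw [h] at this
  simp at this

lemma pochInf_eq_EE (p z : ℂ) : pochInf z p = EE p 0 z := by
  unfold pochInf EE
  have hinj : Function.Injective (fun j : ℕ => (j, 0) : ℕ → ℕ × ℕ) := by
    intro a b h
    simpa using h
  rw [← hinj.tprod_eq (f := fun jk : ℕ × ℕ => 1 - z * p ^ jk.1 * (0:ℂ) ^ jk.2)]
  · simp
  · rintro ⟨j, k⟩ hjk
    rcases Nat.eq_zero_or_pos k with hk | hk
    · exact ⟨j, by simp [hk]⟩
    · exfalso
      apply hjk
      simp [hk.ne']

lemma poch_multipliable {p : ℂ} (hp : ‖p‖ < 1) (z : ℂ) :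
    Multipliable (fun j : ℕ => (1 - z * p ^ j)) := by
  have h1 : Summable (fun j : ℕ => ‖-(z * p ^ j)‖) := by
    have h1 : Summable (fun j : ℕ => ‖p‖ ^ j) := summable_geometric_of_lt_one (norm_nonneg _) hp
    refine (h1.mul_left ‖z‖).congr (fun x => by simp)
  have := multipliable_one_add_of_summable h1
  simpa [sub_eq_add_neg] using this

lemma poch_ne_zero {p : ℂ} (hp : ‖p‖ < 1) {z : ℂ} (h : ∀ j : ℕ, z * p ^ j ≠ 1) :
    pochInf z p ≠ 0 := by
  rw [pochInf_eq_EE]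
  apply EE_ne_zero hp (by simp)
  intro j k
  rcases Nat.eq_zero_or_pos k with hk | hk
  · simpa [hk] using h j
  · simp [hk.ne']

lemma poch_ne_zero_of_lt {p : ℂ} (hp : ‖p‖ < 1) {z : ℂ} (hz : ‖z‖ < 1) :
    pochInf z p ≠ 0 := by
  rw [pochInf_eq_EE]
  exact EE_ne_zero_of_lt hp (by simp) hz

lemma poch_eq_zero {p z : ℂ} {j : ℕ} (h : z * p ^ j = 1) : pochInf z p = 0 := by
  apply tprod_of_exists_eq_zero
  exact ⟨j, by simp [h]⟩

lemma poch_zero (p : ℂ) : pochInf 0 p = 1 := by simp [pochInf]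

lemma poch_shift {p : ℂ} (hp : ‖p‖ < 1) (z : ℂ) :
    pochInf z p = (1 - z) * pochInf (p * z) p := by
  unfold pochInf
  rw [tprod_eq_zero_mul']
  · simp only [pow_zero, mul_one]
    congr 1
    apply tprod_congr
    intro j
    ring
  · refine (poch_multipliable hp (p * z)).congr (fun j => by ring)

lemma EE_shift_q {p q : ℂ} (hp : ‖p‖ < 1) (hq : ‖q‖ < 1) (z : ℂ) :
    EE p q z = pochInf z p * EE p q (q * z) := by
  have hm := EE_multipliable hp hq z
  have h0 : ∀ b : ℕ × ℕ, b ∈ (Set.range (fun j : ℕ => (j, 0) : ℕ → ℕ × ℕ))ᶜ ↔ b.2 ≠ 0 := by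
    rintro ⟨j, k⟩
    simp
    tauto
  have key : ∀ b : ℕ × ℕ, (1 - z * p ^ b.1 * q ^ b.2) =
      (1 - z * p ^ b.1 * (0:ℂ) ^ b.2) * (if b.2 = 0 then 1 else (1 - z * p ^ b.1 * q ^ b.2)) := by
    intro b
    by_cases hb : b.2 = 0
    · simp [hb]
    · simp [hb]
  have hinj : Function.Injective (fun b => (b.1, b.2 + 1) : ℕ × ℕ → ℕ × ℕ) := by
    rintro ⟨a, b⟩ ⟨c, d⟩ h
    simpa using h
  have hsupp : ∀ b ∉ Set.range (fun b => (b.1, b.2 + 1) : ℕ × ℕ → ℕ × ℕ),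
      (if b.2 = 0 then (1:ℂ) else (1 - z * p ^ b.1 * q ^ b.2)) = 1 := by
    rintro ⟨j, k⟩ hjk
    rcases Nat.eq_zero_or_pos k with hk | hk
    · simp [hk]
    · exfalso
      apply hjk
      exact ⟨(j, k - 1), by simp; omega⟩
  have hcomp : ∀ b : ℕ × ℕ, (if (b.1, b.2 + 1).2 = 0 then (1:ℂ) else
      (1 - z * p ^ (b.1, b.2 + 1).1 * q ^ (b.1, b.2 + 1).2)) = 1 - q * z * p ^ b.1 * q ^ b.2 := by
    intro b
    simp
    ring
  have hm2 : Multipliable (fun b : ℕ × ℕ => if b.2 = 0 then (1:ℂ) else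
      (1 - z * p ^ b.1 * q ^ b.2)) := by
    rw [← hinj.multipliable_iff hsupp]
    refine (EE_multipliable hp hq (q * z)).congr (fun b => ?_)
    exact (hcomp b).symm
  have e1 : EE p q z = EE p 0 z * ∏' b : ℕ × ℕ, (if b.2 = 0 then (1:ℂ) else
      (1 - z * p ^ b.1 * q ^ b.2)) := by
    unfold EE
    rw [← Multipliable.tprod_mul (EE_multipliable hp (by simp) z) hm2]
    exact tprod_congr key
  rw [e1, pochInf_eq_EE]
  congr 1
  unfold EE
  rw [← hinj.tprod_eq (f := fun b : ℕ × ℕ => (if b.2 = 0 then (1:ℂ) else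
      (1 - z * p ^ b.1 * q ^ b.2)))]
  · exact tprod_congr hcomp
  · intro b hb
    by_contra hcon
    exact hb (hsupp b hcon)

lemma EE_shift_p {p q : ℂ} (hp : ‖p‖ < 1) (hq : ‖q‖ < 1) (z : ℂ) :
    EE p q z = pochInf z q * EE p q (p * z) := by
  rw [EE_comm, EE_shift_q hq hp, EE_comm q p]

lemma ellGamma_eq {p q : ℂ} (hp : ‖p‖ < 1) (hq : ‖q‖ < 1) (z : ℂ) :
    ellGamma z p q = EE p q (p * q / z) / EE p q z := by
  by_cases h : ∀ j k : ℕ, z * p ^ j * q ^ k ≠ 1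
  · have h1 := (EE_multipliable hp hq (p * q / z)).hasProd
    have h2 := (EE_multipliable hp hq z).hasProd
    have h3 : HasProd (fun jk : ℕ × ℕ => (1 - z⁻¹ * p ^ (jk.1 + 1) * q ^ (jk.2 + 1)) /
        (1 - z * p ^ jk.1 * q ^ jk.2)) (EE p q (p * q / z) / EE p q z) := by
      have := Tendsto.div h1 h2 (EE_ne_zero hp hq h)
      refine this.congr (fun s => ?_)
      rw [Pi.div_apply, ← Finset.prod_div_distrib]
      apply Finset.prod_congr rfl
      intro x _
      congr 2
      ring
    exact h3.tprod_eq
  · push Not at h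
    obtain ⟨j, k, h⟩ := h
    rw [EE_eq_zero h, div_zero]
    apply tprod_of_exists_eq_zero
    exact ⟨(j, k), by simp [h]⟩

/-- theta function -/
noncomputable def th (p z : ℂ) : ℂ := pochInf z p * pochInf (p / z) p
noncomputable def Th (p x z : ℂ) : ℂ := th p (x * z) * th p (x / z)
noncomputable def ps (p x z : ℂ) : ℂ := x⁻¹ * Th p x z
/-- elliptic gamma -/
noncomputable def Gm (p q z : ℂ) : ℂ := EE p q (p * q / z) / EE p q z

lemma th_p_div {p : ℂ} (z : ℂ) (hp0 : p ≠ 0) : th p (p / z) = th p z := by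
  unfold th
  rw [div_div_cancel₀ hp0, mul_comm]

lemma th_inv {p : ℂ} (hp : ‖p‖ < 1) {z : ℂ} (hz : z ≠ 0) : th p z⁻¹ = -z⁻¹ * th p z := by
  unfold th
  have h1 := poch_shift hp z
  have h2 := poch_shift hp z⁻¹
  rw [h1, h2]
  have : p / z⁻¹ = p * z := by simp
  rw [this, div_eq_mul_inv]
  field_simp
  ring

lemma th_mul_p {p : ℂ} (hp : ‖p‖ < 1) (hp0 : p ≠ 0) {z : ℂ} (hz : z ≠ 0) :
    th p (p * z) = -z⁻¹ * th p z := by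
  rw [← th_inv hp hz, ← th_p_div z⁻¹ hp0]
  simp

lemma th_div_p {p : ℂ} (hp : ‖p‖ < 1) (hp0 : p ≠ 0) {z : ℂ} (hz : z ≠ 0) :
    th p (z / p) = -(z / p) * th p z := by
  have := th_mul_p hp hp0 (z := z / p) (div_ne_zero hz hp0)
  rw [mul_div_cancel₀ _ hp0] at this
  rw [this]
  field_simp

lemma th_one (p : ℂ) : th p 1 = 0 := by
  unfold th
  rw [poch_eq_zero (j := 0) (by simp)]
  simp

lemma th_ne_zero {p : ℂ} (hp : ‖p‖ < 1) {z : ℂ} (h1 : ∀ j : ℕ, z * p ^ j ≠ 1)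
    (h2 : ∀ j : ℕ, p ^ (j + 1) ≠ z) (hz : z ≠ 0) : th p z ≠ 0 := by
  unfold th
  refine mul_ne_zero (poch_ne_zero hp h1) (poch_ne_zero hp ?_)
  intro j h
  apply h2 j
  field_simp at h
  rw [← h]; ring

/-- nonvanishing of theta in the annulus -/
lemma th_ne_zero_of_lt {p : ℂ} (hp : ‖p‖ < 1) {z : ℂ} (h1 : ‖z‖ < 1) (h2 : ‖p‖ < ‖z‖) :
    th p z ≠ 0 := by
  unfold th
  refine mul_ne_zero (poch_ne_zero_of_lt hp h1) (poch_ne_zero_of_lt hp ?_)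
  rw [norm_div, div_lt_one (lt_of_le_of_lt (norm_nonneg _) h2)]
  exact h2

lemma th_ne_zero_of_norm_eq {p : ℂ} (hp : ‖p‖ < 1) {z : ℂ} (h1 : ‖z‖ = 1) (h2 : z ≠ 1) :
    th p z ≠ 0 := by
  have hz : z ≠ 0 := by intro h; simp [h] at h1
  refine th_ne_zero hp ?_ ?_ hz
  · intro j h
    have hn : ‖z * p ^ j‖ = 1 := by rw [h]; simp
    rw [norm_mul, h1, one_mul, norm_pow] at hn
    rcases Nat.eq_zero_or_pos j with hj | hj
    · subst hj; simp at h; exact h2 h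
    · have := pow_lt_one₀ (norm_nonneg p) hp hj.ne'
      linarith
  · intro j h
    have hn : ‖p ^ (j + 1)‖ = 1 := by rw [h, h1]
    rw [norm_pow] at hn
    have := pow_lt_one₀ (norm_nonneg p) hp (Nat.succ_ne_zero j)
    simp at this hn
    linarith

lemma Gm_comm (p q z : ℂ) : Gm p q z = Gm q p z := by
  unfold Gm
  rw [EE_comm p q, EE_comm p q, mul_comm p q]

lemma Gm_q {p q : ℂ} (hp : ‖p‖ < 1) (hq : ‖q‖ < 1) (hq0 : q ≠ 0) {z : ℂ}
    (hz : EE p q z ≠ 0) : Gm p q (q * z) = th p z * Gm p q z := by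
  unfold Gm th
  have h1 := EE_shift_q hp hq z
  have h2 := EE_shift_q hp hq (p / z)
  have e1 : p * q / (q * z) = p / z := by field_simp
  have e2 : q * (p / z) = p * q / z := by ring
  rw [e1, h2, e2]
  rw [h1] at hz ⊢
  have := left_ne_zero_of_mul hz
  have := right_ne_zero_of_mul hz
  field_simp

lemma Gm_p {p q : ℂ} (hp : ‖p‖ < 1) (hq : ‖q‖ < 1) (hp0 : p ≠ 0) {z : ℂ}
    (hz : EE p q z ≠ 0) : Gm p q (p * z) = th q z * Gm p q z := by
  rw [Gm_comm p q, Gm_comm p q, Gm_q hq hp hp0]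
  rwa [EE_comm]

lemma Gm_refl {p q : ℂ} {z : ℂ} (h0 : p * q ≠ 0)
    (hz : EE p q z ≠ 0) (hz' : EE p q (p * q / z) ≠ 0) :
    Gm p q z * Gm p q (p * q / z) = 1 := by
  unfold Gm
  rw [div_div_cancel₀ h0]
  field_simp

lemma Gm_ne_zero {p q : ℂ} {z : ℂ}
    (hz : EE p q z ≠ 0) (hz' : EE p q (p * q / z) ≠ 0) : Gm p q z ≠ 0 :=
  div_ne_zero hz' hz

lemma Gm_inv_mul {p q : ℂ} (hp : ‖p‖ < 1) (hq : ‖q‖ < 1) {x : ℂ} (hx : ‖x‖ = 1) :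
    (Gm p q x * Gm p q x⁻¹)⁻¹ = th p x * th q x⁻¹ := by
  have hx0 : x ≠ 0 := by intro h; simp [h] at hx
  have hpq : ‖p * q‖ < 1 := by
    rw [norm_mul]; exact mul_lt_one_of_nonneg_of_lt_one_left (norm_nonneg _) hp hq.le
  have h1 : EE p q (p * q * x) ≠ 0 := EE_ne_zero_of_lt hp hq (by rw [norm_mul, hx, mul_one]; exact hpq)
  have h2 : EE p q (p * q / x) ≠ 0 := EE_ne_zero_of_lt hp hq (by rw [norm_div, hx, div_one]; exact hpq)
  have a1 : EE p q x = pochInf x p * (pochInf (q * x) q * EE p q (p * q * x)) := by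
    rw [EE_shift_q hp hq x, EE_shift_p hp hq (q * x), ← mul_assoc p q x]
  have a2 : EE p q x⁻¹ = pochInf x⁻¹ q * (pochInf (p / x) p * EE p q (p * q / x)) := by
    rw [EE_shift_p hp hq x⁻¹, EE_shift_q hp hq (p * x⁻¹)]
    congr 3
    field_simp
  unfold Gm th
  rw [a1, a2]
  have e1 : p * q / x⁻¹ = p * q * x := by simp
  have e2 : q / x⁻¹ = q * x := by simp
  rw [e1, e2]
  field_simp

end Rains

namespace Rains
open Filter Topology Set

lemma EE_hasProdLU {α : Type*} [TopologicalSpace α] [LocallyCompactSpace α] {K : Set α} (hK : IsOpen K)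
    {a p q : α → ℂ} (ha : ContinuousOn a K) (hp : ContinuousOn p K) (hq : ContinuousOn q K)
    {A P Q : ℝ} (hA : ∀ x ∈ K, ‖a x‖ ≤ A) (hP : ∀ x ∈ K, ‖p x‖ ≤ P) (hQ : ∀ x ∈ K, ‖q x‖ ≤ Q)
    (hP0 : 0 ≤ P) (hQ0 : 0 ≤ Q) (hA0 : 0 ≤ A)
    (hP1 : P < 1) (hQ1 : Q < 1) :
    HasProdLocallyUniformlyOn (fun (jk : ℕ × ℕ) x => 1 + -(a x * p x ^ jk.1 * q x ^ jk.2))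
      (fun x => ∏' jk : ℕ × ℕ, (1 + -(a x * p x ^ jk.1 * q x ^ jk.2))) K := by
  have h1 : Summable (fun j : ℕ => P ^ j) := summable_geometric_of_lt_one hP0 hP1
  have h2 : Summable (fun j : ℕ => Q ^ j) := summable_geometric_of_lt_one hQ0 hQ1
  have h3 := (h1.mul_of_nonneg h2 (fun j => by positivity) (fun j => by positivity)).mul_left A
  refine Summable.hasProdLocallyUniformlyOn_one_add hK h3 ?_ ?_
  · refine Filter.Eventually.of_forall (fun jk x hx => ?_)
    rw [norm_neg, norm_mul, norm_mul, norm_pow, norm_pow, ← mul_assoc]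
    have := hA x hx
    have := hP x hx
    have := hQ x hx
    gcongr
  · intro jk
    fun_prop

lemma exists_lt_bound {a : ℝ} (h : a < 1) : ∃ b, a < b ∧ b < 1 := exists_between h

lemma EE_continuousAt {α : Type*} [TopologicalSpace α]
    {a p q : α → ℂ} {x : α} (ha : ContinuousAt a x) (hp : ContinuousAt p x) (hq : ContinuousAt q x)
    (hp1 : ‖p x‖ < 1) (hq1 : ‖q x‖ < 1) : ContinuousAt (fun x => EE (p x) (q x) (a x)) x := by
  have main : ContinuousAt (fun y : ℂ × ℂ × ℂ => EE y.1 y.2.1 y.2.2) (p x, q x, a x) := by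
    obtain ⟨P, hP, hP1⟩ := exists_between hp1
    obtain ⟨Q, hQ, hQ1⟩ := exists_between hq1
    set K : Set (ℂ × ℂ × ℂ) := {y | ‖y.1‖ < P ∧ ‖y.2.1‖ < Q ∧ ‖y.2.2‖ < ‖a x‖ + 1} with hKdef
    have hK : IsOpen K := by
      refine IsOpen.and (isOpen_lt (by fun_prop) (by fun_prop))
        (IsOpen.and (isOpen_lt (by fun_prop) (by fun_prop)) (isOpen_lt (by fun_prop) (by fun_prop)))
    have := EE_hasProdLU (a := fun y : ℂ × ℂ × ℂ => y.2.2) (p := fun y => y.1)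
      (q := fun y => y.2.1) hK (by fun_prop) (by fun_prop) (by fun_prop)
      (fun y hy => hy.2.2.le) (fun y hy => hy.1.le) (fun y hy => hy.2.1.le)
      ((norm_nonneg _).trans hP.le) ((norm_nonneg _).trans hQ.le) (by positivity) hP1 hQ1
    have hc : ContinuousOn (fun y : ℂ × ℂ × ℂ => EE y.1 y.2.1 y.2.2) K := by
      have h2 := (hasProdLocallyUniformlyOn_iff_tendstoLocallyUniformlyOn.1 this).continuousOn
        (Filter.Frequently.of_forall (fun s => by fun_prop))
      simpa [EE, sub_eq_add_neg] using h2
    exact hc.continuousAt (hK.mem_nhds ⟨hP, hQ, by simp⟩)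
  exact ContinuousAt.comp (f := fun x => (p x, q x, a x)) main (by fun_prop)

lemma EE_analyticAt {a p q : ℂ → ℂ} {x : ℂ} (ha : AnalyticAt ℂ a x) (hp : AnalyticAt ℂ p x)
    (hq : AnalyticAt ℂ q x) (hp1 : ‖p x‖ < 1) (hq1 : ‖q x‖ < 1) :
    AnalyticAt ℂ (fun x => EE (p x) (q x) (a x)) x := by
  obtain ⟨P, hP, hP1⟩ := exists_between hp1
  obtain ⟨Q, hQ, hQ1⟩ := exists_between hq1
  have e1 : ∀ᶠ y in 𝓝 x, ‖p y‖ < P := (hp.continuousAt.norm).eventually_lt continuousAt_const hP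
  have e2 : ∀ᶠ y in 𝓝 x, ‖q y‖ < Q := (hq.continuousAt.norm).eventually_lt continuousAt_const hQ
  have e3 : ∀ᶠ y in 𝓝 x, ‖a y‖ < ‖a x‖ + 1 :=
    (ha.continuousAt.norm).eventually_lt continuousAt_const (by simp)
  have e4 := ha.eventually_analyticAt
  have e5 := hp.eventually_analyticAt
  have e6 := hq.eventually_analyticAt
  obtain ⟨K, hK, hKo, hxK⟩ := eventually_nhds_iff.1 (e1.and (e2.and (e3.and (e4.and (e5.and e6)))))
  have da : DifferentiableOn ℂ a K := fun y hy =>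
    (hK y hy).2.2.2.1.differentiableAt.differentiableWithinAt
  have dp : DifferentiableOn ℂ p K := fun y hy =>
    (hK y hy).2.2.2.2.1.differentiableAt.differentiableWithinAt
  have dq : DifferentiableOn ℂ q K := fun y hy =>
    (hK y hy).2.2.2.2.2.differentiableAt.differentiableWithinAt
  have := EE_hasProdLU hKo da.continuousOn dp.continuousOn dq.continuousOn
      (fun y hy => (hK y hy).2.2.1.le) (fun y hy => (hK y hy).1.le) (fun y hy => (hK y hy).2.1.le)
      ((norm_nonneg _).trans hP.le) ((norm_nonneg _).trans hQ.le) (by positivity) hP1 hQ1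
  have h2 := (hasProdLocallyUniformlyOn_iff_tendstoLocallyUniformlyOn.1 this).differentiableOn
        (Filter.Eventually.of_forall (fun s => by fun_prop)) hKo
  have h3 : DifferentiableOn ℂ (fun x => EE (p x) (q x) (a x)) K := by
    simpa [EE, sub_eq_add_neg] using h2
  exact h3.analyticAt (hKo.mem_nhds hxK)

lemma poch_continuousAt {α : Type*} [TopologicalSpace α]
    {a p : α → ℂ} {x : α} (ha : ContinuousAt a x) (hp : ContinuousAt p x)
    (hp1 : ‖p x‖ < 1) : ContinuousAt (fun x => pochInf (a x) (p x)) x := by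
  simp only [pochInf_eq_EE]
  exact EE_continuousAt ha hp continuousAt_const hp1 (by simp)

lemma poch_analyticAt {a p : ℂ → ℂ} {x : ℂ} (ha : AnalyticAt ℂ a x) (hp : AnalyticAt ℂ p x)
    (hp1 : ‖p x‖ < 1) : AnalyticAt ℂ (fun x => pochInf (a x) (p x)) x := by
  simp only [pochInf_eq_EE]
  exact EE_analyticAt ha hp analyticAt_const hp1 (by simp)

lemma th_continuousAt {α : Type*} [TopologicalSpace α]
    {a p : α → ℂ} {x : α} (ha : ContinuousAt a x) (hp : ContinuousAt p x)
    (hp1 : ‖p x‖ < 1) (h0 : a x ≠ 0) : ContinuousAt (fun x => th (p x) (a x)) x :=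
  (poch_continuousAt ha hp hp1).mul (poch_continuousAt (hp.div ha h0) hp hp1)

lemma th_analyticAt {a p : ℂ → ℂ} {x : ℂ} (ha : AnalyticAt ℂ a x) (hp : AnalyticAt ℂ p x)
    (hp1 : ‖p x‖ < 1) (h0 : a x ≠ 0) : AnalyticAt ℂ (fun x => th (p x) (a x)) x :=
  (poch_analyticAt ha hp hp1).mul (poch_analyticAt (hp.div ha h0) hp hp1)

lemma Gm_continuousAt {α : Type*} [TopologicalSpace α]
    {a p q : α → ℂ} {x : α} (ha : ContinuousAt a x) (hp : ContinuousAt p x) (hq : ContinuousAt q x)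
    (hp1 : ‖p x‖ < 1) (hq1 : ‖q x‖ < 1) (h0 : a x ≠ 0) (hE : EE (p x) (q x) (a x) ≠ 0) :
    ContinuousAt (fun x => Gm (p x) (q x) (a x)) x :=
  (EE_continuousAt ((hp.mul hq).div ha h0) hp hq hp1 hq1).div
    (EE_continuousAt ha hp hq hp1 hq1) hE

lemma Gm_analyticAt {a p q : ℂ → ℂ} {x : ℂ} (ha : AnalyticAt ℂ a x) (hp : AnalyticAt ℂ p x)
    (hq : AnalyticAt ℂ q x) (hp1 : ‖p x‖ < 1) (hq1 : ‖q x‖ < 1) (h0 : a x ≠ 0)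
    (hE : EE (p x) (q x) (a x) ≠ 0) :
    AnalyticAt ℂ (fun x => Gm (p x) (q x) (a x)) x :=
  (EE_analyticAt ((hp.mul hq).div ha h0) hp hq hp1 hq1).div
    (EE_analyticAt ha hp hq hp1 hq1) hE

/-- average over the circle of radius `r` -/
noncomputable def av (r : ℝ) (f : ℂ → ℂ) : ℂ :=
  (2 * (Real.pi : ℂ) * Complex.I)⁻¹ * ∮ z in C(0, r), f z / z

lemma circleInt_eq_av (f : ℂ → ℂ) : circleInt f = av 1 f := rfl

lemma av_eq {r : ℝ} (hr : r ≠ 0) (f : ℂ → ℂ) :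
    av r f = (2 * (Real.pi : ℂ))⁻¹ * ∫ θ in (0:ℝ)..2 * Real.pi, f (circleMap 0 r θ) := by
  unfold av circleIntegral
  have : ∀ θ : ℝ, deriv (circleMap 0 r) θ • (f (circleMap 0 r θ) / circleMap 0 r θ) =
      Complex.I * f (circleMap 0 r θ) := by
    intro θ
    have h0 : circleMap 0 r θ ≠ 0 := circleMap_ne_center (c := 0) hr
    simp only [deriv_circleMap, smul_eq_mul]
    field_simp
  simp only [this]
  rw [intervalIntegral.integral_const_mul]
  have := Complex.I_ne_zero
  have : (Real.pi : ℂ) ≠ 0 := by exact_mod_cast Real.pi_ne_zero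
  field_simp

lemma av_congr {r : ℝ} (hr : 0 < r) {f g : ℂ → ℂ} (h : ∀ z, ‖z‖ = r → f z = g z) :
    av r f = av r g := by
  rw [av_eq hr.ne', av_eq hr.ne']
  congr 1
  apply intervalIntegral.integral_congr
  intro θ _
  apply h
  simp [abs_of_pos hr]

lemma circleInt_congr {f g : ℂ → ℂ} (h : ∀ z, ‖z‖ = 1 → f z = g z) :
    circleInt f = circleInt g := av_congr one_pos h

lemma av_const_mul (r : ℝ) (c : ℂ) (f : ℂ → ℂ) : av r (fun z => c * f z) = c * av r f := by
  unfold av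
  simp only [mul_div_assoc]
  rw [circleIntegral.integral_const_mul]
  ring

/-- continuity in a parameter -/
lemma circleInt_continuousOn {X : Type*} [TopologicalSpace X] {F : X → ℂ → ℂ} {S : Set X}
    (hF : ContinuousOn (fun y : X × ℂ => F y.1 y.2) (S ×ˢ {z | ‖z‖ = 1})) :
    ContinuousOn (fun x => circleInt (F x)) S := by
  rw [continuousOn_iff_continuous_domRestrict]
  simp only [circleInt_eq_av, av_eq one_ne_zero, Set.domRestrict_def]
  refine Continuous.mul continuous_const ?_
  apply intervalIntegral.continuous_parametric_intervalIntegral_of_continuous'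
  have : Continuous (fun y : S × ℝ => ((y.1 : X), circleMap 0 1 y.2)) := by fun_prop
  exact hF.comp_continuous this (fun y => ⟨y.1.2, by simp⟩)

/-- holomorphy in a parameter -/
lemma circleInt_differentiableOn {F : ℂ → ℂ → ℂ} {S : Set ℂ} (hS : IsOpen S)
    (hF : ContinuousOn (fun y : ℂ × ℂ => F y.1 y.2) (S ×ˢ {z | ‖z‖ = 1}))
    (hd : ∀ z, ‖z‖ = 1 → DifferentiableOn ℂ (fun x => F x z) S) :
    DifferentiableOn ℂ (fun x => circleInt (F x)) S := by
  intro x0 hx0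
  apply DifferentiableAt.differentiableWithinAt
  obtain ⟨ε, hε, hball⟩ := Metric.isOpen_iff.1 hS x0 hx0
  set δ := ε / 4 with hδ
  have hδ0 : 0 < δ := by positivity
  have hcb : Metric.closedBall x0 (2 * δ) ⊆ S := by
    intro y hy
    apply hball
    rw [Metric.mem_closedBall] at hy
    rw [Metric.mem_ball]
    linarith
  have hsph : IsCompact {z : ℂ | ‖z‖ = 1} := by
    have := isCompact_sphere (0:ℂ) 1
    convert this using 1
    ext z; simp
  obtain ⟨M, hM⟩ := ((isCompact_closedBall x0 (2 * δ)).prod hsph).exists_bound_of_continuousOn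
    (hF.mono (Set.prod_mono hcb subset_rfl))
  have hcm : ∀ θ : ℝ, ‖circleMap 0 1 θ‖ = 1 := by intro θ; simp
  have hcont : ∀ x ∈ S, Continuous (fun θ : ℝ => F x (circleMap 0 1 θ)) := by
    intro x hx
    have : Continuous (fun θ : ℝ => (x, circleMap 0 1 θ)) := by fun_prop
    exact hF.comp_continuous this (fun y => ⟨hx, hcm y⟩)
  have hderiv : ∀ θ : ℝ, ∀ x ∈ Metric.ball x0 δ, HasDerivAt (fun x => F x (circleMap 0 1 θ))
      (deriv (fun x => F x (circleMap 0 1 θ)) x) x := by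
    intro θ x hx
    apply DifferentiableAt.hasDerivAt
    apply (hd _ (hcm θ)).differentiableAt
    apply hS.mem_nhds
    apply hcb
    rw [Metric.mem_ball] at hx
    rw [Metric.mem_closedBall]
    linarith
  have := intervalIntegral.hasDerivAt_integral_of_dominated_loc_of_deriv_le
    (μ := MeasureTheory.volume) (a := 0) (b := 2 * Real.pi)
    (F := fun x θ => F x (circleMap 0 1 θ))
    (F' := fun x θ => deriv (fun x => F x (circleMap 0 1 θ)) x) (x₀ := x0)
    (s := Metric.ball x0 δ) (bound := fun _ => M / δ) (Metric.ball_mem_nhds x0 hδ0)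
    (by
      filter_upwards [hS.mem_nhds hx0] with x hx
      exact (hcont x hx).aestronglyMeasurable)
    ((hcont x0 hx0).intervalIntegrable _ _)
    (by
      have hlim : ∀ θ : ℝ, Tendsto (fun n : ℕ => ((δ / (n + 2) : ℝ) : ℂ)⁻¹ *
          (F (x0 + (δ / (n + 2) : ℝ)) (circleMap 0 1 θ) - F x0 (circleMap 0 1 θ))) atTop
          (𝓝 (deriv (fun x => F x (circleMap 0 1 θ)) x0)) := by
        intro θ
        have h1 := hderiv θ x0 (Metric.mem_ball_self hδ0)
        have h2 := h1.tendsto_slope_zero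
        have h3 : Tendsto (fun n : ℕ => ((δ / (n + 2) : ℝ) : ℂ)) atTop (𝓝[≠] 0) := by
          rw [tendsto_nhdsWithin_iff]
          constructor
          · have : Tendsto (fun n : ℕ => (δ / (n + 2) : ℝ)) atTop (𝓝 0) := by
              apply Tendsto.div_atTop tendsto_const_nhds
              exact tendsto_atTop_add_const_right _ _ tendsto_natCast_atTop_atTop
            have h4 := (Complex.continuous_ofReal.tendsto 0).comp this
            rw [Complex.ofReal_zero] at h4
            exact h4
          · refine Filter.Eventually.of_forall (fun n => ?_)
            simp only [Set.mem_compl_iff, Set.mem_singleton_iff, Complex.ofReal_eq_zero]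
            positivity
        have := h2.comp h3
        simp only [smul_eq_mul] at this
        exact this
      refine aestronglyMeasurable_of_tendsto_ae atTop (fun n => ?_)
        (Filter.Eventually.of_forall hlim)
      apply Continuous.aestronglyMeasurable
      apply Continuous.mul continuous_const
      refine (hcont _ (hcb ?_)).sub (hcont x0 hx0)
      rw [Metric.mem_closedBall, dist_eq_norm]
      simp only [add_sub_cancel_left, Complex.norm_real, Real.norm_eq_abs]
      rw [abs_of_nonneg (by positivity), div_le_iff₀ (by positivity)]
      have : (0:ℝ) ≤ n := Nat.cast_nonneg n
      nlinarith)
    (by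
      refine Filter.Eventually.of_forall (fun θ _ x hx => ?_)
      apply Complex.norm_deriv_le_of_forall_mem_sphere_norm_le hδ0
      · refine DifferentiableOn.diffContOnCl ?_
        refine (hd _ (hcm θ)).mono ?_
        rw [closure_ball _ hδ0.ne']
        intro y hy
        apply hcb
        rw [Metric.mem_closedBall] at *
        rw [Metric.mem_ball] at hx
        linarith [dist_triangle y x x0]
      · intro y hy
        apply hM (y, circleMap 0 1 θ)
        refine ⟨?_, hcm θ⟩
        rw [Metric.mem_sphere] at hy
        rw [Metric.mem_ball] at hx
        show y ∈ Metric.closedBall x0 (2 * δ)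
        rw [Metric.mem_closedBall]
        linarith [dist_triangle y x x0])
    (by simp)
    (by
      refine Filter.Eventually.of_forall (fun θ _ x hx => hderiv θ x hx))
  simp only [circleInt_eq_av, av_eq one_ne_zero]
  exact (this.2.differentiableAt).const_mul _

end Rains

namespace Rains
open Filter Topology Set

lemma circleMap_eq_exp (r : ℝ) (θ : ℝ) : circleMap 0 r θ = r * Complex.exp (θ * Complex.I) := by
  simp [circleMap]

lemma periodic_circle (f : ℂ → ℂ) (r : ℝ) :
    Function.Periodic (fun θ : ℝ => f (circleMap 0 r θ)) (2 * Real.pi) :=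
  (periodic_circleMap 0 r).comp f

lemma av_mul_left {r : ℝ} (hr : 0 < r) {c : ℂ} (hc : c ≠ 0) (f : ℂ → ℂ) :
    av r (fun z => f (c * z)) = av (‖c‖ * r) f := by
  have hc' : 0 < ‖c‖ := norm_pos_iff.2 hc
  rw [av_eq hr.ne', av_eq (by positivity)]
  congr 1
  have h1 : ∀ θ : ℝ, c * circleMap 0 r θ = circleMap 0 (‖c‖ * r) (θ + Complex.arg c) := by
    intro θ
    rw [circleMap_eq_exp, circleMap_eq_exp]
    conv_lhs => rw [← Complex.norm_mul_exp_arg_mul_I c]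
    push_cast
    rw [add_mul, Complex.exp_add]
    ring
  simp only [h1]
  rw [intervalIntegral.integral_comp_add_right (fun θ => f (circleMap 0 (‖c‖ * r) θ))]
  have := (periodic_circle f (‖c‖ * r)).intervalIntegral_add_eq (Complex.arg c) 0
  simp only [zero_add] at this ⊢
  rw [← this]
  ring_nf

lemma av_div {r : ℝ} (hr : 0 < r) {c : ℂ} (hc : c ≠ 0) (f : ℂ → ℂ) :
    av r (fun z => f (c / z)) = av (‖c‖ / r) f := by
  have hc' : 0 < ‖c‖ := norm_pos_iff.2 hc
  rw [av_eq hr.ne', av_eq (by positivity)]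
  congr 1
  have h1 : ∀ θ : ℝ, c / circleMap 0 r θ = circleMap 0 (‖c‖ / r) (Complex.arg c - θ) := by
    intro θ
    rw [circleMap_eq_exp, circleMap_eq_exp]
    conv_lhs => rw [← Complex.norm_mul_exp_arg_mul_I c]
    push_cast
    rw [sub_mul, Complex.exp_sub]
    ring
  simp only [h1]
  rw [intervalIntegral.integral_comp_sub_left (fun θ => f (circleMap 0 (‖c‖ / r) θ))]
  have := (periodic_circle f (‖c‖ / r)).intervalIntegral_add_eq (Complex.arg c - 2 * Real.pi) 0
  simp only [zero_add] at this ⊢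
  rw [← this]
  ring_nf

lemma circleInt_inv (f : ℂ → ℂ) : circleInt (fun z => f z⁻¹) = circleInt f := by
  have := av_div one_pos (one_ne_zero) f
  simpa [circleInt_eq_av] using this

lemma av_eq_av {r R : ℝ} (hr : 0 < r) (hle : r ≤ R) {f : ℂ → ℂ}
    (hf : ∀ z, r ≤ ‖z‖ → ‖z‖ ≤ R → DifferentiableAt ℂ f z) : av R f = av r f := by
  unfold av
  congr 1
  have hd : ∀ z ∈ Metric.closedBall (0:ℂ) R \ Metric.ball 0 r,
      DifferentiableAt ℂ (fun z => f z / z) z := by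
    intro z hz
    simp only [Set.mem_sdiff, Metric.mem_closedBall, dist_zero_right, Metric.mem_ball, not_lt] at hz
    have h0 : z ≠ 0 := by intro h; simp [h] at hz; linarith
    exact (hf z hz.2 hz.1).div differentiableAt_id h0
  apply Complex.circleIntegral_eq_of_differentiable_on_annulus_off_countable hr hle
    (s := ∅) Set.countable_empty
  · intro z hz
    exact (hd z hz).continuousAt.continuousWithinAt
  · intro z hz
    apply hd
    refine ⟨Metric.ball_subset_closedBall hz.1.1, fun h => hz.1.2 (Metric.ball_subset_closedBall h)⟩

/-- vanishing of a contour integral by antisymmetry under `z ↦ c / z`. -/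
lemma av_eq_zero_of_antisymm {r : ℝ} (hr : 0 < r) {c : ℂ} (hc : ‖c‖ = r * r) {f : ℂ → ℂ}
    (hf : ∀ z, ‖z‖ = r → f (c / z) = - f z) : av r f = 0 := by
  have hc0 : c ≠ 0 := by
    intro h
    rw [h, norm_zero] at hc
    have : 0 < r * r := by positivity
    linarith
  have h1 := av_div hr hc0 f
  rw [hc, mul_div_assoc, div_self hr.ne', mul_one, av_congr hr hf] at h1
  have h2 : av r (fun z => - f z) = - av r f := by
    have := av_const_mul r (-1) f
    simpa using this
  rw [h2] at h1
  have : (2:ℂ) * av r f = 0 := by linear_combination -h1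
  simpa using this

lemma fourier_unique {h : ℂ → ℂ} (hc : ∀ z, ‖z‖ = 1 → ContinuousAt h z)
    (hz : ∀ k : ℤ, circleInt (fun z => h z * z ^ k) = 0) : ∀ z, ‖z‖ = 1 → h z = 0 := by
  have : Fact (0 < 2 * Real.pi) := ⟨by positivity⟩
  have hcont : Continuous (fun x : AddCircle (2 * Real.pi) => h ((AddCircle.toCircle x : Circle) : ℂ)) := by
    rw [continuous_iff_continuousAt]
    intro x
    have h1 := hc (AddCircle.toCircle x : Circle) (Circle.norm_coe _)
    have h2 : Continuous (fun x : AddCircle (2 * Real.pi) => ((AddCircle.toCircle x : Circle) : ℂ)) :=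
      continuous_subtype_val.comp AddCircle.continuous_toCircle
    exact ContinuousAt.comp (g := h) h1 h2.continuousAt
  set g : C(AddCircle (2 * Real.pi), ℂ) := ⟨_, hcont⟩ with hg
  have hto : ∀ θ : ℝ, ((AddCircle.toCircle (θ : AddCircle (2 * Real.pi)) : Circle) : ℂ) =
      circleMap 0 1 θ := by
    intro θ
    rw [AddCircle.toCircle_apply_mk, Circle.coe_exp, circleMap_eq_exp]
    have : (Real.pi : ℂ) ≠ 0 := by exact_mod_cast Real.pi_ne_zero
    push_cast
    rw [one_mul]
    congr 2
    field_simp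
  have hcoef : ∀ n : ℤ, fourierCoeff g n = 0 := by
    intro n
    rw [fourierCoeff_eq_intervalIntegral g n 0]
    have h1 := hz (-n)
    rw [circleInt_eq_av, av_eq one_ne_zero] at h1
    have h2 : (∫ θ in (0:ℝ)..2 * Real.pi, h (circleMap 0 1 θ) * circleMap 0 1 θ ^ (-n)) = 0 := by
      have : (2 * (Real.pi : ℂ))⁻¹ ≠ 0 := by
        have : (Real.pi : ℂ) ≠ 0 := by exact_mod_cast Real.pi_ne_zero
        exact inv_ne_zero (mul_ne_zero two_ne_zero this)
      exact (mul_eq_zero.1 h1).resolve_left this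
    have h3 : (∫ x in (0:ℝ)..0 + 2 * Real.pi, fourier (-n) (x : AddCircle (2 * Real.pi)) •
        g (x : AddCircle (2 * Real.pi))) = 0 := by
      rw [zero_add, ← h2]
      apply intervalIntegral.integral_congr
      intro θ _
      simp only [hg, ContinuousMap.coe_mk, smul_eq_mul, fourier_apply]
      rw [hto, mul_comm, AddCircle.toCircle_zsmul]
      rw [Circle.coe_zpow, hto]
    rw [h3, smul_zero]
  have hs := hasSum_fourier_series_of_summable (f := g) (by
    have : fourierCoeff g = 0 := by ext n; exact hcoef n
    rw [this]; exact summable_zero)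
  have hg0 : g = 0 := by
    refine hs.unique ?_
    simp only [hcoef, zero_smul]
    exact hasSum_zero
  intro z hz1
  have h1 : g ((Complex.arg z : ℝ) : AddCircle (2 * Real.pi)) = 0 := by rw [hg0]; rfl
  simp only [hg, ContinuousMap.coe_mk] at h1
  rw [hto, circleMap_eq_exp] at h1
  rw [← Complex.norm_mul_exp_arg_mul_I z, hz1]
  exact h1

lemma Th_analyticAt {p : ℂ} (hp : ‖p‖ < 1) {x y : ℂ} (hx : x ≠ 0) (hy : y ≠ 0) :
    AnalyticAt ℂ (fun x => Th p x y) x := by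
  refine (th_analyticAt (analyticAt_id.mul analyticAt_const) analyticAt_const hp
    (mul_ne_zero hx hy)).mul (th_analyticAt (analyticAt_id.div analyticAt_const hy)
    analyticAt_const hp (div_ne_zero hx hy))

lemma Th_p_mul {p : ℂ} (hp : ‖p‖ < 1) (hp0 : p ≠ 0) {x y : ℂ} (hx : x ≠ 0) (hy : y ≠ 0) :
    Th p (p * x) y = x⁻¹ ^ 2 * Th p x y := by
  unfold Th
  rw [mul_assoc, mul_div_assoc, th_mul_p hp hp0 (mul_ne_zero hx hy),
    th_mul_p hp hp0 (div_ne_zero hx hy)]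
  field_simp

lemma quasi_unique {p : ℂ} (hp : ‖p‖ < 1) (hp0 : p ≠ 0) {h : ℂ → ℂ}
    (ha : ∀ x, x ≠ 0 → AnalyticAt ℂ h x) (hq : ∀ x, x ≠ 0 → h (p * x) = x⁻¹ ^ 2 * h x)
    (h0 : circleInt h = 0) (h1 : circleInt (fun z => h z * z⁻¹) = 0) :
    ∀ x, x ≠ 0 → h x = 0 := by
  have hpn : 0 < ‖p‖ := norm_pos_iff.2 hp0
  have rec1 : ∀ k : ℤ, circleInt (fun z => h z * z ^ k) =
      p ^ k * circleInt (fun z => h z * z ^ (k - 2)) := by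
    intro k
    rw [circleInt_eq_av, circleInt_eq_av]
    rw [av_eq_av hpn hp.le (f := fun z => h z * z ^ k)]
    · have := av_mul_left one_pos hp0 (fun z => h z * z ^ k)
      rw [mul_one] at this
      rw [← this, ← av_const_mul]
      apply av_congr one_pos
      intro z hz
      have hz0 : z ≠ 0 := by intro h; simp [h] at hz
      rw [hq z hz0, mul_zpow, zpow_sub₀ hz0]
      field_simp
    · intro z hz _
      have hz0 : z ≠ 0 := by intro h; simp [h] at hz; exact hp0 hz
      exact (ha z hz0).differentiableAt.mul (differentiableAt_zpow.2 (Or.inl hz0))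
  have key : ∀ k : ℕ, ∀ j : ℤ, (j = 0 ∨ j = -1) →
      circleInt (fun z => h z * z ^ (j + 2 * k)) = 0 ∧
      circleInt (fun z => h z * z ^ (j - 2 * k)) = 0 := by
    intro k j hj
    induction k with
    | zero =>
      rcases hj with rfl | rfl
      · simp [h0]
      · simp [h1]
    | succ k ih =>
      constructor
      · rw [rec1]
        have : j + 2 * ((k + 1 : ℕ) : ℤ) - 2 = j + 2 * k := by push_cast; ring
        rw [this, ih.1, mul_zero]
      · have := rec1 (j - 2 * k)
        rw [ih.2] at this
        have h3 := (mul_eq_zero.1 this.symm).resolve_left (zpow_ne_zero _ hp0)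
        rw [← h3]
        congr 1
        ext z
        congr 2
        push_cast
        ring
  have hall : ∀ k : ℤ, circleInt (fun z => h z * z ^ k) = 0 := by
    intro k
    rcases Int.emod_two_eq_zero_or_one k with hk | hk
    · rcases le_total 0 k with h | h
      · have := (key (k / 2).toNat 0 (Or.inl rfl)).1
        rwa [show (0:ℤ) + 2 * ((k / 2).toNat : ℤ) = k by omega] at this
      · have := (key (-k / 2).toNat 0 (Or.inl rfl)).2
        rwa [show (0:ℤ) - 2 * ((-k / 2).toNat : ℤ) = k by omega] at this
    · rcases le_total 0 k with h | h
      · have := (key ((k + 1) / 2).toNat (-1) (Or.inr rfl)).1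
        rwa [show (-1:ℤ) + 2 * (((k + 1) / 2).toNat : ℤ) = k by omega] at this
      · have := (key (-(k + 1) / 2).toNat (-1) (Or.inr rfl)).2
        rwa [show (-1:ℤ) - 2 * ((-(k + 1) / 2).toNat : ℤ) = k by omega] at this
  have hcirc := fourier_unique (fun z hz => (ha z (by intro h; simp [h] at hz)).continuousAt) hall
  have hconn : IsPreconnected ({0}ᶜ : Set ℂ) :=
    (isConnected_compl_singleton_of_one_lt_rank (by simp) 0).isPreconnected
  have hon : AnalyticOnNhd ℂ h {0}ᶜ := fun x hx => ha x hx
  have := hon.eqOn_zero_of_preconnected_of_frequently_eq_zero hconn (z₀ := 1) (by simp) (by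
    rw [frequently_iff]
    intro U hU
    have hcm : Tendsto (fun θ : ℝ => Complex.exp (θ * Complex.I)) (𝓝[≠] 0) (𝓝[≠] 1) := by
      rw [tendsto_nhdsWithin_iff]
      constructor
      · have : Continuous (fun θ : ℝ => Complex.exp (θ * Complex.I)) := by fun_prop
        have := this.tendsto 0
        simp only [Complex.ofReal_zero, zero_mul, Complex.exp_zero] at this
        exact this.mono_left nhdsWithin_le_nhds
      · rw [eventually_nhdsWithin_iff]
        have : ∀ᶠ θ : ℝ in 𝓝 0, |θ| < 1 := by
          have := (continuous_abs.tendsto (0:ℝ))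
          simp only [abs_zero] at this
          exact this.eventually_lt_const one_pos
        filter_upwards [this] with θ hθ hθ0
        intro hcon
        simp only [mem_singleton_iff] at hcon
        rw [Complex.exp_eq_one_iff] at hcon
        obtain ⟨n, hn⟩ := hcon
        have h2 : (θ : ℂ) = ((n * (2 * Real.pi) : ℝ) : ℂ) := by
          push_cast
          have := Complex.I_ne_zero
          field_simp at hn
          linear_combination hn
        have h3 : θ = n * (2 * Real.pi) := by exact_mod_cast h2
        have hn0 : n ≠ 0 := by
          rintro rfl
          simp at h3
          exact hθ0 h3
        have h4 : (1:ℝ) ≤ |(n:ℝ)| := by exact_mod_cast Int.one_le_abs hn0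
        rw [h3, abs_mul, abs_of_pos (by positivity : (0:ℝ) < 2 * Real.pi)] at hθ
        nlinarith [Real.pi_gt_three]
    have := (hcm.eventually hU).exists
    obtain ⟨θ, hθ⟩ := this
    exact ⟨_, hθ, hcirc _ (Complex.norm_exp_ofReal_mul_I θ)⟩)
  intro x hx
  exact this hx

lemma rank_two {p : ℂ} (hp : ‖p‖ < 1) (hp0 : p ≠ 0) (y : Fin 3 → ℂ) (hy : ∀ i, y i ≠ 0) :
    ∃ e : Fin 3 → ℂ, e ≠ 0 ∧ ∀ x, x ≠ 0 → ∑ i, e i * Th p x (y i) = 0 := by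
  let L : (Fin 3 → ℂ) →ₗ[ℂ] (Fin 2 → ℂ) := Matrix.toLin'
    (Matrix.of fun (a : Fin 2) (i : Fin 3) =>
      if a = 0 then circleInt (fun z => Th p z (y i)) else circleInt (fun z => Th p z (y i) * z⁻¹))
  have hker : LinearMap.ker L ≠ ⊥ := LinearMap.ker_ne_bot_of_finrank_lt (by simp)
  obtain ⟨e, he, he0⟩ := Submodule.exists_mem_ne_zero_of_ne_bot hker
  refine ⟨e, he0, ?_⟩
  have hL : L e = 0 := he
  have hci : ∀ g : ℂ → ℂ, (∀ z, ‖z‖ = 1 → ContinuousAt g z) → ∀ i,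
      CircleIntegrable (fun z => e i * (Th p z (y i) * g z) / z) 0 1 := by
    intro g hg i
    apply ContinuousOn.circleIntegrable zero_le_one
    intro z hz
    have hz1 : ‖z‖ = 1 := by simpa using hz
    have hz0 : z ≠ 0 := by intro h; simp [h] at hz1
    exact ((continuousAt_const.mul ((Th_analyticAt hp hz0 (hy i)).continuousAt.mul (hg z hz1))).div
      continuousAt_id hz0).continuousWithinAt
  have hsum : ∀ g : ℂ → ℂ, (∀ z, ‖z‖ = 1 → ContinuousAt g z) →
      circleInt (fun z => (∑ i, e i * Th p z (y i)) * g z) =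
      ∑ i, e i * circleInt (fun z => Th p z (y i) * g z) := by
    intro g hg
    simp only [circleInt_eq_av, ← av_const_mul]
    unfold av
    rw [← Finset.mul_sum, ← circleIntegral.integral_fun_sum]
    · congr 1
      congr 1
      ext z
      beta_reduce
      rw [Finset.sum_mul, Finset.sum_div]
      apply Finset.sum_congr rfl
      intro i _
      ring
    · intro i _
      exact hci g hg i
  apply quasi_unique hp hp0 (h := fun x => ∑ i, e i * Th p x (y i))
  · intro x hx
    apply Finset.analyticAt_fun_sum
    intro i _
    exact analyticAt_const.mul (Th_analyticAt hp hx (hy i))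
  · intro x hx
    rw [Finset.mul_sum]
    apply Finset.sum_congr rfl
    intro i _
    rw [Th_p_mul hp hp0 hx (hy i)]
    ring
  · have h1 := hsum (fun _ => 1) (fun z _ => continuousAt_const)
    simp only [mul_one] at h1
    rw [h1]
    have := congrFun hL 0
    simp only [L, Matrix.toLin'_apply, Matrix.mulVec, dotProduct, Matrix.of_apply] at this
    simp only [if_true, Pi.zero_apply] at this
    rw [← this]
    exact Finset.sum_congr rfl (fun i _ => mul_comm _ _)
  · have h1 := hsum (fun z => z⁻¹) (fun z hz => continuousAt_inv₀ (by intro h; simp [h] at hz))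
    rw [h1]
    have := congrFun hL 1
    simp only [L, Matrix.toLin'_apply, Matrix.mulVec, dotProduct, Matrix.of_apply] at this
    simp only [one_ne_zero, if_false, Pi.zero_apply] at this
    rw [← this]
    exact Finset.sum_congr rfl (fun i _ => mul_comm _ _)

lemma ps_antisymm {p : ℂ} (hp : ‖p‖ < 1) {x y : ℂ} (hx : x ≠ 0) (hy : y ≠ 0) :
    ps p y x = - ps p x y := by
  unfold ps Th
  have := th_inv hp (div_ne_zero hx hy)
  rw [inv_div] at this
  rw [this, mul_comm y x]
  field_simp

lemma ps_self (p : ℂ) {x : ℂ} (hx : x ≠ 0) : ps p x x = 0 := by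
  unfold ps Th
  rw [div_self hx, th_one]
  simp

/-- three-term relation, `p ≠ 0` -/
lemma three_term' {p : ℂ} (hp : ‖p‖ < 1) (hp0 : p ≠ 0) {x y c d : ℂ} (hx : x ≠ 0) (hy : y ≠ 0)
    (hc : c ≠ 0) (hd : d ≠ 0) :
    ps p x y * ps p c d = ps p x c * ps p y d - ps p x d * ps p y c := by
  obtain ⟨e, he0, he⟩ := rank_two hp hp0 ![x, y, c] (by
    intro i; fin_cases i <;> simp [hx, hy, hc])
  have he' : ∀ w, w ≠ 0 → e 0 * ps p w x + e 1 * ps p w y + e 2 * ps p w c = 0 := by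
    intro w hw
    have := he w hw
    simp [Fin.sum_univ_three] at this
    unfold ps
    linear_combination w⁻¹ * this
  have a1 := he' x hx
  have a2 := he' y hy
  have a3 := he' c hc
  have a4 := he' d hd
  rw [ps_self p hx] at a1
  rw [ps_self p hy, ps_antisymm hp hx hy] at a2
  rw [ps_self p hc, ps_antisymm hp hx hc, ps_antisymm hp hy hc] at a3
  rw [ps_antisymm hp hx hd, ps_antisymm hp hy hd, ps_antisymm hp hc hd] at a4
  have hne : e 0 ≠ 0 ∨ e 1 ≠ 0 ∨ e 2 ≠ 0 := by
    by_contra hcon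
    push Not at hcon
    apply he0
    ext i
    fin_cases i
    · exact hcon.1
    · exact hcon.2.1
    · exact hcon.2.2
  set A := ps p x y
  set B := ps p x c
  set C := ps p y c
  set X := ps p x d
  set Y := ps p y d
  set Z := ps p c d
  rcases hne with h | h | h
  · apply mul_left_cancel₀ h
    linear_combination (-Z) * a2 + Y * a3 - C * a4
  · apply mul_left_cancel₀ h
    linear_combination Z * a1 - X * a3 + B * a4
  · apply mul_left_cancel₀ h
    linear_combination -Y * a1 + X * a2 - A * a4

lemma th_zero (z : ℂ) : th 0 z = 1 - z := by
  unfold th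
  rw [poch_shift (by simp)]
  simp [poch_zero]

/-- three-term relation -/
lemma three_term {p : ℂ} (hp : ‖p‖ < 1) {x y c d : ℂ} (hx : x ≠ 0) (hy : y ≠ 0)
    (hc : c ≠ 0) (hd : d ≠ 0) :
    ps p x y * ps p c d = ps p x c * ps p y d - ps p x d * ps p y c := by
  by_cases hp0 : p = 0
  · subst hp0
    unfold ps Th
    simp only [th_zero]
    field_simp
    ring
  · exact three_term' hp hp0 hx hy hc hd

end Rains

namespace Rains
open Filter Topology Set

/-- Vandermonde-type product. -/
noncomputable def VV (p : ℂ) {n : ℕ} (x : Fin n → ℂ) : ℂ := ∏ i, ∏ j ∈ Finset.Ioi i, ps p (x i) (x j)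

noncomputable def C0 {n : ℕ} (x : Fin n → ℂ) : ℂ := ∏ i, ∏ j ∈ Finset.Ioi i, -(x i * x j)

noncomputable def ff (p : ℂ) {n : ℕ} (x : Fin n → ℂ) (i : Fin n) (z : ℂ) : ℂ :=
  ∏ k ∈ Finset.univ.erase i, Th p (x k) z

/-- one-variable weight -/
noncomputable def Wt (p q : ℂ) {ι : Type*} [Fintype ι] (t : ι → ℂ) (z : ℂ) : ℂ :=
  (∏ i, Gm p q (t i * z) * Gm p q (t i / z)) * (th p (z ^ 2) * th q (z⁻¹ ^ 2))

noncomputable def DD (p q : ℂ) (n : ℕ) {ι : Type*} [Fintype ι] (t : ι → ℂ) : ℂ :=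
  torusInt n (fun z => VV p z * VV q z * ∏ j, Wt p q t (z j))

lemma torusInt_congr : ∀ (n : ℕ) {f g : (Fin n → ℂ) → ℂ},
    (∀ z, (∀ i, ‖z i‖ = 1) → f z = g z) → torusInt n f = torusInt n g
  | 0, f, g, h => h _ (fun i => i.elim0)
  | n + 1, f, g, h => by
    show circleInt _ = circleInt _
    apply circleInt_congr
    intro z hz
    apply torusInt_congr n
    intro w hw
    apply h
    intro i
    refine Fin.cases ?_ ?_ i
    · simpa using hz
    · intro j; simpa using hw j

lemma ne_zero_of_norm_one {z : ℂ} (h : ‖z‖ = 1) : z ≠ 0 := by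
  intro h0; simp [h0] at h

lemma ps_mul_ps {p q : ℂ} (hp : ‖p‖ < 1) (hq : ‖q‖ < 1) {x y : ℂ} (hx : ‖x‖ = 1) (hy : ‖y‖ = 1) :
    (Gm p q (x * y) * Gm p q (x * y⁻¹) * Gm p q (x⁻¹ * y) * Gm p q (x⁻¹ * y⁻¹))⁻¹ =
      ps p x y * ps q x y := by
  have hx0 := ne_zero_of_norm_one hx
  have hy0 := ne_zero_of_norm_one hy
  have h1 := Gm_inv_mul hp hq (x := x * y) (by simp [hx, hy])
  have h2 := Gm_inv_mul hp hq (x := x * y⁻¹) (by simp [hx, hy])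
  have e1 : (x * y)⁻¹ = x⁻¹ * y⁻¹ := by rw [mul_inv]
  have e2 : (x * y⁻¹)⁻¹ = x⁻¹ * y := by rw [mul_inv, inv_inv]
  have t1 := th_inv hq (z := x * y) (mul_ne_zero hx0 hy0)
  have t2 := th_inv hq (z := x * y⁻¹) (mul_ne_zero hx0 (inv_ne_zero hy0))
  rw [t1, e1] at h1
  rw [t2, e2] at h2
  have : (Gm p q (x * y) * Gm p q (x * y⁻¹) * Gm p q (x⁻¹ * y) * Gm p q (x⁻¹ * y⁻¹))⁻¹ =
    (Gm p q (x * y) * Gm p q (x⁻¹ * y⁻¹))⁻¹ * (Gm p q (x * y⁻¹) * Gm p q (x⁻¹ * y))⁻¹ := by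
    rw [← mul_inv]; ring
  rw [this, h1, h2]
  unfold ps Th
  simp only [div_eq_mul_inv]
  field_simp

lemma deltaBC_eq {p q : ℂ} (hp : ‖p‖ < 1) (hq : ‖q‖ < 1) {n L : ℕ} (t : Fin L → ℂ)
    {z : Fin n → ℂ} (hz : ∀ i, ‖z i‖ = 1) :
    deltaBC p q t z = VV p z * VV q z * ∏ j, Wt p q t (z j) := by
  unfold deltaBC VV
  simp only [ellGamma_eq hp hq]
  change (∏ ij ∈ Finset.univ.filter (fun ij : Fin n × Fin n => ij.1 < ij.2),
      (Gm p q (z ij.1 * z ij.2) * Gm p q (z ij.1 * (z ij.2)⁻¹) *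
        Gm p q ((z ij.1)⁻¹ * z ij.2) * Gm p q ((z ij.1)⁻¹ * (z ij.2)⁻¹))⁻¹) *
    ∏ j, (∏ i, Gm p q (t i * z j) * Gm p q (t i * (z j)⁻¹)) /
      (Gm p q (z j ^ 2) * Gm p q ((z j)⁻¹ ^ 2)) = _
  congr 1
  · rw [← Finset.prod_mul_distrib]
    simp only [← Finset.prod_mul_distrib]
    rw [Finset.prod_sigma']
    refine Finset.prod_bij' (fun ij _ => ⟨ij.1, ij.2⟩) (fun ij _ => (ij.1, ij.2)) ?_ ?_ ?_ ?_ ?_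
    · simp
    · simp
    · simp
    · simp
    · intro ij _
      exact ps_mul_ps hp hq (hz _) (hz _)
  · apply Finset.prod_congr rfl
    intro j _
    unfold Wt
    have h1 := Gm_inv_mul hp hq (x := z j ^ 2) (by simp [hz])
    rw [div_eq_mul_inv]
    simp only [div_eq_mul_inv]
    congr 1
    rw [inv_pow, h1]

lemma torusInt_deltaBC {p q : ℂ} (hp : ‖p‖ < 1) (hq : ‖q‖ < 1) {n L : ℕ} (t : Fin L → ℂ) :
    torusInt n (deltaBC p q t) = DD p q n t :=
  torusInt_congr n (fun _ hz => deltaBC_eq hp hq t hz)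

lemma torusInt_const_mul (n : ℕ) : ∀ (c : ℂ) (f : (Fin n → ℂ) → ℂ),
    torusInt n (fun z => c * f z) = c * torusInt n f := by
  induction n with
  | zero => intro c f; rfl
  | succ n ih =>
    intro c f
    show circleInt _ = c * circleInt _
    simp only [ih]
    exact av_const_mul 1 c _

lemma circleInt_sum {α : Type*} (s : Finset α) (c : α → ℂ) (h : α → ℂ → ℂ)
    (hc : ∀ a ∈ s, ContinuousOn (h a) {z | ‖z‖ = 1}) :
    circleInt (fun z => ∑ a ∈ s, c a * h a z) = ∑ a ∈ s, c a * circleInt (h a) := by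
  simp only [circleInt_eq_av, ← av_const_mul]
  unfold av
  rw [← Finset.mul_sum, ← circleIntegral.integral_fun_sum]
  · congr 1
    congr 1
    ext z
    beta_reduce
    rw [Finset.sum_div]
  · intro a ha
    apply ContinuousOn.circleIntegrable zero_le_one
    intro z hz
    have hz1 : ‖z‖ = 1 := by simpa using hz
    have hs : Metric.sphere (0:ℂ) 1 = {z | ‖z‖ = 1} := by ext; simp
    rw [hs]
    exact (continuousWithinAt_const.mul (hc a ha z hz1)).div continuousWithinAt_id
      (ne_zero_of_norm_one hz1)

lemma torusInt_sum_prod {α : Type*} (s : Finset α) : ∀ (n : ℕ) (c : α → ℂ) (h : α → Fin n → ℂ → ℂ),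
    (∀ a ∈ s, ∀ j, ContinuousOn (h a j) {z | ‖z‖ = 1}) →
    torusInt n (fun z => ∑ a ∈ s, c a * ∏ j, h a j (z j)) =
      ∑ a ∈ s, c a * ∏ j, circleInt (h a j)
  | 0, c, h, _ => by simp [torusInt]
  | n + 1, c, h, hc => by
    show circleInt (fun z => torusInt n fun w => ∑ a ∈ s, c a * ∏ j, h a j
      ((Fin.cons z w : Fin (n + 1) → ℂ) j)) = _
    have h1 : ∀ z, (torusInt n fun w => ∑ a ∈ s, c a * ∏ j, h a j
      ((Fin.cons z w : Fin (n + 1) → ℂ) j)) =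
        ∑ a ∈ s, (c a * ∏ j : Fin n, circleInt (h a j.succ)) * h a 0 z := by
      intro z
      have := torusInt_sum_prod s n (fun a => c a * h a 0 z) (fun a j => h a j.succ)
        (fun a ha j => hc a ha _)
      simp only [Fin.prod_univ_succ, Fin.cons_zero, Fin.cons_succ, ← mul_assoc]
      rw [this]
      exact Finset.sum_congr rfl (fun a _ => by ring)
    simp only [h1]
    rw [circleInt_sum s _ _ (fun a ha => hc a ha 0)]
    apply Finset.sum_congr rfl
    intro a _
    rw [Fin.prod_univ_succ]
    ring

lemma andreief {n : ℕ} (f g : Fin n → ℂ → ℂ) (w : ℂ → ℂ)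
    (hc : ∀ i j, ContinuousOn (fun z => f i z * g j z * w z) {z | ‖z‖ = 1}) :
    torusInt n (fun z => (Matrix.of fun i j => f i (z j)).det * (Matrix.of fun i j => g i (z j)).det *
      ∏ j, w (z j)) =
      n.factorial * (Matrix.of fun i j => circleInt (fun z => f i z * g j z * w z)).det := by
  have h1 := torusInt_sum_prod (Finset.univ : Finset (Equiv.Perm (Fin n) × Equiv.Perm (Fin n))) n
    (fun a => ((Equiv.Perm.sign a.1 : ℤ) : ℂ) * ((Equiv.Perm.sign a.2 : ℤ) : ℂ))
    (fun a j z => f (a.1 j) z * g (a.2 j) z * w z) (fun a _ j => hc _ _)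
  have h2 : (fun z : Fin n → ℂ => (Matrix.of fun i j => f i (z j)).det *
      (Matrix.of fun i j => g i (z j)).det * ∏ j, w (z j)) = fun z =>
      ∑ a : Equiv.Perm (Fin n) × Equiv.Perm (Fin n),
      (((Equiv.Perm.sign a.1 : ℤ) : ℂ) * ((Equiv.Perm.sign a.2 : ℤ) : ℂ)) *
        ∏ j, (f (a.1 j) (z j) * g (a.2 j) (z j) * w (z j)) := by
    ext z
    rw [Matrix.det_apply', Matrix.det_apply', Finset.sum_mul_sum, Fintype.sum_prod_type,
      Finset.sum_mul]
    apply Finset.sum_congr rfl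
    intro σ _
    rw [Finset.sum_mul]
    apply Finset.sum_congr rfl
    intro τ _
    simp only [Matrix.of_apply, Finset.prod_mul_distrib]
    ring
  rw [h2, h1, Fintype.sum_prod_type]
  set M : Matrix (Fin n) (Fin n) ℂ := Matrix.of fun i j => circleInt (fun z => f i z * g j z * w z)
    with hM
  have h3 : ∀ σ : Equiv.Perm (Fin n), ∑ τ : Equiv.Perm (Fin n),
      (((Equiv.Perm.sign σ : ℤ) : ℂ) * ((Equiv.Perm.sign τ : ℤ) : ℂ)) *
        ∏ j, circleInt (fun z => f (σ j) z * g (τ j) z * w z) = M.det := by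
    intro σ
    have h4 : (M.submatrix σ id).det = ∑ τ : Equiv.Perm (Fin n), ((Equiv.Perm.sign τ : ℤ) : ℂ) *
        ∏ j, circleInt (fun z => f (σ j) z * g (τ j) z * w z) := by
      rw [← Matrix.det_transpose, Matrix.det_apply']
      rfl
    rw [Matrix.det_permute] at h4
    have h6 : ∀ a b c : ℂ, a * b * c = a * (b * c) := mul_assoc
    rw [Finset.sum_congr rfl (fun τ _ => h6 _ _ _), ← Finset.mul_sum, ← h4, ← mul_assoc]
    have : ((Equiv.Perm.sign σ : ℤ) : ℂ) * ((Equiv.Perm.sign σ : ℤ) : ℂ) = 1 := by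
      have := Int.units_mul_self (Equiv.Perm.sign σ)
      have h5 : ((Equiv.Perm.sign σ : ℤ)) * ((Equiv.Perm.sign σ : ℤ)) = 1 := by
        rw [← Units.val_mul, this, Units.val_one]
      exact_mod_cast h5
    rw [this, one_mul]
  simp only [h3]
  simp [Fintype.card_perm]

lemma ps_I_one {p : ℂ} (hp : ‖p‖ < 1) : ps p Complex.I 1 ≠ 0 := by
  unfold ps Th
  have h1 : Complex.I ≠ 1 := by
    intro h
    have := congrArg Complex.re h
    simp at this
  have := th_ne_zero_of_norm_eq hp (z := Complex.I) (by simp) h1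
  simp [this]

lemma prod_homog {α : Type*} [DecidableEq α] (s : Finset α) (a b : α → ℂ) (f g : ℂ) :
    ∏ k ∈ s, (a k * g - b k * f) = ∑ l ∈ Finset.range (s.card + 1),
      (∑ u ∈ s.powersetCard l, (∏ k ∈ u, -b k) * ∏ k ∈ s \ u, a k) * (f ^ l * g ^ (s.card - l)) := by
  have h1 : ∏ k ∈ s, (a k * g - b k * f) = ∏ k ∈ s, (-b k * f + a k * g) :=
    Finset.prod_congr rfl (fun k _ => by ring)
  rw [h1, Finset.prod_add, Finset.sum_powerset]
  apply Finset.sum_congr rfl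
  intro l _
  rw [Finset.sum_mul]
  apply Finset.sum_congr rfl
  intro u hu
  rw [Finset.mem_powersetCard] at hu
  rw [Finset.prod_mul_distrib, Finset.prod_mul_distrib, Finset.prod_const, Finset.prod_const, hu.2,
    Finset.card_sdiff_of_subset hu.1, hu.2]
  ring

lemma det_ff_const {p : ℂ} (hp : ‖p‖ < 1) {n : ℕ} {x : Fin n → ℂ} (hx : ∀ i, x i ≠ 0) :
    ∃ c : ℂ, ∀ z : Fin n → ℂ, (∀ i, z i ≠ 0) →
      (Matrix.of fun i j => ff p x i (z j)).det = c * VV p z := by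
  rcases n with _ | n
  · exact ⟨1, fun z _ => by simp [VV]⟩
  set κ := ps p Complex.I 1 with hκ
  have hκ0 : κ ≠ 0 := ps_I_one hp
  set F := fun x => ps p x Complex.I with hF
  set G := fun x => ps p x 1 with hG
  have h3 : ∀ x z, x ≠ 0 → z ≠ 0 → ps p x z * κ = F x * G z - G x * F z := fun x z hx hz =>
    three_term hp hx hz Complex.I_ne_zero one_ne_zero
  set E : Matrix (Fin (n + 1)) (Fin (n + 1)) ℂ := Matrix.of fun i l =>
    (κ⁻¹ ^ n * ∏ k ∈ Finset.univ.erase i, x k) *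
    ∑ u ∈ (Finset.univ.erase i).powersetCard l.1, (∏ k ∈ u, -G (x k)) *
      ∏ k ∈ (Finset.univ.erase i) \ u, F (x k) with hE
  refine ⟨E.det * ∏ i : Fin (n + 1), ∏ j ∈ Finset.Ioi i, (-κ), fun z hz => ?_⟩
  have hmat : (Matrix.of fun i j => ff p x i (z j)) = E *
      (Matrix.projVandermonde (fun i => F (z i)) (fun i => G (z i))).transpose := by
    ext i j
    rw [Matrix.mul_apply]
    simp only [Matrix.of_apply, Matrix.transpose_apply, Matrix.projVandermonde_apply, hE]
    have h4 := prod_homog (Finset.univ.erase i) (fun k => F (x k)) (fun k => G (x k)) (F (z j)) (G (z j))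
    have hcard : (Finset.univ.erase i).card = n := by simp
    rw [hcard, Finset.sum_range] at h4
    have h5 : ff p x i (z j) = κ⁻¹ ^ n * (∏ k ∈ Finset.univ.erase i, x k) *
        ∏ k ∈ Finset.univ.erase i, (F (x k) * G (z j) - G (x k) * F (z j)) := by
      unfold ff
      have h6 : κ⁻¹ ^ n = ∏ k ∈ Finset.univ.erase i, κ⁻¹ := by rw [Finset.prod_const, hcard]
      rw [h6, ← Finset.prod_mul_distrib, ← Finset.prod_mul_distrib]
      apply Finset.prod_congr rfl
      intro k _
      rw [← h3 _ _ (hx k) (hz j)]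
      unfold ps
      have := hx k
      field_simp
    rw [h5, h4, Finset.mul_sum]
    apply Finset.sum_congr rfl
    intro l _
    have : l.rev.1 = n - l.1 := by rw [Fin.val_rev]; omega
    rw [this]
    ring
  rw [hmat, Matrix.det_mul, Matrix.det_transpose, Matrix.det_projVandermonde, mul_assoc]
  congr 1
  unfold VV
  rw [← Finset.prod_mul_distrib]
  apply Finset.prod_congr rfl
  intro i _
  rw [← Finset.prod_mul_distrib]
  apply Finset.prod_congr rfl
  intro j _
  have := h3 (z i) (z j) (hz i) (hz j)
  linear_combination this

lemma det_ff {p : ℂ} (hp : ‖p‖ < 1) {n : ℕ} {x : Fin n → ℂ} (hx : ∀ i, x i ≠ 0)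
    (hV : VV p x ≠ 0) {z : Fin n → ℂ} (hz : ∀ i, z i ≠ 0) :
    (Matrix.of fun i j => ff p x i (z j)).det = C0 x * VV p x * VV p z := by
  obtain ⟨c, hc⟩ := det_ff_const hp hx
  rw [hc z hz]
  congr 1
  have h1 := hc x hx
  have h2 : (Matrix.of fun i j => ff p x i (x j)) = Matrix.diagonal (fun i => ff p x i (x i)) := by
    ext i j
    by_cases h : i = j
    · subst h; simp
    · rw [Matrix.diagonal_apply_ne _ h, Matrix.of_apply]
      unfold ff
      apply Finset.prod_eq_zero (i := j) (by simp [Ne.symm h])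
      unfold Th
      rw [div_self (hx j), th_one, mul_zero]
  rw [h2, Matrix.det_diagonal] at h1
  have h3 : ∏ i, ff p x i (x i) = C0 x * VV p x * VV p x := by
    unfold ff C0 VV
    have := Finset.prod_prod_Ioi_mul_eq_prod_prod_off_diag (fun k i => Th p (x k) (x i))
    simp only [← Finset.prod_mul_distrib]
    have hcompl : ∀ i : Fin n, Finset.univ.erase i = {i}ᶜ := by intro i; ext; simp
    simp only [hcompl]
    rw [← this]
    apply Finset.prod_congr rfl
    intro i _
    apply Finset.prod_congr rfl
    intro j _
    have h4 := ps_antisymm hp (hx i) (hx j)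
    have h5 : Th p (x j) (x i) = x j * ps p (x j) (x i) := by
      unfold ps; rw [mul_inv_cancel_left₀ (hx j)]
    have h6 : Th p (x i) (x j) = x i * ps p (x i) (x j) := by
      unfold ps; rw [mul_inv_cancel_left₀ (hx i)]
    rw [h5, h6, h4]
    ring
  rw [h3] at h1
  exact (mul_right_cancel₀ hV h1).symm

/-- determinantal formula for the multiple integral -/
lemma DET {p q : ℂ} (hp : ‖p‖ < 1) (hq : ‖q‖ < 1) {n : ℕ} {ι : Type*} [Fintype ι] (t : ι → ℂ)
    {x y : Fin n → ℂ} (hx : ∀ i, x i ≠ 0) (hy : ∀ i, y i ≠ 0) (hVx : VV p x ≠ 0) (hVy : VV q y ≠ 0)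
    (hc : ∀ i j, ContinuousOn (fun z => ff p x i z * ff q y j z * Wt p q t z) {z | ‖z‖ = 1}) :
    (n.factorial : ℂ) *
      (Matrix.of fun i j => circleInt (fun z => ff p x i z * ff q y j z * Wt p q t z)).det =
    (C0 x * VV p x) * (C0 y * VV q y) * DD p q n t := by
  rw [← andreief _ _ _ hc]
  unfold DD
  rw [← torusInt_const_mul]
  apply torusInt_congr
  intro z hz
  have hz0 := fun i => ne_zero_of_norm_one (hz i)
  rw [det_ff hp hx hVx hz0, det_ff hq hy hVy hz0]
  ring

end Rains

namespace Rains
open Filter Topology Set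

lemma th_eq_zero {p : ℂ} (hp : ‖p‖ < 1) (_hp0 : p ≠ 0) {z : ℂ} (hz : z ≠ 0) (h : th p z = 0) :
    ∃ k : ℤ, z = p ^ k := by
  by_contra hcon
  push Not at hcon
  refine th_ne_zero hp ?_ ?_ hz h
  · intro j hj
    apply hcon (-(j:ℤ))
    rw [zpow_neg, zpow_natCast]
    exact eq_inv_of_mul_eq_one_left hj
  · intro j hj
    apply hcon (j + 1)
    have : p ^ ((j:ℤ) + 1) = p ^ (j + 1) := by exact_mod_cast zpow_natCast p (j + 1)
    rw [this]
    exact hj.symm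

lemma th_zpow {p : ℂ} (hp : ‖p‖ < 1) (hp0 : p ≠ 0) (k : ℤ) : th p (p ^ k) = 0 := by
  have h1 : ∀ k : ℤ, th p (p ^ k) = 0 → th p (p ^ (k + 1)) = 0 := by
    intro k h
    rw [zpow_add_one₀ hp0, mul_comm, th_mul_p hp hp0 (zpow_ne_zero _ hp0), h, mul_zero]
  have h2 : ∀ k : ℤ, th p (p ^ k) = 0 → th p (p ^ (k - 1)) = 0 := by
    intro k h
    rw [zpow_sub_one₀ hp0, ← div_eq_mul_inv, th_div_p hp hp0 (zpow_ne_zero _ hp0), h, mul_zero]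
  induction k using Int.induction_on with
  | zero => simp [th_one]
  | succ k ih => exact h1 _ ih
  | pred k ih => exact h2 _ ih

lemma two_dim {p : ℂ} (hp : ‖p‖ < 1) {a a' b₁ b₂ : ℂ} (ha : a ≠ 0) (ha' : a' ≠ 0)
    (hb1 : b₁ ≠ 0) (hb2 : b₂ ≠ 0) (h1 : th p (a / a') ≠ 0) (h2 : th p (a * a' / (b₁ * b₂)) ≠ 0) :
    ∃ l m : ℂ, ∀ x, x ≠ 0 → th p (x / b₁) * th p (x / b₂) =
      l * (th p (x / a) * th p (x / (b₁ * b₂ / a))) +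
      m * (th p (x / a') * th p (x / (b₁ * b₂ / a'))) := by
  obtain ⟨g, hg'⟩ := IsAlgClosed.exists_pow_nat_eq (b₁ * b₂) two_pos
  have hg := hg'.symm
  have hg0 : g ≠ 0 := by
    rintro rfl
    simp at hg
    tauto
  have hT : ∀ x y, x ≠ 0 → y ≠ 0 →
      th p (x / y) * th p (x / (b₁ * b₂ / y)) = x / g * ps p (x / g) (g / y) := by
    intro x y hx hy
    unfold ps Th
    rw [mul_inv_cancel_left₀ (div_ne_zero hx hg0)]
    rw [hg]
    congr 2 <;> field_simp
  have hk : ps p (g / a) (g / a') ≠ 0 := by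
    unfold ps Th
    have e1 : g / a * (g / a') = (a * a' / (b₁ * b₂))⁻¹ := by rw [hg]; field_simp
    have e2 : g / a / (g / a') = (a / a')⁻¹ := by field_simp
    rw [e1, e2, th_inv hp (by rw [hg]; exact div_ne_zero (mul_ne_zero ha ha') (pow_ne_zero _ hg0)),
      th_inv hp (div_ne_zero ha ha')]
    have t1 : a * a' / (b₁ * b₂) ≠ 0 := div_ne_zero (mul_ne_zero ha ha') (mul_ne_zero hb1 hb2)
    have t2 : a / a' ≠ 0 := div_ne_zero ha ha'
    have t3 : g / a ≠ 0 := div_ne_zero hg0 ha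
    exact mul_ne_zero (inv_ne_zero t3) (mul_ne_zero (mul_ne_zero (neg_ne_zero.2 (inv_ne_zero t1)) h2)
      (mul_ne_zero (neg_ne_zero.2 (inv_ne_zero t2)) h1))
  refine ⟨ps p (g / b₁) (g / a') / ps p (g / a) (g / a'),
    - ps p (g / b₁) (g / a) / ps p (g / a) (g / a'), fun x hx => ?_⟩
  rw [hT x a hx ha, hT x a' hx ha']
  have h3 := hT x b₁ hx hb1
  rw [mul_div_cancel_left₀ _ hb1] at h3
  rw [h3]
  have h4 := three_term hp (div_ne_zero hx hg0) (div_ne_zero hg0 hb1) (div_ne_zero hg0 ha)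
    (div_ne_zero hg0 ha')
  field_simp
  linear_combination h4

lemma pf_list {p : ℂ} (hp : ‖p‖ < 1) (hp0 : p ≠ 0) {ι : Type*} [DecidableEq ι] (A : ι → ℂ)
    (hA : ∀ i, A i ≠ 0) :
    ∀ (n : ℕ) (B : List ℂ) (s : Finset ι), B.length = n → (∀ b ∈ B, b ≠ 0) → s.card = n →
      (∀ i ∈ s, ∀ j ∈ s, i ≠ j → th p (A i / A j) ≠ 0) → ∏ i ∈ s, A i = B.prod →
      ∑ i ∈ s, (B.map fun b => th p (A i / b)).prod / ∏ j ∈ s.erase i, th p (A i / A j) = 0 := by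
  intro n
  induction n with
  | zero =>
    intro B s hB _ hs
    rw [Finset.card_eq_zero] at hs
    simp [hs]
  | succ n ih =>
    intro B s hB hB0 hs hne hprod
    rcases B with _ | ⟨b₁, _ | ⟨b₂, B⟩⟩
    · simp at hB
    · -- one element
      simp at hB
      subst hB
      obtain ⟨i, rfl⟩ := Finset.card_eq_one.1 hs
      simp at hprod
      have hb : b₁ ≠ 0 := hB0 b₁ (by simp)
      simp [hprod, div_self hb, th_one]
    · have hb1 : b₁ ≠ 0 := hB0 b₁ (by simp)
      have hb2 : b₂ ≠ 0 := hB0 b₂ (by simp)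
      simp only [List.length_cons, Nat.add_right_cancel_iff] at hB
      rcases B with _ | ⟨b₃, B⟩
      · simp at hB
        subst hB
        obtain ⟨i, j, hij, rfl⟩ := Finset.card_eq_two.1 hs
        rw [Finset.prod_pair hij] at hprod
        simp at hprod
        rw [Finset.sum_pair hij]
        have e1 : ({i, j} : Finset ι).erase i = {j} := by ext k; simp; grind
        have e2 : ({i, j} : Finset ι).erase j = {i} := by ext k; simp; grind
        rw [e1, e2]
        simp only [List.map_cons, List.map_nil, List.prod_cons, List.prod_nil, Finset.prod_singleton,
          mul_one]
        have h1 := hne i (by simp) j (by simp) hij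
        have hi := hA i
        have hj := hA j
        have q1 : A j / b₁ = (A i / b₂)⁻¹ := by field_simp; linear_combination hprod
        have q2 : A j / b₂ = (A i / b₁)⁻¹ := by field_simp; linear_combination hprod
        have q3 : A j / A i = (A i / A j)⁻¹ := by rw [inv_div]
        rw [q1, q2, q3, th_inv hp (div_ne_zero hi hb1), th_inv hp (div_ne_zero hi hb2),
          th_inv hp (div_ne_zero hi hj)]
        field_simp
        linear_combination (th p (A i / b₁) * th p (A i / b₂)) * hprod
      · -- main step
        have hcard : 2 < s.card := by rw [hs, ← hB]; simp
        have hbb : b₁ * b₂ ≠ 0 := mul_ne_zero hb1 hb2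
        obtain ⟨i0, i1, hi0, hi1, h01, hnd⟩ : ∃ i0 i1, i0 ∈ s ∧ i1 ∈ s ∧ i0 ≠ i1 ∧
            th p (A i0 * A i1 / (b₁ * b₂)) ≠ 0 := by
          obtain ⟨i, j, k, hi, hj, hk, hij, hik, hjk⟩ := Finset.two_lt_card_iff.1 hcard
          by_contra hcon
          push Not at hcon
          obtain ⟨u, hu⟩ := th_eq_zero hp hp0
            (div_ne_zero (mul_ne_zero (hA _) (hA _)) hbb) (hcon i j hi hj hij)
          obtain ⟨v, hv⟩ := th_eq_zero hp hp0
            (div_ne_zero (mul_ne_zero (hA _) (hA _)) hbb) (hcon i k hi hk hik)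
          apply hne j hj k hk hjk
          have : A j / A k = p ^ (u - v) := by
            rw [zpow_sub₀ hp0, ← hu, ← hv]
            have := hA i
            have := hA j
            have := hA k
            field_simp
          rw [this, th_zpow hp hp0]
        obtain ⟨l, m, hlm⟩ := two_dim hp (hA i0) (hA i1) hb1 hb2 (hne i0 hi0 i1 hi1 h01) hnd
        have red : ∀ i0 ∈ s, ∑ i ∈ s, (th p (A i / A i0) * th p (A i / (b₁ * b₂ / A i0)) *
            ((b₃ :: B).map fun b => th p (A i / b)).prod) / ∏ j ∈ s.erase i, th p (A i / A j) = 0 := by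
          intro i0 hi0
          have h := ih ((b₁ * b₂ / A i0) :: b₃ :: B) (s.erase i0) (by simp at hB ⊢; omega) (by
            intro b hb
            rcases List.mem_cons.1 hb with h | h
            · rw [h]; exact div_ne_zero hbb (hA _)
            · exact hB0 b (by simp only [List.mem_cons] at h ⊢; tauto)) (by
            rw [Finset.card_erase_of_mem hi0, hs]; rfl) (fun i hi j hj hij =>
              hne i (Finset.mem_of_mem_erase hi) j (Finset.mem_of_mem_erase hj) hij) (by
            have := Finset.mul_prod_erase s A hi0
            rw [hprod] at this
            simp only [List.prod_cons] at this ⊢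
            have h0 := hA i0
            field_simp
            linear_combination this)
          rw [← h, ← Finset.add_sum_erase s _ hi0]
          rw [div_self (hA i0), th_one]
          simp only [zero_mul, zero_div, zero_add]
          apply Finset.sum_congr rfl
          intro i hi
          have hmem : i0 ∈ s.erase i := Finset.mem_erase.2 ⟨(Finset.ne_of_mem_erase hi).symm, hi0⟩
          rw [← Finset.mul_prod_erase _ _ hmem, Finset.erase_right_comm]
          have h5 := hne i (Finset.mem_of_mem_erase hi) i0 hi0 (Finset.ne_of_mem_erase hi)
          rw [mul_assoc, mul_div_mul_left _ _ h5, List.map_cons (l := b₃ :: B), List.prod_cons]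
        have r0 := red i0 hi0
        have r1 := red i1 hi1
        have : ∀ i ∈ s, ((b₁ :: b₂ :: b₃ :: B).map fun b => th p (A i / b)).prod /
            ∏ j ∈ s.erase i, th p (A i / A j) =
            l * ((th p (A i / A i0) * th p (A i / (b₁ * b₂ / A i0)) *
            ((b₃ :: B).map fun b => th p (A i / b)).prod) / ∏ j ∈ s.erase i, th p (A i / A j)) +
            m * ((th p (A i / A i1) * th p (A i / (b₁ * b₂ / A i1)) *
            ((b₃ :: B).map fun b => th p (A i / b)).prod) / ∏ j ∈ s.erase i, th p (A i / A j)) := by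
          intro i _
          rw [List.map_cons, List.prod_cons, List.map_cons, List.prod_cons, ← mul_assoc,
            hlm (A i) (hA i)]
          ring
        rw [Finset.sum_congr rfl this, Finset.sum_add_distrib, ← Finset.mul_sum, ← Finset.mul_sum,
          r0, r1]
        simp

lemma th_div_pow {p : ℂ} (hp : ‖p‖ < 1) (hp0 : p ≠ 0) (r : ℕ) :
    ∃ c : ℂ, c ≠ 0 ∧ ∀ z, z ≠ 0 → th p (z / p ^ r) = c * z ^ r * th p z := by
  induction r with
  | zero => exact ⟨1, one_ne_zero, fun z _ => by simp⟩
  | succ r ih =>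
    obtain ⟨c, hc, h⟩ := ih
    refine ⟨-c * p⁻¹ ^ (r + 1), mul_ne_zero (neg_ne_zero.2 hc) (pow_ne_zero _ (inv_ne_zero hp0)),
      fun z hz => ?_⟩
    have : z / p ^ (r + 1) = (z / p) / p ^ r := by
      rw [pow_succ, div_div, mul_comm p]
    rw [this, h _ (div_ne_zero hz hp0), th_div_p hp hp0 hz, div_pow, inv_pow]
    field_simp
    ring

/-- elliptic partial fractions -/
lemma pf_shift {p : ℂ} (hp : ‖p‖ < 1) (hp0 : p ≠ 0) {ι κ : Type*} [Fintype ι] [Fintype κ]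
    [DecidableEq ι] (A : ι → ℂ) (hA : ∀ i, A i ≠ 0) (v : κ → ℂ) (hv : ∀ i, v i ≠ 0) (r : ℕ)
    (hcard : Fintype.card ι = Fintype.card κ)
    (hne : ∀ i j, i ≠ j → th p (A i / A j) ≠ 0) (hprod : (∏ i, A i) * ∏ k, v k = p ^ r) :
    ∑ i, A i ^ r * (∏ k, th p (v k * A i)) / ∏ j ∈ Finset.univ.erase i, th p (A i / A j) = 0 := by
  classical
  rcases isEmpty_or_nonempty κ with hκ | ⟨⟨k0⟩⟩
  · have : IsEmpty ι := by
      rw [← Fintype.card_eq_zero_iff, hcard, Fintype.card_eq_zero_iff]; exact hκ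
    simp
  obtain ⟨c, hc, hcz⟩ := th_div_pow hp hp0 r
  set B : κ → ℂ := fun k => if k = k0 then p ^ r / v k else (v k)⁻¹ with hB
  have hB0 : ∀ k, B k ≠ 0 := by
    intro k
    simp only [hB]
    split_ifs
    · exact div_ne_zero (pow_ne_zero _ hp0) (hv k)
    · exact inv_ne_zero (hv k)
  have hBprod : ∏ k, B k = p ^ r * ∏ k, (v k)⁻¹ := by
    rw [← Finset.mul_prod_erase Finset.univ B (Finset.mem_univ k0),
      ← Finset.mul_prod_erase Finset.univ (fun k => (v k)⁻¹) (Finset.mem_univ k0), ← mul_assoc]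
    congr 1
    · simp [hB, div_eq_mul_inv]
    · apply Finset.prod_congr rfl
      intro k hk
      simp [hB, Finset.ne_of_mem_erase hk]
  have hvp : ∏ k, v k ≠ 0 := Finset.prod_ne_zero_iff.2 (fun k _ => hv k)
  have h := pf_list hp hp0 A hA (Fintype.card κ) (Finset.univ.toList.map B) Finset.univ (by simp)
    (by
      intro b hb
      rw [List.mem_map] at hb
      obtain ⟨k, _, rfl⟩ := hb
      exact hB0 k) (by simp [hcard]) (fun i _ j _ hij => hne i j hij) (by
      rw [Finset.prod_map_toList, hBprod, Finset.prod_inv_distrib, ← hprod]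
      field_simp)
  have hcv : c * v k0 ^ r ≠ 0 := mul_ne_zero hc (pow_ne_zero _ (hv k0))
  apply mul_left_cancel₀ hcv
  rw [mul_zero, ← h, Finset.mul_sum]
  apply Finset.sum_congr rfl
  intro i _
  rw [← mul_div_assoc]
  congr 1
  rw [List.map_map, Finset.prod_map_toList]
  rw [← Finset.mul_prod_erase Finset.univ _ (Finset.mem_univ k0),
      ← Finset.mul_prod_erase Finset.univ (fun k => ((fun b => th p (A i / b)) ∘ B) k)
        (Finset.mem_univ k0)]
  have e1 : ((fun b => th p (A i / b)) ∘ B) k0 = c * (v k0 * A i) ^ r * th p (v k0 * A i) := by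
    rw [← hcz _ (mul_ne_zero (hv k0) (hA i))]
    simp only [Function.comp, hB, if_true]
    congr 1
    field_simp
  have e2 : ∏ k ∈ Finset.univ.erase k0, ((fun b => th p (A i / b)) ∘ B) k =
      ∏ k ∈ Finset.univ.erase k0, th p (v k * A i) := by
    apply Finset.prod_congr rfl
    intro k hk
    simp only [Function.comp, hB, Finset.ne_of_mem_erase hk, if_false]
    congr 1
    field_simp
  rw [e1, e2]
  ring

end Rains

namespace Rains
open Filter Topology Set

lemma th_inv_ne {q : ℂ} (hq : ‖q‖ < 1) {z : ℂ} (hz : z ≠ 0) (h : th q z⁻¹ ≠ 0) : th q z ≠ 0 := by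
  intro h0
  apply h
  rw [th_inv hq hz, h0, mul_zero]

lemma th_ne_zero_of_gt {q : ℂ} (hq : ‖q‖ < 1) {z : ℂ} (h1 : 1 < ‖z‖) (h2 : ‖q‖ * ‖z‖ < 1) :
    th q z ≠ 0 := by
  have hz : z ≠ 0 := by intro h; simp [h] at h1; linarith
  apply th_inv_ne hq hz
  have hz' : 0 < ‖z‖ := norm_pos_iff.2 hz
  apply th_ne_zero_of_lt hq
  · rw [norm_inv]; exact inv_lt_one_of_one_lt₀ h1
  · rw [norm_inv, ← one_div, lt_div_iff₀ hz']
    exact h2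

noncomputable def TT (p q : ℂ) {ι : Type*} [Fintype ι] (u : ι → ℂ) (b b' z : ℂ) : ℂ :=
  z⁻¹ * th p (z ^ 2) * (∏ i, Gm p q (p * (u i * z)) * Gm p q (u i / z)) /
    (th q (z / b) * th q (z / b'))

lemma TT_den {q p : ℂ} (hq : ‖q‖ < 1) (hp0 : p ≠ 0)
    {b : ℂ} (hb0 : b ≠ 0) (hb1 : ‖b‖ < 1) (hb2 : ‖q‖ ^ 2 < ‖b‖ ^ 2 * ‖p‖) {z : ℂ}
    (hz1 : 1 ≤ ‖z‖) (hz2 : ‖z‖ ^ 2 * ‖p‖ ≤ 1) : th q (z / b) ≠ 0 := by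
  have hb0' : 0 < ‖b‖ := norm_pos_iff.2 hb0
  have hp0' : 0 < ‖p‖ := norm_pos_iff.2 hp0
  apply th_ne_zero_of_gt hq
  · rw [norm_div, lt_div_iff₀ hb0']; linarith
  · rw [norm_div, ← mul_div_assoc, div_lt_one hb0']
    have : (‖q‖ * ‖z‖) ^ 2 < ‖b‖ ^ 2 := by
      have hz0 : 0 < ‖z‖ ^ 2 := by positivity
      calc (‖q‖ * ‖z‖) ^ 2 = ‖q‖ ^ 2 * ‖z‖ ^ 2 := by ring
        _ < (‖b‖ ^ 2 * ‖p‖) * ‖z‖ ^ 2 := by gcongr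
        _ = ‖b‖ ^ 2 * (‖z‖ ^ 2 * ‖p‖) := by ring
        _ ≤ ‖b‖ ^ 2 * 1 := by gcongr
        _ = _ := by ring
    exact lt_of_pow_lt_pow_left₀ 2 hb0'.le this

lemma TT_refl {p q : ℂ} (hp : ‖p‖ < 1) (hq : ‖q‖ < 1) (hp0 : p ≠ 0) (hq0 : q ≠ 0)
    {ι : Type*} [Fintype ι] (u : ι → ℂ) {b b' : ℂ} (hbb : b * b' * p = q) {z : ℂ} (hz : z ≠ 0) :
    TT p q u b b' (1 / p / z) = - TT p q u b b' z := by
  have hb0 : b ≠ 0 := by rintro rfl; simp at hbb; exact hq0 hbb.symm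
  have hb'0 : b' ≠ 0 := by rintro rfl; simp at hbb; exact hq0 hbb.symm
  unfold TT
  have e1 : th p ((1 / p / z) ^ 2) = -(p⁻¹ ^ 3 * z⁻¹ ^ 6) * th p (z ^ 2) := by
    have : (1 / p / z) ^ 2 = (z ^ 2)⁻¹ / p / p := by field_simp
    rw [this, th_div_p hp hp0 (div_ne_zero (inv_ne_zero (pow_ne_zero _ hz)) hp0),
      th_div_p hp hp0 (inv_ne_zero (pow_ne_zero _ hz)), th_inv hp (pow_ne_zero _ hz)]
    field_simp
  have key : ∀ c c' : ℂ, c ≠ 0 → c' ≠ 0 → c * c' * p = q →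
      th q (1 / p / z / c) = (c' ^ 2 / (q * z ^ 2)) * th q (z / c') := by
    intro c c' hc hc' h
    have : 1 / p / z / c = (z / c')⁻¹ / q := by
      rw [← h]; field_simp
    rw [this, th_div_p hq hq0 (inv_ne_zero (div_ne_zero hz hc')), th_inv hq (div_ne_zero hz hc')]
    field_simp
  rw [e1, key b b' hb0 hb'0 hbb, key b' b hb'0 hb0 (by rw [← hbb]; ring)]
  have e3 : (∏ i, Gm p q (p * (u i * (1 / p / z))) * Gm p q (u i / (1 / p / z))) =
      ∏ i, Gm p q (p * (u i * z)) * Gm p q (u i / z) := by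
    apply Finset.prod_congr rfl
    intro i _
    rw [show p * (u i * (1 / p / z)) = u i / z by field_simp,
      show u i / (1 / p / z) = p * (u i * z) by field_simp, mul_comm]
  rw [e3]
  set G := ∏ i, Gm p q (p * (u i * z)) * Gm p q (u i / z)
  by_cases h1 : th q (z / b) = 0
  · simp [h1]
  by_cases h2 : th q (z / b') = 0
  · simp [h2]
  have : b' = q / (b * p) := by rw [← hbb]; field_simp
  generalize th q (z / b') = X at *
  subst this
  field_simp

lemma TT_diff {p q : ℂ} (hp : ‖p‖ < 1) (hq : ‖q‖ < 1) (hp0 : p ≠ 0)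
    {ι : Type*} [Fintype ι] (u : ι → ℂ) (hu0 : ∀ i, u i ≠ 0) (hu1 : ∀ i, ‖u i‖ < 1)
    {b b' : ℂ} (hb0 : b ≠ 0) (hb'0 : b' ≠ 0) (hb1 : ‖b‖ < 1) (hb1' : ‖b'‖ < 1)
    (hb2 : ‖q‖ ^ 2 < ‖b‖ ^ 2 * ‖p‖) (hb2' : ‖q‖ ^ 2 < ‖b'‖ ^ 2 * ‖p‖) {z : ℂ}
    (hz1 : 1 ≤ ‖z‖) (hz3 : ‖z‖ ^ 2 * ‖p‖ ≤ 1) : DifferentiableAt ℂ (TT p q u b b') z := by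
    have hz0 : z ≠ 0 := by intro h; simp [h] at hz1; linarith
    have hp0' : 0 < ‖p‖ := norm_pos_iff.2 hp0
    have hz4 : ‖p‖ * ‖z‖ ≤ 1 := by nlinarith
    unfold TT
    apply AnalyticAt.differentiableAt
    refine AnalyticAt.div ?_ ?_ ?_
    · refine ((analyticAt_id.inv hz0).mul (th_analyticAt (analyticAt_id.pow 2) analyticAt_const hp
        (pow_ne_zero _ hz0))).mul ?_
      apply Finset.analyticAt_fun_prod
      intro i _
      refine (Gm_analyticAt (analyticAt_const.mul (analyticAt_const.mul analyticAt_id))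
        analyticAt_const analyticAt_const hp hq (mul_ne_zero hp0 (mul_ne_zero (hu0 i) hz0)) ?_).mul
        (Gm_analyticAt (analyticAt_const.div analyticAt_id hz0)
        analyticAt_const analyticAt_const hp hq (div_ne_zero (hu0 i) hz0) ?_)
      · apply EE_ne_zero_of_lt hp hq
        show ‖p * (u i * z)‖ < 1
        rw [norm_mul, norm_mul]
        calc ‖p‖ * (‖u i‖ * ‖z‖) = ‖u i‖ * (‖p‖ * ‖z‖) := by ring
          _ ≤ ‖u i‖ * 1 := by gcongr
          _ < 1 := by linarith [hu1 i]
      · apply EE_ne_zero_of_lt hp hq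
        show ‖u i / z‖ < 1
        rw [norm_div, div_lt_one (by linarith)]
        linarith [hu1 i]
    · exact (th_analyticAt (analyticAt_id.div analyticAt_const hb0) analyticAt_const hq
        (div_ne_zero hz0 hb0)).mul (th_analyticAt (analyticAt_id.div analyticAt_const hb'0)
        analyticAt_const hq (div_ne_zero hz0 hb'0))
    · exact mul_ne_zero (TT_den hq hp0 hb0 hb1 hb2 hz1 hz3)
        (TT_den hq hp0 hb'0 hb1' hb2' hz1 hz3)

lemma exact0 {p q : ℂ} (hp : ‖p‖ < 1) (hq : ‖q‖ < 1) (hp0 : p ≠ 0) (hq0 : q ≠ 0)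
    {ι : Type*} [Fintype ι] (u : ι → ℂ) (hu0 : ∀ i, u i ≠ 0) (hu1 : ∀ i, ‖u i‖ < 1)
    {b b' : ℂ} (hbb : b * b' * p = q) (hb1 : ‖b‖ < 1) (hb1' : ‖b'‖ < 1)
    (hb2 : ‖q‖ ^ 2 < ‖b‖ ^ 2 * ‖p‖) (hb2' : ‖q‖ ^ 2 < ‖b'‖ ^ 2 * ‖p‖) :
    circleInt (TT p q u b b') = 0 := by
  have hb0 : b ≠ 0 := by rintro rfl; simp at hbb; exact hq0 hbb.symm
  have hb'0 : b' ≠ 0 := by rintro rfl; simp at hbb; exact hq0 hbb.symm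
  have hp0' : 0 < ‖p‖ := norm_pos_iff.2 hp0
  set R := Real.sqrt (1 / ‖p‖) with hR
  have hRR : R * R = 1 / ‖p‖ := Real.mul_self_sqrt (by positivity)
  have hR1 : 1 ≤ R := by
    rw [hR, Real.one_le_sqrt, le_div_iff₀ hp0']; linarith
  have hR0 : 0 < R := by linarith
  rw [circleInt_eq_av, ← av_eq_av one_pos hR1]
  · refine av_eq_zero_of_antisymm hR0 (c := 1 / p) (by rw [hRR]; simp) ?_
    intro z hz
    exact TT_refl hp hq hp0 hq0 u hbb (by intro h; simp [h] at hz; linarith)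
  · intro z hz1 hz2
    have hz0 : z ≠ 0 := by intro h; simp [h] at hz1; linarith
    have hz3 : ‖z‖ ^ 2 * ‖p‖ ≤ 1 := by
      calc ‖z‖ ^ 2 * ‖p‖ ≤ R ^ 2 * ‖p‖ := by gcongr
        _ = 1 := by rw [pow_two, hRR]; field_simp
    exact TT_diff hp hq hp0 u hu0 hu1 hb0 hb'0 hb1 hb1' hb2 hb2' hz1 hz3

end Rains

namespace Rains
open Filter Topology Set

lemma circleInt_congr' {f g : ℂ → ℂ} (h : ∀ z, ‖z‖ = 1 → z ^ 2 ≠ 1 → f z = g z) :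
    circleInt f = circleInt g := by
  unfold circleInt
  congr 1
  apply circleIntegral.circleIntegral_congr_codiscreteWithin _ one_ne_zero
  have h1 : ({1, -1} : Set ℂ)ᶜ ∈ codiscreteWithin (Metric.sphere (0:ℂ) |1|) :=
    compl_finite_mem_codiscreteWithin (by simp)
  have h2 : Metric.sphere (0:ℂ) |1| ∈ codiscreteWithin (Metric.sphere (0:ℂ) |1|) :=
    self_mem_codiscreteWithin _
  filter_upwards [h1, h2] with z hz1 hz2
  simp only [mem_compl_iff, mem_insert_iff, mem_singleton_iff, not_or] at hz1
  simp at hz2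
  show f z / z = g z / z
  rw [h z hz2]
  intro h
  rcases sq_eq_sq_iff_eq_or_eq_neg.1 (show z ^ 2 = 1 ^ 2 by rw [h, one_pow]) with h | h <;> tauto

/-- product of all theta factors but one -/
noncomputable def gg (q : ℂ) {ι : Type*} [Fintype ι] [DecidableEq ι] (y : ι → ℂ) (j : ι) (z : ℂ) : ℂ :=
  ∏ l ∈ Finset.univ.erase j, Th q (y l) z

lemma prod_erase_inl {α β : Type*} [Fintype α] [Fintype β] [DecidableEq α] [DecidableEq β]
    (f : α ⊕ β → ℂ) (i : α) : ∏ j ∈ Finset.univ.erase (Sum.inl i), f j =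
      (∏ j ∈ Finset.univ.erase i, f (Sum.inl j)) * ∏ k, f (Sum.inr k) := by
  rw [← Finset.prod_disjSum]
  congr 1
  ext x
  rcases x with x | x <;> simp

lemma prod_erase_inr {α β : Type*} [Fintype α] [Fintype β] [DecidableEq α] [DecidableEq β]
    (f : α ⊕ β → ℂ) (i : β) : ∏ j ∈ Finset.univ.erase (Sum.inr i), f j =
      (∏ k, f (Sum.inl k)) * (∏ j ∈ Finset.univ.erase i, f (Sum.inr j)) := by
  rw [← Finset.prod_disjSum]
  congr 1
  ext x
  rcases x with x | x <;> simp

lemma prod_erase_four (f : Fin 4 → ℂ) :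
    ∏ j ∈ Finset.univ.erase (0 : Fin 4), f j = f 1 * f 2 * f 3 ∧
    ∏ j ∈ Finset.univ.erase (1 : Fin 4), f j = f 0 * f 2 * f 3 ∧
    ∏ j ∈ Finset.univ.erase (2 : Fin 4), f j = f 0 * f 1 * f 3 ∧
    ∏ j ∈ Finset.univ.erase (3 : Fin 4), f j = f 0 * f 1 * f 2 := by
  have e0 : Finset.univ.erase (0 : Fin 4) = {1, 2, 3} := by decide
  have e1 : Finset.univ.erase (1 : Fin 4) = {0, 2, 3} := by decide
  have e2 : Finset.univ.erase (2 : Fin 4) = {0, 1, 3} := by decide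
  have e3 : Finset.univ.erase (3 : Fin 4) = {0, 1, 2} := by decide
  rw [e0, e1, e2, e3]
  refine ⟨?_, ?_, ?_, ?_⟩ <;> simp [mul_assoc]

lemma Wt_inv {p q : ℂ} (hp : ‖p‖ < 1) (hq : ‖q‖ < 1) {ι : Type*} [Fintype ι] (t : ι → ℂ) {z : ℂ}
    (hz : z ≠ 0) : Wt p q t z⁻¹ = Wt p q t z := by
  unfold Wt
  congr 1
  · apply Finset.prod_congr rfl
    intro i _
    rw [div_inv_eq_mul, ← div_eq_mul_inv, mul_comm]
  · rw [inv_inv, inv_pow, th_inv hp (pow_ne_zero _ hz), th_inv hq (pow_ne_zero _ hz)]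
    ring

lemma Th_inv (q x z : ℂ) : Th q x z⁻¹ = Th q x z := by
  unfold Th
  rw [div_inv_eq_mul, ← div_eq_mul_inv, mul_comm]

lemma Wt_analyticAt {p q : ℂ} (hp : ‖p‖ < 1) (hq : ‖q‖ < 1) {ι : Type*} [Fintype ι] (t : ι → ℂ)
    (ht0 : ∀ i, t i ≠ 0) (ht : ∀ i, ‖t i‖ < 1) {z : ℂ} (hz : ‖z‖ = 1) :
    AnalyticAt ℂ (Wt p q t) z := by
  have hz0 := ne_zero_of_norm_one hz
  unfold Wt
  refine AnalyticAt.mul ?_ ?_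
  · apply Finset.analyticAt_fun_prod
    intro i _
    refine (Gm_analyticAt (analyticAt_const.mul analyticAt_id)
        analyticAt_const analyticAt_const hp hq (mul_ne_zero (ht0 i) hz0) ?_).mul
        (Gm_analyticAt (analyticAt_const.div analyticAt_id hz0)
        analyticAt_const analyticAt_const hp hq (div_ne_zero (ht0 i) hz0) ?_)
    · apply EE_ne_zero_of_lt hp hq
      show ‖t i * z‖ < 1
      rw [norm_mul, hz, mul_one]; exact ht i
    · apply EE_ne_zero_of_lt hp hq
      show ‖t i / z‖ < 1
      rw [norm_div, hz, div_one]; exact ht i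
  · exact (th_analyticAt (analyticAt_id.pow 2) analyticAt_const hp (pow_ne_zero _ hz0)).mul
      (th_analyticAt ((analyticAt_id.inv hz0).pow 2) analyticAt_const hq
        (pow_ne_zero _ (inv_ne_zero hz0)))

lemma Th_analyticAt' {q : ℂ} (hq : ‖q‖ < 1) {x z : ℂ} (hx : x ≠ 0) (hz : z ≠ 0) :
    AnalyticAt ℂ (fun z => Th q x z) z := by
  unfold Th
  exact (th_analyticAt (analyticAt_const.mul analyticAt_id) analyticAt_const hq
    (mul_ne_zero hx hz)).mul (th_analyticAt (analyticAt_const.div analyticAt_id hz)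
    analyticAt_const hq (div_ne_zero hx hz))

lemma Th_ne_zero {q : ℂ} (hq : ‖q‖ < 1) {x z : ℂ} (hx1 : ‖q‖ < ‖x‖) (hx2 : ‖x‖ < 1)
    (hz : ‖z‖ = 1) : Th q x z ≠ 0 := by
  unfold Th
  refine mul_ne_zero (th_ne_zero_of_lt hq ?_ ?_) (th_ne_zero_of_lt hq ?_ ?_) <;>
    simp [hz, hx1, hx2]

/-- the `z`-term of the partial fraction identity -/
lemma zterm {p q : ℂ} (hp : ‖p‖ < 1) (hq : ‖q‖ < 1) (hp0 : p ≠ 0)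
    {ι κ : Type*} [Fintype ι] [Fintype κ]
    (v : κ → ℂ) (y : ι → ℂ) (hy0 : ∀ i, y i ≠ 0)
    (hv1 : ∀ i, ‖v i‖ < 1) (hy1 : ∀ i, ‖y i‖ < 1) (hy2 : ∀ i, ‖q‖ < ‖y i‖)
    {b b' z : ℂ} (hz : ‖z‖ = 1) (hz2 : z ^ 2 ≠ 1) :
    z ^ (Fintype.card ι + 1) * (∏ k, th q (v k * z)) /
      ((∏ l, th q (z / y l)) * (th q (z / b) * th q (z / b') * th q (z / z⁻¹))) *
      ((∏ l, Th q (y l) z) * Wt p q (Sum.elim v y) z) =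
      -(∏ l, -(y l)) * TT p q (Sum.elim v y) b b' z := by
  have hz0 := ne_zero_of_norm_one hz
  have e1 : z / z⁻¹ = z ^ 2 := by field_simp
  have e2 : z⁻¹ ^ 2 = (z ^ 2)⁻¹ := by rw [inv_pow]
  have hth : th q (z ^ 2) ≠ 0 := th_ne_zero_of_norm_eq hq (by simp [hz]) hz2
  have hy3 : ∀ l, th q (z / y l) ≠ 0 := by
    intro l
    have : z / y l = (y l / z)⁻¹ := by rw [inv_div]
    rw [this]
    apply th_inv_ne hq (inv_ne_zero (div_ne_zero (hy0 l) hz0))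
    rw [inv_inv]
    apply th_ne_zero_of_lt hq <;> simp [hz, hy1 l, hy2 l]
  have e3 : ∏ l, Th q (y l) z = (∏ l, -(y l)) * (z⁻¹) ^ Fintype.card ι * (∏ l, th q (z / y l)) *
      ∏ l, th q (y l * z) := by
    have : (z⁻¹) ^ Fintype.card ι = ∏ l : ι, z⁻¹ := by simp
    rw [this, ← Finset.prod_mul_distrib, ← Finset.prod_mul_distrib, ← Finset.prod_mul_distrib]
    apply Finset.prod_congr rfl
    intro l _
    unfold Th
    have : y l / z = (z / y l)⁻¹ := by rw [inv_div]
    rw [this, th_inv hq (div_ne_zero hz0 (hy0 l))]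
    field_simp
  have e4 : ∏ i, (Gm p q (p * (Sum.elim v y i * z)) * Gm p q (Sum.elim v y i / z)) =
      (∏ k, th q (v k * z)) * (∏ l, th q (y l * z)) *
      ∏ i, (Gm p q (Sum.elim v y i * z) * Gm p q (Sum.elim v y i / z)) := by
    have : (∏ k, th q (v k * z)) * (∏ l, th q (y l * z)) = ∏ i, th q (Sum.elim v y i * z) := by
      rw [Fintype.prod_sum_type]; simp
    rw [this, ← Finset.prod_mul_distrib]
    apply Finset.prod_congr rfl
    intro i _
    rw [Gm_p hp hq hp0, mul_assoc]
    apply EE_ne_zero_of_lt hp hq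
    rcases i with i | i <;> simp [hz, hv1, hy1]
  unfold TT Wt
  rw [e4, e3, e1, e2, th_inv hq (pow_ne_zero _ hz0)]
  have hprod : ∏ l, th q (z / y l) ≠ 0 := Finset.prod_ne_zero_iff.2 (fun l _ => hy3 l)
  set G := ∏ i, (Gm p q (Sum.elim v y i * z) * Gm p q (Sum.elim v y i / z))
  set Y := ∏ l, -(y l)
  set P1 := ∏ l, th q (z / y l)
  set P2 := ∏ l, th q (y l * z)
  set P3 := ∏ k, th q (v k * z)
  by_cases h1 : th q (z / b) = 0
  · simp [h1]
  by_cases h2 : th q (z / b') = 0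
  · simp [h2]
  rw [inv_pow, pow_succ]
  field_simp


noncomputable def cc (q : ℂ) {ι κ : Type*} [Fintype ι] [Fintype κ] [DecidableEq ι]
    (v : κ → ℂ) (y : ι → ℂ) (b b' : ℂ) (j : ι) : ℂ :=
  y j ^ (Fintype.card ι + 1) * (∏ k, th q (v k * y j)) /
    ((∏ l ∈ Finset.univ.erase j, th q (y j / y l)) * (th q (y j / b) * th q (y j / b')))

noncomputable def cb (q : ℂ) {ι κ : Type*} [Fintype ι] [Fintype κ]
    (v : κ → ℂ) (y : ι → ℂ) (b b' : ℂ) : ℂ :=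
  b ^ (Fintype.card ι + 1) * (∏ k, th q (v k * b)) / ((∏ l, th q (b / y l)) * th q (b / b'))

lemma th_div_comm_ne {q : ℂ} (hq : ‖q‖ < 1) {a b : ℂ} (ha : a ≠ 0) (hb : b ≠ 0)
    (h : th q (a / b) ≠ 0) : th q (b / a) ≠ 0 := by
  apply th_inv_ne hq (div_ne_zero hb ha)
  rwa [inv_div]

lemma exact_pt {p q : ℂ} (hp : ‖p‖ < 1) (hq : ‖q‖ < 1) (hp0 : p ≠ 0) (hq0 : q ≠ 0)
    {ι κ : Type*} [Fintype ι] [Fintype κ] [DecidableEq ι]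
    (v : κ → ℂ) (y : ι → ℂ) (hcard : Fintype.card κ = Fintype.card ι + 4)
    (hv0 : ∀ i, v i ≠ 0) (hy0 : ∀ i, y i ≠ 0)
    (hv1 : ∀ i, ‖v i‖ < 1) (hy1 : ∀ i, ‖y i‖ < 1) (hy2 : ∀ i, ‖q‖ < ‖y i‖)
    (hprod : (∏ l, y l) * (∏ k, v k) = p * q ^ Fintype.card ι)
    {b b' : ℂ} (hbb : b * b' * p = q) (hb1 : ‖b‖ < 1) (hb1' : ‖b'‖ < 1)
    (hb2 : ‖q‖ < ‖b‖) (hb2' : ‖q‖ < ‖b'‖)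
    (hyy : ∀ i j, i ≠ j → th q (y i / y j) ≠ 0)
    (hyb : ∀ i, th q (y i / b) ≠ 0) (hyb' : ∀ i, th q (y i / b') ≠ 0) (hb : th q (b / b') ≠ 0)
    {z : ℂ} (hz : ‖z‖ = 1) (hz2 : z ^ 2 ≠ 1) :
    (∑ j, cc q v y b b' j * (gg q y j z * Wt p q (Sum.elim v y) z)) +
      (cb q v y b b' * ((∏ l, Th q (y l) z) / Th q b z * Wt p q (Sum.elim v y) z) +
      cb q v y b' b * ((∏ l, Th q (y l) z) / Th q b' z * Wt p q (Sum.elim v y) z) +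
      -(∏ l, -(y l)) * TT p q (Sum.elim v y) b b' z +
      -(∏ l, -(y l)) * TT p q (Sum.elim v y) b b' z⁻¹) = 0 := by
  classical
  have hb0 : b ≠ 0 := by rintro rfl; simp at hbb; exact hq0 hbb.symm
  have hb'0 : b' ≠ 0 := by rintro rfl; simp at hbb; exact hq0 hbb.symm
  have hz0 := ne_zero_of_norm_one hz
  have hth : th q (z / z⁻¹) ≠ 0 := by
    rw [show z / z⁻¹ = z ^ 2 by field_simp]
    exact th_ne_zero_of_norm_eq hq (by simp [hz]) hz2
  have hc1 : ∀ c : ℂ, c ≠ 0 → ‖c‖ < 1 → ‖q‖ < ‖c‖ → ∀ w : ℂ, ‖w‖ = 1 → th q (c / w) ≠ 0 := by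
    intro c _ h1 h2 w hw
    apply th_ne_zero_of_lt hq <;> simp [hw, h1, h2]
  have hc2 : ∀ c : ℂ, c ≠ 0 → ‖c‖ < 1 → ‖q‖ < ‖c‖ → ∀ w : ℂ, ‖w‖ = 1 → th q (w / c) ≠ 0 := by
    intro c h0 h1 h2 w hw
    exact th_div_comm_ne hq h0 (ne_zero_of_norm_one hw) (hc1 c h0 h1 h2 w hw)
  have hzi : ‖z⁻¹‖ = 1 := by simp [hz]
  set A : ι ⊕ Fin 4 → ℂ := Sum.elim y ![b, b', z, z⁻¹] with hA
  have hpf := pf_shift hq hq0 A (by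
      rintro (i | i)
      · exact hy0 i
      · fin_cases i <;> simp [hA, hb0, hb'0, hz0]) v hv0 (Fintype.card ι + 1)
    (by simp [hcard]) (by
      rintro (i | i) (j | j) hij
      · exact hyy i j (fun h => hij (by rw [h]))
      · fin_cases j
        · exact hyb i
        · exact hyb' i
        · exact hc1 _ (hy0 i) (hy1 i) (hy2 i) _ hz
        · exact hc1 _ (hy0 i) (hy1 i) (hy2 i) _ hzi
      · fin_cases i
        · exact th_div_comm_ne hq (hy0 j) hb0 (hyb j)
        · exact th_div_comm_ne hq (hy0 j) hb'0 (hyb' j)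
        · exact hc2 _ (hy0 j) (hy1 j) (hy2 j) _ hz
        · exact hc2 _ (hy0 j) (hy1 j) (hy2 j) _ hzi
      · fin_cases i <;> fin_cases j <;> try (exact absurd rfl hij)
        · exact hb
        · exact hc1 _ hb0 hb1 hb2 _ hz
        · exact hc1 _ hb0 hb1 hb2 _ hzi
        · exact th_div_comm_ne hq hb0 hb'0 hb
        · exact hc1 _ hb'0 hb1' hb2' _ hz
        · exact hc1 _ hb'0 hb1' hb2' _ hzi
        · exact hc2 _ hb0 hb1 hb2 _ hz
        · exact hc2 _ hb'0 hb1' hb2' _ hz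
        · exact hth
        · exact hc2 _ hb0 hb1 hb2 _ hzi
        · exact hc2 _ hb'0 hb1' hb2' _ hzi
        · exact th_div_comm_ne hq hz0 (inv_ne_zero hz0) hth)
    (by
      rw [Fintype.prod_sum_type]
      simp only [hA, Sum.elim_inl, Sum.elim_inr, Fin.prod_univ_four]
      simp only [Matrix.cons_val]
      have : (∏ l, y l) * (b * b' * z * z⁻¹) * ∏ k, v k = ((∏ l, y l) * ∏ k, v k) * (b * b') := by
        field_simp
      rw [this, hprod, pow_succ, ← hbb]
      ring)
  rw [Fintype.sum_sum_type] at hpf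
  simp only [prod_erase_inl, prod_erase_inr, Fin.sum_univ_four] at hpf
  simp only [(prod_erase_four _).1, (prod_erase_four _).2.1, (prod_erase_four _).2.2.1,
    (prod_erase_four _).2.2.2, Fin.prod_univ_four, hA, Sum.elim_inl, Sum.elim_inr] at hpf
  simp only [Matrix.cons_val] at hpf
  have hz3 := zterm hp hq hp0 v y hy0 hv1 hy1 hy2 (b := b) (b' := b') hz hz2
  have hz4 := zterm hp hq hp0 v y hy0 hv1 hy1 hy2 (b := b) (b' := b') hzi (z := z⁻¹) (by
    rw [inv_pow]; simpa using hz2)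
  rw [Wt_inv hp hq _ hz0, inv_inv] at hz4
  simp only [Th_inv] at hz4
  rw [← hz3, ← hz4]
  set W := Wt p q (Sum.elim v y) z
  set P := ∏ l, Th q (y l) z with hP
  have hmul := congrArg (· * (P * W)) hpf
  simp only [zero_mul, add_mul] at hmul
  rw [← hmul, Finset.sum_mul]
  have hdiv : ∀ c : ℂ, th q (c / z⁻¹) = th q (c * z) := by intro c; rw [div_inv_eq_mul]
  congr 1
  · apply Finset.sum_congr rfl
    intro j _
    have hT := Th_ne_zero hq (hy2 j) (hy1 j) hz
    have h1 : P = Th q (y j) z * gg q y j z := (Finset.mul_prod_erase _ _ (Finset.mem_univ j)).symm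
    rw [h1, hdiv]
    unfold cc
    unfold Th at hT ⊢
    have h2 := hyb j
    have h3 := hyb' j
    have h4 : ∏ l ∈ Finset.univ.erase j, th q (y j / y l) ≠ 0 := by
      apply Finset.prod_ne_zero_iff.2
      intro l hl
      exact hyy j l (Finset.ne_of_mem_erase hl).symm
    have h5 := left_ne_zero_of_mul hT
    have h6 := right_ne_zero_of_mul hT
    generalize ∏ x, th q (v x * y j) = X
    field_simp
  · rw [hdiv, hdiv]
    have hT := Th_ne_zero hq hb2 hb1 hz
    have hT' := Th_ne_zero hq hb2' hb1' hz
    unfold cb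
    unfold Th at hT hT' ⊢
    have h5 := left_ne_zero_of_mul hT
    have h6 := right_ne_zero_of_mul hT
    have h5' := left_ne_zero_of_mul hT'
    have h6' := right_ne_zero_of_mul hT'
    have hbr := th_div_comm_ne hq hb0 hb'0 hb
    have h7 : ∏ l, th q (b / y l) ≠ 0 := Finset.prod_ne_zero_iff.2
      (fun l _ => th_div_comm_ne hq (hy0 l) hb0 (hyb l))
    have h8 : ∏ l, th q (b' / y l) ≠ 0 := Finset.prod_ne_zero_iff.2
      (fun l _ => th_div_comm_ne hq (hy0 l) hb'0 (hyb' l))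
    congr 1
    congr 1
    congr 1
    · generalize ∏ x, th q (v x * b) = X
      field_simp
    · generalize ∏ x, th q (v x * b') = X
      field_simp

noncomputable def HH (p q : ℂ) {ι κ : Type*} [Fintype ι] [Fintype κ]
    (v : κ → ℂ) (y : ι → ℂ) (b : ℂ) : ℂ :=
  circleInt (fun z => (∏ l, Th q (y l) z) / Th q b z * Wt p q (Sum.elim v y) z)

lemma exact1 {p q : ℂ} (hp : ‖p‖ < 1) (hq : ‖q‖ < 1) (hp0 : p ≠ 0) (hq0 : q ≠ 0)
    {ι κ : Type*} [Fintype ι] [Fintype κ] [DecidableEq ι]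
    (v : κ → ℂ) (y : ι → ℂ) (hcard : Fintype.card κ = Fintype.card ι + 4)
    (hv0 : ∀ i, v i ≠ 0) (hy0 : ∀ i, y i ≠ 0)
    (hv1 : ∀ i, ‖v i‖ < 1) (hy1 : ∀ i, ‖y i‖ < 1) (hy2 : ∀ i, ‖q‖ < ‖y i‖)
    (hprod : (∏ l, y l) * (∏ k, v k) = p * q ^ Fintype.card ι)
    {b b' : ℂ} (hbb : b * b' * p = q) (hb1 : ‖b‖ < 1) (hb1' : ‖b'‖ < 1)
    (hb2 : ‖q‖ ^ 2 < ‖b‖ ^ 2 * ‖p‖) (hb2' : ‖q‖ ^ 2 < ‖b'‖ ^ 2 * ‖p‖)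
    (hyy : ∀ i j, i ≠ j → th q (y i / y j) ≠ 0)
    (hyb : ∀ i, th q (y i / b) ≠ 0) (hyb' : ∀ i, th q (y i / b') ≠ 0) (hb : th q (b / b') ≠ 0) :
    (∑ j, cc q v y b b' j * circleInt (fun z => gg q y j z * Wt p q (Sum.elim v y) z)) +
      (cb q v y b b' * HH p q v y b + cb q v y b' b * HH p q v y b') = 0 := by
  have hb0 : b ≠ 0 := by rintro rfl; simp at hbb; exact hq0 hbb.symm
  have hb'0 : b' ≠ 0 := by rintro rfl; simp at hbb; exact hq0 hbb.symm
  have hlt : ∀ c : ℂ, ‖q‖ ^ 2 < ‖c‖ ^ 2 * ‖p‖ → ‖q‖ < ‖c‖ := by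
    intro c h
    apply lt_of_pow_lt_pow_left₀ 2 (norm_nonneg _)
    nlinarith [norm_nonneg c, sq_nonneg ‖c‖]
  have hq1 := hlt b hb2
  have hq1' := hlt b' hb2'
  set Y := -(∏ l, -(y l)) with hY
  have hu0 : ∀ i, Sum.elim v y i ≠ 0 := by rintro (i | i) <;> simp [hv0, hy0]
  have hu1 : ∀ i, ‖Sum.elim v y i‖ < 1 := by rintro (i | i) <;> simp [hv1, hy1]
  have hWc : ∀ z : ℂ, ‖z‖ = 1 → ContinuousAt (Wt p q (Sum.elim v y)) z := fun z hz =>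
    (Wt_analyticAt hp hq _ hu0 hu1 hz).continuousAt
  have hThc : ∀ (c : ℂ), c ≠ 0 → ∀ z : ℂ, ‖z‖ = 1 → ContinuousAt (fun z => Th q c z) z :=
    fun c hc z hz => (Th_analyticAt' hq hc (ne_zero_of_norm_one hz)).continuousAt
  have hTT : ∀ z : ℂ, ‖z‖ = 1 → ContinuousAt (TT p q (Sum.elim v y) b b') z := fun z hz =>
    (TT_diff hp hq hp0 _ hu0 hu1 hb0 hb'0 hb1 hb1' hb2 hb2' hz.ge (by rw [hz]; simpa using hp.le)).continuousAt
  let h : ι ⊕ Fin 4 → ℂ → ℂ := Sum.elim (fun j z => gg q y j z * Wt p q (Sum.elim v y) z)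
    ![fun z => (∏ l, Th q (y l) z) / Th q b z * Wt p q (Sum.elim v y) z,
      fun z => (∏ l, Th q (y l) z) / Th q b' z * Wt p q (Sum.elim v y) z,
      fun z => TT p q (Sum.elim v y) b b' z, fun z => TT p q (Sum.elim v y) b b' z⁻¹]
  let c : ι ⊕ Fin 4 → ℂ := Sum.elim (cc q v y b b') ![cb q v y b b', cb q v y b' b, Y, Y]
  have hprodc : ∀ s : Finset ι, ∀ z : ℂ, ‖z‖ = 1 → ContinuousAt (fun z => ∏ l ∈ s, Th q (y l) z) z :=
    fun s z hz => tendsto_finsetProd _ (fun l _ => hThc _ (hy0 l) z hz)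
  have hsum := circleInt_sum Finset.univ c h (by
    rintro (j | j) _ z hz
    · exact ((hprodc _ z hz).mul (hWc z hz)).continuousWithinAt
    · apply ContinuousAt.continuousWithinAt
      fin_cases j
      · exact ((hprodc _ z hz).div (hThc b hb0 z hz) (Th_ne_zero hq hq1 hb1 hz)).mul (hWc z hz)
      · exact ((hprodc _ z hz).div (hThc b' hb'0 z hz) (Th_ne_zero hq hq1' hb1' hz)).mul (hWc z hz)
      · exact hTT z hz
      · exact ContinuousAt.comp (f := fun z : ℂ => z⁻¹) (g := TT p q (Sum.elim v y) b b')
          (hTT z⁻¹ (by simpa using hz)) (continuousAt_inv₀ (ne_zero_of_norm_one hz)))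
  have hzero : circleInt (fun z => ∑ a, c a * h a z) = 0 := by
    have : circleInt (fun z => ∑ a, c a * h a z) = circleInt (fun z => 0) := by
      apply circleInt_congr'
      intro z hz hz2
      rw [Fintype.sum_sum_type, Fin.sum_univ_four]
      exact exact_pt hp hq hp0 hq0 v y hcard hv0 hy0 hv1 hy1 hy2 hprod hbb hb1 hb1' hq1 hq1' hyy hyb
        hyb' hb hz hz2
    rw [this]
    simp [circleInt, circleIntegral]
  rw [hzero, Fintype.sum_sum_type, Fin.sum_univ_four] at hsum
  have e0 := exact0 hp hq hp0 hq0 _ hu0 hu1 hbb hb1 hb1' hb2 hb2'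
  have e1 : circleInt (h (Sum.inr 2)) = 0 := e0
  have e2 : circleInt (h (Sum.inr 3)) = 0 := by
    show circleInt (fun z => TT p q (Sum.elim v y) b b' z⁻¹) = 0
    rw [circleInt_inv, e0]
  rw [e1, e2, mul_zero, mul_zero, add_zero, add_zero] at hsum
  exact hsum.symm

end Rains

namespace Rains
open Filter Topology Set

/-- the modified parameter vector attached to the row `i` -/
noncomputable def hv (q : ℂ) {ι : Type*} [DecidableEq ι] (x : ι → ℂ) (a : Fin 4 → ℂ) (i : ι) :
    ι ⊕ Fin 4 → ℂ := Sum.elim (fun l => if l = i then x l else q * x l) a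

noncomputable def kap {ι : Type*} [Fintype ι] [DecidableEq ι] (x : ι → ℂ) (i : ι) : ℂ :=
  ∏ l ∈ Finset.univ.erase i, -(x l)⁻¹

lemma kap_ne {ι : Type*} [Fintype ι] [DecidableEq ι] {x : ι → ℂ} (hx : ∀ i, x i ≠ 0) (i : ι) :
    kap x i ≠ 0 := Finset.prod_ne_zero_iff.2 (fun l _ => neg_ne_zero.2 (inv_ne_zero (hx l)))

lemma hv_prod {q : ℂ} {ι : Type*} [Fintype ι] [DecidableEq ι]
    (x : ι → ℂ) (a : Fin 4 → ℂ) (i : ι) :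
    q * ∏ k, hv q x a i k = q ^ Fintype.card ι * ((∏ l, x l) * ∏ k, a k) := by
  unfold hv
  rw [Fintype.prod_sum_type]
  simp only [Sum.elim_inl, Sum.elim_inr]
  rw [← mul_assoc, ← mul_assoc]
  congr 1
  rw [← Finset.mul_prod_erase _ _ (Finset.mem_univ i), if_pos rfl]
  have : ∏ l ∈ Finset.univ.erase i, (if l = i then x l else q * x l) =
      ∏ l ∈ Finset.univ.erase i, q * x l :=
    Finset.prod_congr rfl (fun l hl => if_neg (Finset.ne_of_mem_erase hl))
  rw [this, Finset.prod_mul_distrib, ← Finset.mul_prod_erase _ x (Finset.mem_univ i)]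
  rw [Finset.prod_const, Finset.card_erase_of_mem (Finset.mem_univ i), Finset.card_univ]
  have hc : Fintype.card ι = (Fintype.card ι - 1) + 1 := by
    have : 0 < Fintype.card ι := Fintype.card_pos_iff.2 ⟨i⟩
    omega
  conv_rhs => rw [hc, pow_succ]
  ring

lemma hv_th {q : ℂ} (hq : ‖q‖ < 1) (hq0 : q ≠ 0) {ι : Type*} [Fintype ι] [DecidableEq ι]
    {x : ι → ℂ} (hx : ∀ i, x i ≠ 0) (a : Fin 4 → ℂ) (i : ι) {Y : ℂ} (hY : Y ≠ 0) :
    Y ^ Fintype.card ι * ∏ k, th q (hv q x a i k * Y) =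
      kap x i * (Y * ((∏ l, th q (x l * Y)) * ∏ k, th q (a k * Y))) := by
  unfold hv kap
  rw [Fintype.prod_sum_type]
  simp only [Sum.elim_inl, Sum.elim_inr]
  rw [← mul_assoc, ← mul_assoc Y, ← mul_assoc]
  congr 1
  rw [← Finset.mul_prod_erase _ _ (Finset.mem_univ i), if_pos rfl]
  have : ∏ l ∈ Finset.univ.erase i, th q ((if l = i then x l else q * x l) * Y) =
      ∏ l ∈ Finset.univ.erase i, (-(x l)⁻¹ * Y⁻¹ * th q (x l * Y)) := by
    refine Finset.prod_congr rfl (fun l hl => ?_)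
    rw [if_neg (Finset.ne_of_mem_erase hl), mul_assoc, th_mul_p hq hq0 (mul_ne_zero (hx l) hY),
      mul_inv]
    ring
  rw [this, Finset.prod_mul_distrib, Finset.prod_mul_distrib,
    ← Finset.mul_prod_erase _ (fun l => th q (x l * Y)) (Finset.mem_univ i)]
  rw [Finset.prod_const, Finset.card_erase_of_mem (Finset.mem_univ i), Finset.card_univ]
  have hc : Fintype.card ι = (Fintype.card ι - 1) + 1 := by
    have : 0 < Fintype.card ι := Fintype.card_pos_iff.2 ⟨i⟩
    omega
  rw [hc, pow_succ, Nat.add_sub_cancel, inv_pow]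
  field_simp

noncomputable def BB (p q : ℂ) {ι κ : Type*} [Fintype ι] [Fintype κ] [DecidableEq ι]
    (v : κ → ℂ) (y : ι → ℂ) (j : ι) : ℂ :=
  circleInt (fun z => gg q y j z * Wt p q (Sum.elim v y) z)

lemma HH_refl {p q : ℂ} (hq0 : q ≠ 0) {ι κ : Type*} [Fintype ι] [Fintype κ]
    (v : κ → ℂ) (y : ι → ℂ) {b : ℂ} (hb : b ≠ 0) : HH p q v y (q / b) = HH p q v y b := by
  unfold HH
  apply circleInt_congr
  intro z hz
  have hz0 := ne_zero_of_norm_one hz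
  congr 2
  unfold Th
  rw [show q / b * z = q / (b / z) by field_simp, show q / b / z = q / (b * z) by field_simp,
    th_p_div _ hq0, th_p_div _ hq0, mul_comm]

lemma HH_diff {p q : ℂ} (hp : ‖p‖ < 1) (hq : ‖q‖ < 1)
    {ι κ : Type*} [Fintype ι] [Fintype κ]
    (v : κ → ℂ) (y : ι → ℂ) (hv0 : ∀ i, v i ≠ 0) (hy0 : ∀ i, y i ≠ 0)
    (hv1 : ∀ i, ‖v i‖ < 1) (hy1 : ∀ i, ‖y i‖ < 1) {b : ℂ} (hb1 : ‖b‖ < 1) (hb2 : ‖q‖ < ‖b‖) :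
    DifferentiableAt ℂ (HH p q v y) b := by
  set S : Set ℂ := {b | ‖b‖ < 1 ∧ ‖q‖ < ‖b‖} with hS
  have hSo : IsOpen S := (isOpen_lt continuous_norm continuous_const).inter
    (isOpen_lt continuous_const continuous_norm)
  have hu0 : ∀ i, Sum.elim v y i ≠ 0 := by rintro (i | i) <;> simp [hv0, hy0]
  have hu1 : ∀ i, ‖Sum.elim v y i‖ < 1 := by rintro (i | i) <;> simp [hv1, hy1]
  have hS0 : ∀ b ∈ S, b ≠ 0 := by
    rintro b hb rfl
    have := hb.2
    simp at this
    linarith [norm_nonneg q]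
  refine (circleInt_differentiableOn hSo ?_ ?_).differentiableAt (hSo.mem_nhds ⟨hb1, hb2⟩)
  · rintro ⟨b, z⟩ ⟨hb, hz⟩
    simp only [mem_setOf_eq] at hz
    have hz0 := ne_zero_of_norm_one hz
    apply ContinuousAt.continuousWithinAt
    refine ContinuousAt.mul (ContinuousAt.div ?_ ?_ ?_) ?_
    · exact ContinuousAt.comp (f := Prod.snd) (g := fun z => ∏ l, Th q (y l) z)
        (tendsto_finsetProd _ (fun l _ => (Th_analyticAt' hq (hy0 l) hz0).continuousAt)) continuousAt_snd
    · exact (th_continuousAt (continuousAt_fst.mul continuousAt_snd) continuousAt_const hq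
        (mul_ne_zero (hS0 b hb) hz0)).mul (th_continuousAt (continuousAt_fst.div continuousAt_snd hz0)
          continuousAt_const hq (div_ne_zero (hS0 b hb) hz0))
    · exact Th_ne_zero hq hb.2 hb.1 hz
    · exact ContinuousAt.comp (f := Prod.snd) (g := Wt p q (Sum.elim v y))
        (Wt_analyticAt hp hq _ hu0 hu1 hz).continuousAt continuousAt_snd
  · intro z hz b hb
    have hz0 := ne_zero_of_norm_one hz
    apply DifferentiableAt.differentiableWithinAt
    refine DifferentiableAt.mul (DifferentiableAt.div (by fun_prop) ?_ ?_) (by fun_prop)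
    · exact (Th_analyticAt hq (hS0 b hb) hz0).differentiableAt
    · exact Th_ne_zero hq hb.2 hb.1 hz

/-- antisymmetric kernel in the dual variable -/
noncomputable def UU (p q : ℂ) {ι : Type*} [Fintype ι] (u : ι → ℂ) (w : ℂ) : ℂ :=
  w * th p (w ^ 2) * ∏ r, (Gm p q (p * (u r / w)) * Gm p q (u r * w))

lemma UU_refl {p q : ℂ} (hp : ‖p‖ < 1) (hp0 : p ≠ 0) {ι : Type*} [Fintype ι]
    (u : ι → ℂ) {w : ℂ} (hw : w ≠ 0) : UU p q u (p / w) = - UU p q u w := by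
  unfold UU
  have e1 : th p ((p / w) ^ 2) = -(w ^ 2 / p) * th p (w ^ 2) := by
    have : (p / w) ^ 2 = p * (p * (w ^ 2)⁻¹) := by field_simp
    rw [this, th_mul_p hp hp0 (mul_ne_zero hp0 (inv_ne_zero (pow_ne_zero _ hw))),
      th_mul_p hp hp0 (inv_ne_zero (pow_ne_zero _ hw)), th_inv hp (pow_ne_zero _ hw)]
    field_simp
  rw [e1]
  have e3 : (∏ r, (Gm p q (p * (u r / (p / w))) * Gm p q (u r * (p / w)))) =
      ∏ r, (Gm p q (p * (u r / w)) * Gm p q (u r * w)) := by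
    apply Finset.prod_congr rfl
    intro i _
    rw [show p * (u i / (p / w)) = u i * w by field_simp,
      show u i * (p / w) = p * (u i / w) by field_simp, mul_comm]
  rw [e3]
  field_simp

lemma UU_analyticAt {p q : ℂ} (hp : ‖p‖ < 1) (hq : ‖q‖ < 1) (hp0 : p ≠ 0) {ι : Type*} [Fintype ι]
    (u : ι → ℂ) (hu0 : ∀ i, u i ≠ 0) (hu1 : ∀ i, ‖u i‖ < 1) {w : ℂ} (hw : ‖w‖ ≤ 1)
    (hw' : ‖p‖ ≤ ‖w‖) : AnalyticAt ℂ (UU p q u) w := by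
  have hp0' : 0 < ‖p‖ := norm_pos_iff.2 hp0
  have hw0 : w ≠ 0 := by intro h; simp [h] at hw'; exact hp0 hw'
  unfold UU
  refine (analyticAt_id.mul (th_analyticAt (analyticAt_id.pow 2) analyticAt_const hp
        (pow_ne_zero _ hw0))).mul ?_
  apply Finset.analyticAt_fun_prod
  intro i _
  refine (Gm_analyticAt (analyticAt_const.mul (analyticAt_const.div analyticAt_id hw0))
    analyticAt_const analyticAt_const hp hq (mul_ne_zero hp0 (div_ne_zero (hu0 i) hw0)) ?_).mul
    (Gm_analyticAt (analyticAt_const.mul analyticAt_id)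
    analyticAt_const analyticAt_const hp hq (mul_ne_zero (hu0 i) hw0) ?_)
  · apply EE_ne_zero_of_lt hp hq
    show ‖p * (u i / w)‖ < 1
    rw [norm_mul, norm_div, ← mul_div_assoc, div_lt_one (by linarith)]
    nlinarith [hu1 i, norm_nonneg (u i)]
  · apply EE_ne_zero_of_lt hp hq
    show ‖u i * w‖ < 1
    rw [norm_mul]
    nlinarith [hu1 i, norm_nonneg (u i)]

lemma UH_zero {p q s : ℂ} (hp : ‖p‖ < 1) (hq : ‖q‖ < 1) (hp0 : p ≠ 0) (hq0 : q ≠ 0)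
    (hs : s ^ 2 = p * q) (hqp : ‖q‖ < ‖p‖)
    {ι κ κ' : Type*} [Fintype ι] [Fintype κ] [Fintype κ']
    (v : κ → ℂ) (y : ι → ℂ) (hv0 : ∀ i, v i ≠ 0) (hy0 : ∀ i, y i ≠ 0)
    (hv1 : ∀ i, ‖v i‖ < 1) (hy1 : ∀ i, ‖y i‖ < 1)
    (u : κ' → ℂ) (hu0 : ∀ i, u i ≠ 0) (hu1 : ∀ i, ‖u i‖ < 1) :
    circleInt (fun w => UU p q u w * HH p q v y (s / p * w)) = 0 := by
  have hp0' : 0 < ‖p‖ := norm_pos_iff.2 hp0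
  have hq0' : 0 < ‖q‖ := norm_pos_iff.2 hq0
  have hs0 : s ≠ 0 := by rintro rfl; simp [hp0, hq0] at hs
  set r := Real.sqrt ‖p‖ with hr
  have hrr : r * r = ‖p‖ := Real.mul_self_sqrt hp0'.le
  have hr0 : 0 < r := Real.sqrt_pos.2 hp0'
  have hr1 : r ≤ 1 := by nlinarith
  have hs2 : ‖s / p‖ ^ 2 * ‖p‖ = ‖q‖ := by
    rw [norm_div, div_pow, ← norm_pow, hs, norm_mul]
    field_simp
  rw [circleInt_eq_av, av_eq_av hr0 hr1]
  · refine av_eq_zero_of_antisymm hr0 (c := p) hrr.symm ?_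
    intro w hw
    have hw0 : w ≠ 0 := by intro h; simp [h] at hw; linarith
    rw [UU_refl hp hp0 u hw0]
    have : s / p * (p / w) = q / (s / p * w) := by
      field_simp
      rw [← hs]
    rw [this, HH_refl hq0 v y (mul_ne_zero (div_ne_zero hs0 hp0) hw0)]
    ring
  · intro w h1 h2
    refine DifferentiableAt.mul ((UU_analyticAt hp hq hp0 u hu0 hu1 h2 ?_).differentiableAt) ?_
    · nlinarith
    · have hd := HH_diff hp hq v y hv0 hy0 hv1 hy1 (b := s / p * w) ?_ ?_
      · exact DifferentiableAt.comp (g := HH p q v y) (f := fun w => s / p * w) w hd (by fun_prop)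
      · rw [norm_mul]
        have : ‖s / p‖ < 1 := by
          apply lt_of_pow_lt_pow_left₀ 2 zero_le_one
          rw [one_pow]
          by_contra hcon
          push Not at hcon
          nlinarith
        nlinarith [norm_nonneg (s / p)]
      · rw [norm_mul]
        have h3 : ‖q‖ ≤ (‖s / p‖ * ‖w‖) ^ 2 := by
          calc ‖q‖ = ‖s / p‖ ^ 2 * (r * r) := by rw [hrr, hs2]
            _ ≤ ‖s / p‖ ^ 2 * (‖w‖ * ‖w‖) := by gcongr
            _ = _ := by ring
        apply lt_of_pow_lt_pow_left₀ 2 (by positivity)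
        nlinarith

end Rains

namespace Rains
open Filter Topology Set

noncomputable def alf (q : ℂ) {ι : Type*} [Fintype ι] [DecidableEq ι] (x y : ι → ℂ) (a : Fin 4 → ℂ)
    (j : ι) : ℂ :=
  ((∏ l, th q (x l * y j)) * ∏ k, th q (a k * y j)) / ∏ l ∈ Finset.univ.erase j, th q (y j / y l)

lemma cc_eq {p q s : ℂ} (hq : ‖q‖ < 1) (hp0 : p ≠ 0) (hq0 : q ≠ 0)
    (hs : s ^ 2 = p * q) {ι : Type*} [Fintype ι] [DecidableEq ι]
    (x y : ι → ℂ) (a : Fin 4 → ℂ) (hx0 : ∀ i, x i ≠ 0) (hy0 : ∀ i, y i ≠ 0) (i j : ι) {w : ℂ}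
    (hw : w ≠ 0) (hT : Th q (s / (p * y j)) w ≠ 0) :
    (∏ l, Th q (s / (p * y l)) w) * cc q (hv q x a i) y (s / p * w) (s / p * w⁻¹) j =
      kap x i * (q / p) * alf q x y a j * gg q (fun l => s / (p * y l)) j w := by
  have hs0 : s ≠ 0 := by rintro rfl; simp [hp0, hq0] at hs
  have h1 : ∏ l, Th q (s / (p * y l)) w =
      Th q (s / (p * y j)) w * gg q (fun l => s / (p * y l)) j w :=
    (Finset.mul_prod_erase _ (fun l => Th q (s / (p * y l)) w) (Finset.mem_univ j)).symm
  have h2 := hv_th hq hq0 hx0 a i (hy0 j)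
  have h3 : th q (y j / (s / p * w)) * th q (y j / (s / p * w⁻¹)) =
      (p * y j / s) ^ 2 * Th q (s / (p * y j)) w := by
    have hyt : s / (p * y j) ≠ 0 := div_ne_zero hs0 (mul_ne_zero hp0 (hy0 j))
    rw [show y j / (s / p * w) = (s / (p * y j) * w)⁻¹ by field_simp,
      show y j / (s / p * w⁻¹) = (s / (p * y j) / w)⁻¹ by field_simp,
      th_inv hq (mul_ne_zero hyt hw), th_inv hq (div_ne_zero hyt hw)]
    unfold Th
    field_simp
  unfold cc alf
  rw [h1, h3, pow_succ]
  rw [show y j ^ Fintype.card ι * y j * ∏ k, th q (hv q x a i k * y j) =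
    y j * (y j ^ Fintype.card ι * ∏ k, th q (hv q x a i k * y j)) by ring, h2]
  have hq' : q = s ^ 2 / p := by rw [hs]; field_simp
  have hq'' : q / p = s ^ 2 / p ^ 2 := by rw [hs]; field_simp
  rw [hq'']
  have hyj := hy0 j
  generalize ∏ l, th q (x l * y j) = X1
  generalize ∏ k, th q (a k * y j) = X2
  generalize ∏ l ∈ Finset.univ.erase j, th q (y j / y l) = X3
  generalize Th q (s / (p * y j)) w = X4 at *
  generalize gg q (fun l => s / (p * y l)) j w = X5
  by_cases h3 : X3 = 0
  · simp [h3]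
  field_simp

lemma cb_eq {p q s : ℂ} (hp : ‖p‖ < 1) (hq : ‖q‖ < 1) (hp0 : p ≠ 0) (hq0 : q ≠ 0)
    (hs : s ^ 2 = p * q) {ι : Type*} [Fintype ι] [DecidableEq ι]
    (x y : ι → ℂ) (a : Fin 4 → ℂ) (hx0 : ∀ i, x i ≠ 0) (hy0 : ∀ i, y i ≠ 0) (ha0 : ∀ i, a i ≠ 0)
    (i k : ι) {w : ℂ} (hw : ‖w‖ = 1) (hw2 : w ^ 2 ≠ 1)
    (hT : ∀ l, Th q (s / (p * y l)) w ≠ 0)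
    (hu1 : ∀ r, ‖Sum.elim (hv q (fun l => s / (q * x l)) (fun l => s / a l) k)
      (fun l => s / (p * y l)) r‖ < 1) :
    (∏ l, Th q (s / (p * y l)) w) * Wt p q (Sum.elim (hv q (fun l => s / (q * x l))
        (fun l => s / a l) k) (fun l => s / (p * y l))) w *
        cb q (hv q x a i) y (s / p * w) (s / p * w⁻¹) =
      -(kap x i * (q / p) * (∏ l, -(s / (q * x l))⁻¹) / kap (fun l => s / (q * x l)) k) *
      UU p q (Sum.elim (hv q (fun l => s / (q * x l))
        (fun l => s / a l) k) (fun l => s / (p * y l))) w := by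
  have hw0 := ne_zero_of_norm_one hw
  have hs0 : s ≠ 0 := by rintro rfl; simp [hp0, hq0] at hs
  set xt : ι → ℂ := fun l => s / (q * x l) with hxt
  set yt : ι → ℂ := fun l => s / (p * y l) with hyt
  set at' : Fin 4 → ℂ := fun l => s / a l with hat
  set vt := hv q xt at' k with hvt
  have hxt0 : ∀ l, xt l ≠ 0 := fun l => div_ne_zero hs0 (mul_ne_zero hq0 (hx0 l))
  have hyt0 : ∀ l, yt l ≠ 0 := fun l => div_ne_zero hs0 (mul_ne_zero hp0 (hy0 l))
  have hb0 : s / p * w ≠ 0 := mul_ne_zero (div_ne_zero hs0 hp0) hw0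
  have h1 := hv_th hq hq0 hx0 a i hb0
  have h2 := hv_th hq hq0 hxt0 at' k (inv_ne_zero hw0)
  have hth : th q (w ^ 2) ≠ 0 := th_ne_zero_of_norm_eq hq (by simp [hw]) hw2
  have e1 : ∏ l, th q (x l * (s / p * w)) =
      (∏ l, -(xt l)⁻¹) * w ^ Fintype.card ι * ∏ l, th q (xt l * w⁻¹) := by
    have : w ^ Fintype.card ι = ∏ l : ι, w := by simp
    rw [this, ← Finset.prod_mul_distrib, ← Finset.prod_mul_distrib]
    apply Finset.prod_congr rfl
    intro l _
    have hxl := hx0 l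
    have : x l * (s / p * w) = (xt l * w⁻¹)⁻¹ := by
      simp only [hxt]
      field_simp
      rw [hs]
    rw [this, th_inv hq (mul_ne_zero (hxt0 l) (inv_ne_zero hw0))]
    field_simp
  have e2 : ∏ l, th q (a l * (s / p * w)) = ∏ l, th q (at' l * w⁻¹) := by
    apply Finset.prod_congr rfl
    intro l _
    have hal := ha0 l
    have : a l * (s / p * w) = q / (at' l * w⁻¹) := by
      simp only [hat]
      field_simp
      rw [hs]
    rw [this, th_p_div _ hq0]
  have e3 : ∏ r, (Gm p q (p * (Sum.elim vt yt r / w)) * Gm p q (Sum.elim vt yt r * w)) =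
      (∏ r, th q (vt r * w⁻¹)) * (∏ l, th q (yt l / w)) *
      ∏ r, (Gm p q (Sum.elim vt yt r * w) * Gm p q (Sum.elim vt yt r / w)) := by
    have : (∏ r, th q (vt r * w⁻¹)) * (∏ l, th q (yt l / w)) = ∏ r, th q (Sum.elim vt yt r / w) := by
      rw [Fintype.prod_sum_type]; simp [div_eq_mul_inv]
    rw [this, ← Finset.prod_mul_distrib]
    apply Finset.prod_congr rfl
    intro r _
    rw [Gm_p hp hq hp0]
    · ring
    · apply EE_ne_zero_of_lt hp hq
      rw [norm_div, hw, div_one]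
      exact hu1 r
  have e4 : ∏ l, th q (s / p * w / y l) = ∏ l, th q (yt l * w) := by
    apply Finset.prod_congr rfl
    intro l _
    congr 1
    simp only [hyt]
    have := hy0 l
    field_simp
  have e5 : s / p * w / (s / p * w⁻¹) = w ^ 2 := by field_simp
  have e6 : ∏ l, Th q (yt l) w = (∏ l, th q (yt l * w)) * ∏ l, th q (yt l / w) := by
    unfold Th
    rw [Finset.prod_mul_distrib]
  have hne : ∏ l, th q (yt l * w) ≠ 0 := by
    apply Finset.prod_ne_zero_iff.2
    intro l _
    exact left_ne_zero_of_mul (hT l)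
  have hk := kap_ne hxt0 k
  unfold cb UU Wt
  rw [e3, e4, e5, e6, inv_pow, th_inv hq (pow_ne_zero _ hw0), pow_succ (s / p * w),
    show (∏ l, -(s / (q * x l))⁻¹) = ∏ l, -(xt l)⁻¹ from rfl]
  rw [show (s / p * w) ^ Fintype.card ι * (s / p * w) * ∏ r, th q (hv q x a i r * (s / p * w)) =
    (s / p * w) * ((s / p * w) ^ Fintype.card ι * ∏ r, th q (hv q x a i r * (s / p * w))) by ring,
    h1, e1, e2]
  have hq'' : q / p = s ^ 2 / p ^ 2 := by rw [hs]; field_simp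
  rw [hq'']
  have h3 : (∏ l, th q (xt l * w⁻¹)) * ∏ l, th q (at' l * w⁻¹) =
      (kap xt k)⁻¹ * w * (w⁻¹ ^ Fintype.card ι * ∏ r, th q (vt r * w⁻¹)) := by
    rw [h2]; field_simp
  have h4 : (∏ l, -(xt l)⁻¹) * w ^ Fintype.card ι * (∏ l, th q (xt l * w⁻¹)) *
      ∏ l, th q (at' l * w⁻¹) = (∏ l, -(xt l)⁻¹) * (kap xt k)⁻¹ * w * ∏ r, th q (vt r * w⁻¹) := by
    rw [mul_assoc, h3, inv_pow]
    field_simp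
  rw [h4]
  generalize ∏ r, th q (vt r * w⁻¹) = X1
  generalize (∏ r, (Gm p q (Sum.elim vt yt r * w) * Gm p q (Sum.elim vt yt r / w))) = X2
  generalize ∏ l, th q (yt l * w) = X3 at *
  generalize ∏ l, th q (yt l / w) = X4
  generalize ∏ l, -(xt l)⁻¹ = X5
  generalize kap xt k = X6 at *
  field_simp

/-- orthogonality relation -/
lemma ortho {p q s : ℂ} (hp : ‖p‖ < 1) (hq : ‖q‖ < 1) (hp0 : p ≠ 0) (hq0 : q ≠ 0)
    (hs : s ^ 2 = p * q) (hqp : ‖q‖ < ‖p‖) {ι : Type*} [Fintype ι] [DecidableEq ι]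
    (x y : ι → ℂ) (a : Fin 4 → ℂ) (hx0 : ∀ i, x i ≠ 0) (hy0 : ∀ i, y i ≠ 0) (ha0 : ∀ i, a i ≠ 0)
    (i k : ι)
    (hv1 : ∀ r, ‖hv q x a i r‖ < 1) (hy1 : ∀ l, ‖y l‖ < 1) (hy2 : ∀ l, ‖q‖ < ‖y l‖)
    (hvt1 : ∀ r, ‖hv q (fun l => s / (q * x l)) (fun l => s / a l) k r‖ < 1)
    (hyt1 : ∀ l, ‖s / (p * y l)‖ < 1) (hyt2 : ∀ l, ‖q‖ < ‖s / (p * y l)‖)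
    (hprod : (∏ l, x l) * (∏ l, y l) * (∏ l, a l) = p * q)
    (hyy : ∀ i j, i ≠ j → th q (y i / y j) ≠ 0) :
    ∑ j, alf q x y a j * BB p q (hv q x a i) y j *
      BB p q (hv q (fun l => s / (q * x l)) (fun l => s / a l) k) (fun l => s / (p * y l)) j = 0 := by
  have hp0' : 0 < ‖p‖ := norm_pos_iff.2 hp0
  have hq0' : 0 < ‖q‖ := norm_pos_iff.2 hq0
  have hs0 : s ≠ 0 := by rintro rfl; simp [hp0, hq0] at hs
  have hs2 : ‖s / p‖ ^ 2 * ‖p‖ = ‖q‖ := by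
    rw [norm_div, div_pow, ← norm_pow, hs, norm_mul]
    field_simp
  have hsp : ‖s / p‖ < 1 := by
    apply lt_of_pow_lt_pow_left₀ 2 zero_le_one
    rw [one_pow]
    by_contra hcon
    push Not at hcon
    nlinarith
  have hxt0 : ∀ l, s / (q * x l) ≠ 0 := fun l => div_ne_zero hs0 (mul_ne_zero hq0 (hx0 l))
  have hyt0 : ∀ l, s / (p * y l) ≠ 0 := fun l => div_ne_zero hs0 (mul_ne_zero hp0 (hy0 l))
  set v := hv q x a i with hvdef
  set vt := hv q (fun l => s / (q * x l)) (fun l => s / a l) k with hvt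
  set yt : ι → ℂ := fun l => s / (p * y l) with hyt
  have hv0 : ∀ r, v r ≠ 0 := by
    rintro (r | r)
    · simp only [hvdef, hv, Sum.elim_inl]
      split_ifs
      · exact hx0 r
      · exact mul_ne_zero hq0 (hx0 r)
    · exact ha0 r
  have hvt0 : ∀ r, vt r ≠ 0 := by
    rintro (r | r)
    · simp only [hvt, hv, Sum.elim_inl]
      split_ifs
      · exact hxt0 r
      · exact mul_ne_zero hq0 (hxt0 r)
    · exact div_ne_zero hs0 (ha0 r)
  have hu0 : ∀ i, Sum.elim vt yt i ≠ 0 := by rintro (i | i) <;> simp [hvt0, hyt, hyt0]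
  have hu1 : ∀ i, ‖Sum.elim vt yt i‖ < 1 := by
    rintro (i | i)
    · exact hvt1 i
    · exact hyt1 i
  set κ1 := kap x i * (q / p) with hκ1
  have hκ10 : κ1 ≠ 0 := mul_ne_zero (kap_ne hx0 i) (div_ne_zero hq0 hp0)
  set κ2 := -(κ1 * (∏ l, -(s / (q * x l))⁻¹) / kap (fun l => s / (q * x l)) k) with hκ2
  let Fn : ι ⊕ Fin 2 → ℂ → ℂ := Sum.elim (fun j w => gg q yt j w * Wt p q (Sum.elim vt yt) w)
    ![fun w => UU p q (Sum.elim vt yt) w * HH p q v y (s / p * w),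
      fun w => UU p q (Sum.elim vt yt) w⁻¹ * HH p q v y (s / p * w⁻¹)]
  let c : ι ⊕ Fin 2 → ℂ := Sum.elim (fun j => κ1 * alf q x y a j * BB p q v y j) ![κ2, κ2]
  have hprodc : ∀ s : Finset ι, ∀ z : ℂ, ‖z‖ = 1 → ContinuousAt (fun z => ∏ l ∈ s, Th q (yt l) z) z :=
    fun s z hz => tendsto_finsetProd _
      (fun l _ => (Th_analyticAt' hq (hyt0 l) (ne_zero_of_norm_one hz)).continuousAt)
  have hUH : ∀ w : ℂ, ‖w‖ = 1 →
      ContinuousAt (fun w => UU p q (Sum.elim vt yt) w * HH p q v y (s / p * w)) w := by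
    intro w hw
    refine (UU_analyticAt hp hq hp0 _ hu0 hu1 hw.le (by rw [hw]; exact hp.le)).continuousAt.mul ?_
    refine ContinuousAt.comp (f := fun w : ℂ => s / p * w) (g := HH p q v y) ?_ (by fun_prop)
    refine (HH_diff hp hq v y hv0 hy0 hv1 hy1 ?_ ?_).continuousAt
    · rw [norm_mul, hw, mul_one]; exact hsp
    · rw [norm_mul, hw, mul_one]
      apply lt_of_pow_lt_pow_left₀ 2 (norm_nonneg _)
      nlinarith [norm_nonneg (s / p), sq_nonneg ‖s / p‖]
  have hsum := circleInt_sum Finset.univ c Fn (by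
    rintro (j | j) _ z hz
    · exact ((hprodc _ z hz).mul (Wt_analyticAt hp hq _ hu0 hu1 hz).continuousAt).continuousWithinAt
    · apply ContinuousAt.continuousWithinAt
      fin_cases j
      · exact hUH z hz
      · exact ContinuousAt.comp (f := fun z : ℂ => z⁻¹)
          (g := fun w => UU p q (Sum.elim vt yt) w * HH p q v y (s / p * w))
          (hUH z⁻¹ (by simpa using hz)) (continuousAt_inv₀ (ne_zero_of_norm_one hz)))
  have hzero : circleInt (fun z => ∑ a, c a * Fn a z) = 0 := by
    have : circleInt (fun z => ∑ a, c a * Fn a z) = circleInt (fun z => 0) := by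
      apply circleInt_congr'
      intro w hw hw2
      have hw0 := ne_zero_of_norm_one hw
      have hwi : ‖w⁻¹‖ = 1 := by simp [hw]
      rw [Fintype.sum_sum_type, Fin.sum_univ_two]
      have hT : ∀ l, Th q (s / (p * y l)) w ≠ 0 := fun l => Th_ne_zero hq (hyt2 l) (hyt1 l) hw
      have hT' : ∀ l, Th q (s / (p * y l)) w⁻¹ ≠ 0 := fun l => Th_ne_zero hq (hyt2 l) (hyt1 l) hwi
      have hyb : ∀ (w : ℂ), ‖w‖ = 1 → ∀ l, th q (y l / (s / p * w)) ≠ 0 := by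
        intro w hw l
        have hw0 := ne_zero_of_norm_one hw
        have hyl := hy0 l
        rw [show y l / (s / p * w) = (s / (p * y l) * w)⁻¹ by field_simp]
        apply th_inv_ne hq (inv_ne_zero (mul_ne_zero (hyt0 l) hw0))
        rw [inv_inv]
        exact left_ne_zero_of_mul (Th_ne_zero hq (hyt2 l) (hyt1 l) hw)
      have hbnd : ∀ w : ℂ, ‖w‖ = 1 → ‖q‖ ^ 2 < ‖s / p * w‖ ^ 2 * ‖p‖ := by
        intro w hw
        rw [norm_mul, hw, mul_one, hs2]; nlinarith
      have hex := exact1 hp hq hp0 hq0 v y (by simp) hv0 hy0 hv1 hy1 hy2 (by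
          apply mul_left_cancel₀ hq0
          have := hv_prod (q := q) x a i
          calc q * ((∏ l, y l) * ∏ r, v r) = (∏ l, y l) * (q * ∏ r, v r) := by ring
            _ = q ^ Fintype.card ι * ((∏ l, x l) * (∏ l, y l) * ∏ l, a l) := by rw [this]; ring
            _ = _ := by rw [hprod]; ring)
        (b := s / p * w) (b' := s / p * w⁻¹) (by
          rw [show s / p * w * (s / p * w⁻¹) * p = s ^ 2 / p by field_simp, hs]; field_simp)
        (by rw [norm_mul, hw, mul_one]; exact hsp) (by rw [norm_mul, hwi, mul_one]; exact hsp)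
        (hbnd w hw) (hbnd _ hwi) hyy (hyb w hw) (hyb _ hwi) (by
          rw [show s / p * w / (s / p * w⁻¹) = w ^ 2 by field_simp]
          exact th_ne_zero_of_norm_eq hq (by simp [hw]) hw2)
      have hc1 := cb_eq hp hq hp0 hq0 hs x y a hx0 hy0 ha0 i k hw hw2 hT hu1
      have hc2 := cb_eq hp hq hp0 hq0 hs x y a hx0 hy0 ha0 i k hwi
        (by rw [inv_pow]; simpa using hw2) hT' hu1
      rw [Wt_inv hp hq _ hw0, inv_inv] at hc2
      simp only [Th_inv] at hc2
      set M := (∏ l, Th q (s / (p * y l)) w) * Wt p q (Sum.elim vt yt) w with hM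
      have hm := congrArg (M * ·) hex
      simp only [mul_zero, mul_add, Finset.mul_sum] at hm
      rw [← hm]
      congr 1
      · apply Finset.sum_congr rfl
        intro j _
        have := cc_eq hq hp0 hq0 hs x y a hx0 hy0 i j hw0 (hT j)
        show κ1 * alf q x y a j * BB p q v y j * (gg q yt j w * Wt p q (Sum.elim vt yt) w) =
          M * (cc q v y (s / p * w) (s / p * w⁻¹) j * BB p q v y j)
        rw [hM]
        linear_combination (-(Wt p q (Sum.elim vt yt) w) * BB p q v y j) * this
      · show κ2 * (UU p q (Sum.elim vt yt) w * HH p q v y (s / p * w)) +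
          κ2 * (UU p q (Sum.elim vt yt) w⁻¹ * HH p q v y (s / p * w⁻¹)) = _
        rw [← mul_assoc, ← mul_assoc, ← mul_assoc, ← mul_assoc, hc1, hc2]
    rw [this]
    simp [circleInt, circleIntegral]
  rw [hzero, Fintype.sum_sum_type, Fin.sum_univ_two] at hsum
  have e0 := UH_zero hp hq hp0 hq0 hs hqp v y hv0 hy0 hv1 hy1 _ hu0 hu1
  have e1 : circleInt (Fn (Sum.inr 0)) = 0 := e0
  have e2 : circleInt (Fn (Sum.inr 1)) = 0 := by
    have := circleInt_inv (fun w => UU p q (Sum.elim vt yt) w * HH p q v y (s / p * w))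
    rw [e0] at this
    exact this
  rw [e1, e2, mul_zero, mul_zero, add_zero, add_zero] at hsum
  apply mul_left_cancel₀ hκ10
  rw [mul_zero, hsum, Finset.mul_sum]
  apply Finset.sum_congr rfl
  intro j _
  show _ = κ1 * alf q x y a j * BB p q v y j * BB p q vt yt j
  ring

end Rains

namespace Rains
open Filter Topology Set

lemma Wt_equiv (p q : ℂ) {ι κ : Type*} [Fintype ι] [Fintype κ] (e : κ ≃ ι) (t : ι → ℂ) (z : ℂ) :
    Wt p q (fun k => t (e k)) z = Wt p q t z := by
  unfold Wt
  rw [Fintype.prod_equiv e (fun k => Gm p q (t (e k) * z) * Gm p q (t (e k) / z))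
    (fun i => Gm p q (t i * z) * Gm p q (t i / z)) (fun _ => rfl)]

lemma DD_equiv (p q : ℂ) (n : ℕ) {ι κ : Type*} [Fintype ι] [Fintype κ] (e : κ ≃ ι) (t : ι → ℂ) :
    DD p q n (fun k => t (e k)) = DD p q n t := by
  unfold DD
  apply torusInt_congr
  intro z _
  simp only [Wt_equiv p q e t]

lemma gg_equiv (q : ℂ) {ι κ : Type*} [Fintype ι] [Fintype κ] [DecidableEq ι] [DecidableEq κ]
    (e : κ ≃ ι) (y : ι → ℂ) (j : κ) (z : ℂ) :
    gg q (fun k => y (e k)) j z = gg q y (e j) z := by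
  unfold gg
  refine Finset.prod_equiv e (fun k => ?_) (fun k _ => rfl)
  simp

lemma BB_y (p q : ℂ) {ι ι' κ : Type*} [Fintype ι] [Fintype ι'] [Fintype κ] [DecidableEq ι]
    [DecidableEq ι'] (e : ι' ≃ ι) (v : κ → ℂ) (y : ι → ℂ) (j : ι') :
    BB p q v (fun k => y (e k)) j = BB p q v y (e j) := by
  unfold BB
  congr 1; funext z
  rw [gg_equiv]
  congr 1
  rw [← Wt_equiv p q (Equiv.sumCongr (Equiv.refl κ) e)]
  congr 1; funext k
  rcases k with k | k <;> rfl

lemma BB_v (p q : ℂ) {ι κ κ' : Type*} [Fintype ι] [Fintype κ'] [Fintype κ] [DecidableEq ι]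
    (e : κ' ≃ κ) (v : κ → ℂ) (y : ι → ℂ) (j : ι) :
    BB p q (fun k => v (e k)) y j = BB p q v y j := by
  unfold BB
  congr 1; funext z
  congr 1
  rw [← Wt_equiv p q (Equiv.sumCongr e (Equiv.refl ι))]
  congr 1; funext k
  rcases k with k | k <;> rfl

lemma gshift_q {p q : ℂ} (hp : ‖p‖ < 1) (hq : ‖q‖ < 1) (hq0 : q ≠ 0) {x z : ℂ} (hx : ‖x‖ < 1)
    (hz : ‖z‖ = 1) : Gm p q (q * x * z) * Gm p q (q * x / z) =
      Th p x z * (Gm p q (x * z) * Gm p q (x / z)) := by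
  unfold Th
  rw [mul_assoc q x z, mul_div_assoc q x z, Gm_q hp hq hq0 (EE_ne_zero_of_lt hp hq (by simp [hz, hx])),
    Gm_q hp hq hq0 (EE_ne_zero_of_lt hp hq (by simp [hz, hx]))]
  ring

lemma gshift_p {p q : ℂ} (hp : ‖p‖ < 1) (hq : ‖q‖ < 1) (hp0 : p ≠ 0) {x z : ℂ} (hx : ‖x‖ < 1)
    (hz : ‖z‖ = 1) : Gm p q (p * x * z) * Gm p q (p * x / z) =
      Th q x z * (Gm p q (x * z) * Gm p q (x / z)) := by
  rw [Gm_comm p q, Gm_comm p q, gshift_q hq hp hp0 hx hz, Gm_comm p q, Gm_comm p q]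

/-- the parameter vector -/
noncomputable def tv (p q : ℂ) {α β : Type*} (x y : α ⊕ β → ℂ) (a : Fin 4 → ℂ) :
    ((α ⊕ β) ⊕ Fin 4) ⊕ (α ⊕ β) → ℂ :=
  Sum.elim (Sum.elim (Sum.elim (fun i => x (Sum.inl i)) (fun k => q * x (Sum.inr k))) a)
    (Sum.elim (fun i => y (Sum.inl i)) (fun k => p * y (Sum.inr k)))

lemma entry_pt {p q : ℂ} (hp : ‖p‖ < 1) (hq : ‖q‖ < 1) (hp0 : p ≠ 0) (hq0 : q ≠ 0) {n m : ℕ}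
    (x y : Fin n ⊕ Fin m → ℂ) (a : Fin 4 → ℂ) (hx : ∀ i, ‖x (Sum.inl i)‖ < 1)
    (hy : ∀ l, ‖y l‖ < 1) (i j : Fin n) {z : ℂ} (hz : ‖z‖ = 1) :
    ff p (fun i => x (Sum.inl i)) i z * ff q (fun i => y (Sum.inl i)) j z * Wt p q (tv p q x y a) z =
    gg q y (Sum.inl j) z * Wt p q (Sum.elim (hv q x a (Sum.inl i)) y) z := by
  unfold Wt tv hv gg ff
  simp only [Fintype.prod_sum_type, Sum.elim_inl, Sum.elim_inr, prod_erase_inl]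
  have e1 : ∏ k : Fin m, (Gm p q (p * y (Sum.inr k) * z) * Gm p q (p * y (Sum.inr k) / z)) =
      (∏ k : Fin m, Th q (y (Sum.inr k)) z) *
        ∏ k : Fin m, (Gm p q (y (Sum.inr k) * z) * Gm p q (y (Sum.inr k) / z)) := by
    rw [← Finset.prod_mul_distrib]
    exact Finset.prod_congr rfl (fun k _ => gshift_p hp hq hp0 (hy _) hz)
  have e2 : ∏ k : Fin n, (Gm p q ((if (Sum.inl k : Fin n ⊕ Fin m) = Sum.inl i then x (Sum.inl k) else q * x (Sum.inl k)) * z) *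
        Gm p q ((if (Sum.inl k : Fin n ⊕ Fin m) = Sum.inl i then x (Sum.inl k) else q * x (Sum.inl k)) / z)) =
      (∏ k ∈ Finset.univ.erase i, Th p (x (Sum.inl k)) z) *
        ∏ k : Fin n, (Gm p q (x (Sum.inl k) * z) * Gm p q (x (Sum.inl k) / z)) := by
    rw [← Finset.mul_prod_erase _ _ (Finset.mem_univ i), if_pos rfl,
      ← Finset.mul_prod_erase _ (fun k : Fin n => (Gm p q (x (Sum.inl k) * z) * Gm p q (x (Sum.inl k) / z)))
      (Finset.mem_univ i), mul_left_comm, ← Finset.prod_mul_distrib]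
    congr 1
    refine Finset.prod_congr rfl (fun k hk => ?_)
    rw [if_neg (fun h => Finset.ne_of_mem_erase hk (Sum.inl_injective h))]
    exact gshift_q hp hq hq0 (hx k) hz
  have e3 : ∏ k : Fin m, (Gm p q ((if (Sum.inr k : Fin n ⊕ Fin m) = Sum.inl i then x (Sum.inr k) else q * x (Sum.inr k)) * z) *
        Gm p q ((if (Sum.inr k : Fin n ⊕ Fin m) = Sum.inl i then x (Sum.inr k) else q * x (Sum.inr k)) / z)) =
        ∏ k : Fin m, (Gm p q (q * x (Sum.inr k) * z) * Gm p q (q * x (Sum.inr k) / z)) := by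
    refine Finset.prod_congr rfl (fun k hk => ?_)
    rw [if_neg (by simp)]
  rw [e1, e2, e3]
  ring

lemma det_swap {n m : ℕ} (M : Matrix (Fin n) (Fin n) ℂ) (M2 : Matrix (Fin n) (Fin m) ℂ)
    (C1 : Matrix (Fin m) (Fin n) ℂ) (C2 : Matrix (Fin m) (Fin m) ℂ) (α : Fin n → ℂ) (β : Fin m → ℂ)
    (h : M * Matrix.diagonal α * C1.transpose + M2 * Matrix.diagonal β * C2.transpose = 0)
    (j : Fin n) (k : Fin m) :
    α j * M.det * (C2.updateCol k (fun r => C1 r j)).det +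
      β k * (M.updateCol j (fun r => M2 r k)).det * C2.det = 0 := by
  have h1 : M.adjugate * (M * Matrix.diagonal α * C1.transpose + M2 * Matrix.diagonal β * C2.transpose) *
    C2.transpose.adjugate = 0 := by rw [h]; simp
  have h2 : M.det • (Matrix.diagonal α * (C1.transpose * C2.transpose.adjugate)) +
      C2.det • ((M.adjugate * M2) * Matrix.diagonal β) = 0 := by
    rw [← h1, Matrix.mul_add, Matrix.add_mul]
    congr 1
    · rw [← Matrix.mul_assoc, ← Matrix.mul_assoc, ← Matrix.mul_assoc, Matrix.adjugate_mul]
      simp [Matrix.mul_assoc]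
    · rw [Matrix.mul_assoc, Matrix.mul_assoc, Matrix.mul_assoc, Matrix.mul_assoc, Matrix.mul_adjugate,
        Matrix.det_transpose]
      simp
  have h3 := congrFun (congrFun h2 j) k
  rw [Matrix.add_apply, Matrix.smul_apply, Matrix.smul_apply, Matrix.diagonal_mul, Matrix.mul_diagonal] at h3
  have e1 : (M.adjugate * M2) j k = (M.updateCol j (fun r => M2 r k)).det := by
    rw [← Matrix.cramer_apply, Matrix.cramer_eq_adjugate_mulVec]
    rfl
  have e2 : (C1.transpose * C2.transpose.adjugate) j k = (C2.updateCol k (fun r => C1 r j)).det := by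
    rw [← Matrix.cramer_apply, Matrix.cramer_eq_adjugate_mulVec, ← Matrix.adjugate_transpose,
      ← Matrix.transpose_mul]
    rfl
  rw [e1, e2] at h3
  simp only [smul_eq_mul, Matrix.zero_apply] at h3
  linear_combination h3

lemma detA {p q : ℂ} (hp : ‖p‖ < 1) (hq : ‖q‖ < 1) (hp0 : p ≠ 0) (hq0 : q ≠ 0) {n m : ℕ}
    (x y : Fin n ⊕ Fin m → ℂ) (a : Fin 4 → ℂ)
    (ht : ∀ i, ‖tv p q x y a i‖ < 1) (ht0 : ∀ i, tv p q x y a i ≠ 0)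
    (hy : ∀ l, ‖y l‖ < 1) (hVx : VV p (fun i => x (Sum.inl i)) ≠ 0)
    (hVy : VV q (fun i => y (Sum.inl i)) ≠ 0) :
    (n.factorial : ℂ) *
      (Matrix.of fun i j : Fin n => BB p q (hv q x a (Sum.inl i)) y (Sum.inl j)).det =
    (C0 (fun i => x (Sum.inl i)) * VV p (fun i => x (Sum.inl i))) *
      (C0 (fun i => y (Sum.inl i)) * VV q (fun i => y (Sum.inl i))) * DD p q n (tv p q x y a) := by
  have hx0 : ∀ i, x (Sum.inl i) ≠ 0 := fun i => ht0 (Sum.inl (Sum.inl (Sum.inl i)))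
  have hy0 : ∀ i, y (Sum.inl i) ≠ 0 := fun i => ht0 (Sum.inr (Sum.inl i))
  have hx : ∀ i, ‖x (Sum.inl i)‖ < 1 := fun i => ht (Sum.inl (Sum.inl (Sum.inl i)))
  rw [← DET hp hq (tv p q x y a) hx0 hy0 hVx hVy]
  · congr 2
    ext i j
    simp only [Matrix.of_apply]
    unfold BB
    exact circleInt_congr (fun z hz => (entry_pt hp hq hp0 hq0 x y a hx hy i j hz).symm)
  · intro i j z hz
    have hz' : ‖z‖ = 1 := hz
    have hz0 := ne_zero_of_norm_one hz'
    apply ContinuousAt.continuousWithinAt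
    refine ((ContinuousAt.mul ?_ ?_).mul (Wt_analyticAt hp hq _ ht0 ht hz').continuousAt)
    · exact tendsto_finsetProd _ (fun k _ => (Th_analyticAt' hp (hx0 k) hz0).continuousAt)
    · exact tendsto_finsetProd _ (fun k _ => (Th_analyticAt' hq (hy0 k) hz0).continuousAt)

lemma detB {p q s : ℂ} (hp : ‖p‖ < 1) (hq : ‖q‖ < 1) (hp0 : p ≠ 0) (hq0 : q ≠ 0) (hs0 : s ≠ 0) {n m : ℕ}
    (x y : Fin n ⊕ Fin m → ℂ) (a : Fin 4 → ℂ)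
    (ht : ∀ i, ‖s‖ < ‖tv p q x y a i‖)
    (hy : ∀ l, ‖s / (p * y l)‖ < 1) (hVx : VV p (fun i => s / (q * x (Sum.inr i))) ≠ 0)
    (hVy : VV q (fun i => s / (p * y (Sum.inr i))) ≠ 0) :
    (m.factorial : ℂ) *
      (Matrix.of fun i j : Fin m => BB p q (hv q (fun l => s / (q * x l)) (fun l => s / a l) (Sum.inr i))
        (fun l => s / (p * y l)) (Sum.inr j)).det =
    (C0 (fun i => s / (q * x (Sum.inr i))) * VV p (fun i => s / (q * x (Sum.inr i)))) *
      (C0 (fun i => s / (p * y (Sum.inr i))) * VV q (fun i => s / (p * y (Sum.inr i)))) *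
      DD p q m (fun i => s / tv p q x y a i) := by
  have htp : ∀ i, 0 < ‖tv p q x y a i‖ := fun i => lt_of_le_of_lt (norm_nonneg _) (ht i)
  have ht0 : ∀ i, tv p q x y a i ≠ 0 := fun i => norm_pos_iff.1 (htp i)
  let e : Fin m ⊕ Fin n ≃ Fin n ⊕ Fin m := Equiv.sumComm _ _
  have hE : ∀ i, tv p q (fun l => s / (q * x (e l))) (fun l => s / (p * y (e l))) (fun l => s / a l) i
      = s / tv p q x y a ((Equiv.sumCongr (Equiv.sumCongr e (Equiv.refl _)) e) i) := by
    rintro (((i | i) | i) | (i | i))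
    · rfl
    · change q * (s / (q * x (Sum.inl i))) = s / x (Sum.inl i)
      have := ht0 (Sum.inl (Sum.inl (Sum.inl i)))
      change x (Sum.inl i) ≠ 0 at this
      field_simp
    · rfl
    · rfl
    · change p * (s / (p * y (Sum.inl i))) = s / y (Sum.inl i)
      have := ht0 (Sum.inr (Sum.inl i))
      change y (Sum.inl i) ≠ 0 at this
      field_simp
  have := detA hp hq hp0 hq0 (fun l => s / (q * x (e l))) (fun l => s / (p * y (e l))) (fun l => s / a l)
    (fun i => by rw [hE, norm_div, div_lt_one (htp _)]; exact ht _)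
    (fun i => by rw [hE]; exact div_ne_zero hs0 (ht0 _)) (fun l => hy _) hVx hVy
  rw [show tv p q (fun l => s / (q * x (e l))) (fun l => s / (p * y (e l))) (fun l => s / a l) =
    (fun i => (fun j => s / tv p q x y a j) ((Equiv.sumCongr (Equiv.sumCongr e (Equiv.refl _)) e) i))
    from funext hE, DD_equiv p q m (Equiv.sumCongr (Equiv.sumCongr e (Equiv.refl _)) e)
      (fun j => s / tv p q x y a j)] at this
  rw [show (fun i => s / (q * x (Sum.inr i))) = (fun i => s / (q * x (e (Sum.inl i)))) from rfl,
    show (fun i => s / (p * y (Sum.inr i))) = (fun i => s / (p * y (e (Sum.inl i)))) from rfl, ← this]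
  congr 2
  ext i j
  simp only [Matrix.of_apply]
  rw [BB_y p q e _ (fun l => s / (p * y l)), ← BB_v p q (Equiv.sumCongr e (Equiv.refl (Fin 4)))]
  congr 1
  funext k
  rcases k with (k | k) | k
  · change (if (Sum.inr k : Fin n ⊕ Fin m) = Sum.inr i then _ else _) =
      (if (Sum.inl k : Fin m ⊕ Fin n) = Sum.inl i then _ else _)
    simp only [Sum.inr.injEq, Sum.inl.injEq]
  · simp [hv, e]
  · rfl

end Rains

namespace Rains
open Filter Topology Set

lemma CV_succ {q : ℂ} {n : ℕ} {w : Fin (n+1) → ℂ} (hw : ∀ i, w i ≠ 0) : C0 w * VV q w =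
    (∏ k : Fin n, -(w k.succ)) * (∏ k : Fin n, Th q (w 0) (w k.succ)) *
      (C0 (fun k => w (Fin.succ k)) * VV q (fun k => w (Fin.succ k))) := by
  unfold C0 VV
  rw [Fin.prod_univ_succ, Fin.prod_univ_succ]
  simp only [Fin.Ioi_zero_eq_map, Finset.prod_map, ← Fin.map_succEmb_Ioi, Fin.coe_succEmb]
  have : ∏ k : Fin n, ps q (w 0) (w k.succ) = ∏ k : Fin n, (w 0)⁻¹ * Th q (w 0) (w k.succ) := rfl
  have h2 : (∏ k : Fin n, -(w 0 * w k.succ)) * ∏ k : Fin n, ps q (w 0) (w k.succ) =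
    (∏ k : Fin n, -(w k.succ)) * (∏ k : Fin n, Th q (w 0) (w k.succ)) := by
    rw [this, ← Finset.prod_mul_distrib, ← Finset.prod_mul_distrib]
    refine Finset.prod_congr rfl (fun k _ => ?_)
    have := hw 0
    field_simp
  linear_combination h2 * (∏ i : Fin n, ∏ k ∈ Finset.Ioi i, -(w i.succ * w k.succ)) *
    (∏ i : Fin n, ∏ k ∈ Finset.Ioi i, ps q (w i.succ) (w k.succ))

lemma alf_book {p q s : ℂ} (hq : ‖q‖ < 1) (hp0 : p ≠ 0) (hq0 : q ≠ 0)
    (hs : s ^ 2 = p * q) {n m : ℕ} (x : Fin (n+1) ⊕ Fin (m+1) → ℂ) (hx0 : ∀ i, x i ≠ 0)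
    (y : Fin (n+1) ⊕ Fin (m+1) → ℂ) (hy0 : ∀ i, y i ≠ 0)
    (a : Fin 4 → ℂ) (j : Fin (n+1) ⊕ Fin (m+1)) {c d : ℂ} (hc : y j = c)
    (hc0 : c ≠ 0)
    (hden : ∏ l ∈ Finset.univ.erase j, th q (y j / y l) = th q (c / d) *
      (∏ k : Fin n, th q (c / y (Sum.inl k.succ))) * (∏ k : Fin m, th q (c / y (Sum.inr k.succ))))
    (hne : ∏ l ∈ Finset.univ.erase j, th q (y j / y l) ≠ 0) :
    alf q x y a j * ((∏ k : Fin n, Th q c (y (Sum.inl k.succ))) *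
      ∏ k : Fin m, Th q (s / (p * c)) (s / (p * y (Sum.inr k.succ)))) * th q (c / d) =
      ((∏ k : Fin (m+1), -x (Sum.inr k)) * ∏ k : Fin m, -y (Sum.inr k.succ)) * c *
      ((∏ l, th q (c * tv p q x y a (Sum.inl l))) * ((∏ k : Fin n, th q (c * y (Sum.inl k.succ))) *
        ∏ k : Fin m, th q (c * (p * y (Sum.inr k.succ))))) := by
  have hs0 : s ≠ 0 := by rintro rfl; simp [hp0, hq0] at hs
  unfold alf
  rw [hden] at hne
  rw [hden, hc]
  have e1 : ∏ k : Fin n, Th q c (y (Sum.inl k.succ)) = (∏ k : Fin n, th q (c * y (Sum.inl k.succ))) *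
      ∏ k : Fin n, th q (c / y (Sum.inl k.succ)) := by
    rw [← Finset.prod_mul_distrib]; rfl
  have e2 : ∏ k : Fin m, Th q (s / (p * c)) (s / (p * y (Sum.inr k.succ))) =
      (∏ k : Fin m, -y (Sum.inr k.succ)) * (c ^ m)⁻¹ * (∏ k : Fin m, th q (c * (p * y (Sum.inr k.succ)))) *
      ∏ k : Fin m, th q (c / y (Sum.inr k.succ)) := by
    have : (c ^ m)⁻¹ = ∏ k : Fin m, c⁻¹ := by simp
    rw [this, ← Finset.prod_mul_distrib, ← Finset.prod_mul_distrib, ← Finset.prod_mul_distrib]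
    refine Finset.prod_congr rfl (fun k _ => ?_)
    have hy := hy0 (Sum.inr k.succ)
    unfold Th
    have h1 : s / (p * c) * (s / (p * y (Sum.inr k.succ))) = q / (c * (p * y (Sum.inr k.succ))) := by
      field_simp
      linear_combination hs
    have h2 : s / (p * c) / (s / (p * y (Sum.inr k.succ))) = (c / y (Sum.inr k.succ))⁻¹ := by
      field_simp
    rw [h1, h2, th_p_div _ hq0, th_inv hq (div_ne_zero hc0 hy)]
    field_simp
  have e3 : ∏ l, th q (x l * c) = (∏ k : Fin (n+1), th q (x (Sum.inl k) * c)) *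
     ((∏ k : Fin (m+1), -x (Sum.inr k)) * c ^ (m+1) * ∏ k : Fin (m+1), th q (c * (q * x (Sum.inr k)))) := by
    rw [Fintype.prod_sum_type]
    congr 1
    have : c ^ (m+1) = ∏ k : Fin (m+1), c := by simp
    rw [this, ← Finset.prod_mul_distrib, ← Finset.prod_mul_distrib]
    refine Finset.prod_congr rfl (fun k _ => ?_)
    have hx := hx0 (Sum.inr k)
    rw [show c * (q * x (Sum.inr k)) = q * (x (Sum.inr k) * c) by ring, th_mul_p hq hq0 (mul_ne_zero hx hc0)]
    field_simp
  have e4 : ∏ l, th q (c * tv p q x y a (Sum.inl l)) = (∏ k : Fin (n+1), th q (x (Sum.inl k) * c)) *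
      (∏ k : Fin (m+1), th q (c * (q * x (Sum.inr k)))) * ∏ k, th q (a k * c) := by
    rw [Fintype.prod_sum_type, Fintype.prod_sum_type]
    simp only [tv, Sum.elim_inl, Sum.elim_inr]
    congr 1
    · congr 1
      exact Finset.prod_congr rfl (fun k _ => by rw [mul_comm])
    · exact Finset.prod_congr rfl (fun k _ => by rw [mul_comm])
  rw [e1, e2, e3, e4, pow_succ]
  generalize (∏ k : Fin (n+1), th q (x (Sum.inl k) * c)) = A1 at *
  generalize (∏ k : Fin (m+1), th q (c * (q * x (Sum.inr k)))) = A2 at *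
  generalize ∏ k, th q (a k * c) = A3 at *
  generalize (∏ k : Fin (m+1), -x (Sum.inr k)) = A4 at *
  generalize (∏ k : Fin n, th q (c * y (Sum.inl k.succ))) = A5 at *
  generalize (∏ k : Fin n, th q (c / y (Sum.inl k.succ))) = A6 at *
  generalize (∏ k : Fin m, -y (Sum.inr k.succ)) = A7 at *
  generalize (∏ k : Fin m, th q (c * (p * y (Sum.inr k.succ)))) = A8 at *
  generalize (∏ k : Fin m, th q (c / y (Sum.inr k.succ))) = A9 at *
  generalize th q (c / d) = A10 at *
  have h9 : A9 ≠ 0 := right_ne_zero_of_mul hne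
  have h6 : A6 ≠ 0 := right_ne_zero_of_mul (left_ne_zero_of_mul hne)
  have h10 : A10 ≠ 0 := left_ne_zero_of_mul (left_ne_zero_of_mul hne)
  field_simp
/-- exchange of the two distinguished entries -/
def sw (n m : ℕ) : Equiv.Perm (Fin (n+1) ⊕ Fin (m+1)) := Equiv.swap (Sum.inl 0) (Sum.inr 0)

lemma sw_inl (n m : ℕ) (k : Fin n) : sw n m (Sum.inl k.succ) = Sum.inl k.succ :=
  Equiv.swap_apply_of_ne_of_ne (by simp) (by simp)
lemma sw_inr (n m : ℕ) (k : Fin m) : sw n m (Sum.inr k.succ) = Sum.inr k.succ :=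
  Equiv.swap_apply_of_ne_of_ne (by simp) (by simp)
lemma sw_inl0 (n m : ℕ) : sw n m (Sum.inl 0) = Sum.inr 0 := Equiv.swap_apply_left _ _
lemma sw_inr0 (n m : ℕ) : sw n m (Sum.inr 0) = Sum.inl 0 := Equiv.swap_apply_right _ _

lemma prod_erase_zero {n : ℕ} (f : Fin (n+1) → ℂ) : ∏ j ∈ Finset.univ.erase 0, f j =
    ∏ k : Fin n, f k.succ := by
  rw [Fin.univ_succ]
  simp

lemma VV_ne {q : ℂ} {n : ℕ} {w : Fin n → ℂ} (h0 : ∀ i, w i ≠ 0)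
    (h : ∀ i j, i ≠ j → th q (w i * w j) ≠ 0 ∧ th q (w i / w j) ≠ 0) : VV q w ≠ 0 := by
  refine Finset.prod_ne_zero_iff.2 (fun i _ => Finset.prod_ne_zero_iff.2 (fun j hj => ?_))
  have := h i j (ne_of_lt (Finset.mem_Ioi.1 hj))
  exact mul_ne_zero (inv_ne_zero (h0 i)) (mul_ne_zero this.1 this.2)

lemma C0_ne {n : ℕ} {w : Fin n → ℂ} (h0 : ∀ i, w i ≠ 0) : C0 w ≠ 0 :=
  Finset.prod_ne_zero_iff.2 (fun i _ => Finset.prod_ne_zero_iff.2 (fun j _ =>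
    neg_ne_zero.2 (mul_ne_zero (h0 i) (h0 j))))

lemma swap_raw {p q s : ℂ} (hp : ‖p‖ < 1) (hq : ‖q‖ < 1) (hp0 : p ≠ 0) (hq0 : q ≠ 0)
    (hs : s ^ 2 = p * q) (hqp : ‖q‖ < ‖p‖) {n m : ℕ} (x y : Fin (n+1) ⊕ Fin (m+1) → ℂ) (a : Fin 4 → ℂ)
    (hx1 : ∀ i, ‖s‖ < ‖x (Sum.inl i)‖) (hx2 : ∀ i, ‖x (Sum.inl i)‖ < 1)
    (hx3 : ∀ i, ‖s‖ < ‖q * x (Sum.inr i)‖) (hx4 : ∀ i, ‖q * x (Sum.inr i)‖ < 1)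
    (ha1 : ∀ i, ‖s‖ < ‖a i‖) (ha2 : ∀ i, ‖a i‖ < 1)
    (hy1 : ∀ i, ‖s‖ < ‖p * y i‖) (hy2 : ∀ i, ‖y i‖ < 1)
    (hprod : (∏ l, x l) * (∏ l, y l) * (∏ l, a l) = p * q)
    (hyy : ∀ i j, i ≠ j → th q (y i / y j) ≠ 0)
    (hVx : VV p (fun i => x (Sum.inl i)) ≠ 0) (hVx' : VV p (fun i => s / (q * x (Sum.inr i))) ≠ 0) :
    DD p q (n+1) (tv p q x (fun l => y (sw n m l)) a) * DD p q (m+1) (fun i => s / tv p q x y a i) *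
      ((∏ l, th q (y (Sum.inr 0) * tv p q x y a (Sum.inl l))) *
        ((∏ k : Fin n, th q (y (Sum.inr 0) * y (Sum.inl k.succ))) *
        ∏ k : Fin m, th q (y (Sum.inr 0) * (p * y (Sum.inr k.succ))))) =
    DD p q (n+1) (tv p q x y a) * DD p q (m+1) (fun i => s / tv p q x (fun l => y (sw n m l)) a i) *
      ((∏ l, th q (y (Sum.inl 0) * tv p q x y a (Sum.inl l))) *
        ((∏ k : Fin n, th q (y (Sum.inl 0) * y (Sum.inl k.succ))) *
        ∏ k : Fin m, th q (y (Sum.inl 0) * (p * y (Sum.inr k.succ))))) := by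
  have hs0 : s ≠ 0 := by rintro rfl; simp [hp0, hq0] at hs
  have hs' : ‖s‖ * ‖s‖ = ‖p‖ * ‖q‖ := by rw [← norm_mul, ← norm_mul, ← hs, sq]
  have hsp : 0 < ‖s‖ := norm_pos_iff.2 hs0
  have hpp : 0 < ‖p‖ := norm_pos_iff.2 hp0
  have hqp' : 0 < ‖q‖ := norm_pos_iff.2 hq0
  have hqs : ‖q‖ < ‖s‖ := by nlinarith
  have hspp : ‖s‖ < ‖p‖ := by nlinarith
  have hy0 : ∀ i, y i ≠ 0 := fun i h => by have := hy1 i; rw [h] at this; simp at this; linarith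
  have hyn : ∀ i, 0 < ‖y i‖ := fun i => norm_pos_iff.2 (hy0 i)
  have hx0 : ∀ i, x i ≠ 0 := by
    rintro (i | i) h
    · have := hx1 i; rw [h] at this; simp at this; linarith
    · have := hx3 i; rw [h] at this; simp at this; linarith
  have ha0 : ∀ i, a i ≠ 0 := fun i h => by have := ha1 i; rw [h] at this; simp at this; linarith
  have hy1' : ∀ i, ‖s‖ < ‖p‖ * ‖y i‖ := fun i => by rw [← norm_mul]; exact hy1 i
  have hy3 : ∀ i, ‖s‖ < ‖y i‖ := fun i => by have := hy1' i; nlinarith [hyn i]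
  have hyt : ∀ i, ‖s / (p * y i)‖ < 1 := fun i => by
    rw [norm_div, div_lt_one (lt_trans hsp (hy1 i))]; exact hy1 i
  have hyt2 : ∀ i, ‖q‖ < ‖s / (p * y i)‖ := fun i => by
    rw [norm_div, lt_div_iff₀ (lt_trans hsp (hy1 i)), norm_mul]
    have := hy2 i
    have : ‖q‖ * (‖p‖ * ‖y i‖) < ‖q‖ * (‖p‖ * 1) := by gcongr
    nlinarith
  have htlo : ∀ (w : Fin (n+1) ⊕ Fin (m+1) → ℂ), (∀ i, ‖s‖ < ‖p * w i‖) → (∀ i, ‖s‖ < ‖w i‖) →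
      ∀ i, ‖s‖ < ‖tv p q x w a i‖ := by
    rintro w h1 h2 (((i | i) | i) | (i | i))
    exacts [hx1 i, hx3 i, ha1 i, h2 _, h1 _]
  have hthi : ∀ (w : Fin (n+1) ⊕ Fin (m+1) → ℂ), (∀ i, ‖w i‖ < 1) →
      ∀ i, ‖tv p q x w a i‖ < 1 := by
    rintro w h1 (((i | i) | i) | (i | i))
    · exact hx2 i
    · exact hx4 i
    · exact ha2 i
    · exact h1 _
    · change ‖p * w _‖ < 1
      rw [norm_mul]; have := h1 (Sum.inr i); nlinarith [norm_nonneg (w (Sum.inr i))]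
  have htne : ∀ (w : Fin (n+1) ⊕ Fin (m+1) → ℂ), (∀ i, ‖s‖ < ‖p * w i‖) → (∀ i, ‖s‖ < ‖w i‖) →
      ∀ i, tv p q x w a i ≠ 0 := fun w h1 h2 i => norm_pos_iff.1 (lt_trans hsp (htlo w h1 h2 i))
  have hpyy : ∀ i j, ‖q‖ < ‖p‖ * ‖y i‖ * ‖y j‖ := fun i j => by
    have h1 := hy1' i
    have h2 := hy1' j
    have : ‖s‖ * ‖s‖ < (‖p‖ * ‖y i‖) * (‖p‖ * ‖y j‖) := by gcongr
    rw [hs'] at this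
    have h3 : ‖p‖ * ‖q‖ < ‖p‖ * (‖p‖ * ‖y i‖ * ‖y j‖) := by linarith
    exact lt_of_mul_lt_mul_left h3 hpp.le
  have hmul : ∀ i j, th q (y i * y j) ≠ 0 := fun i j => by
    refine th_ne_zero_of_lt hq ?_ ?_ <;> rw [norm_mul]
    · nlinarith [hy2 i, hy2 j, hyn i, hyn j]
    · nlinarith [hpyy i j, mul_pos (hyn i) (hyn j)]
  have hmul' : ∀ i j, th q (s / (p * y i) * (s / (p * y j))) ≠ 0 := fun i j => by
    have e : s / (p * y i) * (s / (p * y j)) = q / (p * y i * y j) := by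
      have := hy0 i; have := hy0 j
      field_simp
      linear_combination hs
    rw [e, th_p_div _ hq0]
    refine th_ne_zero_of_lt hq ?_ ?_ <;> rw [norm_mul, norm_mul]
    · nlinarith [hy2 i, hy2 j, hyn i, hyn j, mul_pos (hyn i) (hyn j)]
    · exact hpyy i j
  have hdiv' : ∀ i j, i ≠ j → th q (s / (p * y i) / (s / (p * y j))) ≠ 0 := fun i j hij => by
    have e : s / (p * y i) / (s / (p * y j)) = y j / y i := by
      have := hy0 i; have := hy0 j
      field_simp
    rw [e]; exact hyy j i hij.symm
  have hw0 : ∀ i, s / (p * y i) ≠ 0 := fun i => div_ne_zero hs0 (mul_ne_zero hp0 (hy0 i))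
  have V1 : ∀ f : Fin (n+1) → Fin (n+1) ⊕ Fin (m+1), Function.Injective f →
      VV q (fun i => y (f i)) ≠ 0 := fun f hf =>
    VV_ne (fun i => hy0 _) (fun i j hij => ⟨hmul _ _, hyy _ _ (fun h => hij (hf h))⟩)
  have V2 : ∀ f : Fin (m+1) → Fin (n+1) ⊕ Fin (m+1), Function.Injective f →
      VV q (fun i => s / (p * y (f i))) ≠ 0 := fun f hf =>
    VV_ne (fun i => hw0 _) (fun i j hij => ⟨hmul' _ _, hdiv' _ _ (fun h => hij (hf h))⟩)
  have D1 := detA hp hq hp0 hq0 x y a (hthi y hy2) (htne y hy1 hy3) hy2 hVx (V1 _ Sum.inl_injective)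
  have D1' := detA hp hq hp0 hq0 x (fun l => y (sw n m l)) a (hthi _ (fun _ => hy2 _))
    (htne _ (fun _ => hy1 _) (fun _ => hy3 _)) (fun _ => hy2 _) hVx
    (V1 (fun i => sw n m (Sum.inl i)) ((sw n m).injective.comp Sum.inl_injective))
  have D2 := detB hp hq hp0 hq0 hs0 x y a (htlo y hy1 hy3) hyt hVx' (V2 _ Sum.inr_injective)
  have D2' := detB hp hq hp0 hq0 hs0 x (fun l => y (sw n m l)) a
    (htlo _ (fun _ => hy1 _) (fun _ => hy3 _)) (fun _ => hyt _) hVx'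
    (V2 (fun i => sw n m (Sum.inr i)) ((sw n m).injective.comp Sum.inr_injective))
  set xt : Fin (n+1) ⊕ Fin (m+1) → ℂ := fun l => s / (q * x l) with hxt
  set yt : Fin (n+1) ⊕ Fin (m+1) → ℂ := fun l => s / (p * y l) with hytd
  set at1 : Fin 4 → ℂ := fun l => s / a l with hat
  have L := det_swap (Matrix.of fun i j => BB p q (hv q x a (Sum.inl i)) y (Sum.inl j))
    (Matrix.of fun i j => BB p q (hv q x a (Sum.inl i)) y (Sum.inr j))
    (Matrix.of fun i j => BB p q (hv q xt at1 (Sum.inr i)) yt (Sum.inl j))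
    (Matrix.of fun i j => BB p q (hv q xt at1 (Sum.inr i)) yt (Sum.inr j))
    (fun j => alf q x y a (Sum.inl j)) (fun j => alf q x y a (Sum.inr j))
    (by
      ext i k
      have := ortho hp hq hp0 hq0 hs hqp x y a hx0 hy0 ha0 (Sum.inl i) (Sum.inr k) ?_ hy2
        (fun l => lt_trans hqs (hy3 l)) ?_ hyt hyt2 hprod hyy
      · rw [Fintype.sum_sum_type] at this
        rw [Matrix.add_apply, Matrix.mul_apply, Matrix.mul_apply, Matrix.zero_apply, ← this]
        congr 1
        · refine Finset.sum_congr rfl (fun j _ => ?_)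
          rw [Matrix.mul_diagonal, Matrix.transpose_apply]
          simp only [Matrix.of_apply]
          ring
        · refine Finset.sum_congr rfl (fun j _ => ?_)
          rw [Matrix.mul_diagonal, Matrix.transpose_apply]
          simp only [Matrix.of_apply]
          ring
      · rintro ((r | r) | r)
        · change ‖if (Sum.inl r : Fin (n+1) ⊕ Fin (m+1)) = Sum.inl i then x (Sum.inl r) else q * x (Sum.inl r)‖ < 1
          split_ifs
          · exact hx2 r
          · rw [norm_mul]; nlinarith [hx2 r, norm_nonneg (x (Sum.inl r))]
        · simpa [hv] using hx4 r
        · exact ha2 r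
      · rintro ((r | r) | r)
        · have := hx0 (Sum.inl r)
          have e : q * (s / (q * x (Sum.inl r))) = s / x (Sum.inl r) := by field_simp
          simp only [hv, Sum.elim_inl, reduceCtorEq, if_false]
          rw [e, norm_div, div_lt_one (lt_trans hsp (hx1 r))]; exact hx1 r
        · have h1 : ‖s / (q * x (Sum.inr r))‖ < 1 := by
            rw [norm_div, div_lt_one (lt_trans hsp (hx3 r))]; exact hx3 r
          change ‖if (Sum.inr r : Fin (n+1) ⊕ Fin (m+1)) = Sum.inr k then s / (q * x (Sum.inr r)) else q * (s / (q * x (Sum.inr r)))‖ < 1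
          split_ifs
          · exact h1
          · rw [norm_mul]; nlinarith [norm_nonneg (s / (q * x (Sum.inr r)))]
        · change ‖s / a r‖ < 1
          rw [norm_div, div_lt_one (lt_trans hsp (ha1 r))]; exact ha1 r) 0 0
  have E1 : (Matrix.of fun i j => BB p q (hv q x a (Sum.inl i)) y (Sum.inl j)).updateCol 0
      (fun r => (Matrix.of fun i j => BB p q (hv q x a (Sum.inl i)) y (Sum.inr j)) r 0) =
      Matrix.of fun i j => BB p q (hv q x a (Sum.inl i)) (fun l => y (sw n m l)) (Sum.inl j) := by
    ext i j
    rw [Matrix.of_apply, BB_y p q (sw n m)]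
    refine Fin.cases ?_ (fun k => ?_) j
    · rw [Matrix.updateCol_self, sw_inl0]; rfl
    · rw [Matrix.updateCol_ne (Fin.succ_ne_zero k), sw_inl]; rfl
  have E2 : (Matrix.of fun i j => BB p q (hv q xt at1 (Sum.inr i)) yt (Sum.inr j)).updateCol 0
      (fun r => (Matrix.of fun i j => BB p q (hv q xt at1 (Sum.inr i)) yt (Sum.inl j)) r 0) =
      Matrix.of fun i j => BB p q (hv q xt at1 (Sum.inr i)) (fun l => s / (p * y (sw n m l))) (Sum.inr j) := by
    ext i j
    rw [Matrix.of_apply, BB_y p q (sw n m) _ yt]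
    refine Fin.cases ?_ (fun k => ?_) j
    · rw [Matrix.updateCol_self, sw_inr0]; rfl
    · rw [Matrix.updateCol_ne (Fin.succ_ne_zero k), sw_inr]; rfl
  rw [E1, E2] at L
  rw [CV_succ (fun i => hy0 _)] at D1 D1'
  rw [CV_succ (fun i => hw0 (Sum.inr i))] at D2
  rw [CV_succ (w := fun i => s / (p * y (sw n m (Sum.inr i)))) (fun i => hw0 _)] at D2'
  simp only [sw_inl, sw_inl0, sw_inr, sw_inr0] at D1 D1' D2 D2'
  have B1 := alf_book hq hp0 hq0 hs x hx0 y hy0 a (Sum.inl 0) (c := y (Sum.inl 0)) (d := y (Sum.inr 0)) rfl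
    (hy0 _) (by
      rw [prod_erase_inl, prod_erase_zero, Fin.prod_univ_succ]; ring)
    (Finset.prod_ne_zero_iff.2 (fun l hl => hyy _ _ (Finset.ne_of_mem_erase hl).symm))
  have B2 := alf_book hq hp0 hq0 hs x hx0 y hy0 a (Sum.inr 0) (c := y (Sum.inr 0)) (d := y (Sum.inl 0)) rfl
    (hy0 _) (by
      rw [prod_erase_inr, prod_erase_zero, Fin.prod_univ_succ])
    (Finset.prod_ne_zero_iff.2 (fun l hl => hyy _ _ (Finset.ne_of_mem_erase hl).symm))
  have T1 : th q (y (Sum.inl 0) / y (Sum.inr 0)) = -(y (Sum.inl 0) / y (Sum.inr 0)) *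
      th q (y (Sum.inr 0) / y (Sum.inl 0)) := by
    rw [← inv_div, th_inv hq (div_ne_zero (hy0 _) (hy0 _))]
  have T2 := hyy (Sum.inr 0) (Sum.inl 0) (by simp)
  have K1 : C0 (fun k : Fin n => y (Sum.inl k.succ)) * VV q (fun k : Fin n => y (Sum.inl k.succ)) ≠ 0 :=
    mul_ne_zero (C0_ne (fun _ => hy0 _)) (VV_ne (fun i => hy0 _) (fun i j hij =>
      ⟨hmul _ _, hyy _ _ (fun h => hij (Fin.succ_injective _ (Sum.inl_injective h)))⟩))
  have K2 : C0 (fun k : Fin m => s / (p * y (Sum.inr k.succ))) * VV q (fun k : Fin m => s / (p * y (Sum.inr k.succ))) ≠ 0 :=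
    mul_ne_zero (C0_ne (fun _ => hw0 _)) (VV_ne (fun i => hw0 _) (fun i j hij =>
      ⟨hmul' _ _, hdiv' _ _ (fun h => hij (Fin.succ_injective _ (Sum.inr_injective h)))⟩))
  have X1 : C0 (fun i => x (Sum.inl i)) * VV p (fun i => x (Sum.inl i)) ≠ 0 :=
    mul_ne_zero (C0_ne (fun _ => hx0 _)) hVx
  have X2 : C0 (fun i => s / (q * x (Sum.inr i))) * VV p (fun i => s / (q * x (Sum.inr i))) ≠ 0 :=
    mul_ne_zero (C0_ne (fun _ => div_ne_zero hs0 (mul_ne_zero hq0 (hx0 _)))) hVx'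
  have Y1 : (∏ k : Fin n, -(y (Sum.inl k.succ))) ≠ 0 :=
    Finset.prod_ne_zero_iff.2 (fun k _ => neg_ne_zero.2 (hy0 _))
  have Y2 : (∏ k : Fin m, -(s / (p * y (Sum.inr k.succ)))) ≠ 0 :=
    Finset.prod_ne_zero_iff.2 (fun k _ => neg_ne_zero.2 (hw0 _))
  have Y3 : (∏ k : Fin (m+1), -x (Sum.inr k)) * (∏ k : Fin m, -y (Sum.inr k.succ)) ≠ 0 :=
    mul_ne_zero (Finset.prod_ne_zero_iff.2 (fun k _ => neg_ne_zero.2 (hx0 _)))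
     (Finset.prod_ne_zero_iff.2 (fun k _ => neg_ne_zero.2 (hy0 _)))
  have ha' := hy0 (Sum.inl 0)
  have hb' := hy0 (Sum.inr 0)
  clear_value yt xt at1
  clear E1 E2 hmul hmul' hpyy hdiv' htlo hthi htne hyt hyt2
  generalize DD p q (n+1) (tv p q x y a) = G1 at *
  generalize DD p q (n+1) (tv p q x (fun l => y (sw n m l)) a) = G1' at *
  generalize DD p q (m+1) (fun i => s / tv p q x y a i) = G2 at *
  generalize DD p q (m+1) (fun i => s / tv p q x (fun l => y (sw n m l)) a i) = G2' at *
  generalize (∏ l, th q (y (Sum.inl 0) * tv p q x y a (Sum.inl l))) *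
        ((∏ k : Fin n, th q (y (Sum.inl 0) * y (Sum.inl k.succ))) *
        ∏ k : Fin m, th q (y (Sum.inl 0) * (p * y (Sum.inr k.succ)))) = Ga at *
  generalize (∏ l, th q (y (Sum.inr 0) * tv p q x y a (Sum.inl l))) *
        ((∏ k : Fin n, th q (y (Sum.inr 0) * y (Sum.inl k.succ))) *
        ∏ k : Fin m, th q (y (Sum.inr 0) * (p * y (Sum.inr k.succ)))) = Gb at *
  generalize (C0 (fun k : Fin n => y (Sum.inl k.succ)) * VV q (fun k : Fin n => y (Sum.inl k.succ))) = k1 at *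
  generalize C0 (fun k : Fin m => s / (p * y (Sum.inr k.succ))) * VV q (fun k : Fin m => s / (p * y (Sum.inr k.succ))) = k2 at *
  generalize C0 (fun i => x (Sum.inl i)) * VV p (fun i => x (Sum.inl i)) = x1 at *
  generalize C0 (fun i => s / (q * x (Sum.inr i))) * VV p (fun i => s / (q * x (Sum.inr i))) = x2 at *
  generalize (∏ k : Fin n, -(y (Sum.inl k.succ))) = y1 at *
  generalize (∏ k : Fin m, -(s / (p * y (Sum.inr k.succ)))) = y2 at *
  generalize (∏ k : Fin (m+1), -x (Sum.inr k)) * (∏ k : Fin m, -y (Sum.inr k.succ)) = y3 at *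
  generalize (∏ k : Fin n, Th q (y (Sum.inl 0)) (y (Sum.inl k.succ))) = P1 at *
  generalize (∏ k : Fin n, Th q (y (Sum.inr 0)) (y (Sum.inl k.succ))) = P2 at *
  generalize (∏ k : Fin m, Th q (s / (p * y (Sum.inl 0))) (s / (p * y (Sum.inr k.succ)))) = P3 at *
  generalize (∏ k : Fin m, Th q (s / (p * y (Sum.inr 0))) (s / (p * y (Sum.inr k.succ)))) = P4 at *
  generalize alf q x y a (Sum.inl 0) = f1 at *
  generalize alf q x y a (Sum.inr 0) = f2 at *
  generalize th q (y (Sum.inl 0) / y (Sum.inr 0)) = t1 at *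
  generalize th q (y (Sum.inr 0) / y (Sum.inl 0)) = t2 at *
  generalize (Matrix.of fun i j => BB p q (hv q x a (Sum.inl i)) y (Sum.inl j)).det = d1 at *
  generalize (Matrix.of fun i j => BB p q (hv q x a (Sum.inl i)) (fun l => y (sw n m l)) (Sum.inl j)).det = d1' at *
  generalize (Matrix.of fun i j => BB p q (hv q xt at1 (Sum.inr i)) yt (Sum.inr j)).det = d2 at *
  generalize (Matrix.of fun i j => BB p q (hv q xt at1 (Sum.inr i)) (fun l => s / (p * y (sw n m l))) (Sum.inr j)).det = d2' at *
  have L' := congrArg (fun w => (((n+1).factorial : ℂ) * ((m+1).factorial : ℂ)) * w) L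
  simp only [mul_zero] at L'
  have M1 : (x1 * x2 * y1 * y2 * k1 * k2) * (f1 * (P1 * P3) * (G1 * G2') + f2 * (P2 * P4) * (G1' * G2)) = 0 := by
    linear_combination L' - f1 * (((m+1).factorial : ℂ) * d2') * D1 - f1 * (x1 * (y1 * P1 * k1) * G1) * D2'
      - f2 * (((m+1).factorial : ℂ) * d2) * D1' - f2 * (x1 * (y1 * P2 * k1) * G1') * D2
  have M2 := (mul_eq_zero.1 M1).resolve_left (by simp_all)
  have M3 : (y3 * y (Sum.inr 0)) * (Gb * G1' * G2 - Ga * G1 * G2') = 0 := by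
    have N1 : f1 * (P1 * P3) * t2 = -(y (Sum.inr 0)) * y3 * Ga := by
      rw [T1] at B1
      field_simp at B1
      linear_combination -B1
    linear_combination t2 * M2 - N1 * (G1 * G2') - (G1' * G2) * B2
  have M4 := (mul_eq_zero.1 M3).resolve_left (mul_ne_zero Y3 hb')
  linear_combination M4

end Rains

namespace Rains
open Filter Topology Set

lemma torusInt_continuousOn (n : ℕ) : ∀ {X : Type} [TopologicalSpace X] {F : X → (Fin n → ℂ) → ℂ} {S : Set X},
    ContinuousOn (fun y : X × (Fin n → ℂ) => F y.1 y.2) (S ×ˢ {z | ∀ i, ‖z i‖ = 1}) →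
    ContinuousOn (fun x => torusInt n (F x)) S := by
  induction n with
  | zero =>
    intro X _ F S hF
    show ContinuousOn (fun x => F x Fin.elim0) S
    have : ContinuousOn (fun x : X => (x, (Fin.elim0 : Fin 0 → ℂ))) S := by fun_prop
    exact hF.comp this (fun x hx => ⟨hx, fun i => i.elim0⟩)
  | succ n ih =>
    intro X _ F S hF
    show ContinuousOn (fun x => circleInt (fun z => torusInt n (fun w => F x (Fin.cons z w)))) S
    apply circleInt_continuousOn (F := fun x z => torusInt n (fun w => F x (Fin.cons z w)))
    refine ih (F := fun (y : X × ℂ) w => F y.1 (Fin.cons y.2 w)) ?_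
    refine hF.comp (f := fun y : (X × ℂ) × (Fin n → ℂ) => (y.1.1, (Fin.cons y.1.2 y.2 : Fin (n+1) → ℂ))) ?_ ?_
    · apply Continuous.continuousOn
      refine (continuous_fst.comp continuous_fst).prodMk ?_
      refine continuous_pi (fun i => ?_)
      refine Fin.cases ?_ (fun k => ?_) i
      · simp only [Fin.cons_zero]; fun_prop
      · simp only [Fin.cons_succ]; fun_prop
    · rintro ⟨⟨x, z⟩, w⟩ ⟨⟨hx, hz⟩, hw⟩
      refine ⟨hx, fun i => ?_⟩
      refine Fin.cases ?_ (fun k => ?_) i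
      · simpa using hz
      · simpa using hw k

lemma torusInt_differentiableOn (n : ℕ) : ∀ {F : ℂ → (Fin n → ℂ) → ℂ} {S : Set ℂ}, IsOpen S →
    ContinuousOn (fun y : ℂ × (Fin n → ℂ) => F y.1 y.2) (S ×ˢ {z | ∀ i, ‖z i‖ = 1}) →
    (∀ z, (∀ i, ‖z i‖ = 1) → DifferentiableOn ℂ (fun x => F x z) S) →
    DifferentiableOn ℂ (fun x => torusInt n (F x)) S := by
  induction n with
  | zero =>
    intro F S _ _ hd
    exact hd Fin.elim0 (fun i => i.elim0)
  | succ n ih =>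
    intro F S hS hF hd
    show DifferentiableOn ℂ (fun x => circleInt (fun z => torusInt n (fun w => F x (Fin.cons z w)))) S
    have hcons : Continuous (fun y : (ℂ × ℂ) × (Fin n → ℂ) => (y.1.1, (Fin.cons y.1.2 y.2 : Fin (n+1) → ℂ))) := by
      refine (continuous_fst.comp continuous_fst).prodMk ?_
      refine continuous_pi (fun i => ?_)
      refine Fin.cases ?_ (fun k => ?_) i
      · simp only [Fin.cons_zero]; fun_prop
      · simp only [Fin.cons_succ]; fun_prop
    have hF' : ContinuousOn (fun y : (ℂ × ℂ) × (Fin n → ℂ) => F y.1.1 (Fin.cons y.1.2 y.2))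
        ((S ×ˢ {z | ‖z‖ = 1}) ×ˢ {z | ∀ i, ‖z i‖ = 1}) := by
      refine hF.comp (f := fun y : (ℂ × ℂ) × (Fin n → ℂ) => (y.1.1, (Fin.cons y.1.2 y.2 : Fin (n+1) → ℂ)))
        hcons.continuousOn ?_
      rintro ⟨⟨x, z⟩, w⟩ ⟨⟨hx, hz⟩, hw⟩
      refine ⟨hx, fun i => ?_⟩
      refine Fin.cases ?_ (fun k => ?_) i
      · simpa using hz
      · simpa using hw k
    apply circleInt_differentiableOn (F := fun x z => torusInt n (fun w => F x (Fin.cons z w))) hS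
    · exact torusInt_continuousOn n (F := fun (y : ℂ × ℂ) w => F y.1 (Fin.cons y.2 w)) hF'
    · intro z hz
      refine ih (F := fun x w => F x (Fin.cons z w)) hS ?_ ?_
      · refine hF'.comp (f := fun y : ℂ × (Fin n → ℂ) => ((y.1, z), y.2)) (by fun_prop) ?_
        rintro ⟨x, w⟩ ⟨hx, hw⟩
        exact ⟨⟨hx, hz⟩, hw⟩
      · intro w hw
        refine hd _ (fun i => ?_)
        refine Fin.cases ?_ (fun k => ?_) i
        · simpa using hz
        · simpa using hw k

/-- weight with decoupled numerator parameters -/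
noncomputable def WE (p q : ℂ) {ι : Type*} [Fintype ι] (e t : ι → ℂ) (z : ℂ) : ℂ :=
  (∏ i, EE p q (e i / z) / EE p q (t i * z) * (EE p q (e i * z) / EE p q (t i / z))) *
    (th p (z ^ 2) * th q (z⁻¹ ^ 2))

noncomputable def DE (p q : ℂ) (n : ℕ) {ι : Type*} [Fintype ι] (e t : ι → ℂ) : ℂ :=
  torusInt n (fun z => VV p z * VV q z * ∏ j, WE p q e t (z j))

lemma DD_eq_DE (p q : ℂ) (n : ℕ) {ι : Type*} [Fintype ι] (t : ι → ℂ) :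
    DD p q n t = DE p q n (fun i => p * q / t i) t := by
  unfold DD DE
  apply torusInt_congr
  intro z hz
  congr 1
  refine Finset.prod_congr rfl (fun j _ => ?_)
  have := ne_zero_of_norm_one (hz j)
  unfold Wt WE
  congr 1
  refine Finset.prod_congr rfl (fun i _ => ?_)
  unfold Gm
  have e1 : p * q / t i / z j = p * q / (t i * z j) := div_div _ _ _
  have e2 : p * q / t i * z j = p * q / (t i / z j) := by
    rw [div_div_eq_mul_div, div_mul_eq_mul_div]
  rw [e1, e2]

lemma VV_cont {α : Type*} [TopologicalSpace α] {n : ℕ} {p : α → ℂ} {z : α → Fin n → ℂ} {x : α}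
    (hp : ContinuousAt p x) (hp1 : ‖p x‖ < 1) (hz : ∀ i, ContinuousAt (fun x => z x i) x) (hz0 : ∀ i, z x i ≠ 0) :
    ContinuousAt (fun x => VV (p x) (z x)) x := by
  unfold VV
  refine tendsto_finsetProd _ (fun i _ => tendsto_finsetProd _ (fun j _ => ?_))
  unfold ps Th
  refine ((hz i).inv₀ (hz0 i)).mul (ContinuousAt.mul ?_ ?_)
  · exact th_continuousAt ((hz i).mul (hz j)) hp hp1 (mul_ne_zero (hz0 i) (hz0 j))
  · exact th_continuousAt ((hz i).div (hz j) (hz0 j)) hp hp1 (div_ne_zero (hz0 i) (hz0 j))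

lemma WE_cont {α : Type*} [TopologicalSpace α] {p q z : α → ℂ} {ι : Type*} [Fintype ι] {e t : ι → α → ℂ} {x : α}
    (hp : ContinuousAt p x) (hp1 : ‖p x‖ < 1) (hq : ContinuousAt q x) (hq1 : ‖q x‖ < 1)
    (he : ∀ i, ContinuousAt (e i) x) (ht : ∀ i, ContinuousAt (t i) x) (ht1 : ∀ i, ‖t i x‖ < 1)
    (hz : ContinuousAt z x) (hz1 : ‖z x‖ = 1) :
    ContinuousAt (fun x => WE (p x) (q x) (fun i => e i x) (fun i => t i x) (z x)) x := by
  have hz0 := ne_zero_of_norm_one hz1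
  unfold WE
  refine ContinuousAt.mul (tendsto_finsetProd _ (fun i _ => ContinuousAt.mul ?_ ?_)) (ContinuousAt.mul ?_ ?_)
  · refine (EE_continuousAt ((he i).div hz hz0) hp hq hp1 hq1).div (EE_continuousAt ((ht i).mul hz) hp hq hp1 hq1) ?_
    exact EE_ne_zero_of_lt hp1 hq1 (by simp [hz1, ht1 i])
  · refine (EE_continuousAt ((he i).mul hz) hp hq hp1 hq1).div (EE_continuousAt ((ht i).div hz hz0) hp hq hp1 hq1) ?_
    exact EE_ne_zero_of_lt hp1 hq1 (by simp [hz1, ht1 i])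
  · exact th_continuousAt (hz.pow 2) hp hp1 (pow_ne_zero 2 hz0)
  · exact th_continuousAt ((hz.inv₀ hz0).pow 2) hq hq1 (pow_ne_zero 2 (inv_ne_zero hz0))

lemma DEint_cont {X : Type} [TopologicalSpace X] {p q : X → ℂ} {n : ℕ} {ι : Type*} [Fintype ι]
    {e t : ι → X → ℂ} {S : Set X}
    (hp : ∀ x ∈ S, ContinuousAt p x) (hp1 : ∀ x ∈ S, ‖p x‖ < 1) (hq : ∀ x ∈ S, ContinuousAt q x)
    (hq1 : ∀ x ∈ S, ‖q x‖ < 1) (he : ∀ x ∈ S, ∀ i, ContinuousAt (e i) x)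
    (ht : ∀ x ∈ S, ∀ i, ContinuousAt (t i) x) (ht1 : ∀ x ∈ S, ∀ i, ‖t i x‖ < 1) :
    ContinuousOn (fun y : X × (Fin n → ℂ) => VV (p y.1) y.2 * VV (q y.1) y.2 *
      ∏ j, WE (p y.1) (q y.1) (fun i => e i y.1) (fun i => t i y.1) (y.2 j)) (S ×ˢ {z | ∀ i, ‖z i‖ = 1}) := by
  rintro ⟨x, z⟩ ⟨hx, hz⟩
  have hz' : ∀ i, ‖z i‖ = 1 := hz
  apply ContinuousAt.continuousWithinAt
  have c1 : ∀ f : X → ℂ, ContinuousAt f x → ContinuousAt (fun y : X × (Fin n → ℂ) => f y.1) (x, z) :=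
    fun f hf => ContinuousAt.comp (f := Prod.fst) hf continuousAt_fst
  have c2 : ∀ i, ContinuousAt (fun y : X × (Fin n → ℂ) => y.2 i) (x, z) := fun i => by fun_prop
  refine ContinuousAt.mul (ContinuousAt.mul ?_ ?_) (tendsto_finsetProd _ (fun j _ => ?_))
  · exact VV_cont (p := fun y : X × (Fin n → ℂ) => p y.1) (z := fun y : X × (Fin n → ℂ) => y.2) (x := (x, z)) (c1 p (hp x hx)) (hp1 x hx) c2 (fun i => ne_zero_of_norm_one (hz' i))
  · exact VV_cont (p := fun y : X × (Fin n → ℂ) => q y.1) (z := fun y : X × (Fin n → ℂ) => y.2) (x := (x, z)) (c1 q (hq x hx)) (hq1 x hx) c2 (fun i => ne_zero_of_norm_one (hz' i))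
  · exact WE_cont (p := fun y : X × (Fin n → ℂ) => p y.1) (q := fun y : X × (Fin n → ℂ) => q y.1) (z := fun y : X × (Fin n → ℂ) => y.2 j) (x := (x, z)) (e := fun i y => e i y.1) (t := fun i y => t i y.1) (c1 p (hp x hx)) (hp1 x hx) (c1 q (hq x hx)) (hq1 x hx) (fun i => c1 _ (he x hx i))
      (fun i => c1 _ (ht x hx i)) (fun i => ht1 x hx i) (c2 j) (hz' j)

lemma DE_continuousOn {X : Type} [TopologicalSpace X] {p q : X → ℂ} {n : ℕ} {ι : Type*} [Fintype ι]
    {e t : ι → X → ℂ} {S : Set X}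
    (hp : ∀ x ∈ S, ContinuousAt p x) (hp1 : ∀ x ∈ S, ‖p x‖ < 1) (hq : ∀ x ∈ S, ContinuousAt q x)
    (hq1 : ∀ x ∈ S, ‖q x‖ < 1) (he : ∀ x ∈ S, ∀ i, ContinuousAt (e i) x)
    (ht : ∀ x ∈ S, ∀ i, ContinuousAt (t i) x) (ht1 : ∀ x ∈ S, ∀ i, ‖t i x‖ < 1) :
    ContinuousOn (fun x => DE (p x) (q x) n (fun i => e i x) (fun i => t i x)) S :=
  torusInt_continuousOn n (F := fun x z => VV (p x) z * VV (q x) z *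
      ∏ j, WE (p x) (q x) (fun i => e i x) (fun i => t i x) (z j)) (DEint_cont hp hp1 hq hq1 he ht ht1)

lemma DE_differentiableOn {p q : ℂ → ℂ} {n : ℕ} {ι : Type*} [Fintype ι]
    {e t : ι → ℂ → ℂ} {S : Set ℂ} (hS : IsOpen S)
    (hp : ∀ x ∈ S, AnalyticAt ℂ p x) (hp1 : ∀ x ∈ S, ‖p x‖ < 1) (hq : ∀ x ∈ S, AnalyticAt ℂ q x)
    (hq1 : ∀ x ∈ S, ‖q x‖ < 1) (he : ∀ x ∈ S, ∀ i, AnalyticAt ℂ (e i) x)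
    (ht : ∀ x ∈ S, ∀ i, AnalyticAt ℂ (t i) x) (ht1 : ∀ x ∈ S, ∀ i, ‖t i x‖ < 1) :
    DifferentiableOn ℂ (fun x => DE (p x) (q x) n (fun i => e i x) (fun i => t i x)) S := by
  refine torusInt_differentiableOn n (F := fun x z => VV (p x) z * VV (q x) z *
      ∏ j, WE (p x) (q x) (fun i => e i x) (fun i => t i x) (z j)) hS
      (DEint_cont (fun x hx => (hp x hx).continuousAt) hp1 (fun x hx => (hq x hx).continuousAt) hq1
      (fun x hx i => (he x hx i).continuousAt) (fun x hx i => (ht x hx i).continuousAt) ht1) ?_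
  intro z hz x hx
  apply DifferentiableAt.differentiableWithinAt
  apply AnalyticAt.differentiableAt
  have hz0 := fun i => ne_zero_of_norm_one (hz i)
  have hVV : ∀ f : ℂ → ℂ, AnalyticAt ℂ f x → ‖f x‖ < 1 → AnalyticAt ℂ (fun x => VV (f x) z) x := by
    intro f hf hf1
    unfold VV
    refine Finset.analyticAt_fun_prod _ (fun i _ => Finset.analyticAt_fun_prod _ (fun j _ => ?_))
    unfold ps Th
    refine analyticAt_const.mul (AnalyticAt.mul ?_ ?_)
    · exact th_analyticAt analyticAt_const hf hf1 (mul_ne_zero (hz0 i) (hz0 j))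
    · exact th_analyticAt analyticAt_const hf hf1 (div_ne_zero (hz0 i) (hz0 j))
  refine ((hVV p (hp x hx) (hp1 x hx)).mul (hVV q (hq x hx) (hq1 x hx))).mul
    (Finset.analyticAt_fun_prod _ (fun j _ => ?_))
  have P := hp x hx
  have Q := hq x hx
  have P1 := hp1 x hx
  have Q1 := hq1 x hx
  unfold WE
  refine AnalyticAt.mul (Finset.analyticAt_fun_prod _ (fun i _ => AnalyticAt.mul ?_ ?_)) (AnalyticAt.mul ?_ ?_)
  · refine (EE_analyticAt ((he x hx i).div analyticAt_const (hz0 j)) P Q P1 Q1).div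
      (EE_analyticAt ((ht x hx i).mul analyticAt_const) P Q P1 Q1) ?_
    exact EE_ne_zero_of_lt P1 Q1 (by simp [hz j, ht1 x hx i])
  · refine (EE_analyticAt ((he x hx i).mul analyticAt_const) P Q P1 Q1).div
      (EE_analyticAt ((ht x hx i).div analyticAt_const (hz0 j)) P Q P1 Q1) ?_
    exact EE_ne_zero_of_lt P1 Q1 (by simp [hz j, ht1 x hx i])
  · exact th_analyticAt analyticAt_const P P1 (pow_ne_zero 2 (hz0 j))
  · exact th_analyticAt analyticAt_const Q Q1 (pow_ne_zero 2 (inv_ne_zero (hz0 j)))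

lemma DD_differentiableOn {p q : ℂ → ℂ} {n : ℕ} {ι : Type*} [Fintype ι]
    {t : ι → ℂ → ℂ} {S : Set ℂ} (hS : IsOpen S)
    (hp : ∀ x ∈ S, AnalyticAt ℂ p x) (hp1 : ∀ x ∈ S, ‖p x‖ < 1) (hq : ∀ x ∈ S, AnalyticAt ℂ q x)
    (hq1 : ∀ x ∈ S, ‖q x‖ < 1)
    (ht : ∀ x ∈ S, ∀ i, AnalyticAt ℂ (t i) x) (ht1 : ∀ x ∈ S, ∀ i, ‖t i x‖ < 1)
    (ht0 : ∀ x ∈ S, ∀ i, t i x ≠ 0) :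
    DifferentiableOn ℂ (fun x => DD (p x) (q x) n (fun i => t i x)) S := by
  simp only [DD_eq_DE]
  exact DE_differentiableOn (e := fun i x => p x * q x / t i x) hS hp hp1 hq hq1
    (fun x hx i => ((hp x hx).mul (hq x hx)).div (ht x hx i) (ht0 x hx i)) ht ht1

end Rains

namespace Rains
open Filter Topology Set

lemma DD_continuousOn {X : Type} [TopologicalSpace X] {p q : X → ℂ} {n : ℕ} {ι : Type*} [Fintype ι]
    {t : ι → X → ℂ} {S : Set X}
    (hp : ∀ x ∈ S, ContinuousAt p x) (hp1 : ∀ x ∈ S, ‖p x‖ < 1) (hq : ∀ x ∈ S, ContinuousAt q x)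
    (hq1 : ∀ x ∈ S, ‖q x‖ < 1)
    (ht : ∀ x ∈ S, ∀ i, ContinuousAt (t i) x) (ht1 : ∀ x ∈ S, ∀ i, ‖t i x‖ < 1)
    (ht0 : ∀ x ∈ S, ∀ i, t i x ≠ 0) :
    ContinuousOn (fun x => DD (p x) (q x) n (fun i => t i x)) S := by
  simp only [DD_eq_DE]
  exact DE_continuousOn (e := fun i x => p x * q x / t i x) hp hp1 hq hq1
    (fun x hx i => ((hp x hx).mul (hq x hx)).div (ht x hx i) (ht0 x hx i)) ht ht1

lemma torusInt_pos (n : ℕ) : ∀ {G : (Fin n → ℂ) → ℝ}, Continuous G → (∀ z, 0 ≤ G z) →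
    ∃ r : ℝ, torusInt n (fun z => (G z : ℂ)) = r ∧ 0 ≤ r ∧ ((∃ z, (∀ i, ‖z i‖ = 1) ∧ 0 < G z) → 0 < r) := by
  induction n with
  | zero =>
    intro G hG h0
    refine ⟨G Fin.elim0, rfl, h0 _, ?_⟩
    rintro ⟨z, _, hz⟩
    rwa [Subsingleton.elim z Fin.elim0] at hz
  | succ n ih =>
    intro G hG h0
    have hcons : Continuous (fun y : ℂ × (Fin n → ℂ) => (Fin.cons y.1 y.2 : Fin (n+1) → ℂ)) := by
      refine continuous_pi (fun i => ?_)
      refine Fin.cases ?_ (fun k => ?_) i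
      · simp only [Fin.cons_zero]; fun_prop
      · simp only [Fin.cons_succ]; fun_prop
    have hGc : Continuous (fun y : ℂ × (Fin n → ℂ) => G (Fin.cons y.1 y.2 : Fin (n+1) → ℂ)) := hG.comp hcons
    have H := fun z : ℂ => ih (G := fun w => G (Fin.cons z w))
      (hGc.comp (f := fun w => (z, w)) (by fun_prop)) (fun w => h0 _)
    choose r hr hr0 hrp using H
    have hrc : Continuous r := by
      have : Continuous (fun z => (r z : ℂ)) := by
        rw [← continuousOn_univ]
        have := torusInt_continuousOn n (X := ℂ) (F := fun z w => (G (Fin.cons z w) : ℂ)) (S := univ)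
          (by apply Continuous.continuousOn; exact Complex.continuous_ofReal.comp hGc)
        refine this.congr (fun z _ => (hr z).symm)
      exact Complex.continuous_re.comp this
    have hpi : (0:ℝ) < 2 * Real.pi := by positivity
    refine ⟨(2 * Real.pi)⁻¹ * ∫ θ in (0:ℝ)..2 * Real.pi, r (circleMap 0 1 θ), ?_, ?_, ?_⟩
    · show circleInt (fun z => torusInt n (fun w => (G (Fin.cons z w) : ℂ))) = _
      simp only [hr, circleInt_eq_av, av_eq one_ne_zero, intervalIntegral.integral_ofReal]
      push_cast; rfl
    · refine mul_nonneg (by positivity) (intervalIntegral.integral_nonneg hpi.le (fun θ _ => hr0 _))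
    · rintro ⟨z, hz, hzp⟩
      refine mul_pos (by positivity) ?_
      obtain ⟨θ, hθ, hθz⟩ : ∃ θ ∈ Icc (0:ℝ) (2 * Real.pi), circleMap 0 1 θ = z 0 := by
        have : z 0 ∈ Metric.sphere (0:ℂ) |1| := by simp [hz 0]
        rw [← image_circleMap_Ioc] at this
        obtain ⟨θ, hθ, h⟩ := this
        exact ⟨θ, Ioc_subset_Icc_self hθ, h⟩
      refine intervalIntegral.integral_pos hpi (by fun_prop) (fun θ _ => hr0 _) ⟨θ, hθ, ?_⟩
      refine hrp _ ⟨Fin.tail z, fun i => hz _, ?_⟩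
      rw [hθz]
      simpa using hzp

lemma EE_zero (p q : ℂ) : EE p q 0 = 1 := by
  unfold EE; simp

lemma exists_re {x : ℝ} (h0 : -1 ≤ x) (h1 : x ≤ 1) : ∃ z : ℂ, ‖z‖ = 1 ∧ z.re = x := by
  refine ⟨Complex.exp (Real.arccos x * Complex.I), by simp, ?_⟩
  rw [Complex.exp_ofReal_mul_I_re, Real.cos_arccos h0 h1]

lemma DE_zero_ne (m : ℕ) {ι : Type*} [Fintype ι] : DE 0 0 m (fun _ : ι => 0) (fun _ => 0) ≠ 0 := by
  let G : (Fin m → ℂ) → ℝ := fun z => (∏ i, ∏ j ∈ Finset.Ioi i, (2 * (z i).re - 2 * (z j).re)) ^ 2 *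
    ∏ j, ‖1 - z j ^ 2‖ ^ 2
  have e : DE 0 0 m (fun _ : ι => 0) (fun _ => 0) = torusInt m (fun z => (G z : ℂ)) := by
    unfold DE
    apply torusInt_congr
    intro z hz
    have c : ∀ w : ℂ, ‖w‖ = 1 → w⁻¹ = (starRingEnd ℂ) w := fun w hw => by
      rw [Complex.inv_def, Complex.normSq_eq_norm_sq, hw]; simp
    have hV : VV 0 z = ((∏ i, ∏ j ∈ Finset.Ioi i, (2 * (z i).re - 2 * (z j).re) : ℝ) : ℂ) := by
      unfold VV
      push_cast
      refine Finset.prod_congr rfl (fun i _ => Finset.prod_congr rfl (fun j _ => ?_))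
      unfold ps Th
      rw [th_zero, th_zero]
      have h1 := ne_zero_of_norm_one (hz i)
      have h2 := ne_zero_of_norm_one (hz j)
      have a1 := Complex.add_conj (z i)
      have a2 := Complex.add_conj (z j)
      rw [← c _ (hz i)] at a1
      rw [← c _ (hz j)] at a2
      push_cast at a1 a2
      rw [← a1, ← a2]
      field_simp
      ring
    have hW : ∀ j, WE 0 0 (fun _ : ι => 0) (fun _ => 0) (z j) = ((‖1 - z j ^ 2‖ ^ 2 : ℝ) : ℂ) := by
      intro j
      unfold WE
      simp only [zero_div, zero_mul, EE_zero, div_one, mul_one, Finset.prod_const_one, one_mul, th_zero]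
      rw [c _ (hz j), ← Complex.normSq_eq_norm_sq, ← Complex.mul_conj]
      simp
    simp only [hV, hW, G]
    push_cast
    ring
  rw [e]
  obtain ⟨r, h1, h2, h3⟩ := torusInt_pos m (G := G) (by unfold G; fun_prop) (fun z => by positivity)
  rw [h1]
  have : 0 < r := by
    apply h3
    have H : ∀ i : Fin m, ∃ z : ℂ, ‖z‖ = 1 ∧ z.re = (i:ℝ) / m := fun i => by
      have hm : (0:ℝ) < m := by exact_mod_cast i.pos
      refine exists_re (le_trans (by norm_num) (by positivity : (0:ℝ) ≤ _)) ?_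
      rw [div_le_one hm]; exact_mod_cast i.2.le
    choose z hz hre using H
    refine ⟨z, hz, ?_⟩
    refine mul_pos (sq_pos_of_ne_zero ?_) (Finset.prod_pos fun j _ => pow_pos (norm_pos_iff.mpr ?_) 2)
    · refine Finset.prod_ne_zero_iff.mpr (fun i _ => Finset.prod_ne_zero_iff.mpr (fun j hj => ?_))
      have hij : i < j := Finset.mem_Ioi.mp hj
      have hm : (0:ℝ) < m := by exact_mod_cast i.pos
      rw [hre, hre]
      have : (i:ℝ) / m < (j:ℝ) / m := by gcongr; exact_mod_cast hij
      linarith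
    · intro h
      have hm : (0:ℝ) < m := by exact_mod_cast j.pos
      have : (z j - 1) * (z j + 1) = 0 := by linear_combination -h
      have h4 : (z j).re < 1 := by rw [hre, div_lt_one hm]; exact_mod_cast j.2
      have h5 : 0 ≤ (z j).re := by rw [hre]; positivity
      rcases mul_eq_zero.mp this with h | h
      · have := congrArg Complex.re h; simp at this; linarith
      · have := congrArg Complex.re h; simp at this; linarith
  exact_mod_cast this.ne'

lemma DE_ne_zero (m : ℕ) (ι : Type) [Fintype ι] : ∃ δ : ℝ, 0 < δ ∧ ∀ (p q : ℂ) (e t : ι → ℂ), ‖p‖ < δ → ‖q‖ < δ →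
    (∀ i, ‖e i‖ < δ) → (∀ i, ‖t i‖ < δ) → DE p q m e t ≠ 0 := by
  have hc : ContinuousOn (fun x : ℂ × ℂ × (ι → ℂ) × (ι → ℂ) => DE x.1 x.2.1 m (fun i => x.2.2.1 i) (fun i => x.2.2.2 i))
      (Metric.ball 0 1) := by
    have key : ∀ x ∈ Metric.ball (0 : ℂ × ℂ × (ι → ℂ) × (ι → ℂ)) 1, ‖x.1‖ < 1 ∧ ‖x.2.1‖ < 1 ∧ ∀ i, ‖x.2.2.2 i‖ < 1 := by
      intro x hx
      rw [mem_ball_zero_iff] at hx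
      have h1 := norm_fst_le x
      have h2 := norm_snd_le x
      have h3 := norm_fst_le x.2
      have h4 := norm_snd_le x.2
      have h5 := norm_snd_le x.2.2
      exact ⟨by linarith, by linarith, fun i => by have := norm_le_pi_norm x.2.2.2 i; linarith⟩
    apply DE_continuousOn (X := ℂ × ℂ × (ι → ℂ) × (ι → ℂ)) (p := fun x => x.1) (q := fun x => x.2.1)
      (e := fun i x => x.2.2.1 i) (t := fun i x => x.2.2.2 i)
    · intro x _; fun_prop
    · exact fun x hx => (key x hx).1
    · intro x _; fun_prop
    · exact fun x hx => (key x hx).2.1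
    · intro x _ i; fun_prop
    · intro x _ i; fun_prop
    · exact fun x hx => (key x hx).2.2
  have hc0 := hc.continuousAt (Metric.ball_mem_nhds 0 one_pos)
  have := hc0.eventually_ne (y := 0) (DE_zero_ne m)
  obtain ⟨δ, hδ, h⟩ := Metric.eventually_nhds_iff_ball.mp this
  refine ⟨δ, hδ, fun p q e t h1 h2 h3 h4 => ?_⟩
  refine h (p, q, e, t) ?_
  rw [mem_ball_zero_iff]
  simp only [Prod.norm_def, max_lt_iff]
  exact ⟨h1, h2, (pi_norm_lt_iff hδ).mpr h3, (pi_norm_lt_iff hδ).mpr h4⟩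

end Rains

namespace Rains
open Filter Topology Set

abbrev Ix (n m : ℕ) := ((Fin (n+1) ⊕ Fin (m+1)) ⊕ Fin 4) ⊕ (Fin (n+1) ⊕ Fin (m+1))

abbrev al (n m : ℕ) : Ix n m := Sum.inr (Sum.inl 0)
abbrev be (n m : ℕ) : Ix n m := Sum.inr (Sum.inr 0)

noncomputable def tpr {ι : Type*} [DecidableEq ι] (p : ℂ) (a b : ι) (t : ι → ℂ) : ι → ℂ :=
  fun i => if i = a then p * t a else if i = b then t b / p else t i

lemma rest_prod {n m : ℕ} (f : Ix n m → ℂ) :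
    (∏ l, f (Sum.inl l)) * ((∏ k : Fin n, f (Sum.inr (Sum.inl k.succ))) *
        ∏ k : Fin m, f (Sum.inr (Sum.inr k.succ))) = ∏ r, if r = al n m ∨ r = be n m then 1 else f r := by
  have aux : ∀ (k : ℕ) (g : Fin (k+1) → ℂ), (∏ x, if x = 0 then 1 else g x) = ∏ x : Fin k, g x.succ := by
    intro k g
    rw [Fin.prod_univ_succ]; simp
  rw [Fintype.prod_sum_type (f := fun r : Ix n m => if r = al n m ∨ r = be n m then 1 else f r)]
  rw [Fintype.prod_sum_type (f := fun x : Fin (n+1) ⊕ Fin (m+1) =>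
    if (Sum.inr x : Ix n m) = al n m ∨ (Sum.inr x : Ix n m) = be n m then 1 else f (Sum.inr x))]
  simp only [al, be, Sum.inr.injEq, Sum.inl.injEq, reduceCtorEq, or_false, false_or, if_false]
  rw [aux n (fun x => f (Sum.inr (Sum.inl x))), aux m (fun x => f (Sum.inr (Sum.inr x)))]

lemma swap_gen {p q s : ℂ} (hp : ‖p‖ < 1) (hq : ‖q‖ < 1) (hp0 : p ≠ 0) (hq0 : q ≠ 0)
    (hs : s ^ 2 = p * q) (hqp : ‖q‖ < ‖p‖) {n m : ℕ} (t : Ix n m → ℂ)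
    (h1 : ∀ i, ‖s‖ < ‖p‖ * ‖t i‖) (h2 : ∀ i, ‖t i‖ < ‖p‖) (hprod : ∏ i, t i = (p * q) ^ (m + 2))
    (hg1 : ∀ i j : Fin (n+1) ⊕ Fin (m+1), i ≠ j →
      th q ((Sum.elim (fun _ => 1) (fun _ => p⁻¹) i : ℂ) * t (Sum.inr i) / ((Sum.elim (fun _ => 1) (fun _ => p⁻¹) j : ℂ) * t (Sum.inr j))) ≠ 0)
    (hg2 : ∀ i j : Fin (n+1), i ≠ j →
      th p (t (Sum.inl (Sum.inl (Sum.inl i))) * t (Sum.inl (Sum.inl (Sum.inl j)))) ≠ 0 ∧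
      th p (t (Sum.inl (Sum.inl (Sum.inl i))) / t (Sum.inl (Sum.inl (Sum.inl j)))) ≠ 0)
    (hg3 : ∀ i j : Fin (m+1), i ≠ j →
      th p (s / t (Sum.inl (Sum.inl (Sum.inr i))) * (s / t (Sum.inl (Sum.inl (Sum.inr j))))) ≠ 0 ∧
      th p (s / t (Sum.inl (Sum.inl (Sum.inr i))) / (s / t (Sum.inl (Sum.inl (Sum.inr j))))) ≠ 0) :
    DD p q (n+1) (tpr p (al n m) (be n m) t) * DD p q (m+1) (fun i => s / t i) *
      (∏ r, if r = al n m ∨ r = be n m then 1 else th q (t (be n m) / p * t r)) =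
    DD p q (n+1) t * DD p q (m+1) (fun i => s / tpr p (al n m) (be n m) t i) *
      (∏ r, if r = al n m ∨ r = be n m then 1 else th q (t (al n m) * t r)) := by
  have hpp : 0 < ‖p‖ := norm_pos_iff.2 hp0
  have hs0 : s ≠ 0 := by rintro rfl; simp [hp0, hq0] at hs
  have hsp : 0 < ‖s‖ := norm_pos_iff.2 hs0
  have ht0 : ∀ i, t i ≠ 0 := fun i h => by have := h1 i; rw [h] at this; simp at this; linarith
  have h1' : ∀ i, ‖s‖ < ‖t i‖ := fun i => by have := h1 i; nlinarith [norm_nonneg (t i)]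
  have h2' : ∀ i, ‖t i‖ < 1 := fun i => (h2 i).trans hp
  set x : Fin (n+1) ⊕ Fin (m+1) → ℂ := Sum.elim (fun i => t (Sum.inl (Sum.inl (Sum.inl i))))
    (fun i => t (Sum.inl (Sum.inl (Sum.inr i))) / q) with hx
  set y : Fin (n+1) ⊕ Fin (m+1) → ℂ := Sum.elim (fun i => t (Sum.inr (Sum.inl i)))
    (fun i => t (Sum.inr (Sum.inr i)) / p) with hy
  set a : Fin 4 → ℂ := fun k => t (Sum.inl (Sum.inr k)) with ha
  have hqx : ∀ i, q * x (Sum.inr i) = t (Sum.inl (Sum.inl (Sum.inr i))) := fun i => by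
    simp only [hx, Sum.elim_inr]; field_simp
  have hpy : ∀ i, p * y (Sum.inr i) = t (Sum.inr (Sum.inr i)) := fun i => by
    simp only [hy, Sum.elim_inr]; field_simp
  have e1 : tv p q x y a = t := by
    funext i
    rcases i with ((i | i) | i) | (i | i)
    · rfl
    · exact hqx i
    · rfl
    · rfl
    · exact hpy i
  have e2 : tv p q x (fun l => y (sw n m l)) a = fun i => tpr p (al n m) (be n m) t (Equiv.swap (al n m) (be n m) i) := by
    funext i
    rcases i with ((i | i) | i) | (i | i)
    · rw [Equiv.swap_apply_of_ne_of_ne (by simp) (by simp)]; simp [tpr, tv, hx]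
    · rw [Equiv.swap_apply_of_ne_of_ne (by simp) (by simp)]; simp [tpr, tv]; exact hqx i
    · rw [Equiv.swap_apply_of_ne_of_ne (by simp) (by simp)]; simp [tpr, tv, ha]
    · refine Fin.cases ?_ (fun k => ?_) i
      · rw [Equiv.swap_apply_left]; simp [tpr, tv, sw_inl0, hy]
      · rw [Equiv.swap_apply_of_ne_of_ne (by simp) (by simp)]; simp [tpr, tv, sw_inl, hy]
    · refine Fin.cases ?_ (fun k => ?_) i
      · rw [Equiv.swap_apply_right]; simp [tpr, tv, sw_inr0, hy]
      · rw [Equiv.swap_apply_of_ne_of_ne (by simp) (by simp)]; simp [tpr, tv, sw_inr]; exact hpy _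
  have H := swap_raw hp hq hp0 hq0 hs hqp x y a (fun i => h1' _) (fun i => h2' _)
    (fun i => by rw [hqx]; exact h1' _) (fun i => by rw [hqx]; exact h2' _) (fun i => h1' _) (fun i => h2' _)
    (by
      rintro (i | i)
      · rw [norm_mul]; exact h1 _
      · rw [hpy]; exact h1' _)
    (by
      rintro (i | i)
      · exact h2' _
      · simp only [hy, Sum.elim_inr]; rw [norm_div, div_lt_one hpp]; exact h2 _)
    (by
      rw [Fintype.prod_sum_type, Fintype.prod_sum_type, Fintype.prod_sum_type, Fintype.prod_sum_type] at hprod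
      rw [Fintype.prod_sum_type, Fintype.prod_sum_type]
      simp only [hx, hy, Sum.elim_inl, Sum.elim_inr, Finset.prod_div_distrib, Finset.prod_const, Finset.card_univ, Fintype.card_fin]
      generalize (∏ i, t (Sum.inl (Sum.inl (Sum.inl i)))) = A1 at *
      generalize (∏ i, t (Sum.inl (Sum.inl (Sum.inr i)))) = A2 at *
      generalize (∏ i, t (Sum.inr (Sum.inl i))) = A3 at *
      generalize (∏ i, t (Sum.inr (Sum.inr i))) = A4 at *
      generalize (∏ i, a i) = A5 at *
      rw [pow_succ, mul_pow] at hprod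
      field_simp
      linear_combination hprod)
    (by
      intro i j hij
      have := hg1 i j hij
      have E : ∀ i, y i = (Sum.elim (fun _ => 1) (fun _ => p⁻¹) i : ℂ) * t (Sum.inr i) := by
        rintro (i | i)
        · simp [hy]
        · simp [hy]; ring
      rwa [E, E])
    (VV_ne (fun i => ht0 _) hg2)
    (by
      refine VV_ne (fun i => div_ne_zero hs0 (by rw [hqx]; exact ht0 _)) (fun i j hij => ?_)
      rw [hqx, hqx]; exact hg3 i j hij)
  rw [e1, e2, DD_equiv, DD_equiv p q (m+1) (Equiv.swap (al n m) (be n m)) (fun i => s / tpr p (al n m) (be n m) t i)] at H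
  have r1 := rest_prod (fun r => th q (t (be n m) / p * t r))
  have r2 := rest_prod (fun r => th q (t (al n m) * t r))
  rw [← r1, ← r2]
  simp only [hpy] at H
  exact H

end Rains

namespace Rains
open Filter Topology Set

lemma th_pert {p c k : ℂ} (hp : ‖p‖ < 1) (hc : c ≠ 0) (hk : k ≠ 0) :
    ∀ᶠ ε in 𝓝[≠] (0:ℂ), th p (c * Complex.exp (ε * k)) ≠ 0 := by
  have han : ∀ ε : ℂ, AnalyticAt ℂ (fun ε => th p (c * Complex.exp (ε * k))) ε := fun ε =>
    th_analyticAt (by fun_prop) analyticAt_const hp (mul_ne_zero hc (Complex.exp_ne_zero _))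
  rcases (han 0).eventually_eq_zero_or_eventually_ne_zero with h | h
  · exfalso
    have H : AnalyticOnNhd ℂ (fun ε => th p (c * Complex.exp (ε * k))) univ := fun ε _ => han ε
    have H2 := H.eqOn_zero_of_preconnected_of_eventuallyEq_zero isPreconnected_univ (mem_univ 0) h
    obtain ⟨r, hr1, hr2⟩ := exists_between hp
    have hr0 : 0 < r := (norm_nonneg p).trans_lt hr1
    have hw : (r : ℂ) / c ≠ 0 := div_ne_zero (by exact_mod_cast hr0.ne') hc
    have := H2 (mem_univ (Complex.log ((r : ℂ) / c) / k))
    simp only [Pi.zero_apply] at this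
    rw [div_mul_cancel₀ _ hk, Complex.exp_log hw, mul_div_cancel₀ _ hc] at this
    have hn : ‖(r:ℂ)‖ = r := by simp [abs_of_pos hr0]
    exact th_ne_zero_of_lt hp (by rw [hn]; exact hr2) (by rw [hn]; exact hr1) this
  · exact h

lemma exists_kappa {ι : Type*} [Fintype ι] [DecidableEq ι] (i0 : ι) : ∃ κ : ι → ℂ, ∑ i, κ i = 0 ∧
    ∀ i j, i ≠ i0 → j ≠ i0 → i ≠ j → κ i - κ j ≠ 0 ∧ κ i + κ j ≠ 0 := by
  let k' : ι → ℂ := fun i => ((Fintype.equivFin ι i : ℕ) : ℂ) + 1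
  refine ⟨fun i => if i = i0 then - ∑ j ∈ Finset.univ.erase i0, k' j else k' i, ?_, ?_⟩
  · rw [← Finset.add_sum_erase _ _ (Finset.mem_univ i0)]
    have := Finset.sum_congr (rfl : Finset.univ.erase i0 = Finset.univ.erase i0)
      (f := fun i => if i = i0 then - ∑ j ∈ Finset.univ.erase i0, k' j else k' i) (g := k')
      (fun j hj => if_neg (Finset.ne_of_mem_erase hj))
    rw [this, if_pos rfl, neg_add_cancel]
  · intro i j hi hj hij
    simp only [hi, hj, if_false, k']
    refine ⟨fun h => hij ?_, fun h => ?_⟩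
    · have : ((Fintype.equivFin ι i : ℕ) : ℂ) = ((Fintype.equivFin ι j : ℕ) : ℂ) := by linear_combination h
      exact (Fintype.equivFin ι).injective (Fin.ext (by exact_mod_cast this))
    · have : (((Fintype.equivFin ι i : ℕ) + (Fintype.equivFin ι j : ℕ) + 2 : ℕ) : ℂ) = 0 := by push_cast; linear_combination h
      have := Nat.cast_eq_zero.mp this
      omega

lemma swap_t {p q s : ℂ} (hp : ‖p‖ < 1) (hq : ‖q‖ < 1) (hp0 : p ≠ 0) (hq0 : q ≠ 0)
    (hs : s ^ 2 = p * q) (hqp : ‖q‖ < ‖p‖) {n m : ℕ} (t : Ix n m → ℂ)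
    (h1 : ∀ i, ‖s‖ < ‖p‖ * ‖t i‖) (h2 : ∀ i, ‖t i‖ < ‖p‖) (hprod : ∏ i, t i = (p * q) ^ (m + 2)) :
    DD p q (n+1) (tpr p (al n m) (be n m) t) * DD p q (m+1) (fun i => s / t i) *
      (∏ r, if r = al n m ∨ r = be n m then 1 else th q (t (be n m) / p * t r)) =
    DD p q (n+1) t * DD p q (m+1) (fun i => s / tpr p (al n m) (be n m) t i) *
      (∏ r, if r = al n m ∨ r = be n m then 1 else th q (t (al n m) * t r)) := by
  have hpp : 0 < ‖p‖ := norm_pos_iff.2 hp0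
  have hs0 : s ≠ 0 := by rintro rfl; simp [hp0, hq0] at hs
  have hsp : 0 < ‖s‖ := norm_pos_iff.2 hs0
  obtain ⟨κ, hκ, hκ2⟩ := exists_kappa (Sum.inl (Sum.inr 0) : Ix n m)
  let T : Ix n m → ℂ → ℂ := fun i ε => t i * Complex.exp (ε * κ i)
  have hTc : ∀ i, Continuous (T i) := fun i => by unfold T; fun_prop
  let S : Set ℂ := {ε | ∀ i, ‖s‖ < ‖p‖ * ‖T i ε‖ ∧ ‖T i ε‖ < ‖p‖}
  have hS : IsOpen S := by
    have : S = ⋂ i, {ε | ‖s‖ < ‖p‖ * ‖T i ε‖ ∧ ‖T i ε‖ < ‖p‖} := by ext; simp [S]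
    rw [this]
    refine isOpen_iInter_of_finite (fun i => ?_)
    have := hTc i
    exact (isOpen_lt continuous_const (continuous_const.mul this.norm)).inter (isOpen_lt this.norm continuous_const)
  have hT0 : ∀ i, T i 0 = t i := fun i => by simp [T]
  have hT0' : (fun i => T i 0) = t := funext hT0
  have h0S : (0:ℂ) ∈ S := fun i => by rw [hT0]; exact ⟨h1 i, h2 i⟩
  have hTn : ∀ ε ∈ S, ∀ i, T i ε ≠ 0 := fun ε hε i h => by
    have := (hε i).1; rw [h] at this; simp at this; linarith
  have hT1 : ∀ ε ∈ S, ∀ i, ‖T i ε‖ < 1 := fun ε hε i => (hε i).2.trans hp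
  have hTs : ∀ ε ∈ S, ∀ i, ‖s‖ < ‖T i ε‖ := fun ε hε i => by
    have := (hε i).1; nlinarith [norm_nonneg (T i ε)]
  have hTpr0 : ∀ ε ∈ S, ∀ i, tpr p (al n m) (be n m) (fun i => T i ε) i ≠ 0 := fun ε hε i => by
    unfold tpr; split_ifs
    · exact mul_ne_zero hp0 (hTn ε hε _)
    · exact div_ne_zero (hTn ε hε _) hp0
    · exact hTn ε hε _
  have hTpr1 : ∀ ε ∈ S, ∀ i, ‖tpr p (al n m) (be n m) (fun i => T i ε) i‖ < 1 := fun ε hε i => by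
    unfold tpr; split_ifs
    · rw [norm_mul]; nlinarith [hT1 ε hε (al n m), norm_nonneg (T (al n m) ε)]
    · rw [norm_div, div_lt_one hpp]; exact (hε _).2
    · exact hT1 ε hε _
  have hTpr2 : ∀ ε ∈ S, ∀ i, ‖s‖ < ‖tpr p (al n m) (be n m) (fun i => T i ε) i‖ := fun ε hε i => by
    unfold tpr; split_ifs
    · rw [norm_mul]; exact (hε _).1
    · rw [norm_div, lt_div_iff₀ hpp]; nlinarith [hTs ε hε (be n m)]
    · exact hTs ε hε _
  have hTprc : ∀ i, Continuous (fun ε => tpr p (al n m) (be n m) (fun i => T i ε) i) := fun i => by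
    unfold tpr
    split_ifs
    · exact continuous_const.mul (hTc _)
    · exact (hTc _).div_const _
    · exact hTc _
  have cst : ∀ c : ℂ, ∀ x ∈ S, ContinuousAt (fun _ : ℂ => c) x := fun c x _ => continuousAt_const
  have dual : ∀ {τ : ℂ}, ‖s‖ < ‖τ‖ → ‖s / τ‖ < 1 := fun {τ} h => by
    rw [norm_div, div_lt_one (hsp.trans h)]; exact h
  have c1 : ContinuousAt (fun ε => DD p q (n+1) (tpr p (al n m) (be n m) (fun i => T i ε))) 0 :=
    (DD_continuousOn (X := ℂ) (t := fun i ε => tpr p (al n m) (be n m) (fun i => T i ε) i) (cst p) (fun _ _ => hp) (cst q)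
      (fun _ _ => hq) (fun x hx i => (hTprc i).continuousAt) hTpr1 hTpr0).continuousAt (hS.mem_nhds h0S)
  have c2 : ContinuousAt (fun ε => DD p q (n+1) (fun i => T i ε)) 0 :=
    (DD_continuousOn (X := ℂ) (t := T) (cst p) (fun _ _ => hp) (cst q)
      (fun _ _ => hq) (fun x hx i => (hTc i).continuousAt) hT1 hTn).continuousAt (hS.mem_nhds h0S)
  have c3 : ContinuousAt (fun ε => DD p q (m+1) (fun i => s / T i ε)) 0 :=
    (DD_continuousOn (X := ℂ) (t := fun i ε => s / T i ε) (cst p) (fun _ _ => hp) (cst q)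
      (fun _ _ => hq) (fun x hx i => continuousAt_const.div (hTc i).continuousAt (hTn x hx i))
      (fun x hx i => dual (hTs x hx i)) (fun x hx i => div_ne_zero hs0 (hTn x hx i))).continuousAt (hS.mem_nhds h0S)
  have c4 : ContinuousAt (fun ε => DD p q (m+1) (fun i => s / tpr p (al n m) (be n m) (fun i => T i ε) i)) 0 :=
    (DD_continuousOn (X := ℂ) (t := fun i ε => s / tpr p (al n m) (be n m) (fun i => T i ε) i) (cst p) (fun _ _ => hp) (cst q)
      (fun _ _ => hq) (fun x hx i => continuousAt_const.div (hTprc i).continuousAt (hTpr0 x hx i))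
      (fun x hx i => dual (hTpr2 x hx i)) (fun x hx i => div_ne_zero hs0 (hTpr0 x hx i))).continuousAt (hS.mem_nhds h0S)
  have ht0 : ∀ i, t i ≠ 0 := fun i => by have := hTn 0 h0S i; rwa [hT0] at this
  have c5 : ContinuousAt (fun ε => ∏ r, if r = al n m ∨ r = be n m then 1 else th q (T (be n m) ε / p * T r ε)) 0 := by
    refine tendsto_finsetProd _ (fun r _ => ?_)
    by_cases hr : r = al n m ∨ r = be n m
    · simp only [hr, if_true]; exact tendsto_const_nhds
    · simp only [hr, if_false]
      exact th_continuousAt (((hTc _).div_const _).mul (hTc r)).continuousAt continuousAt_const hq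
        (by simp only [hT0]; exact mul_ne_zero (div_ne_zero (ht0 _) hp0) (ht0 _))
  have c6 : ContinuousAt (fun ε => ∏ r, if r = al n m ∨ r = be n m then 1 else th q (T (al n m) ε * T r ε)) 0 := by
    refine tendsto_finsetProd _ (fun r _ => ?_)
    by_cases hr : r = al n m ∨ r = be n m
    · simp only [hr, if_true]; exact tendsto_const_nhds
    · simp only [hr, if_false]
      exact th_continuousAt ((hTc _).mul (hTc r)).continuousAt continuousAt_const hq
        (by simp only [hT0]; exact mul_ne_zero (ht0 _) (ht0 _))
  have hL := (c1.mul c3).mul c5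
  have hR := (c2.mul c4).mul c6
  have key := (hL.eventuallyEq_nhds_iff_eventuallyEq_nhdsNE hR).mp ?_
  · have := key.eq_of_nhds
    simp only [Pi.mul_apply, hT0] at this
    exact this
  have hSe : ∀ᶠ ε in 𝓝[≠] (0:ℂ), ε ∈ S := mem_nhdsWithin_of_mem_nhds (hS.mem_nhds h0S)
  have g1 : ∀ᶠ ε in 𝓝[≠] (0:ℂ), ∀ i j : Fin (n+1) ⊕ Fin (m+1), i ≠ j →
      th q ((Sum.elim (fun _ => 1) (fun _ => p⁻¹) i : ℂ) * T (Sum.inr i) ε / ((Sum.elim (fun _ => 1) (fun _ => p⁻¹) j : ℂ) * T (Sum.inr j) ε)) ≠ 0 := by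
    refine eventually_all.mpr (fun i => eventually_all.mpr (fun j => ?_))
    by_cases hij : i = j
    · simp [hij]
    simp only [ne_eq, hij, not_false_eq_true, forall_const]
    have hz : ∀ i : Fin (n+1) ⊕ Fin (m+1), (Sum.elim (fun _ => 1) (fun _ => p⁻¹) i : ℂ) ≠ 0 := by
      rintro (i | i) <;> simp [hp0]
    have := th_pert (p := q) (c := (Sum.elim (fun _ => 1) (fun _ => p⁻¹) i : ℂ) * t (Sum.inr i) / ((Sum.elim (fun _ => 1) (fun _ => p⁻¹) j : ℂ) * t (Sum.inr j))) hq
      (div_ne_zero (mul_ne_zero (hz _) (ht0 _)) (mul_ne_zero (hz _) (ht0 _)))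
      (hκ2 (Sum.inr i) (Sum.inr j) (by simp) (by simp) (by simpa using hij)).1
    filter_upwards [this] with ε hε
    convert hε using 2
    rw [mul_sub, Complex.exp_sub]
    simp only [T]
    have := hz j
    have := ht0 (Sum.inr j)
    field_simp
  have g2 : ∀ᶠ ε in 𝓝[≠] (0:ℂ), ∀ i j : Fin (n+1), i ≠ j →
      th p (T (Sum.inl (Sum.inl (Sum.inl i))) ε * T (Sum.inl (Sum.inl (Sum.inl j))) ε) ≠ 0 ∧
      th p (T (Sum.inl (Sum.inl (Sum.inl i))) ε / T (Sum.inl (Sum.inl (Sum.inl j))) ε) ≠ 0 := by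
    refine eventually_all.mpr (fun i => eventually_all.mpr (fun j => ?_))
    by_cases hij : i = j
    · simp [hij]
    simp only [ne_eq, hij, not_false_eq_true, forall_const]
    have hk := hκ2 (Sum.inl (Sum.inl (Sum.inl i))) (Sum.inl (Sum.inl (Sum.inl j))) (by simp) (by simp) (by simpa using hij)
    filter_upwards [th_pert hp (mul_ne_zero (ht0 (Sum.inl (Sum.inl (Sum.inl i)))) (ht0 (Sum.inl (Sum.inl (Sum.inl j))))) hk.2,
      th_pert hp (div_ne_zero (ht0 (Sum.inl (Sum.inl (Sum.inl i)))) (ht0 (Sum.inl (Sum.inl (Sum.inl j))))) hk.1] with ε e1 e2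
    constructor
    · convert e1 using 3
      rw [mul_add, Complex.exp_add]
      simp only [T]; ring
    · convert e2 using 3
      rw [mul_sub, Complex.exp_sub]
      simp only [T]
      have := ht0 (Sum.inl (Sum.inl (Sum.inl j)))
      field_simp
  have g3 : ∀ᶠ ε in 𝓝[≠] (0:ℂ), ∀ i j : Fin (m+1), i ≠ j →
      th p (s / T (Sum.inl (Sum.inl (Sum.inr i))) ε * (s / T (Sum.inl (Sum.inl (Sum.inr j))) ε)) ≠ 0 ∧
      th p (s / T (Sum.inl (Sum.inl (Sum.inr i))) ε / (s / T (Sum.inl (Sum.inl (Sum.inr j))) ε)) ≠ 0 := by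
    refine eventually_all.mpr (fun i => eventually_all.mpr (fun j => ?_))
    by_cases hij : i = j
    · simp [hij]
    simp only [ne_eq, hij, not_false_eq_true, forall_const]
    have hk := hκ2 (Sum.inl (Sum.inl (Sum.inr i))) (Sum.inl (Sum.inl (Sum.inr j))) (by simp) (by simp) (by simpa using hij)
    have hi := ht0 (Sum.inl (Sum.inl (Sum.inr i)))
    have hj := ht0 (Sum.inl (Sum.inl (Sum.inr j)))
    filter_upwards [th_pert hp (mul_ne_zero (div_ne_zero hs0 hi) (div_ne_zero hs0 hj)) (neg_ne_zero.mpr hk.2),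
      th_pert hp (div_ne_zero (div_ne_zero hs0 hi) (div_ne_zero hs0 hj)) (neg_ne_zero.mpr hk.1)] with ε e1 e2
    constructor
    · convert e1 using 3
      rw [mul_neg, mul_add, Complex.exp_neg, Complex.exp_add]
      simp only [T]; field_simp
    · convert e2 using 3
      rw [mul_neg, mul_sub, Complex.exp_neg, Complex.exp_sub]
      simp only [T]
      field_simp
  filter_upwards [hSe, g1, g2, g3] with ε hε k1 k2 k3
  refine swap_gen hp hq hp0 hq0 hs hqp (fun i => T i ε) (fun i => (hε i).1) (fun i => (hε i).2) ?_ k1 k2 k3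
  simp only [T]
  rw [Finset.prod_mul_distrib, hprod, ← Complex.exp_sum, ← Finset.mul_sum, hκ]
  simp

end Rains

namespace Rains
open Filter Topology Set

lemma pair_split {ι : Type*} [LinearOrder ι] (g : ι → ι → ℂ) (hg : ∀ i j, g i j = g j i) (a : ι) (S : Finset ι)
    (ha : a ∉ S) : (∏ i ∈ insert a S, ∏ j ∈ (insert a S).filter (i < ·), g i j) =
      (∏ r ∈ S, g a r) * ∏ i ∈ S, ∏ j ∈ S.filter (i < ·), g i j := by
  rw [Finset.prod_insert ha, Finset.filter_insert, if_neg (lt_irrefl a), Finset.prod_filter]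
  have : ∀ i ∈ S, (∏ j ∈ (insert a S).filter (i < ·), g i j) =
      (if i < a then g a i else 1) * ∏ j ∈ S.filter (i < ·), g i j := by
    intro i hi
    rw [Finset.filter_insert]
    split_ifs
    · rw [Finset.prod_insert (by simp [ha]), hg]
    · rw [one_mul]
  rw [Finset.prod_congr rfl this, Finset.prod_mul_distrib, ← mul_assoc, ← Finset.prod_mul_distrib]
  congr 1
  refine Finset.prod_congr rfl (fun r hr => ?_)
  have : r ≠ a := fun h => ha (h ▸ hr)
  rcases lt_or_gt_of_ne this with h | h
  · simp [h, h.le]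
  · simp [h, h.le]

noncomputable def PP (p q : ℂ) {N : ℕ} (t : Fin N → ℂ) : ℂ := ∏ i, ∏ j ∈ Finset.univ.filter (i < ·), Gm p q (t i * t j)

lemma PP_split (p q : ℂ) {N : ℕ} (t : Fin N → ℂ) {a b : Fin N} (hab : a ≠ b) : ∃ S : Finset (Fin N), a ∉ S ∧ b ∉ S ∧
    insert a (insert b S) = Finset.univ ∧ S = (Finset.univ.erase a).erase b ∧
    PP p q t = Gm p q (t a * t b) * (∏ r ∈ S, Gm p q (t a * t r)) * ((∏ r ∈ S, Gm p q (t b * t r)) *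
      ∏ i ∈ S, ∏ j ∈ S.filter (i < ·), Gm p q (t i * t j)) := by
  refine ⟨(Finset.univ.erase a).erase b, by simp, by simp, ?_, rfl, ?_⟩
  · rw [Finset.insert_erase (by simp [hab.symm]), Finset.insert_erase (by simp)]
  · have h : insert a (insert b ((Finset.univ.erase a).erase b)) = (Finset.univ : Finset (Fin N)) := by
      rw [Finset.insert_erase (by simp [hab.symm]), Finset.insert_erase (by simp)]
    have haS : a ∉ (Finset.univ.erase a).erase b := by simp
    have hbS : b ∉ (Finset.univ.erase a).erase b := by simp
    unfold PP
    generalize (Finset.univ.erase a).erase b = S at *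
    rw [← h, pair_split (fun i j => Gm p q (t i * t j)) (fun i j => by rw [mul_comm]) a _ (by simp [hab, haS]),
      pair_split (fun i j => Gm p q (t i * t j)) (fun i j => by rw [mul_comm]) b _ hbS,
      Finset.prod_insert hbS]

lemma prod_ite_rest {N : ℕ} {a b : Fin N} (f : Fin N → ℂ) :
    (∏ r, if r = a ∨ r = b then 1 else f r) = ∏ r ∈ (Finset.univ.erase a).erase b, f r := by
  rw [← Finset.prod_subset (Finset.subset_univ ((Finset.univ.erase a).erase b))]
  · refine Finset.prod_congr rfl (fun r hr => if_neg ?_)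
    simp at hr; tauto
  · intro r _ hr
    apply if_pos
    simp at hr; tauto

lemma PP_swap {p q : ℂ} (hp : ‖p‖ < 1) (hq : ‖q‖ < 1) (hp0 : p ≠ 0) {N : ℕ} (t : Fin N → ℂ) {a b : Fin N} (hab : a ≠ b)
    (h2 : ∀ i, ‖t i‖ < ‖p‖) :
    PP p q (tpr p a b t) * (∏ r, if r = a ∨ r = b then 1 else th q (t b / p * t r)) =
    PP p q t * (∏ r, if r = a ∨ r = b then 1 else th q (t a * t r)) := by
  have hpp : 0 < ‖p‖ := norm_pos_iff.2 hp0
  have hm : ∀ x y : ℂ, ‖x‖ < 1 → ‖y‖ < 1 → EE p q (x * y) ≠ 0 := fun x y hx hy =>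
    EE_ne_zero_of_lt hp hq (by rw [norm_mul]; nlinarith [norm_nonneg x, norm_nonneg y])
  obtain ⟨S, haS, hbS, hS, hSe, e1⟩ := PP_split p q (tpr p a b t) hab
  obtain ⟨S', -, -, -, hSe', e2⟩ := PP_split p q t hab
  rw [prod_ite_rest, prod_ite_rest, ← hSe, e1, e2, hSe', ← hSe]
  have ta : tpr p a b t a = p * t a := by simp [tpr]
  have tb : tpr p a b t b = t b / p := by simp [tpr, hab.symm]
  have tr : ∀ r ∈ S, tpr p a b t r = t r := fun r hr => by
    have h1 : r ≠ a := fun h => haS (h ▸ hr)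
    have h2 : r ≠ b := fun h => hbS (h ▸ hr)
    simp [tpr, h1, h2]
  have f1 : (∏ r ∈ S, Gm p q (tpr p a b t a * tpr p a b t r)) =
      (∏ r ∈ S, th q (t a * t r)) * ∏ r ∈ S, Gm p q (t a * t r) := by
    rw [← Finset.prod_mul_distrib]
    refine Finset.prod_congr rfl (fun r hr => ?_)
    rw [ta, tr r hr, mul_assoc, Gm_p hp hq hp0 (hm _ _ ((h2 _).trans hp) ((h2 _).trans hp))]
  have f2 : (∏ r ∈ S, Gm p q (t b * t r)) = (∏ r ∈ S, th q (t b / p * t r)) *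
      ∏ r ∈ S, Gm p q (tpr p a b t b * tpr p a b t r) := by
    rw [← Finset.prod_mul_distrib]
    refine Finset.prod_congr rfl (fun r hr => ?_)
    rw [tb, tr r hr, ← Gm_p hp hq hp0 (hm _ _ (by rw [norm_div, div_lt_one hpp]; exact h2 _) ((h2 _).trans hp))]
    congr 1
    field_simp
  have f3 : (∏ i ∈ S, ∏ j ∈ S.filter (i < ·), Gm p q (tpr p a b t i * tpr p a b t j)) =
      ∏ i ∈ S, ∏ j ∈ S.filter (i < ·), Gm p q (t i * t j) :=
    Finset.prod_congr rfl (fun i hi => Finset.prod_congr rfl (fun j hj => by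
      rw [tr i hi, tr j (Finset.mem_filter.mp hj).1]))
  have f4 : tpr p a b t a * tpr p a b t b = t a * t b := by rw [ta, tb]; field_simp
  rw [f1, f2, f3, f4]
  ring

lemma exists_equiv {n m N : ℕ} (hN : N = 2 * (n + 1) + 2 * (m + 1) + 4) {a b : Fin N} (hab : a ≠ b) :
    ∃ e : Fin N ≃ Ix n m, e a = al n m ∧ e b = be n m := by
  have hc : Fintype.card (Fin N) = Fintype.card (Ix n m) := by simp; omega
  let e0 := Fintype.equivOfCardEq hc
  let e1 := e0.trans (Equiv.swap (e0 a) (al n m))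
  have h1 : e1 a = al n m := by simp [e1]
  refine ⟨e1.trans (Equiv.swap (e1 b) (be n m)), ?_, by simp⟩
  rw [Equiv.trans_apply, h1, Equiv.swap_apply_of_ne_of_ne]
  · rw [← h1]; exact fun h => hab (e1.injective h)
  · simp [al, be]

lemma swap_pair {p q s : ℂ} (hp : ‖p‖ < 1) (hq : ‖q‖ < 1) (hp0 : p ≠ 0) (hq0 : q ≠ 0)
    (hs : s ^ 2 = p * q) (hqp : ‖q‖ < ‖p‖) {n m N : ℕ} (hN : N = 2 * (n + 1) + 2 * (m + 1) + 4)
    {a b : Fin N} (hab : a ≠ b) (t : Fin N → ℂ)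
    (h1 : ∀ i, ‖s‖ < ‖p‖ * ‖t i‖) (h2 : ∀ i, ‖t i‖ < ‖p‖) (hprod : ∏ i, t i = (p * q) ^ (m + 2)) :
    DD p q (n+1) (tpr p a b t) * DD p q (m+1) (fun i => s / t i) * PP p q t =
    DD p q (n+1) t * DD p q (m+1) (fun i => s / tpr p a b t i) * PP p q (tpr p a b t) := by
  obtain ⟨e, ea, eb⟩ := exists_equiv (n := n) (m := m) hN hab
  have hpp : 0 < ‖p‖ := norm_pos_iff.2 hp0
  have hqq : 0 < ‖q‖ := norm_pos_iff.2 hq0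
  have hs0 : s ≠ 0 := by rintro rfl; simp [hp0, hq0] at hs
  have hsp : 0 < ‖s‖ := norm_pos_iff.2 hs0
  have hs' : ‖s‖ * ‖s‖ = ‖p‖ * ‖q‖ := by rw [← norm_mul, ← norm_mul, ← hs, sq]
  have H := swap_t hp hq hp0 hq0 hs hqp (n := n) (m := m) (fun i => t (e.symm i)) (fun i => h1 _) (fun i => h2 _)
    (by rw [Equiv.prod_comp e.symm t]; exact hprod)
  have ea' : e.symm (al n m) = a := by rw [← ea, Equiv.symm_apply_apply]
  have eb' : e.symm (be n m) = b := by rw [← eb, Equiv.symm_apply_apply]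
  have et : tpr p (al n m) (be n m) (fun i => t (e.symm i)) = fun i => tpr p a b t (e.symm i) := by
    funext i
    have k1 : i = al n m ↔ e.symm i = a := by rw [← ea']; exact e.symm.injective.eq_iff.symm
    have k2 : i = be n m ↔ e.symm i = b := by rw [← eb']; exact e.symm.injective.eq_iff.symm
    simp only [tpr, k1, k2, ea', eb']
  have er : ∀ f : Fin N → ℂ, (∏ r : Ix n m, if r = al n m ∨ r = be n m then 1 else f (e.symm r)) =
      ∏ r, if r = a ∨ r = b then 1 else f r := by
    intro f
    rw [← Equiv.prod_comp e.symm]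
    refine Finset.prod_congr rfl (fun i _ => ?_)
    have k1 : i = al n m ↔ e.symm i = a := by rw [← ea']; exact e.symm.injective.eq_iff.symm
    have k2 : i = be n m ↔ e.symm i = b := by rw [← eb']; exact e.symm.injective.eq_iff.symm
    simp only [k1, k2]
  simp only [et, ea', eb'] at H
  rw [DD_equiv, DD_equiv, DD_equiv p q (m+1) e.symm (fun i => s / t i),
    DD_equiv p q (m+1) e.symm (fun i => s / tpr p a b t i), er (fun r => th q (t b / p * t r)),
    er (fun r => th q (t a * t r))] at H
  have K := PP_swap hp hq hp0 t hab h2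
  have hne : (∏ r, if r = a ∨ r = b then 1 else th q (t a * t r)) ≠ 0 := by
    refine Finset.prod_ne_zero_iff.mpr (fun r _ => ?_)
    split_ifs
    · exact one_ne_zero
    · have g1 := h1 a; have g2 := h1 r; have g3 := h2 a; have g4 := h2 r
      apply th_ne_zero_of_lt hq
      · rw [norm_mul]; nlinarith [norm_nonneg (t a), norm_nonneg (t r)]
      · rw [norm_mul]
        have : ‖p‖ * ‖q‖ < (‖p‖ * ‖t a‖) * (‖p‖ * ‖t r‖) := by rw [← hs']; gcongr
        have : ‖q‖ < ‖p‖ * (‖t a‖ * ‖t r‖) := by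
          by_contra hc; push Not at hc; nlinarith
        nlinarith [mul_nonneg (norm_nonneg (t a)) (norm_nonneg (t r))]
  apply mul_right_cancel₀ hne
  linear_combination (PP p q (tpr p a b t)) * H -
    DD p q (n+1) (tpr p a b t) * DD p q (m+1) (fun i => s / t i) * K

end Rains

namespace Rains
open Filter Topology Set

lemma const_of_periodic {f : ℂ → ℂ} {l : ℝ} {P : ℂ} (hl : 0 < l) (hP : P.re = -l)
    (hf : DifferentiableOn ℂ f {v | |v.re| < l})
    (h1 : ∀ v : ℂ, |v.re| < l → |(v + P).re| < l → f (v + P) = f v)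
    (h2 : ∀ v : ℂ, |v.re| < l → f (v + 2 * Real.pi * Complex.I) = f v) :
    ∀ v : ℂ, |v.re| < l → f v = f 0 := by
  let Ω : Set ℂ := {v | |v.re| < l}
  have hΩo : IsOpen Ω := isOpen_lt (by fun_prop) continuous_const
  have hΩc : IsPreconnected Ω := by
    have : Ω = Complex.reLm ⁻¹' (Ioo (-l) l) := by
      ext v; simp [Ω, abs_lt]
    rw [this]
    exact ((convex_Ioo _ _).linear_preimage Complex.reLm).isPreconnected
  let K : Set ℂ := Icc (-(l/2)) (l/2) ×ℂ Icc 0 (2 * Real.pi)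
  have hK : IsCompact K := isCompact_Icc.reProdIm isCompact_Icc
  have hKΩ : K ⊆ Ω := by
    intro v hv
    have := (Complex.mem_reProdIm.mp hv).1
    show |v.re| < l
    rw [abs_lt]; constructor <;> linarith [this.1, this.2]
  have hKne : K.Nonempty := ⟨0, by
    refine Complex.mem_reProdIm.mpr ⟨⟨?_, ?_⟩, ⟨?_, ?_⟩⟩ <;> simp <;> first | linarith | positivity⟩
  have hperiod : ∀ v ∈ Ω, ∀ k : ℤ, f (v + k * (2 * Real.pi * Complex.I)) = f v := by
    intro v hv k
    have hre : ∀ k : ℤ, (v + k * (2 * Real.pi * Complex.I)).re = v.re := by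
      intro k; simp
    induction k using Int.induction_on with
    | zero => simp
    | succ k ih =>
      rw [← ih, ← h2 (v + (k : ℤ) * (2 * Real.pi * Complex.I)) (by rw [hre]; exact hv)]
      congr 1; push_cast; ring
    | pred k ih =>
      rw [← ih, ← h2 (v + ((-k - 1 : ℤ) : ℂ) * (2 * Real.pi * Complex.I)) (by rw [hre]; exact hv)]
      congr 1; push_cast; ring
  have hred : ∀ v ∈ Ω, ∃ w ∈ K, f w = f v := by
    have A : ∀ v : ℂ, |v.re| ≤ l / 2 → ∃ w ∈ K, f w = f v := by
      intro v hv
      have hpi : (0:ℝ) < 2 * Real.pi := by positivity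
      refine ⟨v + (-⌊v.im / (2 * Real.pi)⌋ : ℤ) * (2 * Real.pi * Complex.I), ?_, hperiod v (show |v.re| < l by linarith) _⟩
      rw [abs_le] at hv
      refine Complex.mem_reProdIm.mpr ⟨by simpa using hv, ?_⟩
      have e : (v + (-⌊v.im / (2 * Real.pi)⌋ : ℤ) * (2 * Real.pi * Complex.I)).im = v.im - ⌊v.im / (2 * Real.pi)⌋ * (2 * Real.pi) := by
        simp; ring
      rw [e]
      have i1 := Int.floor_le (v.im / (2 * Real.pi))
      have i2 := Int.lt_floor_add_one (v.im / (2 * Real.pi))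
      rw [le_div_iff₀ hpi] at i1
      rw [div_lt_iff₀ hpi] at i2
      constructor <;> nlinarith
    intro v hv
    have hv' : |v.re| < l := hv
    have hv2 := abs_lt.mp hv'
    rcases le_or_gt |v.re| (l/2) with h | h
    · exact A v h
    · rcases lt_abs.mp h with h | h
      · obtain ⟨w, hw, e⟩ := A (v + P) (by rw [abs_le]; simp [hP]; constructor <;> linarith)
        exact ⟨w, hw, e.trans (h1 v hv (by rw [abs_lt]; simp only [Complex.add_re, hP]; constructor <;> linarith))⟩
      · obtain ⟨w, hw, e⟩ := A (v - P) (by rw [abs_le]; simp [hP]; constructor <;> linarith)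
        refine ⟨w, hw, e.trans ?_⟩
        rw [← h1 (v - P) (by rw [abs_lt]; simp [hP]; constructor <;> linarith) (by simpa using hv')]
        simp
  obtain ⟨v0, hv0, hmax⟩ := hK.exists_isMaxOn hKne (hf.continuousOn.mono hKΩ).norm
  have hM : IsMaxOn (norm ∘ f) Ω v0 := by
    intro v hv
    obtain ⟨w, hw, e⟩ := hred v hv
    have h3 : ‖f w‖ ≤ ‖f v0‖ := hmax hw
    show ‖f v‖ ≤ ‖f v0‖
    rw [← e]; exact h3
  have := Complex.eqOn_of_isPreconnected_of_isMaxOn_norm hΩc hΩo hf (hKΩ hv0) hM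
  intro v hv
  have a := this hv
  have b := this (show (0:ℂ) ∈ Ω by simp [Ω, hl])
  simp only [Function.const_apply] at a b
  rw [a, b]

lemma line_lemma {κ : Type*} [Finite κ] (A B : κ → ℂ) (hA : ∀ k, (A k).re < 0) (hB : ∀ k, (A k + B k).re < 0)
    {f : ℂ → ℂ} (hf : DifferentiableOn ℂ f {x | ∀ k, (A k + x * B k).re < 0}) (h0 : ∀ᶠ x in 𝓝 (0:ℂ), f x = 0) :
    f 1 = 0 := by
  let Ω : Set ℂ := {x | ∀ k, (A k + x * B k).re < 0}
  have hΩ : Ω = ⋂ k, {x | (A k + x * B k).re < 0} := by ext; simp [Ω]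
  have hΩo : IsOpen Ω := by
    rw [hΩ]
    exact isOpen_iInter_of_finite (fun k => isOpen_lt (by fun_prop) continuous_const)
  have hΩc : IsPreconnected Ω := by
    apply Convex.isPreconnected
    rw [hΩ]
    refine convex_iInter (fun k => ?_)
    intro x hx y hy a b ha hb hab
    simp only [Set.mem_ofPred_eq] at *
    have : (A k + (a • x + b • y) * B k).re = a * (A k + x * B k).re + b * (A k + y * B k).re := by
      have : A k + (a • x + b • y) * B k = a * (A k + x * B k) + b * (A k + y * B k) := by
        simp only [Complex.real_smul]
        have : (a:ℂ) + b = 1 := by exact_mod_cast hab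
        linear_combination (-(A k)) * this
      rw [this]; simp
    rw [this]
    rcases ha.eq_or_lt with h | h
    · have : b = 1 := by linarith
      rw [← h, this]; linarith
    · nlinarith
  have hc0 : (0:ℂ) ∈ Ω := fun k => by simpa using hA k
  have hc1 : (1:ℂ) ∈ Ω := fun k => by simpa using hB k
  have := (hf.analyticOnNhd hΩo).eqOn_zero_of_preconnected_of_eventuallyEq_zero hΩc hc0 h0
  exact this hc1

end Rains

namespace Rains
open Filter Topology Set

lemma PP_analyticAt {p q : ℂ → ℂ} {N : ℕ} {t : Fin N → ℂ → ℂ} {x : ℂ} (hp : AnalyticAt ℂ p x) (hp1 : ‖p x‖ < 1)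
    (hq : AnalyticAt ℂ q x) (hq1 : ‖q x‖ < 1) (ht : ∀ i, AnalyticAt ℂ (t i) x) (ht0 : ∀ i, t i x ≠ 0)
    (ht1 : ∀ i, ‖t i x‖ < 1) : AnalyticAt ℂ (fun x => PP (p x) (q x) (fun i => t i x)) x := by
  unfold PP
  refine Finset.analyticAt_fun_prod _ (fun i _ => Finset.analyticAt_fun_prod _ (fun j _ => ?_))
  refine Gm_analyticAt ((ht i).mul (ht j)) hp hq hp1 hq1 (mul_ne_zero (ht0 i) (ht0 j)) ?_
  exact EE_ne_zero_of_lt hp1 hq1 (by rw [norm_mul]; nlinarith [ht1 i, ht1 j, norm_nonneg (t i x), norm_nonneg (t j x)])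

lemma PP_ne_zero {p q s : ℂ} (hp : ‖p‖ < 1) (hq : ‖q‖ < 1) (hs : s ^ 2 = p * q) {N : ℕ} {t : Fin N → ℂ}
    (h1 : ∀ i, ‖s‖ < ‖t i‖) (h2 : ∀ i, ‖t i‖ < 1) : PP p q t ≠ 0 := by
  have hs' : ‖p * q‖ = ‖s‖ * ‖s‖ := by rw [← hs, norm_pow, sq]
  refine Finset.prod_ne_zero_iff.mpr (fun i _ => Finset.prod_ne_zero_iff.mpr (fun j _ => ?_))
  refine Gm_ne_zero (EE_ne_zero_of_lt hp hq ?_) (EE_ne_zero_of_lt hp hq ?_)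
  · rw [norm_mul]; nlinarith [h2 i, h2 j, norm_nonneg (t i), norm_nonneg (t j)]
  · have := (norm_nonneg s).trans_lt (h1 i)
    have := (norm_nonneg s).trans_lt (h1 j)
    rw [norm_div, norm_mul (t i), hs', div_lt_one (by positivity)]
    exact mul_lt_mul'' (h1 i) (h1 j) (norm_nonneg _) (norm_nonneg _)

noncomputable def mv {ι : Type*} [DecidableEq ι] (a b : ι) (v : ℂ) (t : ι → ℂ) : ι → ℂ :=
  fun i => if i = a then t a * Complex.exp v else if i = b then t b * Complex.exp (-v) else t i

lemma mv_zero {ι : Type*} [DecidableEq ι] (a b : ι) (t : ι → ℂ) : mv a b 0 t = t := by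
  funext i; unfold mv; split_ifs with h1 h2 <;> simp [*]

lemma mv_prod {ι : Type*} [Fintype ι] [DecidableEq ι] {a b : ι} (hab : a ≠ b) (v : ℂ) (t : ι → ℂ) :
    ∏ i, mv a b v t i = ∏ i, t i := by
  have : ∀ f : ι → ℂ, ∏ i, f i = f a * (f b * ∏ i ∈ (Finset.univ.erase a).erase b, f i) := fun f => by
    rw [Finset.mul_prod_erase _ _ (by simp [hab.symm]), Finset.mul_prod_erase _ _ (by simp)]
  rw [this, this t]
  have e : (∏ i ∈ (Finset.univ.erase a).erase b, mv a b v t i) = ∏ i ∈ (Finset.univ.erase a).erase b, t i := by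
    refine Finset.prod_congr rfl (fun i hi => ?_)
    simp at hi
    simp [mv, hi]
  rw [e]
  simp only [mv, if_true, hab.symm, if_false]
  rw [Complex.exp_neg]
  have := Complex.exp_ne_zero v
  field_simp

lemma tpr_mv {ι : Type*} [DecidableEq ι] {p P : ℂ} (hP : Complex.exp P = p) {a b : ι} (hab : a ≠ b) (v : ℂ) (t : ι → ℂ) :
    tpr p a b (mv a b v t) = mv a b (v + P) t := by
  funext i
  have h3 : b ≠ a := hab.symm
  by_cases h1 : i = a
  · subst h1
    simp only [tpr, mv, if_true, Complex.exp_add, hP]; ring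
  · by_cases h2 : i = b
    · subst h2
      simp only [tpr, mv, h3, if_false, if_true, neg_add, Complex.exp_add, Complex.exp_neg P, hP]; ring
    · simp [tpr, mv, h1, h2]

noncomputable def cfn (p q s : ℂ) (n m : ℕ) {N : ℕ} (t : Fin N → ℂ) : ℂ :=
  DD p q n t / (PP p q t * DD p q m (fun i => s / t i))

lemma DDdual_ne {p q s : ℂ} {N m : ℕ} {δ : ℝ} (hp : ‖p‖ < 1) (hp0 : p ≠ 0) (hq0 : q ≠ 0) (hs : s ^ 2 = p * q) (hqp : ‖q‖ < ‖p‖)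
    (hpδ : ‖p‖ < δ) (hδ : ∀ (p q : ℂ) (e t : Fin N → ℂ), ‖p‖ < δ → ‖q‖ < δ →
    (∀ i, ‖e i‖ < δ) → (∀ i, ‖t i‖ < δ) → DE p q m e t ≠ 0) (t : Fin N → ℂ)
    (h1 : ∀ i, ‖s‖ < ‖p‖ * ‖t i‖) (h2 : ∀ i, ‖t i‖ < ‖p‖) : DD p q m (fun i => s / t i) ≠ 0 := by
  have hpp : 0 < ‖p‖ := norm_pos_iff.2 hp0
  have hs0 : s ≠ 0 := by rintro rfl; simp [hp0, hq0] at hs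
  have hsp : 0 < ‖s‖ := norm_pos_iff.2 hs0
  have hs' : ‖s‖ * ‖s‖ = ‖p‖ * ‖q‖ := by rw [← norm_mul, ← norm_mul, ← hs, sq]
  have hsp' : ‖s‖ < ‖p‖ := by
    by_contra h; push Not at h
    nlinarith
  have ht0 : ∀ i, 0 < ‖t i‖ := fun i => by
    by_contra h; push Not at h
    nlinarith [h1 i]
  rw [DD_eq_DE]
  refine hδ _ _ _ _ hpδ (hqp.trans hpδ) (fun i => ?_) (fun i => ?_)
  · have : t i ≠ 0 := norm_pos_iff.mp (ht0 i)
    have e : p * q / (s / t i) = s * t i := by rw [← hs]; field_simp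
    rw [e, norm_mul]; nlinarith [h2 i, ht0 i]
  · refine lt_trans ?_ hpδ
    rw [norm_div, div_lt_iff₀ (ht0 i)]; exact h1 i

lemma cfn_move {p q s : ℂ} (hp : ‖p‖ < 1) (hq : ‖q‖ < 1) (hp0 : p ≠ 0) (hq0 : q ≠ 0)
    (hs : s ^ 2 = p * q) (hqp : ‖q‖ < ‖p‖) {n m N : ℕ} (hN : N = 2 * (n + 1) + 2 * (m + 1) + 4)
    {δ : ℝ} (hpδ : ‖p‖ < δ) (hδ : ∀ (p q : ℂ) (e t : Fin N → ℂ), ‖p‖ < δ → ‖q‖ < δ →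
    (∀ i, ‖e i‖ < δ) → (∀ i, ‖t i‖ < δ) → DE p q (m+1) e t ≠ 0)
    {a b : Fin N} (hab : a ≠ b) (t : Fin N → ℂ)
    (h1 : ∀ i, ‖s‖ < ‖p‖ ^ 2 * ‖t i‖) (h2 : ∀ i, ‖t i‖ < ‖p‖ ^ 2) (hprod : ∏ i, t i = (p * q) ^ (m + 2))
    (v : ℂ) (hv : |v.re| < - Real.log ‖p‖) :
    cfn p q s (n+1) (m+1) (mv a b v t) = cfn p q s (n+1) (m+1) t := by
  have hpp : 0 < ‖p‖ := norm_pos_iff.2 hp0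
  have hs0 : s ≠ 0 := by rintro rfl; simp [hp0, hq0] at hs
  have hsp : 0 < ‖s‖ := norm_pos_iff.2 hs0
  have ht0 : ∀ i, 0 < ‖t i‖ := fun i => by
    by_contra h; push Not at h
    nlinarith [h1 i, sq_nonneg ‖p‖]
  have hexp : ∀ v : ℂ, |v.re| < - Real.log ‖p‖ → ‖p‖ < ‖Complex.exp v‖ ∧ ‖Complex.exp v‖ * ‖p‖ < 1 := by
    intro v hv
    rw [Complex.norm_exp]
    have := abs_lt.mp hv
    constructor
    · calc ‖p‖ = Real.exp (Real.log ‖p‖) := (Real.exp_log hpp).symm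
        _ < _ := Real.exp_lt_exp.mpr (by linarith)
    · calc Real.exp v.re * ‖p‖ = Real.exp (v.re + Real.log ‖p‖) := by rw [Real.exp_add, Real.exp_log hpp]
        _ < 1 := by rw [Real.exp_lt_one_iff]; linarith
  have hneg : ∀ v : ℂ, |v.re| < - Real.log ‖p‖ → |(-v).re| < - Real.log ‖p‖ := fun v hv => by simpa using hv
  have hm : ∀ v : ℂ, |v.re| < - Real.log ‖p‖ → ∀ i, ‖s‖ < ‖p‖ * ‖mv a b v t i‖ ∧ ‖mv a b v t i‖ < ‖p‖ := by
    have base : ∀ v : ℂ, |v.re| < - Real.log ‖p‖ → ∀ i, ‖s‖ < ‖p‖ * ‖t i * Complex.exp v‖ ∧ ‖t i * Complex.exp v‖ < ‖p‖ := by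
      intro v hv i
      obtain ⟨e1, e2⟩ := hexp v hv
      rw [norm_mul]
      have g1 := h1 i
      have g2 := h2 i
      have g0 := ht0 i
      constructor
      · have : ‖t i‖ * ‖p‖ < ‖t i‖ * ‖Complex.exp v‖ := by gcongr
        nlinarith
      · have : ‖t i‖ * ‖Complex.exp v‖ < ‖p‖ ^ 2 * ‖Complex.exp v‖ := by
          have : 0 < ‖Complex.exp v‖ := hpp.trans e1
          gcongr
        nlinarith
    intro v hv i
    unfold mv
    split_ifs
    · exact base v hv a
    · exact base (-v) (hneg v hv) b
    · have := base 0 (by have := abs_nonneg v.re; simp; linarith) i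
      simpa using this
  have hmn0 : ∀ v : ℂ, |v.re| < - Real.log ‖p‖ → ∀ i, mv a b v t i ≠ 0 := fun v hv i h => by
    have := (hm v hv i).1; rw [h] at this; simp at this; linarith
  have hm1 : ∀ v : ℂ, |v.re| < - Real.log ‖p‖ → ∀ i, ‖mv a b v t i‖ < 1 := fun v hv i => (hm v hv i).2.trans hp
  have hms : ∀ v : ℂ, |v.re| < - Real.log ‖p‖ → ∀ i, ‖s‖ < ‖mv a b v t i‖ := fun v hv i => by
    nlinarith [(hm v hv i).1, norm_nonneg (mv a b v t i)]
  have hPP : ∀ v : ℂ, |v.re| < - Real.log ‖p‖ → PP p q (mv a b v t) ≠ 0 := fun v hv =>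
    PP_ne_zero hp hq hs (hms v hv) (hm1 v hv)
  have hDD : ∀ v : ℂ, |v.re| < - Real.log ‖p‖ → DD p q (m+1) (fun i => s / mv a b v t i) ≠ 0 := fun v hv =>
    DDdual_ne hp hp0 hq0 hs hqp hpδ hδ _ (fun i => (hm v hv i).1) (fun i => (hm v hv i).2)
  have hP : Complex.exp (Complex.log p) = p := Complex.exp_log hp0
  have hl : 0 < - Real.log ‖p‖ := by have := Real.log_neg hpp hp; linarith
  have han : ∀ i (v : ℂ), AnalyticAt ℂ (fun v => mv a b v t i) v := by
    intro i v
    unfold mv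
    split_ifs <;> fun_prop
  have hopen : IsOpen {v : ℂ | |v.re| < - Real.log ‖p‖} := isOpen_lt (by fun_prop) continuous_const
  have key := const_of_periodic (f := fun v => cfn p q s (n+1) (m+1) (mv a b v t)) (P := Complex.log p) hl
    (by rw [Complex.log_re, neg_neg]) ?_ ?_ ?_ v hv
  · simpa only [mv_zero] using key
  · unfold cfn
    refine DifferentiableOn.div ?_ (DifferentiableOn.mul ?_ ?_) (fun v hv => mul_ne_zero (hPP v hv) (hDD v hv))
    · exact DD_differentiableOn (p := fun _ => p) (q := fun _ => q) (t := fun i v => mv a b v t i) hopen (fun _ _ => analyticAt_const) (fun _ _ => hp)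
        (fun _ _ => analyticAt_const) (fun _ _ => hq) (fun v _ i => han i v) hm1 hmn0
    · intro v hv
      exact (PP_analyticAt (p := fun _ => p) (q := fun _ => q) (t := fun i v => mv a b v t i) analyticAt_const hp analyticAt_const hq (fun i => han i v)
        (hmn0 v hv) (hm1 v hv)).differentiableAt.differentiableWithinAt
    · refine DD_differentiableOn (p := fun _ => p) (q := fun _ => q) (t := fun i v => s / mv a b v t i) hopen (fun _ _ => analyticAt_const) (fun _ _ => hp)
        (fun _ _ => analyticAt_const) (fun _ _ => hq) (fun v hv i => analyticAt_const.div (han i v) (hmn0 v hv i)) (fun v hv i => ?_)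
        (fun v hv i => div_ne_zero hs0 (hmn0 v hv i))
      rw [norm_div, div_lt_one (norm_pos_iff.mpr (hmn0 v hv i))]
      exact hms v hv i
  · intro v hv hv'
    have H := swap_pair hp hq hp0 hq0 hs hqp hN hab (mv a b v t) (fun i => (hm v hv i).1) (fun i => (hm v hv i).2)
      (by rw [mv_prod hab]; exact hprod)
    rw [tpr_mv hP hab] at H
    simp only [cfn]
    rw [div_eq_div_iff (mul_ne_zero (hPP _ hv') (hDD _ hv')) (mul_ne_zero (hPP _ hv) (hDD _ hv))]
    linear_combination H
  · intro v hv
    have : mv a b (v + 2 * Real.pi * Complex.I) t = mv a b v t := by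
      funext i
      unfold mv
      rw [neg_add, Complex.exp_add, Complex.exp_add, Complex.exp_neg (2 * Real.pi * Complex.I), Complex.exp_two_pi_mul_I]
      simp
    simp only [this]

end Rains

namespace Rains
open Filter Topology Set

lemma cfn_local {p q s : ℂ} (hp : ‖p‖ < 1) (hq : ‖q‖ < 1) (hp0 : p ≠ 0) (hq0 : q ≠ 0)
    (hs : s ^ 2 = p * q) (hqp : ‖q‖ < ‖p‖) {n m N : ℕ} (hN : N = 2 * (n + 1) + 2 * (m + 1) + 4)
    {δ : ℝ} (hpδ : ‖p‖ < δ) (hδ : ∀ (p q : ℂ) (e t : Fin N → ℂ), ‖p‖ < δ → ‖q‖ < δ →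
    (∀ i, ‖e i‖ < δ) → (∀ i, ‖t i‖ < δ) → DE p q (m+1) e t ≠ 0)
    (τ : ℂ) (h1 : ‖s‖ < ‖p‖ ^ 2 * ‖τ‖) (h2 : ‖τ‖ < ‖p‖ ^ 2) (hprod : τ ^ N = (p * q) ^ (m + 2)) :
    ∃ η : ℝ, 0 < η ∧ ∀ w : Fin N → ℂ, ∑ i, w i = 0 → (∀ i, ‖w i‖ < η) →
      cfn p q s (n+1) (m+1) (fun i => τ * Complex.exp (w i)) = cfn p q s (n+1) (m+1) (fun _ : Fin N => τ) := by
  have hpp : 0 < ‖p‖ := norm_pos_iff.2 hp0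
  have hl : 0 < - Real.log ‖p‖ := by have := Real.log_neg hpp hp; linarith
  obtain ⟨ρ, hρ0, hρ1, hρ2, hρ3⟩ : ∃ ρ : ℝ, 0 < ρ ∧ ρ < - Real.log ‖p‖ ∧ ‖s‖ < ‖p‖ ^ 2 * (‖τ‖ * Real.exp (-ρ)) ∧
      ‖τ‖ * Real.exp ρ < ‖p‖ ^ 2 := by
    have e1 : ∀ᶠ ρ : ℝ in 𝓝 0, ρ < - Real.log ‖p‖ := eventually_lt_nhds hl
    have e2 : ∀ᶠ ρ : ℝ in 𝓝 0, ‖s‖ < ‖p‖ ^ 2 * (‖τ‖ * Real.exp (-ρ)) := by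
      have : ContinuousAt (fun ρ : ℝ => ‖p‖ ^ 2 * (‖τ‖ * Real.exp (-ρ))) 0 := by fun_prop
      exact this.eventually (lt_mem_nhds (by simpa using h1))
    have e3 : ∀ᶠ ρ : ℝ in 𝓝 0, ‖τ‖ * Real.exp ρ < ‖p‖ ^ 2 := by
      have : ContinuousAt (fun ρ : ℝ => ‖τ‖ * Real.exp ρ) 0 := by fun_prop
      exact this.eventually (gt_mem_nhds (by simpa using h2))
    obtain ⟨ρ, ⟨⟨h1, h2⟩, h3⟩, h0⟩ := (((((e1.and e2).and e3).filter_mono nhdsWithin_le_nhds).and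
      (self_mem_nhdsWithin : Ioi (0:ℝ) ∈ 𝓝[>] 0))).exists
    exact ⟨ρ, h0, h1, h2, h3⟩
  have hN0 : 0 < N := by omega
  have hNr : (0:ℝ) < N := by exact_mod_cast hN0
  refine ⟨ρ / N, by positivity, fun w hw hwη => ?_⟩
  obtain ⟨z0⟩ : Nonempty (Fin N) := ⟨⟨0, hN0⟩⟩
  let W : Finset (Fin N) → Fin N → ℂ := fun S i => if i = z0 then - ∑ j ∈ S, w j else if i ∈ S then w i else 0
  have hre : ∀ S i, |(W S i).re| ≤ ρ := by
    have hw1 : ∀ i, ‖w i‖ ≤ ρ := fun i => (hwη i).le.trans (div_le_self hρ0.le (by exact_mod_cast hN0))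
    intro S i
    refine (Complex.abs_re_le_norm _).trans ?_
    simp only [W]
    split_ifs
    · rw [norm_neg]
      refine (norm_sum_le _ _).trans ((Finset.sum_le_sum (fun j _ => (hwη j).le)).trans ?_)
      rw [Finset.sum_const, nsmul_eq_mul]
      have : (S.card : ℝ) ≤ N := by exact_mod_cast (card_finset_fin_le S)
      calc (S.card : ℝ) * (ρ / N) ≤ N * (ρ / N) := by gcongr
        _ = ρ := by field_simp
    · exact hw1 i
    · simpa using hρ0.le
  have key : ∀ S : Finset (Fin N), z0 ∉ S → cfn p q s (n+1) (m+1) (fun i => τ * Complex.exp (W S i)) =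
      cfn p q s (n+1) (m+1) (fun _ : Fin N => τ) ∧ ∏ i, (τ * Complex.exp (W S i)) = (p * q) ^ (m + 2) := by
    intro S
    induction S using Finset.induction_on with
    | empty => intro _; simp [W, hprod]
    | insert a S ha ih =>
      intro hz
      have hz' : z0 ∉ S := fun h => hz (Finset.mem_insert_of_mem h)
      have haz : a ≠ z0 := fun h => hz (h ▸ Finset.mem_insert_self _ _)
      obtain ⟨i1, i2⟩ := ih hz'
      have e : (fun i => τ * Complex.exp (W (insert a S) i)) = mv a z0 (w a) (fun i => τ * Complex.exp (W S i)) := by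
        funext i
        unfold mv
        by_cases hia : i = a
        · subst hia
          simp [W, haz, ha]
        · by_cases hiz : i = z0
          · subst hiz
            simp only [W, haz.symm, if_true, if_false, Finset.sum_insert ha, neg_add, Complex.exp_add]
            ring
          · simp [W, hia, hiz]
      rw [e]
      refine ⟨?_, by rw [mv_prod haz]; exact i2⟩
      rw [← i1]
      refine cfn_move hp hq hp0 hq0 hs hqp hN hpδ hδ haz _ (fun i => ?_) (fun i => ?_) i2 _ ?_
      · rw [norm_mul, Complex.norm_exp]
        refine hρ2.trans_le ?_
        have := (abs_le.mp (hre S i)).1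
        gcongr
      · rw [norm_mul, Complex.norm_exp]
        refine lt_of_le_of_lt ?_ hρ3
        have := (abs_le.mp (hre S i)).2
        gcongr
      · refine lt_of_le_of_lt ?_ hρ1
        exact (Complex.abs_re_le_norm _).trans ((hwη a).le.trans (div_le_self hρ0.le (by exact_mod_cast hN0)))
  have := (key (Finset.univ.erase z0) (by simp)).1
  rw [← this]
  congr 1
  funext i
  congr 2
  by_cases hi : i = z0
  · subst hi
    simp only [W, if_true]
    rw [← Finset.add_sum_erase _ _ (Finset.mem_univ i)] at hw
    linear_combination hw
  · simp [W, hi]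

lemma exists_logs {N : ℕ} (hN : 0 < N) {τ : ℂ} (hτ : τ ≠ 0) {t : Fin N → ℂ} (ht : ∀ i, t i ≠ 0) (h : ∏ i, t i = τ ^ N) :
    ∃ w : Fin N → ℂ, ∑ i, w i = 0 ∧ ∀ i, τ * Complex.exp (w i) = t i := by
  have h1 : Complex.exp (∑ i, Complex.log (t i / τ)) = 1 := by
    rw [Complex.exp_sum]
    rw [Finset.prod_congr rfl (fun i _ => Complex.exp_log (div_ne_zero (ht i) hτ)), Finset.prod_div_distrib, h]
    simp [hτ]
  obtain ⟨k, hk⟩ := Complex.exp_eq_one_iff.mp h1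
  let z0 : Fin N := ⟨0, hN⟩
  refine ⟨fun i => Complex.log (t i / τ) - if i = z0 then k * (2 * Real.pi * Complex.I) else 0, ?_, fun i => ?_⟩
  · rw [Finset.sum_sub_distrib, hk]; simp
  · have : Complex.exp (if i = z0 then k * (2 * Real.pi * Complex.I) else 0) = 1 := by
      split_ifs
      · exact Complex.exp_int_mul_two_pi_mul_I k
      · simp
    rw [Complex.exp_sub, this, Complex.exp_log (div_ne_zero (ht i) hτ)]
    field_simp

lemma DD_const {p q s : ℂ} (hp : ‖p‖ < 1) (hq : ‖q‖ < 1) (hp0 : p ≠ 0) (hq0 : q ≠ 0)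
    (hs : s ^ 2 = p * q) (hqp : ‖q‖ < ‖p‖) {n m N : ℕ} (hN : N = 2 * (n + 1) + 2 * (m + 1) + 4)
    {δ : ℝ} (hpδ : ‖p‖ < δ) (hδ : ∀ (p q : ℂ) (e t : Fin N → ℂ), ‖p‖ < δ → ‖q‖ < δ →
    (∀ i, ‖e i‖ < δ) → (∀ i, ‖t i‖ < δ) → DE p q (m+1) e t ≠ 0)
    (τ : ℂ) (h1 : ‖s‖ < ‖p‖ ^ 2 * ‖τ‖) (h2 : ‖τ‖ < ‖p‖ ^ 2) (hprod : τ ^ N = (p * q) ^ (m + 2)) :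
    ∃ c : ℂ, ∀ t : Fin N → ℂ, (∀ i, ‖s‖ < ‖t i‖) → (∀ i, ‖t i‖ < 1) → ∏ i, t i = (p * q) ^ (m + 2) →
      DD p q (n+1) t = c * PP p q t * DD p q (m+1) (fun i => s / t i) := by
  obtain ⟨η, hη, H⟩ := cfn_local hp hq hp0 hq0 hs hqp hN hpδ hδ τ h1 h2 hprod
  refine ⟨cfn p q s (n+1) (m+1) (fun _ : Fin N => τ), fun t ht1 ht2 htp => ?_⟩
  have hpp : 0 < ‖p‖ := norm_pos_iff.2 hp0
  have hs0 : s ≠ 0 := by rintro rfl; simp [hp0, hq0] at hs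
  have hsp : 0 < ‖s‖ := norm_pos_iff.2 hs0
  have hτ0 : τ ≠ 0 := by rintro rfl; simp at h1; linarith
  have hτp : 0 < ‖τ‖ := norm_pos_iff.2 hτ0
  have ht0 : ∀ i, t i ≠ 0 := fun i h => by have := ht1 i; rw [h, norm_zero] at this; linarith
  obtain ⟨w, hw, hwt⟩ := exists_logs (by omega) hτ0 ht0 (htp.trans hprod.symm)
  set c := cfn p q s (n+1) (m+1) (fun _ : Fin N => τ)
  let T : Fin N → ℂ → ℂ := fun i x => τ * Complex.exp (x * w i)
  have hT0 : ∀ i x, T i x ≠ 0 := fun i x => mul_ne_zero hτ0 (Complex.exp_ne_zero _)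
  have hTa : ∀ i x, AnalyticAt ℂ (T i) x := fun i x => by
    show AnalyticAt ℂ (fun x => τ * Complex.exp (x * w i)) x
    fun_prop
  let A : Fin N ⊕ Fin N → ℂ := Sum.elim (fun _ => Complex.log τ) (fun _ => Complex.log s - Complex.log τ)
  let B : Fin N ⊕ Fin N → ℂ := Sum.elim (fun i => w i) (fun i => - w i)
  have hlogT : ∀ i x, ‖T i x‖ = Real.exp (Complex.log τ + x * w i).re := by
    intro i x
    rw [← Complex.norm_exp, Complex.exp_add, Complex.exp_log hτ0]
  have hlogS : ∀ i x, ‖s / T i x‖ = Real.exp (Complex.log s - Complex.log τ + x * (- w i)).re := by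
    intro i x
    have : Complex.log s - Complex.log τ + x * (- w i) = Complex.log s - (Complex.log τ + x * w i) := by ring
    rw [← Complex.norm_exp, this, Complex.exp_sub, Complex.exp_add, Complex.exp_log hτ0, Complex.exp_log hs0]
  have hS1 : ∀ x ∈ {x : ℂ | ∀ k, (A k + x * B k).re < 0}, ∀ i, ‖T i x‖ < 1 := fun x hx i => by
    rw [hlogT, Real.exp_lt_one_iff]; exact hx (Sum.inl i)
  have hS2 : ∀ x ∈ {x : ℂ | ∀ k, (A k + x * B k).re < 0}, ∀ i, ‖s / T i x‖ < 1 := fun x hx i => by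
    rw [hlogS, Real.exp_lt_one_iff]; exact hx (Sum.inr i)
  have hopen : IsOpen {x : ℂ | ∀ k, (A k + x * B k).re < 0} := by
    simp only [Set.ofPred_forall]
    exact isOpen_iInter_of_finite (fun k => isOpen_lt (by fun_prop) continuous_const)
  have hT1 : ∀ i, T i 1 = t i := fun i => by simp only [T, one_mul, hwt]
  have hTz : ∀ i, T i 0 = τ := fun i => by simp [T]
  have hpq1 : ‖p‖ ^ 2 < ‖p‖ := by nlinarith
  have hsτ' : ‖s‖ < ‖p‖ * ‖τ‖ := h1.trans (by gcongr)
  have hsτ : ‖s‖ < ‖τ‖ := by nlinarith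
  have hτ1 : ‖τ‖ < 1 := by nlinarith
  have := line_lemma (f := fun x => DD p q (n+1) (fun i => T i x) - c * PP p q (fun i => T i x) * DD p q (m+1) (fun i => s / T i x))
    A B ?_ ?_ ?_ ?_
  · simp only [hT1] at this
    linear_combination this
  · rintro (i | i)
    · have := hlogT i 0
      rw [hTz] at this; simp only [zero_mul, add_zero] at this
      rw [← Real.exp_lt_one_iff]; simp only [A, Sum.elim_inl]; rw [← this]; exact hτ1
    · have := hlogS i 0
      rw [hTz] at this; simp only [zero_mul, add_zero] at this
      rw [← Real.exp_lt_one_iff]; simp only [A, Sum.elim_inr]; rw [← this, norm_div, div_lt_one hτp]; exact hsτ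
  · rintro (i | i)
    · have := hlogT i 1
      rw [hT1] at this; simp only [one_mul] at this
      rw [← Real.exp_lt_one_iff]; simp only [A, B, Sum.elim_inl]; rw [← this]; exact ht2 i
    · have := hlogS i 1
      rw [hT1] at this; simp only [one_mul] at this
      rw [← Real.exp_lt_one_iff]; simp only [A, B, Sum.elim_inr]; rw [← this, norm_div, div_lt_one (norm_pos_iff.2 (ht0 i))]; exact ht1 i
  · refine DifferentiableOn.sub ?_ (DifferentiableOn.mul (DifferentiableOn.mul (differentiableOn_const _) ?_) ?_)
    · exact DD_differentiableOn (p := fun _ => p) (q := fun _ => q) (t := T) hopen (fun _ _ => analyticAt_const) (fun _ _ => hp)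
        (fun _ _ => analyticAt_const) (fun _ _ => hq) (fun v _ i => hTa i v) hS1 (fun x _ i => hT0 i x)
    · intro v hv
      exact (PP_analyticAt (p := fun _ => p) (q := fun _ => q) (t := T) analyticAt_const hp analyticAt_const hq (fun i => hTa i v)
        (fun i => hT0 i v) (hS1 v hv)).differentiableAt.differentiableWithinAt
    · exact DD_differentiableOn (p := fun _ => p) (q := fun _ => q) (t := fun i v => s / T i v) hopen (fun _ _ => analyticAt_const) (fun _ _ => hp)
        (fun _ _ => analyticAt_const) (fun _ _ => hq) (fun v hv i => analyticAt_const.div (hTa i v) (hT0 i v)) hS2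
        (fun v hv i => div_ne_zero hs0 (hT0 i v))
  · have hev : ∀ᶠ x : ℂ in 𝓝 0, ∀ i, ‖x * w i‖ < η := by
      rw [Filter.eventually_all]
      intro i
      have : ContinuousAt (fun x : ℂ => ‖x * w i‖) 0 := by fun_prop
      exact this.eventually (gt_mem_nhds (by simpa using hη))
    have hev2 : ∀ᶠ x : ℂ in 𝓝 0, ∀ i, ‖T i x‖ < ‖p‖ ∧ ‖s‖ < ‖p‖ * ‖T i x‖ := by
      rw [Filter.eventually_all]
      intro i
      have hc : ContinuousAt (fun x : ℂ => ‖T i x‖) 0 := (hTa i 0).continuousAt.norm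
      have hc2 : ContinuousAt (fun x : ℂ => ‖p‖ * ‖T i x‖) 0 := hc.const_mul _
      refine (hc.eventually (gt_mem_nhds ?_)).and (hc2.eventually (lt_mem_nhds ?_))
      · simp only [hTz]; linarith
      · simp only [hTz]; exact hsτ'
    filter_upwards [hev, hev2] with x hx hx2
    have e := H (fun i => x * w i) (by rw [← Finset.mul_sum, hw, mul_zero]) hx
    have d1 := DDdual_ne hp hp0 hq0 hs hqp hpδ hδ (fun i => T i x) (fun i => (hx2 i).2) (fun i => (hx2 i).1)
    have d2 : PP p q (fun i => T i x) ≠ 0 := PP_ne_zero hp hq hs (fun i => by nlinarith [(hx2 i).2, norm_nonneg (T i x)]) (fun i => (hx2 i).1.trans hp)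
    have e' : cfn p q s (n+1) (m+1) (fun i => T i x) = c := e
    rw [← e', cfn]
    field_simp
    ring

end Rains

namespace Rains
open Filter Topology Set

lemma circleInt_add {f g : ℂ → ℂ} (hf : ContinuousOn f {z | ‖z‖ = 1}) (hg : ContinuousOn g {z | ‖z‖ = 1}) :
    circleInt (fun z => f z + g z) = circleInt f + circleInt g := by
  have := circleInt_sum (Finset.univ : Finset Bool) (fun _ => 1) (fun b => cond b f g) (by rintro (_|_) _ <;> assumption)
  simpa using this

lemma circleInt_sub {f g : ℂ → ℂ} (hf : ContinuousOn f {z | ‖z‖ = 1}) (hg : ContinuousOn g {z | ‖z‖ = 1}) :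
    circleInt (fun z => f z - g z) = circleInt f - circleInt g := by
  have := circleInt_sum (Finset.univ : Finset Bool) (fun b => cond b 1 (-1)) (fun b => cond b f g) (by rintro (_|_) _ <;> assumption)
  simpa [sub_eq_add_neg] using this

def Ann (r0 : ℝ) : Set ℂ := {z | r0 < ‖z‖ ∧ ‖z‖ < r0⁻¹}

structure Reg (r0 ρ0 : ℝ) (R : ℝ → ℂ → ℂ) : Prop where
  an : ∀ ρ ∈ Ioc ρ0 1, ∀ z ∈ Ann r0, AnalyticAt ℂ (R ρ) z
  co : ∀ ρ ∈ Ioc ρ0 1, ∀ z ∈ Ann r0, ContinuousAt (fun x : ℝ × ℂ => R x.1 x.2) (ρ, z)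
  sy : ∀ ρ ∈ Ioc ρ0 1, ∀ z, ‖z‖ = 1 → R ρ z⁻¹ = R ρ z

lemma Reg.mul {r0 ρ0 : ℝ} {R R' : ℝ → ℂ → ℂ} (h : Reg r0 ρ0 R) (h' : Reg r0 ρ0 R') : Reg r0 ρ0 (fun ρ z => R ρ z * R' ρ z) :=
  ⟨fun ρ hρ z hz => (h.an ρ hρ z hz).mul (h'.an ρ hρ z hz), fun ρ hρ z hz => (h.co ρ hρ z hz).mul (h'.co ρ hρ z hz),
    fun ρ hρ z hz => by rw [h.sy ρ hρ z hz, h'.sy ρ hρ z hz]⟩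

lemma Reg.prod {r0 ρ0 : ℝ} {κ : Type*} (s : Finset κ) {R : κ → ℝ → ℂ → ℂ} (h : ∀ i ∈ s, Reg r0 ρ0 (R i)) : Reg r0 ρ0 (fun ρ z => ∏ i ∈ s, R i ρ z) :=
  ⟨fun ρ hρ z hz => Finset.analyticAt_fun_prod _ (fun i hi => (h i hi).an ρ hρ z hz),
    fun ρ hρ z hz => tendsto_finsetProd _ (fun i hi => (h i hi).co ρ hρ z hz),
    fun ρ hρ z hz => Finset.prod_congr rfl (fun i hi => (h i hi).sy ρ hρ z hz)⟩

lemma circle_sub_Ann {r0 : ℝ} (h0 : 0 < r0) (h1 : r0 < 1) {z : ℂ} (hz : ‖z‖ = 1) : z ∈ Ann r0 := by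
  refine ⟨by rw [hz]; exact h1, by rw [hz]; exact (one_lt_inv₀ h0).mpr h1⟩

lemma one_sub_ne {a w : ℂ} (h : ‖a‖ * ‖w‖ < 1) : 1 - a * w ≠ 0 := by
  intro e
  have : a * w = 1 := by linear_combination -e
  rw [← norm_mul, this, norm_one] at h
  exact lt_irrefl _ h

lemma ker_eq {r0 r : ℝ} (h0 : 0 < r0) (hr : r0 < r) (hr1 : r < 1) {F : ℂ → ℂ} (hF : ∀ z ∈ Ann r0, AnalyticAt ℂ F z)
    (hsy : ∀ z, ‖z‖ = 1 → F z⁻¹ = F z) {a : ℂ} (ha : ‖a‖ < 1) (k : ℕ) :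
    (1 - a ^ 2) * circleInt (fun z => F z / ((1 - a * z ^ k) * (1 - a * z⁻¹ ^ k))) =
    2 * av r (fun z => F z / (1 - a * z ^ k)) - circleInt F := by
  have h01 : r0 < 1 := hr.trans hr1
  have hC : ∀ z : ℂ, ‖z‖ = 1 → AnalyticAt ℂ F z := fun z hz => hF z (circle_sub_Ann h0 h01 hz)
  have hne : ∀ z : ℂ, ‖z‖ ≤ 1 → 1 - a * z ^ k ≠ 0 := fun z hz => by
    refine one_sub_ne ?_
    rw [norm_pow]
    have : ‖z‖ ^ k ≤ 1 := pow_le_one₀ (norm_nonneg _) hz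
    nlinarith [norm_nonneg a]
  have hne' : ∀ z : ℂ, ‖z‖ = 1 → 1 - a * z⁻¹ ^ k ≠ 0 := fun z hz => hne _ (by rw [norm_inv, hz]; simp)
  have c1 : ContinuousOn (fun z => F z / (1 - a * z ^ k)) {z | ‖z‖ = 1} := fun z hz =>
    ((hC z hz).continuousAt.div (by fun_prop) (hne z (le_of_eq hz))).continuousWithinAt
  have c2 : ContinuousOn (fun z => F z / (1 - a * z⁻¹ ^ k)) {z | ‖z‖ = 1} := fun z hz => by
    have hz0 := ne_zero_of_norm_one hz
    exact ((hC z hz).continuousAt.div (by fun_prop (disch := assumption)) (hne' z hz)).continuousWithinAt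
  have c3 : ContinuousOn F {z | ‖z‖ = 1} := fun z hz => (hC z hz).continuousAt.continuousWithinAt
  have e1 : circleInt (fun z => F z / (1 - a * z⁻¹ ^ k)) = circleInt (fun z => F z / (1 - a * z ^ k)) := by
    rw [← circleInt_inv (fun z => F z / (1 - a * z ^ k))]
    refine circleInt_congr (fun z hz => ?_)
    rw [hsy z hz]
  have e2 : circleInt (fun z => F z / (1 - a * z ^ k)) = av r (fun z => F z / (1 - a * z ^ k)) := by
    rw [circleInt_eq_av]
    refine av_eq_av (h0.trans hr) hr1.le (fun z h1 h2 => ?_)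
    refine ((hF z ⟨hr.trans_le h1, h2.trans_lt ((one_lt_inv₀ h0).mpr h01)⟩).differentiableAt).div (by fun_prop) (hne z h2)
  rw [circleInt_eq_av (fun z => F z / ((1 - a * z ^ k) * (1 - a * z⁻¹ ^ k))), ← av_const_mul 1 (1 - a^2), ← e2]
  change circleInt _ = _
  calc _ = circleInt (fun z => (F z / (1 - a * z ^ k) + F z / (1 - a * z⁻¹ ^ k)) - F z) := by
        refine circleInt_congr (fun z hz => ?_)
        have h1 := hne z hz.le
        have h2 := hne' z hz
        have hz0 := ne_zero_of_norm_one hz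
        have h3 : z ^ k * z⁻¹ ^ k = 1 := by rw [← mul_pow, mul_inv_cancel₀ hz0, one_pow]
        generalize z ^ k = u at *
        generalize z⁻¹ ^ k = v at *
        field_simp
        linear_combination (a^2 * F z) * h3
    _ = _ := by
      have c12 : ContinuousOn (fun z => F z / (1 - a * z ^ k) + F z / (1 - a * z⁻¹ ^ k)) {z | ‖z‖ = 1} := c1.add c2
      rw [circleInt_sub c12 c3, circleInt_add c1 c2, e1]
      ring

lemma ker_lim {r0 r ρ0 : ℝ} (h0 : 0 < r0) (hr : r0 < r) (hr1 : r < 1) (hρ : ρ0 < 1) {R : ℝ → ℂ → ℂ} (hR : Reg r0 ρ0 R) {a : ℝ → ℂ}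
    (ha : Continuous a) (ha1 : ∀ ρ ∈ Ioo ρ0 1, ‖a ρ‖ < 1) (haa : ‖a 1‖ ≤ 1) {k : ℕ} (hk : k ≠ 0) :
    Tendsto (fun ρ => (1 - a ρ ^ 2) * circleInt (fun z => R ρ z / ((1 - a ρ * z ^ k) * (1 - a ρ * z⁻¹ ^ k)))) (𝓝[<] 1)
    (𝓝 (2 * av r (fun z => R 1 z / (1 - a 1 * z ^ k)) - circleInt (R 1))) := by
  have h01 : r0 < 1 := hr.trans hr1
  have hrp : 0 < r := h0.trans hr
  have hav : ∀ f, av r f = circleInt (fun z => f ((r:ℂ) * z)) := fun f => by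
    have := av_mul_left one_pos (c := (r:ℂ)) (by exact_mod_cast hrp.ne') f
    rw [circleInt_eq_av, this]; congr 1; simp [abs_of_pos hrp]
  have ha2 : ∀ ρ ∈ Ioc ρ0 1, ‖a ρ‖ ≤ 1 := fun ρ hρ => by
    rcases eq_or_lt_of_le hρ.2 with h | h
    · rw [h]; exact haa
    · exact (ha1 ρ ⟨hρ.1, h⟩).le
  have hcont : ContinuousOn (fun ρ => 2 * av r (fun z => R ρ z / (1 - a ρ * z ^ k)) - circleInt (R ρ)) (Ioc ρ0 1) := by
    refine ContinuousOn.sub (continuousOn_const.mul ?_) ?_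
    · simp only [hav]
      refine circleInt_continuousOn (fun x hx => ContinuousAt.continuousWithinAt ?_)
      obtain ⟨h1, h2⟩ := hx
      have h2 : ‖x.2‖ = 1 := h2
      have hn : ‖(r:ℂ) * x.2‖ = r := by rw [norm_mul, h2]; simp [abs_of_pos hrp]
      refine ContinuousAt.div ?_ ?_ ?_
      · have hc := hR.co x.1 h1 ((r:ℂ) * x.2) ⟨by rw [hn]; exact hr, by rw [hn]; exact hr1.trans ((one_lt_inv₀ h0).mpr h01)⟩
        exact ContinuousAt.comp (f := fun x : ℝ × ℂ => (x.1, (r:ℂ) * x.2)) (x := x) hc (by fun_prop)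
      · fun_prop
      · refine one_sub_ne ?_
        rw [norm_pow, hn]
        have : r ^ k < 1 := pow_lt_one₀ hrp.le hr1 hk
        have := ha2 _ h1
        nlinarith [pow_pos hrp k]
    · refine circleInt_continuousOn (fun x hx => ContinuousAt.continuousWithinAt ?_)
      exact hR.co x.1 hx.1 x.2 (circle_sub_Ann h0 h01 hx.2)
  have hlim := (hcont 1 ⟨hρ, le_rfl⟩).tendsto
  have hlim2 := hlim.mono_left (nhdsWithin_mono 1 (Ioo_subset_Ioc_self : Ioo ρ0 1 ⊆ Ioc ρ0 1))
  rw [nhdsWithin_Ioo_eq_nhdsLT hρ] at hlim2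
  refine hlim2.congr' ?_
  filter_upwards [Ioo_mem_nhdsLT hρ] with ρ hρ'
  rw [ker_eq h0 hr hr1 (hR.an ρ ⟨hρ'.1, hρ'.2.le⟩) (hR.sy ρ ⟨hρ'.1, hρ'.2.le⟩) (ha1 ρ hρ')]

lemma res_eq {r0 r : ℝ} (h0 : 0 < r0) (hr : r0 < r) (hr1 : r < 1) {F : ℂ → ℂ} (hF : ∀ z ∈ Ann r0, AnalyticAt ℂ F z)
    (hsy : ∀ z, ‖z‖ = 1 → F z⁻¹ = F z) :
    2 * av r (fun z => F z / (1 - (-1) * z ^ 2)) - circleInt F = F Complex.I := by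
  have h01 : r0 < 1 := hr.trans hr1
  have hrp : 0 < r := h0.trans hr
  have hopen : IsOpen (Ann r0) := (isOpen_lt continuous_const continuous_norm).inter (isOpen_lt continuous_norm continuous_const)
  have hFd : DifferentiableOn ℂ F (Ann r0) := fun z hz => (hF z hz).differentiableAt.differentiableWithinAt
  have hI : Complex.I ∈ Ann r0 := circle_sub_Ann h0 h01 (by simp)
  have hI' : -Complex.I ∈ Ann r0 := circle_sub_Ann h0 h01 (by simp)
  let g := dslope F Complex.I
  let h := dslope g (-Complex.I)
  have hg : DifferentiableOn ℂ g (Ann r0) := (Complex.differentiableOn_dslope (hopen.mem_nhds hI)).mpr hFd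
  have hh : DifferentiableOn ℂ h (Ann r0) := (Complex.differentiableOn_dslope (hopen.mem_nhds hI')).mpr hg
  have hFI : F (-Complex.I) = F Complex.I := by
    have := hsy Complex.I (by simp); rw [Complex.inv_I] at this; exact this
  have hgI : g (-Complex.I) = 0 := by
    have : -Complex.I ≠ Complex.I := by
      intro e; have := congrArg Complex.im e; norm_num at this
    simp only [g]
    rw [dslope_of_ne _ this, slope_def_field, hFI, sub_self, zero_div]
  have key : ∀ z, F z = F Complex.I + (1 + z ^ 2) * h z := by
    intro z
    have e1 := sub_smul_dslope F Complex.I z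
    have e2 := sub_smul_dslope g (-Complex.I) z
    simp only [smul_eq_mul] at e1 e2
    rw [hgI] at e2
    have e3 : (z + Complex.I) * h z = g z := by linear_combination e2
    have e4 : (z - Complex.I) * g z = F z - F Complex.I := e1
    have hII : Complex.I ^ 2 = -1 := Complex.I_sq
    linear_combination (-1) * e4 - (z - Complex.I) * e3 - hII * h z
  have hFe : circleInt F = circleInt (fun z => F Complex.I + (1 + z ^ 2) * h z) := circleInt_congr (fun z _ => key z)
  have hconst : ∀ c, circleInt (fun _ => c) = c := by
    intro c
    rw [circleInt_eq_av, av_eq one_ne_zero]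
    simp [Real.pi_ne_zero, mul_assoc]
  have hhc : ContinuousOn h {z | ‖z‖ = 1} := hh.continuousOn.mono (fun z hz => circle_sub_Ann h0 h01 hz)
  have havr : av r (fun z => F z / (1 - (-1) * z ^ 2)) = F Complex.I + circleInt h := by
    have hne : ∀ z : ℂ, ‖z‖ ≤ r → 1 - (-1) * z ^ 2 ≠ 0 := fun z hz => by
      refine one_sub_ne ?_
      rw [norm_pow]; simp
      exact hz.trans_lt hr1
    have e1 : av r (fun z => F z / (1 - (-1) * z ^ 2)) = av r (fun z => F Complex.I * (1 / (1 - (-1) * z ^ 2)) + h z) := by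
      refine av_congr hrp (fun z hz => ?_)
      have := hne z hz.le
      rw [key z, add_div, mul_one_div]
      congr 1
      rw [div_eq_iff this]; ring
    have hav : ∀ f, av r f = circleInt (fun z => f ((r:ℂ) * z)) := fun f => by
      have := av_mul_left one_pos (c := (r:ℂ)) (by exact_mod_cast hrp.ne') f
      rw [circleInt_eq_av, this]; congr 1; simp [abs_of_pos hrp]
    have hn : ∀ z : ℂ, ‖z‖ = 1 → ‖(r:ℂ) * z‖ = r := fun z hz => by rw [norm_mul, hz]; simp [abs_of_pos hrp]
    rw [e1, hav, circleInt_add]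
    · congr 1
      · rw [circleInt_eq_av, av_const_mul]
        have : av 1 (fun z => 1 / (1 - (-1) * ((r:ℂ) * z) ^ 2)) = 1 := by
          have := Complex.circleIntegral_sub_inv_smul_of_differentiable_on_off_countable (s := ∅) (R := 1) (c := 0) (w := 0)
            (f := fun z : ℂ => 1 / (1 - (-1) * ((r:ℂ) * z) ^ 2)) countable_empty (by simp) ?_ ?_
          · unfold av
            have e : (∮ z in C(0, 1), 1 / (1 - (-1) * ((r:ℂ) * z) ^ 2) / z) = (∮ z in C(0, 1), (z - 0)⁻¹ • (1 / (1 - (-1) * ((r:ℂ) * z) ^ 2))) := by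
              congr 1; funext z; simp [div_eq_mul_inv, mul_comm]
            rw [e, this]
            have := Complex.two_pi_I_ne_zero
            simp only [smul_eq_mul]; field_simp; simp
          · intro z hz
            have hz' : ‖z‖ ≤ 1 := by simpa using hz
            refine ContinuousAt.continuousWithinAt (ContinuousAt.div (by fun_prop) (by fun_prop) (hne _ ?_))
            rw [norm_mul]; simp [abs_of_pos hrp]; nlinarith
          · intro z hz
            have hz' : ‖z‖ < 1 := by simpa using hz.1
            refine DifferentiableAt.div (by fun_prop) (by fun_prop) (hne _ ?_)
            rw [norm_mul]; simp [abs_of_pos hrp]; nlinarith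
        rw [this, mul_one]
      · rw [← hav, circleInt_eq_av]
        refine (av_eq_av hrp hr1.le (fun z h1 h2 => ?_)).symm
        exact hh.differentiableAt (hopen.mem_nhds ⟨hr.trans_le h1, h2.trans_lt ((one_lt_inv₀ h0).mpr h01)⟩)
    · intro z hz
      have hd := hne _ (hn z hz).le
      exact ContinuousAt.continuousWithinAt (by fun_prop (disch := assumption))
    · intro z hz
      have hz : ‖z‖ = 1 := hz
      have : ContinuousAt h ((r:ℂ) * z) := (hh.differentiableAt (hopen.mem_nhds ⟨by rw [hn z hz]; exact hr, by rw [hn z hz]; exact hr1.trans ((one_lt_inv₀ h0).mpr h01)⟩)).continuousAt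
      exact (ContinuousAt.comp (f := fun z => (r:ℂ) * z) this (by fun_prop)).continuousWithinAt
  have hanti : circleInt (fun z => (1 - z ^ 2) * h z) = 0 := by
    have hP : ∀ z : ℂ, ‖z‖ = 1 → z ^ 2 ≠ -1 → (1 - (1/z)^2) * h (1/z) = - ((1 - z^2) * h z) := by
      intro z hz h1
      have hz0 := ne_zero_of_norm_one hz
      have k1 := key z
      have k2 := key z⁻¹
      rw [hsy z hz] at k2
      have h2 : 1 + z ^ 2 ≠ 0 := fun e => h1 (by linear_combination e)
      have k3 : (1 + z⁻¹ ^ 2) * h z⁻¹ = (1 + z ^ 2) * h z := by linear_combination k1 - k2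
      have k4 : h z⁻¹ = z ^ 2 * h z := by
        have : (1 + z ^ 2) * h z⁻¹ = (1 + z ^ 2) * (z ^ 2 * h z) := by
          have hzz : z ^ 2 * z⁻¹ ^ 2 = 1 := by rw [← mul_pow, mul_inv_cancel₀ hz0, one_pow]
          linear_combination z ^ 2 * k3 - h z⁻¹ * hzz
        exact mul_left_cancel₀ h2 this
      rw [one_div, k4]
      field_simp
      ring
    have rot : ∀ f : ℂ → ℂ, circleInt (fun z => f (Complex.I * z)) = circleInt f := fun f => by
      have := av_mul_left one_pos (c := Complex.I) Complex.I_ne_zero f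
      rw [circleInt_eq_av, circleInt_eq_av, this]; simp
    have e1 : circleInt (fun z => (1 - (1/z) ^ 2) * h (1/z)) = circleInt (fun z => (-1) * ((1 - z ^ 2) * h z)) := by
      rw [← rot, ← rot (fun z => (-1) * ((1 - z ^ 2) * h z))]
      refine circleInt_congr' (fun z hz hz2 => ?_)
      have := hP (Complex.I * z) (by simp [hz]) (fun e => hz2 (by rw [mul_pow, Complex.I_sq] at e; linear_combination -e))
      rw [this]; ring
    have e2 := circleInt_inv (fun z => (1 - z ^ 2) * h z)
    simp only [← one_div] at e2
    rw [e1, circleInt_eq_av, av_const_mul, ← circleInt_eq_av] at e2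
    linear_combination (-1/2) * e2
  have : circleInt F = F Complex.I + 2 * circleInt h := by
    have e : circleInt F = circleInt (fun z => F Complex.I + (2 * h z - (1 - z ^ 2) * h z)) := by
      rw [hFe]; congr 1; funext z; ring
    have cz : ContinuousOn (fun z : ℂ => (1 - z ^ 2) * h z) {z | ‖z‖ = 1} := ContinuousOn.mul (by fun_prop) hhc
    have c2 : ContinuousOn (fun z : ℂ => 2 * h z) {z | ‖z‖ = 1} := continuousOn_const.mul hhc
    have c3 : ContinuousOn (fun z : ℂ => 2 * h z - (1 - z ^ 2) * h z) {z | ‖z‖ = 1} := c2.sub cz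
    rw [e, circleInt_add continuousOn_const c3, circleInt_sub c2 cz, hanti, hconst,
      circleInt_eq_av (fun z => 2 * h z), av_const_mul, ← circleInt_eq_av]
    ring
  rw [this, havr]
  ring

end Rains

namespace Rains
open Filter Topology Set

noncomputable def Gt (p q z : ℂ) : ℂ := EE p q (p * q / z) / (pochInf (p * z) p * EE p q (q * z))

lemma Gm_eq_Gt {p q : ℂ} (hp : ‖p‖ < 1) (hq : ‖q‖ < 1) (z : ℂ) : Gm p q z = Gt p q z / (1 - z) := by
  unfold Gm Gt
  rw [EE_shift_q hp hq z, poch_shift hp z, div_div]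
  congr 1; ring

lemma Gt_one {p q : ℂ} (hp : ‖p‖ < 1) (hq : ‖q‖ < 1) : Gt p q 1 = (pochInf p p * pochInf q q)⁻¹ := by
  unfold Gt
  have h : EE p q (p * q) ≠ 0 := EE_ne_zero_of_lt hp hq (by rw [norm_mul]; nlinarith [norm_nonneg p, norm_nonneg q])
  rw [mul_one, mul_one, div_one, EE_shift_p hp hq q]
  have h2 : pochInf p p ≠ 0 := poch_ne_zero_of_lt hp hp
  have h3 : pochInf q q ≠ 0 := poch_ne_zero_of_lt hq hq
  field_simp

lemma Gt_den {p q : ℂ} (hp : ‖p‖ < 1) (hq : ‖q‖ < 1) {z : ℂ} (h1 : ‖p * z‖ < 1) (h2 : ‖q * z‖ < 1) :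
    pochInf (p * z) p * EE p q (q * z) ≠ 0 := mul_ne_zero (poch_ne_zero_of_lt hp h1) (EE_ne_zero_of_lt hp hq h2)

lemma Gt_analyticAt {p q : ℂ} (hp : ‖p‖ < 1) (hq : ‖q‖ < 1) {a : ℂ → ℂ} {x : ℂ} (ha : AnalyticAt ℂ a x) (h0 : a x ≠ 0)
    (h1 : ‖p * a x‖ < 1) (h2 : ‖q * a x‖ < 1) : AnalyticAt ℂ (fun x => Gt p q (a x)) x :=
  (EE_analyticAt (analyticAt_const.div ha h0) analyticAt_const analyticAt_const hp hq).div
    ((poch_analyticAt (analyticAt_const.mul ha) analyticAt_const hp).mul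
      (EE_analyticAt (analyticAt_const.mul ha) analyticAt_const analyticAt_const hp hq)) (Gt_den hp hq h1 h2)

lemma Gt_continuousAt {p q : ℂ} (hp : ‖p‖ < 1) (hq : ‖q‖ < 1) {α : Type*} [TopologicalSpace α] {a : α → ℂ} {x : α} (ha : ContinuousAt a x) (h0 : a x ≠ 0)
    (h1 : ‖p * a x‖ < 1) (h2 : ‖q * a x‖ < 1) : ContinuousAt (fun x => Gt p q (a x)) x :=
  (EE_continuousAt (continuousAt_const.div ha h0) continuousAt_const continuousAt_const hp hq).div
    ((poch_continuousAt (continuousAt_const.mul ha) continuousAt_const hp).mul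
      (EE_continuousAt (continuousAt_const.mul ha) continuousAt_const continuousAt_const hp hq)) (Gt_den hp hq h1 h2)

lemma Ann_ne {r0 : ℝ} (h0 : 0 < r0) {z : ℂ} (hz : z ∈ Ann r0) : z ≠ 0 := norm_pos_iff.mp (h0.trans hz.1)

lemma Ann_mul {r0 : ℝ} (h0 : 0 < r0) {z c : ℂ} (hz : z ∈ Ann r0) (hc : ‖c‖ ≤ r0) : ‖c * z‖ < 1 := by
  rw [norm_mul]
  calc ‖c‖ * ‖z‖ ≤ r0 * ‖z‖ := by gcongr
    _ < r0 * r0⁻¹ := by have := hz.2; gcongr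
    _ = 1 := mul_inv_cancel₀ h0.ne'

lemma Ann_div {r0 : ℝ} (h0 : 0 < r0) {z c : ℂ} (hz : z ∈ Ann r0) (hc : ‖c‖ ≤ r0) : ‖c / z‖ < 1 := by
  rw [norm_div, div_lt_one (h0.trans hz.1)]
  exact hc.trans_lt hz.1

lemma Reg_Gm {p q : ℂ} (hp : ‖p‖ < 1) (hq : ‖q‖ < 1) {r0 ρ0 : ℝ} (h0 : 0 < r0) {c : ℝ → ℂ} (hc : ∀ ρ ∈ Ioc ρ0 1, ContinuousAt c ρ)
    (hc0 : ∀ ρ ∈ Ioc ρ0 1, c ρ ≠ 0) (hc1 : ∀ ρ ∈ Ioc ρ0 1, ‖c ρ‖ ≤ r0) :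
    Reg r0 ρ0 (fun ρ z => Gm p q (c ρ * z) * Gm p q (c ρ / z)) := by
  refine ⟨fun ρ hρ z hz => ?_, fun ρ hρ z hz => ?_, fun ρ hρ z hz => ?_⟩
  · have hz0 := Ann_ne h0 hz
    refine (Gm_analyticAt (a := fun z => c ρ * z) (by fun_prop) analyticAt_const analyticAt_const hp hq (mul_ne_zero (hc0 ρ hρ) hz0) (EE_ne_zero_of_lt hp hq (Ann_mul h0 hz (hc1 ρ hρ)))).mul
      (Gm_analyticAt (a := fun z => c ρ / z) (by fun_prop (disch := assumption)) analyticAt_const analyticAt_const hp hq (div_ne_zero (hc0 ρ hρ) hz0) (EE_ne_zero_of_lt hp hq (Ann_div h0 hz (hc1 ρ hρ))))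
  · have hz0 := Ann_ne h0 hz
    have hcc : ContinuousAt (fun x : ℝ × ℂ => c x.1) (ρ, z) := ContinuousAt.comp (f := fun x : ℝ × ℂ => x.1) (hc ρ hρ) continuousAt_fst
    refine (Gm_continuousAt (hcc.mul continuousAt_snd) continuousAt_const continuousAt_const hp hq (mul_ne_zero (hc0 ρ hρ) hz0) (EE_ne_zero_of_lt hp hq (Ann_mul h0 hz (hc1 ρ hρ)))).mul
      (Gm_continuousAt (hcc.div continuousAt_snd hz0) continuousAt_const continuousAt_const hp hq (div_ne_zero (hc0 ρ hρ) hz0) (EE_ne_zero_of_lt hp hq (Ann_div h0 hz (hc1 ρ hρ))))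
  · simp only [div_eq_mul_inv, mul_comm, inv_inv]

lemma Reg_Gt {p q : ℂ} {r0 ρ0 : ℝ} (h0 : 0 < r0) (hr1 : r0 < 1) (hρ0 : 0 ≤ ρ0) (hp : ‖p‖ ≤ r0) (hq : ‖q‖ ≤ r0) {u : ℂ} (hu : ‖u‖ = 1) :
    Reg r0 ρ0 (fun ρ z => Gt p q (u * ρ * z) * Gt p q (u * ρ / z)) := by
  have hp1 := hp.trans_lt hr1
  have hq1 := hq.trans_lt hr1
  have hu0 := ne_zero_of_norm_one hu
  have hn : ∀ ρ ∈ Ioc ρ0 1, ∀ c : ℂ, ‖c‖ ≤ r0 → ‖c * (u * (ρ:ℂ))‖ ≤ r0 := fun ρ hρ c hc => by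
    have : 0 < ρ := hρ0.trans_lt hρ.1
    rw [norm_mul, norm_mul, hu, one_mul, Complex.norm_real, Real.norm_eq_abs, abs_of_pos this]
    nlinarith [norm_nonneg c, hρ.2]
  have hc0 : ∀ ρ ∈ Ioc ρ0 1, u * (ρ:ℂ) ≠ 0 := fun ρ hρ => by
    have : 0 < ρ := hρ0.trans_lt hρ.1
    exact mul_ne_zero hu0 (by exact_mod_cast this.ne')
  have hA : ∀ ρ ∈ Ioc ρ0 1, ∀ z ∈ Ann r0, ∀ c : ℂ, ‖c‖ ≤ r0 → ‖c * (u * ρ * z)‖ < 1 := fun ρ hρ z hz c hc => by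
    rw [← mul_assoc]; exact Ann_mul h0 hz (hn ρ hρ c hc)
  have hB : ∀ ρ ∈ Ioc ρ0 1, ∀ z ∈ Ann r0, ∀ c : ℂ, ‖c‖ ≤ r0 → ‖c * (u * ρ / z)‖ < 1 := fun ρ hρ z hz c hc => by
    rw [← mul_div_assoc]; exact Ann_div h0 hz (hn ρ hρ c hc)
  refine ⟨fun ρ hρ z hz => ?_, fun ρ hρ z hz => ?_, fun ρ hρ z hz => ?_⟩
  · have hz0 := Ann_ne h0 hz
    exact (Gt_analyticAt hp1 hq1 (a := fun z => u * ρ * z) (by fun_prop) (mul_ne_zero (hc0 ρ hρ) hz0) (hA ρ hρ z hz p hp) (hA ρ hρ z hz q hq)).mul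
      (Gt_analyticAt hp1 hq1 (a := fun z => u * ρ / z) (by fun_prop (disch := assumption)) (div_ne_zero (hc0 ρ hρ) hz0) (hB ρ hρ z hz p hp) (hB ρ hρ z hz q hq))
  · have hz0 := Ann_ne h0 hz
    have hcc : ContinuousAt (fun x : ℝ × ℂ => u * (x.1 : ℂ)) (ρ, z) := by fun_prop
    exact (Gt_continuousAt hp1 hq1 (hcc.mul continuousAt_snd) (mul_ne_zero (hc0 ρ hρ) hz0) (hA ρ hρ z hz p hp) (hA ρ hρ z hz q hq)).mul
      (Gt_continuousAt hp1 hq1 (hcc.div continuousAt_snd hz0) (div_ne_zero (hc0 ρ hρ) hz0) (hB ρ hρ z hz p hp) (hB ρ hρ z hz q hq))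
  · simp only [div_eq_mul_inv, mul_comm, inv_inv]

lemma Reg_Th {p : ℂ} (hp : ‖p‖ < 1) {r0 ρ0 : ℝ} (h0 : 0 < r0) {x : ℂ} (hx : x ≠ 0) : Reg r0 ρ0 (fun _ z => Th p x z) := by
  refine ⟨fun ρ hρ z hz => Th_analyticAt' hp hx (Ann_ne h0 hz), fun ρ hρ z hz => ?_, fun ρ hρ z hz => Th_inv _ _ _⟩
  exact ContinuousAt.comp (g := fun z => Th p x z) (f := fun x : ℝ × ℂ => x.2) (Th_analyticAt' hp hx (Ann_ne h0 hz)).continuousAt continuousAt_snd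

lemma Reg_Wt {p q : ℂ} (hp : ‖p‖ < 1) (hq : ‖q‖ < 1) {r0 ρ0 : ℝ} (h0 : 0 < r0) {N : ℕ} {T : Fin N → ℝ → ℂ}
    (hc : ∀ i, ∀ ρ ∈ Ioc ρ0 1, ContinuousAt (T i) ρ)
    (hc0 : ∀ i, ∀ ρ ∈ Ioc ρ0 1, T i ρ ≠ 0) (hc1 : ∀ i, ∀ ρ ∈ Ioc ρ0 1, ‖T i ρ‖ ≤ r0) :
    Reg r0 ρ0 (fun ρ z => Wt p q (fun i => T i ρ) z) := by
  have h := Reg.prod Finset.univ (fun i _ => Reg_Gm (p := p) (q := q) hp hq h0 (hc i) (hc0 i) (hc1 i))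
  have hth : ∀ z ∈ Ann r0, AnalyticAt ℂ (fun z => th p (z ^ 2) * th q (z⁻¹ ^ 2)) z := fun z hz => by
    have hz0 := Ann_ne h0 hz
    exact (th_analyticAt (a := fun z => z ^ 2) (by fun_prop) analyticAt_const hp (pow_ne_zero 2 hz0)).mul
      (th_analyticAt (a := fun z => z⁻¹ ^ 2) (by fun_prop (disch := assumption)) analyticAt_const hq (pow_ne_zero 2 (inv_ne_zero hz0)))
  refine ⟨fun ρ hρ z hz => (h.an ρ hρ z hz).mul (hth z hz), fun ρ hρ z hz => (h.co ρ hρ z hz).mul ?_, fun ρ hρ z hz => ?_⟩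
  · exact ContinuousAt.comp (g := fun z => th p (z ^ 2) * th q (z⁻¹ ^ 2)) (f := fun x : ℝ × ℂ => x.2) (hth z hz).continuousAt continuousAt_snd
  · exact Wt_inv hp hq _ (ne_zero_of_norm_one hz)

lemma ff_cons_zero (p : ℂ) {n : ℕ} (a : ℂ) (x : Fin n → ℂ) (z : ℂ) : ff p (Fin.cons a x : Fin (n+1) → ℂ) 0 z = ∏ j, Th p (x j) z := by
  unfold ff
  have : (Finset.univ.erase (0 : Fin (n+1))) = Finset.univ.map (Fin.succEmb n) := by
    ext j; simp [Fin.exists_succ_eq]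
  rw [this, Finset.prod_map]; simp

lemma ff_cons_succ (p : ℂ) {n : ℕ} (a : ℂ) (x : Fin n → ℂ) (i : Fin n) (z : ℂ) : ff p (Fin.cons a x : Fin (n+1) → ℂ) i.succ z = Th p a z * ff p x i z := by
  unfold ff
  have : (Finset.univ.erase (i.succ)) = insert (0 : Fin (n+1)) ((Finset.univ.erase i).map (Fin.succEmb n)) := by
    ext j
    refine Fin.cases ?_ (fun j => ?_) j <;> simp [Fin.succ_ne_zero, (Fin.succ_ne_zero i).symm]
  rw [this, Finset.prod_insert (by simp), Finset.prod_map]; simp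

lemma Wt_cons (p q : ℂ) {N : ℕ} (a : ℂ) (t : Fin N → ℂ) (z : ℂ) : Wt p q (Fin.cons a t : Fin (N+1) → ℂ) z = (Gm p q (a * z) * Gm p q (a / z)) * Wt p q t z := by
  unfold Wt
  rw [Fin.prod_univ_succ]; simp only [Fin.cons_zero, Fin.cons_succ]; ring

end Rains

namespace Rains
open Filter Topology Set

lemma generic_pts (n : ℕ) : ∃ x : Fin n → ℂ, (∀ j, ‖x j‖ = 1) ∧
    ∀ i j : Fin (n+1), i ≠ j → (Fin.cons Complex.I x : Fin (n+1) → ℂ) i * (Fin.cons Complex.I x : Fin (n+1) → ℂ) j ≠ 1 ∧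
      (Fin.cons Complex.I x : Fin (n+1) → ℂ) i / (Fin.cons Complex.I x : Fin (n+1) → ℂ) j ≠ 1 := by
  let w : Fin (n+1) → ℂ := fun i => Complex.exp ((Real.pi / (2 * ((i:ℕ) + 1)) : ℝ) * Complex.I)
  have hw0 : w 0 = Complex.I := by
    simp only [w]
    have : (Real.pi / (2 * (((0 : Fin (n+1)):ℕ) + 1)) : ℝ) = Real.pi / 2 := by simp
    rw [this]; push_cast; exact Complex.exp_pi_div_two_mul_I
  have hcons : (Fin.cons Complex.I (fun j : Fin n => w j.succ) : Fin (n+1) → ℂ) = w := by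
    funext i
    refine Fin.cases ?_ (fun j => ?_) i
    · simp [hw0]
    · simp
  have hpi := Real.pi_pos
  have hang : ∀ i : Fin (n+1), 0 < (Real.pi / (2 * ((i:ℕ) + 1)) : ℝ) ∧ (Real.pi / (2 * ((i:ℕ) + 1)) : ℝ) ≤ Real.pi / 2 := by
    intro i
    refine ⟨by positivity, ?_⟩
    gcongr
    have : (0:ℝ) ≤ (i:ℕ) := by positivity
    linarith
  have hone : ∀ θ : ℝ, Complex.exp (θ * Complex.I) = 1 → |θ| < 2 * Real.pi → θ = 0 := by
    intro θ h hlt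
    obtain ⟨k, hk⟩ := Complex.exp_eq_one_iff.mp h
    have h2 : (θ : ℂ) = ((k * (2 * Real.pi) : ℝ) : ℂ) := by
      have := Complex.I_ne_zero
      apply mul_right_cancel₀ this
      push_cast; linear_combination hk
    have h3 : θ = k * (2 * Real.pi) := by exact_mod_cast h2
    rw [h3, abs_mul, abs_of_pos (by positivity : 0 < 2 * Real.pi)] at hlt
    have h4 : |(k:ℝ)| < 1 := by
      by_contra hc; push Not at hc
      nlinarith
    have h5 : |k| < 1 := by exact_mod_cast h4
    rw [Int.abs_lt_one_iff] at h5
    rw [h3, h5]; simp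
  refine ⟨fun j => w j.succ, fun j => ?_, ?_⟩
  · simp only [w]; exact Complex.norm_exp_ofReal_mul_I _
  · rw [hcons]
    intro i j hij
    obtain ⟨i1, i2⟩ := hang i
    obtain ⟨j1, j2⟩ := hang j
    constructor
    · intro h
      simp only [w] at h
      rw [← Complex.exp_add, ← add_mul, ← Complex.ofReal_add] at h
      have := hone _ h (by rw [abs_of_pos (by positivity)]; linarith)
      linarith
    · intro h
      simp only [w] at h
      rw [← Complex.exp_sub, ← sub_mul, ← Complex.ofReal_sub] at h
      have := hone _ h (by rw [abs_lt]; constructor <;> linarith)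
      have h3 : (Real.pi / (2 * ((i:ℕ) + 1)) : ℝ) = Real.pi / (2 * ((j:ℕ) + 1)) := by linarith
      rw [div_eq_div_iff (by positivity) (by positivity)] at h3
      have h4 := mul_left_cancel₀ hpi.ne' h3
      have h5 : ((i:ℕ):ℝ) = (j:ℕ) := by linarith
      exact hij (Fin.ext (by exact_mod_cast h5))

lemma VV_cons (p : ℂ) {n : ℕ} (a : ℂ) (x : Fin n → ℂ) : VV p (Fin.cons a x : Fin (n+1) → ℂ) = (∏ j, ps p a (x j)) * VV p x := by
  unfold VV
  rw [Fin.prod_univ_succ]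
  congr 1
  · rw [Fin.Ioi_zero_eq_map, Finset.prod_map]; simp
  · refine Finset.prod_congr rfl (fun i _ => ?_)
    rw [← Fin.map_succEmb_Ioi, Finset.prod_map]; simp

lemma C0_cons {n : ℕ} (a : ℂ) (x : Fin n → ℂ) : C0 (Fin.cons a x : Fin (n+1) → ℂ) = (∏ j, -(a * x j)) * C0 x := by
  unfold C0
  rw [Fin.prod_univ_succ]
  congr 1
  · rw [Fin.Ioi_zero_eq_map, Finset.prod_map]; simp
  · refine Finset.prod_congr rfl (fun i _ => ?_)
    rw [← Fin.map_succEmb_Ioi, Finset.prod_map]; simp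

lemma K_cons {p : ℂ} (hp : ‖p‖ < 1) {n : ℕ} {a : ℂ} (ha : a ≠ 0) {x : Fin n → ℂ} (hx : ∀ j, x j ≠ 0) :
    C0 (Fin.cons a x : Fin (n+1) → ℂ) * VV p (Fin.cons a x : Fin (n+1) → ℂ) = (a ^ n * ∏ j, Th p (x j) a) * (C0 x * VV p x) := by
  rw [VV_cons, C0_cons]
  have : (∏ j, -(a * x j)) * (∏ j, ps p a (x j)) = a ^ n * ∏ j, Th p (x j) a := by
    rw [← Finset.prod_mul_distrib]
    have : a ^ n = ∏ _j : Fin n, a := by simp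
    rw [this, ← Finset.prod_mul_distrib]
    refine Finset.prod_congr rfl (fun j _ => ?_)
    rw [ps_antisymm hp (hx j) ha, ps]
    have := hx j
    field_simp
  linear_combination C0 x * VV p x * this

lemma det_lim {n : ℕ} {M : ℝ → Matrix (Fin (n+1)) (Fin (n+1)) ℂ} {u : ℝ → ℂ} {l : Filter ℝ} {c0 : ℂ} {B : Matrix (Fin n) (Fin n) ℂ}
    (h00 : Tendsto (fun ρ => u ρ * M ρ 0 0) l (𝓝 c0)) (h0j : ∀ j : Fin n, Tendsto (fun ρ => u ρ * M ρ 0 j.succ) l (𝓝 0))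
    (hi0 : ∀ i : Fin n, ∃ c, Tendsto (fun ρ => M ρ i.succ 0) l (𝓝 c)) (hij : ∀ i j : Fin n, Tendsto (fun ρ => M ρ i.succ j.succ) l (𝓝 (B i j))) :
    Tendsto (fun ρ => u ρ * (M ρ).det) l (𝓝 (c0 * B.det)) := by
  choose d hd using hi0
  let L : Matrix (Fin (n+1)) (Fin (n+1)) ℂ := Matrix.of (Fin.cons (Fin.cons c0 (fun _ => 0)) (fun i => Fin.cons (d i) (B i)))
  have hL : L.det = c0 * B.det := by
    rw [Matrix.det_succ_row_zero, Fin.sum_univ_succ]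
    have : L.submatrix Fin.succ (Fin.succAbove 0) = B := by
      ext i j; simp [L]
    rw [this]
    simp [L]
  rw [← hL]
  have hv : ∀ ρ, u ρ * (M ρ).det = (Matrix.of (fun i j => (Fin.cons (u ρ) (fun _ => 1) : Fin (n+1) → ℂ) i * M ρ i j)).det := by
    intro ρ
    rw [Matrix.det_mul_column, Fin.prod_univ_succ]; simp
  simp only [hv]
  have hc : Continuous (fun A : Matrix (Fin (n+1)) (Fin (n+1)) ℂ => A.det) := continuous_id.matrix_det
  refine (hc.tendsto L).comp ?_
  refine tendsto_pi_nhds.mpr (fun i => tendsto_pi_nhds.mpr (fun j => ?_))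
  refine Fin.cases ?_ (fun i => ?_) i <;> refine Fin.cases ?_ (fun j => ?_) j
  · simpa [L] using h00
  · simpa [L] using h0j j
  · simpa [L] using hd i
  · simpa [L] using hij i j

end Rains

namespace Rains
open Filter Topology Set

noncomputable def tc {N : ℕ} (ρ : ℂ) (t : Fin N → ℂ) : Fin (N+2) → ℂ :=
  Fin.cons (Complex.I * ρ) (Fin.cons (-Complex.I * ρ) t : Fin (N+1) → ℂ)

section
variable {p q : ℂ} {r0 ρ0 : ℝ} {N n : ℕ} {T : Fin N → ℝ → ℂ} {x y : Fin n → ℂ}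

noncomputable def GG (p q u : ℂ) (ρ : ℝ) (z : ℂ) : ℂ := Gm p q (u * ρ * z) * Gm p q (u * ρ / z)
noncomputable def GT (p q u : ℂ) (ρ : ℝ) (z : ℂ) : ℂ := Gt p q (u * ρ * z) * Gt p q (u * ρ / z)

lemma GG_eq (hp : ‖p‖ < 1) (hq : ‖q‖ < 1) (u : ℂ) (ρ : ℝ) (z : ℂ) :
    GG p q u ρ z = GT p q u ρ z / ((1 - (u * ρ) * z ^ 1) * (1 - (u * ρ) * z⁻¹ ^ 1)) := by
  unfold GG GT
  rw [Gm_eq_Gt hp hq, Gm_eq_Gt hp hq, div_mul_div_comm]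
  congr 2
  · ring
  · rw [pow_one, div_eq_mul_inv]

lemma GG_ne {u : ℂ} (hu : ‖u‖ = 1) {ρ : ℝ} (h0 : 0 < ρ) (h1 : ρ < 1) {z : ℂ} (hz : ‖z‖ = 1) (hp : ‖p‖ < 1) (hq : ‖q‖ < 1) :
    EE p q (u * ρ * z) ≠ 0 ∧ EE p q (u * ρ / z) ≠ 0 := by
  constructor <;> refine EE_ne_zero_of_lt hp hq ?_
  · simp [hu, hz, abs_of_pos h0, h1]
  · simp [hu, hz, abs_of_pos h0, h1]

lemma Th_GG_q (hp : ‖p‖ < 1) (hq : ‖q‖ < 1) (hq0 : q ≠ 0) {u : ℂ} (hu : ‖u‖ = 1) {ρ : ℝ} (h0 : 0 < ρ) (h1 : ρ < 1) {z : ℂ} (hz : ‖z‖ = 1) :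
    Th p (u * ρ) z * GG p q u ρ z = GG p q (u * q) ρ z := by
  obtain ⟨e1, e2⟩ := GG_ne (p := p) (q := q) hu h0 h1 hz hp hq
  unfold GG Th
  have a1 : u * q * ρ * z = q * (u * ρ * z) := by ring
  have a2 : u * q * ρ / z = q * (u * ρ / z) := by ring
  rw [a1, a2, Gm_q hp hq hq0 e1, Gm_q hp hq hq0 e2]
  ring

lemma Th_GG_p (hp : ‖p‖ < 1) (hq : ‖q‖ < 1) (hp0 : p ≠ 0) {u : ℂ} (hu : ‖u‖ = 1) {ρ : ℝ} (h0 : 0 < ρ) (h1 : ρ < 1) {z : ℂ} (hz : ‖z‖ = 1) :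
    Th q (u * ρ) z * GG p q u ρ z = GG p q (u * p) ρ z := by
  obtain ⟨e1, e2⟩ := GG_ne (p := p) (q := q) hu h0 h1 hz hp hq
  unfold GG Th
  have a1 : u * p * ρ * z = p * (u * ρ * z) := by ring
  have a2 : u * p * ρ / z = p * (u * ρ / z) := by ring
  rw [a1, a2, Gm_p hp hq hp0 e1, Gm_p hp hq hp0 e2]
  ring

lemma GG_GG_one (hp : ‖p‖ < 1) (hq : ‖q‖ < 1) (hp0 : p ≠ 0) (hq0 : q ≠ 0) {z : ℂ} (hz : ‖z‖ = 1) :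
    GG p q (Complex.I * q) 1 z * GG p q (-Complex.I * p) 1 z = 1 := by
  have hz0 := ne_zero_of_norm_one hz
  have hI : Complex.I * Complex.I = -1 := Complex.I_mul_I
  have hI0 := Complex.I_ne_zero
  have e1 : p * q / (Complex.I * q * z) = -Complex.I * p / z := by
    field_simp; linear_combination hI
  have e2 : p * q / (Complex.I * q / z) = -Complex.I * p * z := by
    field_simp; linear_combination hI
  have n1 : ‖Complex.I * q * z‖ < 1 := by simp [hz, hq]
  have n2 : ‖Complex.I * q / z‖ < 1 := by simp [hz, hq]
  have n3 : ‖-Complex.I * p * z‖ < 1 := by simp [hz, hp]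
  have n4 : ‖-Complex.I * p / z‖ < 1 := by simp [hz, hp]
  have r1 := Gm_refl (p := p) (q := q) (z := Complex.I * q * z) (mul_ne_zero hp0 hq0) (EE_ne_zero_of_lt hp hq n1)
    (by rw [e1]; exact EE_ne_zero_of_lt hp hq n4)
  have r2 := Gm_refl (p := p) (q := q) (z := Complex.I * q / z) (mul_ne_zero hp0 hq0) (EE_ne_zero_of_lt hp hq n2)
    (by rw [e2]; exact EE_ne_zero_of_lt hp hq n3)
  rw [e1] at r1
  rw [e2] at r2
  unfold GG
  simp only [Complex.ofReal_one, mul_one]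
  linear_combination r1 * (Gm p q (Complex.I * q / z) * Gm p q (-Complex.I * p * z)) + r2

lemma Wt_tc (ρ : ℝ) (t : Fin N → ℂ) (z : ℂ) :
    Wt p q (tc ρ t) z = GG p q Complex.I ρ z * GG p q (-Complex.I) ρ z * Wt p q t z := by
  unfold tc
  rw [Wt_cons, Wt_cons]; unfold GG; ring

lemma pinch_det (hp0 : p ≠ 0) (hq0 : q ≠ 0) (h0 : 0 < r0) (hr1 : r0 < 1) (hρ0 : 0 ≤ ρ0) (hρ1 : ρ0 < 1)
    (hp : ‖p‖ ≤ r0) (hq : ‖q‖ ≤ r0) (hx : ∀ j, x j ≠ 0) (hy : ∀ j, y j ≠ 0)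
    (hc : ∀ i, ∀ ρ ∈ Ioc ρ0 1, ContinuousAt (T i) ρ)
    (hc0 : ∀ i, ∀ ρ ∈ Ioc ρ0 1, T i ρ ≠ 0) (hc1 : ∀ i, ∀ ρ ∈ Ioc ρ0 1, ‖T i ρ‖ ≤ r0) :
    Tendsto (fun ρ : ℝ => (1 - (ρ:ℂ)^2) * (Matrix.of fun i j => circleInt (fun z =>
      ff p (Fin.cons (Complex.I * ρ) x : Fin (n+1) → ℂ) i z * ff q (Fin.cons (-Complex.I * ρ) y : Fin (n+1) → ℂ) j z *
        Wt p q (tc ρ (fun i => T i ρ)) z)).det) (𝓝[<] 1)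
    (𝓝 ((1/2 * ((∏ j, Th p (x j) Complex.I) * (∏ j, Th q (y j) Complex.I) * (GT p q Complex.I 1 Complex.I * GT p q (-Complex.I) 1 Complex.I) * Wt p q (fun i => T i 1) Complex.I)) *
      (Matrix.of fun i j => circleInt (fun z => ff p x i z * ff q y j z * Wt p q (fun i => T i 1) z)).det)) := by
  have hp1 := hp.trans_lt hr1
  have hq1 := hq.trans_lt hr1
  have hIn : ‖Complex.I‖ = 1 := by simp
  have hIn' : ‖-Complex.I‖ = 1 := by simp
  obtain ⟨r, hr0, hr⟩ := exists_between hr1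
  have RW := Reg_Wt (p := p) (q := q) (r0 := r0) (ρ0 := ρ0) hp1 hq1 h0 hc hc0 hc1
  have RTI : Reg r0 ρ0 (GT p q Complex.I) := Reg_Gt h0 hr1 hρ0 hp hq hIn
  have RTI' : Reg r0 ρ0 (GT p q (-Complex.I)) := Reg_Gt h0 hr1 hρ0 hp hq hIn'
  have RG : ∀ u : ℂ, u ≠ 0 → ‖u‖ ≤ r0 → Reg r0 ρ0 (GG p q u) := fun u hu hur => by
    refine Reg_Gm hp1 hq1 h0 (c := fun ρ => u * ρ) (fun ρ _ => by fun_prop) (fun ρ hρ => ?_) (fun ρ hρ => ?_)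
    · exact mul_ne_zero hu (by exact_mod_cast (hρ0.trans_lt hρ.1).ne')
    · have : 0 < ρ := hρ0.trans_lt hρ.1
      rw [norm_mul, Complex.norm_real, Real.norm_eq_abs, abs_of_pos this]
      nlinarith [norm_nonneg u, hρ.2]
  have RGq := RG (Complex.I * q) (mul_ne_zero Complex.I_ne_zero hq0) (by simpa using hq)
  have RGp := RG (-Complex.I * p) (mul_ne_zero (neg_ne_zero.mpr Complex.I_ne_zero) hp0) (by simpa using hp)
  have Rx : Reg r0 ρ0 (fun _ z => ∏ j, Th p (x j) z) := Reg.prod _ (fun j _ => Reg_Th hp1 h0 (hx j))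
  have Ry : Reg r0 ρ0 (fun _ z => ∏ j, Th q (y j) z) := Reg.prod _ (fun j _ => Reg_Th hq1 h0 (hy j))
  have Rfx : ∀ i, Reg r0 ρ0 (fun _ z => ff p x i z) := fun i => Reg.prod _ (fun j _ => Reg_Th hp1 h0 (hx j))
  have Rfy : ∀ i, Reg r0 ρ0 (fun _ z => ff q y i z) := fun i => Reg.prod _ (fun j _ => Reg_Th hq1 h0 (hy j))
  have hev : ∀ᶠ ρ : ℝ in 𝓝[<] 1, ρ ∈ Ioo ρ0 1 := Ioo_mem_nhdsLT hρ1
  have hu0 : Tendsto (fun ρ : ℝ => (1 - (ρ:ℂ)^2)) (𝓝[<] 1) (𝓝 0) := by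
    have : Continuous (fun ρ : ℝ => (1 - (ρ:ℂ)^2)) := by fun_prop
    have := (this.tendsto 1).mono_left (nhdsWithin_le_nhds (s := Iio 1))
    simpa using this
  have habs : ∀ ρ ∈ Ioo ρ0 1, ‖(ρ:ℂ)‖ = ρ := fun ρ hρ => by
    rw [Complex.norm_real, Real.norm_eq_abs, abs_of_pos (hρ0.trans_lt hρ.1)]
  have h1ρ : Tendsto (fun ρ : ℝ => (1 + (ρ:ℂ)^2)⁻¹) (𝓝[<] 1) (𝓝 (1/2)) := by
    have : ContinuousAt (fun ρ : ℝ => (1 + (ρ:ℂ)^2)⁻¹) 1 := by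
      refine ContinuousAt.inv₀ (by fun_prop) (by norm_num)
    have := this.tendsto.mono_left (nhdsWithin_le_nhds (s := Iio 1))
    convert this using 2; norm_num
  have hne : ∀ ρ : ℝ, (1 + (ρ:ℂ)^2) ≠ 0 := fun ρ => by
    have : (0:ℝ) < 1 + ρ ^ 2 := by positivity
    exact_mod_cast this.ne'
  have one : ∀ u : ℂ, ‖u‖ = 1 → u ^ 2 = -1 → ∀ R : ℝ → ℂ → ℂ, Reg r0 ρ0 R → ∃ c, Tendsto (fun ρ : ℝ => circleInt (fun z =>
      R ρ z / ((1 - (u * ρ) * z ^ 1) * (1 - (u * ρ) * z⁻¹ ^ 1)))) (𝓝[<] 1) (𝓝 c) := by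
    intro u hu hu2 R hR
    have := ker_lim h0 hr0 hr hρ1 hR (a := fun ρ : ℝ => u * ρ) (by fun_prop) (fun ρ hρ => by rw [norm_mul, hu, one_mul, habs ρ hρ]; exact hρ.2)
      (by simp [hu]) one_ne_zero
    refine ⟨_, (h1ρ.mul this).congr (fun ρ => ?_)⟩
    have e : (1 - (u * (ρ:ℂ)) ^ 2) = 1 + (ρ:ℂ)^2 := by rw [mul_pow, hu2]; ring
    rw [e, ← mul_assoc, inv_mul_cancel₀ (hne ρ), one_mul]
  refine det_lim ?_ (fun j => ?_) (fun i => ?_) (fun i j => ?_)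
  · have H := ker_lim h0 hr0 hr hρ1 ((((Rx.mul Ry).mul (RTI.mul RTI')).mul RW)) (a := fun ρ : ℝ => -(ρ:ℂ)^2) (by fun_prop)
      (fun ρ hρ => by rw [norm_neg, norm_pow, habs ρ hρ]; nlinarith [hρ.2, hρ0.trans_lt hρ.1]) (by simp) two_ne_zero
    have hR := (((Rx.mul Ry).mul (RTI.mul RTI')).mul RW)
    have e1 := res_eq h0 hr0 hr (hR.an 1 ⟨hρ1, le_rfl⟩) (hR.sy 1 ⟨hρ1, le_rfl⟩)
    have e2 : (-((1:ℝ):ℂ)^2) = -1 := by simp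
    rw [e2, e1] at H
    refine (h1ρ.mul H).congr' ?_
    filter_upwards [hev] with ρ hρ
    have hρp : 0 < ρ := hρ0.trans_lt hρ.1
    have e3 : (1 - (-(ρ:ℂ)^2)^2) = (1 + (ρ:ℂ)^2) * (1 - (ρ:ℂ)^2) := by ring
    rw [e3, ← mul_assoc, ← mul_assoc, inv_mul_cancel₀ (hne ρ), one_mul]
    congr 1
    refine circleInt_congr (fun z hz => ?_)
    have hz0 := ne_zero_of_norm_one hz
    rw [ff_cons_zero, ff_cons_zero, Wt_tc, GG_eq hp1 hq1, GG_eq hp1 hq1]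
    have e4 : (1 - -(ρ:ℂ) ^ 2 * z ^ 2) * (1 - -(ρ:ℂ) ^ 2 * z⁻¹ ^ 2) = ((1 - (Complex.I * ρ) * z ^ 1) * (1 - (Complex.I * ρ) * z⁻¹ ^ 1)) *
      ((1 - (-Complex.I * ρ) * z ^ 1) * (1 - (-Complex.I * ρ) * z⁻¹ ^ 1)) := by
      have a1 : (1 - -(ρ:ℂ) ^ 2 * z ^ 2) = (1 - (Complex.I * ρ) * z ^ 1) * (1 - (-Complex.I * ρ) * z ^ 1) := by
        linear_combination ((ρ:ℂ)^2 * z ^ 2) * Complex.I_sq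
      have a2 : (1 - -(ρ:ℂ) ^ 2 * z⁻¹ ^ 2) = (1 - (Complex.I * ρ) * z⁻¹ ^ 1) * (1 - (-Complex.I * ρ) * z⁻¹ ^ 1) := by
        linear_combination ((ρ:ℂ)^2 * z⁻¹ ^ 2) * Complex.I_sq
      rw [a1, a2]; ring
    rw [e4, div_mul_div_comm]
    ring
  · obtain ⟨c, H⟩ := one Complex.I hIn Complex.I_sq _ (((Rx.mul (Rfy j)).mul (RTI.mul RGp)).mul RW)
    have := hu0.mul H
    rw [zero_mul] at this
    refine this.congr' ?_
    filter_upwards [hev] with ρ hρ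
    have hρp : 0 < ρ := hρ0.trans_lt hρ.1
    congr 1
    refine circleInt_congr (fun z hz => ?_)
    rw [ff_cons_zero, ff_cons_succ, Wt_tc, ← Th_GG_p hp1 hq1 hp0 hIn' hρp hρ.2 hz, GG_eq hp1 hq1 Complex.I]
    ring
  · obtain ⟨c, H⟩ := one (-Complex.I) hIn' (by rw [neg_sq, Complex.I_sq]) _ ((((Rfx i).mul Ry).mul (RGq.mul RTI')).mul RW)
    refine ⟨c, H.congr' ?_⟩
    filter_upwards [hev] with ρ hρ
    have hρp : 0 < ρ := hρ0.trans_lt hρ.1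
    refine circleInt_congr (fun z hz => ?_)
    rw [ff_cons_zero, ff_cons_succ, Wt_tc, ← Th_GG_q hp1 hq1 hq0 hIn hρp hρ.2 hz, GG_eq hp1 hq1 (-Complex.I)]
    ring
  · have hR := ((((Rfx i).mul (Rfy j)).mul (RGq.mul RGp)).mul RW)
    have hcont : ContinuousOn (fun ρ => circleInt (fun z => ff p x i z * ff q y j z * (GG p q (Complex.I * q) ρ z * GG p q (-Complex.I * p) ρ z) * Wt p q (fun i => T i ρ) z)) (Ioc ρ0 1) := by
      refine circleInt_continuousOn (fun x hx => ContinuousAt.continuousWithinAt ?_)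
      exact hR.co x.1 hx.1 x.2 (circle_sub_Ann h0 hr1 hx.2)
    have hlim := (hcont 1 ⟨hρ1, le_rfl⟩).tendsto
    have hlim2 := hlim.mono_left (nhdsWithin_mono 1 (Ioo_subset_Ioc_self : Ioo ρ0 1 ⊆ Ioc ρ0 1))
    rw [nhdsWithin_Ioo_eq_nhdsLT hρ1] at hlim2
    have e : circleInt (fun z => ff p x i z * ff q y j z * (GG p q (Complex.I * q) 1 z * GG p q (-Complex.I * p) 1 z) * Wt p q (fun i => T i 1) z)
      = circleInt (fun z => ff p x i z * ff q y j z * Wt p q (fun i => T i 1) z) :=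
      circleInt_congr (fun z hz => by rw [GG_GG_one hp1 hq1 hp0 hq0 hz, mul_one])
    rw [e] at hlim2
    refine hlim2.congr' ?_
    filter_upwards [hev] with ρ hρ
    have hρp : 0 < ρ := hρ0.trans_lt hρ.1
    refine circleInt_congr (fun z hz => ?_)
    rw [ff_cons_succ, ff_cons_succ, Wt_tc, ← Th_GG_q hp1 hq1 hq0 hIn hρp hρ.2 hz, ← Th_GG_p hp1 hq1 hp0 hIn' hρp hρ.2 hz]
    ring

end

end Rains

namespace Rains
open Filter Topology Set

lemma hc_DET {p q : ℂ} (hp : ‖p‖ < 1) (hq : ‖q‖ < 1) {n N : ℕ} {x y : Fin n → ℂ} (hx : ∀ i, x i ≠ 0) (hy : ∀ i, y i ≠ 0)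
    {t : Fin N → ℂ} (ht0 : ∀ i, t i ≠ 0) (ht : ∀ i, ‖t i‖ < 1) (i j : Fin n) :
    ContinuousOn (fun z => ff p x i z * ff q y j z * Wt p q t z) {z | ‖z‖ = 1} := by
  intro z hz
  have hz1 : ‖z‖ = 1 := hz
  have hz0 := ne_zero_of_norm_one hz1
  refine ContinuousAt.continuousWithinAt (ContinuousAt.mul (ContinuousAt.mul ?_ ?_) (Wt_analyticAt hp hq t ht0 ht hz1).continuousAt)
  · exact tendsto_finsetProd _ (fun k _ => (Th_analyticAt' hp (hx k) hz0).continuousAt)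
  · exact tendsto_finsetProd _ (fun k _ => (Th_analyticAt' hq (hy k) hz0).continuousAt)

lemma pinch_DD {p q : ℂ} (hp0 : p ≠ 0) (hq0 : q ≠ 0) {r0 ρ0 : ℝ} (h0 : 0 < r0) (hr1 : r0 < 1) (hρ0 : 0 ≤ ρ0) (hρ1 : ρ0 < 1)
    (hp : ‖p‖ ≤ r0) (hq : ‖q‖ ≤ r0) (n : ℕ) {N : ℕ} (T : Fin N → ℝ → ℂ)
    (hc : ∀ i, ∀ ρ ∈ Ioc ρ0 1, ContinuousAt (T i) ρ)
    (hc0 : ∀ i, ∀ ρ ∈ Ioc ρ0 1, T i ρ ≠ 0) (hc1 : ∀ i, ∀ ρ ∈ Ioc ρ0 1, ‖T i ρ‖ ≤ r0) :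
    Tendsto (fun ρ : ℝ => (1 - (ρ:ℂ)^2) * DD p q (n+1) (tc ρ (fun i => T i ρ))) (𝓝[<] 1)
     (𝓝 (2 * (n+1) * (Gt p q 1)^2 * (∏ i, Gm p q (T i 1 * Complex.I) * Gm p q (T i 1 / Complex.I)) * DD p q n (fun i => T i 1))) := by
  have hp1 := hp.trans_lt hr1
  have hq1 := hq.trans_lt hr1
  obtain ⟨x, hx1, hgen⟩ := generic_pts n
  have hx0 : ∀ j, x j ≠ 0 := fun j => ne_zero_of_norm_one (hx1 j)
  let y : Fin n → ℂ := fun j => (x j)⁻¹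
  have hy1 : ∀ j, ‖y j‖ = 1 := fun j => by simp [y, hx1]
  have hy0 : ∀ j, y j ≠ 0 := fun j => ne_zero_of_norm_one (hy1 j)
  have hI0 := Complex.I_ne_zero
  have hIinv : (-Complex.I : ℂ) = Complex.I⁻¹ := by simp
  have gx : ∀ i j, i ≠ j → x i * x j ≠ 1 ∧ x i / x j ≠ 1 := fun i j hij => by
    have := hgen i.succ j.succ (by simpa using hij)
    simpa using this
  have gI : ∀ j, x j * Complex.I ≠ 1 ∧ x j / Complex.I ≠ 1 := fun j => by
    have := hgen j.succ 0 (Fin.succ_ne_zero j)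
    simpa only [Fin.cons_succ, Fin.cons_zero] using this
  have thne : ∀ {r : ℂ}, ‖r‖ < 1 → ∀ z : ℂ, ‖z‖ = 1 → z ≠ 1 → th r z ≠ 0 := fun hr z h1 h2 =>
    th_ne_zero_of_norm_eq hr h1 h2
  have VVx : VV p x ≠ 0 := VV_ne hx0 (fun i j hij => ⟨thne hp1 _ (by simp [hx1]) (gx i j hij).1, thne hp1 _ (by simp [hx1]) (gx i j hij).2⟩)
  have VVy : VV q y ≠ 0 := VV_ne hy0 (fun i j hij => by
    have e1 : y i * y j = (x i * x j)⁻¹ := by simp [y, mul_comm]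
    have e2 : y i / y j = (x i / x j)⁻¹ := by simp [y, div_eq_mul_inv, mul_comm]
    rw [e1, e2]
    exact ⟨thne hq1 _ (by simp [hx1]) (inv_ne_one.2 (gx i j hij).1), thne hq1 _ (by simp [hx1]) (inv_ne_one.2 (gx i j hij).2)⟩)
  have Tx : ∏ j, Th p (x j) Complex.I ≠ 0 := Finset.prod_ne_zero_iff.2 (fun j _ =>
    mul_ne_zero (thne hp1 _ (by simp [hx1]) (gI j).1) (thne hp1 _ (by simp [hx1]) (gI j).2))
  have Ty : ∏ j, Th q (y j) Complex.I ≠ 0 := Finset.prod_ne_zero_iff.2 (fun j _ => by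
    have e1 : y j * Complex.I = (x j / Complex.I)⁻¹ := by simp [y, div_eq_mul_inv, mul_comm]
    have e2 : y j / Complex.I = (x j * Complex.I)⁻¹ := by simp [y, div_eq_mul_inv, mul_comm]
    unfold Th
    rw [e1, e2]
    exact mul_ne_zero (thne hq1 _ (by simp [hx1]) (inv_ne_one.2 (gI j).2)) (thne hq1 _ (by simp [hx1]) (inv_ne_one.2 (gI j).1)))
  have Ty' : ∏ j, Th q (y j) (-Complex.I) = ∏ j, Th q (y j) Complex.I :=
    Finset.prod_congr rfl (fun j _ => by rw [hIinv, Th_inv])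
  have cTx : ContinuousAt (fun ρ : ℝ => ∏ j, Th p (x j) (Complex.I * ρ)) 1 :=
    tendsto_finsetProd _ (fun k _ => by
      have := (Th_analyticAt' (q := p) (x := x k) (z := Complex.I * ((1:ℝ):ℂ)) hp1 (hx0 k) (by simp)).continuousAt
      exact ContinuousAt.comp (g := fun z => Th p (x k) z) (f := fun ρ : ℝ => Complex.I * (ρ:ℂ)) this (by fun_prop))
  have cTy : ContinuousAt (fun ρ : ℝ => ∏ j, Th q (y j) (-Complex.I * ρ)) 1 :=
    tendsto_finsetProd _ (fun k _ => by
      have := (Th_analyticAt' (q := q) (x := y k) (z := -Complex.I * ((1:ℝ):ℂ)) hq1 (hy0 k) (by simp)).continuousAt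
      exact ContinuousAt.comp (g := fun z => Th q (y k) z) (f := fun ρ : ℝ => -Complex.I * (ρ:ℂ)) this (by fun_prop))
  let K : ℝ → ℂ := fun ρ => ((Complex.I * ρ) ^ n * ∏ j, Th p (x j) (Complex.I * ρ)) * ((-Complex.I * ρ) ^ n * ∏ j, Th q (y j) (-Complex.I * ρ))
  have cK : ContinuousAt K 1 := by
    have c1 : ContinuousAt (fun ρ : ℝ => (Complex.I * (ρ:ℂ)) ^ n) 1 := by fun_prop
    have c2 : ContinuousAt (fun ρ : ℝ => (-Complex.I * (ρ:ℂ)) ^ n) 1 := by fun_prop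
    exact (c1.mul cTx).mul (c2.mul cTy)
  have K1 : K 1 = (∏ j, Th p (x j) Complex.I) * (∏ j, Th q (y j) Complex.I) := by
    simp only [K, Complex.ofReal_one, mul_one, Ty']
    have : Complex.I ^ n * (-Complex.I) ^ n = 1 := by rw [← mul_pow]; simp
    linear_combination (∏ j, Th p (x j) Complex.I) * (∏ j, Th q (y j) Complex.I) * this
  have K1ne : K 1 ≠ 0 := by rw [K1]; exact mul_ne_zero Tx Ty
  have h1m : (1:ℝ) ∈ Ioc ρ0 1 := ⟨hρ1, le_rfl⟩
  have D0 := DET (n := n) hp1 hq1 (fun i => T i 1) hx0 hy0 VVx VVy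
    (hc_DET hp1 hq1 hx0 hy0 (fun i => hc0 i 1 h1m) (fun i => (hc1 i 1 h1m).trans_lt hr1))
  have L := pinch_det (n := n) (T := T) hp0 hq0 h0 hr1 hρ0 hρ1 hp hq hx0 hy0 hc hc0 hc1
  have hCx := C0_ne hx0
  have hCy := C0_ne hy0
  have hcK : Tendsto K (𝓝[<] 1) (𝓝 (K 1)) := cK.tendsto.mono_left nhdsWithin_le_nhds
  have L2 := (L.div hcK K1ne).const_mul ((n+1).factorial / (C0 x * VV p x * (C0 y * VV q y)) : ℂ)
  have hKn : (C0 x * VV p x * (C0 y * VV q y)) ≠ 0 := mul_ne_zero (mul_ne_zero hCx VVx) (mul_ne_zero hCy VVy)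
  have hev : ∀ᶠ ρ : ℝ in 𝓝[<] 1, K ρ ≠ 0 := hcK.eventually_ne K1ne
  have hev2 : ∀ᶠ ρ : ℝ in 𝓝[<] 1, ρ ∈ Ioo ρ0 1 := Ioo_mem_nhdsLT hρ1
  refine Tendsto.congr' ?_ (L2.trans (le_of_eq (congrArg 𝓝 ?_)))
  · filter_upwards [hev, hev2] with ρ hK hρ
    have hρm : ρ ∈ Ioc ρ0 1 := ⟨hρ.1, hρ.2.le⟩
    have hρp : 0 < ρ := hρ0.trans_lt hρ.1
    have hρc : (ρ:ℂ) ≠ 0 := by exact_mod_cast hρp.ne'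
    have a0 : Complex.I * (ρ:ℂ) ≠ 0 := mul_ne_zero hI0 hρc
    have b0 : -Complex.I * (ρ:ℂ) ≠ 0 := mul_ne_zero (neg_ne_zero.2 hI0) hρc
    have X0 : ∀ i, (Fin.cons (Complex.I * ρ) x : Fin (n+1) → ℂ) i ≠ 0 := fun i => by
      refine Fin.cases ?_ (fun j => ?_) i
      · simpa using hρc
      · simpa using hx0 j
    have Y0 : ∀ i, (Fin.cons (-Complex.I * ρ) y : Fin (n+1) → ℂ) i ≠ 0 := fun i => by
      refine Fin.cases ?_ (fun j => ?_) i
      · simpa using hρc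
      · simpa using hy0 j
    have Kx := K_cons hp1 a0 hx0
    have Ky := K_cons hq1 b0 hy0
    have hKK : (C0 (Fin.cons (Complex.I * ρ) x : Fin (n+1) → ℂ) * VV p (Fin.cons (Complex.I * ρ) x : Fin (n+1) → ℂ)) *
       (C0 (Fin.cons (-Complex.I * ρ) y : Fin (n+1) → ℂ) * VV q (Fin.cons (-Complex.I * ρ) y : Fin (n+1) → ℂ)) = K ρ * (C0 x * VV p x * (C0 y * VV q y)) := by
      rw [Kx, Ky]; simp only [K]; ring
    have hKKne : (C0 (Fin.cons (Complex.I * ρ) x : Fin (n+1) → ℂ) * VV p (Fin.cons (Complex.I * ρ) x : Fin (n+1) → ℂ)) *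
       (C0 (Fin.cons (-Complex.I * ρ) y : Fin (n+1) → ℂ) * VV q (Fin.cons (-Complex.I * ρ) y : Fin (n+1) → ℂ)) ≠ 0 := by
      rw [hKK]; exact mul_ne_zero hK hKn
    have V1 := right_ne_zero_of_mul (left_ne_zero_of_mul hKKne)
    have V2 := right_ne_zero_of_mul (right_ne_zero_of_mul hKKne)
    have nI : ‖Complex.I * (ρ:ℂ)‖ < 1 := by simp [abs_of_pos hρp, hρ.2]
    have nI' : ‖-Complex.I * (ρ:ℂ)‖ < 1 := by simp [abs_of_pos hρp, hρ.2]
    have t0 : ∀ i, tc ρ (fun i => T i ρ) i ≠ 0 := fun i => by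
      refine Fin.cases a0 (fun j => Fin.cases b0 (fun k => hc0 k ρ hρm) j) i
    have t1 : ∀ i, ‖tc ρ (fun i => T i ρ) i‖ < 1 := fun i => by
      refine Fin.cases nI (fun j => Fin.cases nI' (fun k => (hc1 k ρ hρm).trans_lt hr1) j) i
    have D1 := DET (n := n+1) hp1 hq1 (tc ρ (fun i => T i ρ)) X0 Y0 V1 V2 (hc_DET hp1 hq1 X0 Y0 t0 t1)
    rw [hKK] at D1
    simp only [Pi.div_apply]
    generalize (Matrix.det (n := Fin (n+1)) (R := ℂ) _) = Δ at D1 ⊢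
    generalize (C0 x * VV p x * (C0 y * VV q y)) = A at *
    generalize DD p q (n+1) (tc ρ (fun i => T i ρ)) = B at *
    generalize K ρ = k at *
    field_simp
    linear_combination (1 - (ρ:ℂ)^2) * D1
  · have hW : Wt p q (fun i => T i 1) Complex.I = (∏ i, Gm p q (T i 1 * Complex.I) * Gm p q (T i 1 / Complex.I)) * (th p (-1) * th q (-1)) := by
      unfold Wt; simp [Complex.I_sq]
    have hG1 : GT p q Complex.I 1 Complex.I = Gt p q (-1) * Gt p q 1 := by
      unfold GT; simp
    have hG2 : GT p q (-Complex.I) 1 Complex.I = Gt p q 1 * Gt p q (-1) := by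
      unfold GT
      have : -Complex.I / Complex.I = -1 := by field_simp
      simp [this]
    have hGm := Gm_inv_mul (p := p) (q := q) (x := -1) hp1 hq1 (by simp)
    have hg : Gm p q (-1) = Gt p q (-1) / 2 := by rw [Gm_eq_Gt hp1 hq1]; norm_num
    have hi : ((-1 : ℂ))⁻¹ = -1 := by norm_num
    rw [hi, hg] at hGm
    have e1 : th p (-1) ≠ 0 := thne hp1 _ (by simp) (by norm_num)
    have e2 : th q (-1) ≠ 0 := thne hq1 _ (by simp) (by norm_num)
    have hGt : Gt p q (-1) * Gt p q (-1) * (th p (-1) * th q (-1)) = 4 := by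
      have hne : Gt p q (-1) ≠ 0 := by
        intro h; rw [h] at hGm; simp at hGm; tauto
      rw [← hGm]; field_simp; norm_num
    rw [hW, hG1, hG2, K1]
    have hf : ((n+1).factorial : ℂ) = (n+1) * n.factorial := by rw [Nat.factorial_succ]; push_cast; ring
    have hfn : (n.factorial : ℂ) ≠ 0 := by exact_mod_cast n.factorial_ne_zero
    rw [hf]
    generalize (Matrix.det (n := Fin n) (R := ℂ) _) = Δ at D0 ⊢
    generalize (C0 x * VV p x * (C0 y * VV q y)) = A at *
    generalize DD p q n (fun i => T i 1) = B at *
    generalize ∏ j, Th p (x j) Complex.I = P1 at *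
    generalize ∏ j, Th q (y j) Complex.I = P2 at *
    generalize (∏ i, Gm p q (T i 1 * Complex.I) * Gm p q (T i 1 / Complex.I)) = P3 at *
    generalize Gt p q (-1) = g at *
    generalize th p (-1) = e at *
    generalize th q (-1) = e' at *
    have : Δ = A * B / n.factorial := by field_simp; linear_combination D0
    rw [this]
    field_simp
    linear_combination hGt * Gt p q 1 ^ 2 * P3 * B
end Rains

namespace Rains
open Filter Topology Set

noncomputable def JJ (p q : ℂ) (n : ℕ) {N : ℕ} (t : Fin N → ℂ) : ℂ :=
  (pochInf p p * pochInf q q) ^ n / (2 ^ n * n.factorial) * DD p q n t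

def RT (p q s : ℂ) (N n m : ℕ) (d c : ℂ) : Prop := ∀ t : Fin N → ℂ, (∀ i, ‖s‖ < ‖t i‖) → (∀ i, ‖t i‖ < 1) →
  ∏ i, t i = (p * q) ^ (m + 1) → d * JJ p q n t = c * PP p q t * JJ p q m (fun i => s / t i)

lemma PP_cons (p q : ℂ) {N : ℕ} (a : ℂ) (t : Fin N → ℂ) : PP p q (Fin.cons a t : Fin (N+1) → ℂ) = (∏ j, Gm p q (a * t j)) * PP p q t := by
  have e : ∀ (M : ℕ) (u : Fin M → ℂ), PP p q u = ∏ i, ∏ j ∈ Finset.Ioi i, Gm p q (u i * u j) := fun M u => by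
    unfold PP
    refine Finset.prod_congr rfl (fun i _ => Finset.prod_congr (by ext j; simp) (fun _ _ => rfl))
  rw [e, e, Fin.prod_univ_succ]
  congr 1
  · rw [Fin.Ioi_zero_eq_map, Finset.prod_map]; simp
  · refine Finset.prod_congr rfl (fun i _ => ?_)
    rw [← Fin.map_succEmb_Ioi, Finset.prod_map]; simp

lemma PP_tc {p q : ℂ} (hp : ‖p‖ < 1) (hq : ‖q‖ < 1) {N : ℕ} {ρ : ℂ} (hρ : 1 - ρ ^ 2 ≠ 0) (t : Fin N → ℂ) : (1 - ρ ^ 2) * PP p q (tc ρ t) =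
    Gt p q (ρ ^ 2) * (∏ i, Gm p q (Complex.I * ρ * t i) * Gm p q (-Complex.I * ρ * t i)) * PP p q t := by
  unfold tc
  rw [PP_cons, PP_cons, Fin.prod_univ_succ]
  simp only [Fin.cons_zero, Fin.cons_succ, Finset.prod_mul_distrib]
  have : Complex.I * ρ * (-Complex.I * ρ) = ρ ^ 2 := by linear_combination (-ρ^2) * Complex.I_mul_I
  rw [this, Gm_eq_Gt hp hq]
  field_simp

lemma DD_dual_tc {p q s : ℂ} (hp : ‖p‖ < 1) (hq : ‖q‖ < 1) (hp0 : p ≠ 0) (hq0 : q ≠ 0) (hs : s ^ 2 = p * q) (hs1 : ‖s‖ < 1) {N : ℕ} (m : ℕ) (t : Fin N → ℂ) :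
    DD p q m (fun i => s / tc 1 t i) = DD p q m (fun i => s / t i) := by
  have e : (fun i => s / tc 1 t i) = (Fin.cons (s / Complex.I) (Fin.cons (s / (-Complex.I)) (fun i => s / t i) : Fin (N+1) → ℂ) : Fin (N+2) → ℂ) := by
    funext i
    refine Fin.cases (by simp [tc]) (fun j => Fin.cases (by simp [tc]) (fun k => by simp [tc]) j) i
  rw [e]
  unfold DD
  refine torusInt_congr m (fun z hz => ?_)
  congr 1
  refine Finset.prod_congr rfl (fun j _ => ?_)
  rw [Wt_cons, Wt_cons, ← mul_assoc]
  have hz0 := ne_zero_of_norm_one (hz j)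
  have hI0 := Complex.I_ne_zero
  have hs0 : s ≠ 0 := by rintro rfl; exact mul_ne_zero hp0 hq0 (by rw [← hs]; simp)
  have e1 : p * q / (s / Complex.I * z j) = s / (-Complex.I) / z j := by
    rw [← hs]; field_simp; linear_combination Complex.I_mul_I
  have e2 : p * q / (s / Complex.I / z j) = s / (-Complex.I) * z j := by
    rw [← hs]; field_simp; linear_combination Complex.I_mul_I
  have r1 := Gm_refl (p := p) (q := q) (z := s / Complex.I * z j) (mul_ne_zero hp0 hq0) (EE_ne_zero_of_lt hp hq (by simp [hz, hs1]))
    (by rw [e1]; exact EE_ne_zero_of_lt hp hq (by simp [hz, hs1]))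
  have r2 := Gm_refl (p := p) (q := q) (z := s / Complex.I / z j) (mul_ne_zero hp0 hq0) (EE_ne_zero_of_lt hp hq (by simp [hz, hs1]))
    (by rw [e2]; exact EE_ne_zero_of_lt hp hq (by simp [hz, hs1]))
  rw [e1] at r1
  rw [e2] at r2
  have : Gm p q (s / Complex.I * z j) * Gm p q (s / Complex.I / z j) * (Gm p q (s / -Complex.I * z j) * Gm p q (s / -Complex.I / z j)) = 1 := by
    linear_combination r1 * (Gm p q (s / Complex.I / z j) * Gm p q (s / -Complex.I * z j)) + r2
  rw [this, one_mul]

lemma exists_w {ι : Type*} [Finite ι] (a : ι → ℝ) (ha : ∀ i, a i < 1) : ∃ w : ℝ, 0 < w ∧ w < 1 ∧ ∀ i, a i ≤ w ^ 4 := by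
  have h1 : ∀ᶠ w : ℝ in 𝓝[<] 1, ∀ i, a i ≤ w ^ 4 := by
    rw [eventually_all]
    intro i
    have : ContinuousAt (fun w : ℝ => w ^ 4) 1 := by fun_prop
    have h := this.tendsto.mono_left (nhdsWithin_le_nhds (s := Iio 1))
    filter_upwards [h.eventually (lt_mem_nhds (by simpa using ha i))] with w hw using hw.le
  have h2 : ∀ᶠ w : ℝ in 𝓝[<] 1, w ∈ Ioo (0:ℝ) 1 := Ioo_mem_nhdsLT one_pos
  obtain ⟨w, hw1, hw2⟩ := (h1.and h2).exists
  exact ⟨w, hw2.1, hw2.2, hw1⟩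

lemma RT_descend {p q s : ℂ} (hp : ‖p‖ < 1) (hq : ‖q‖ < 1) (hp0 : p ≠ 0) (hq0 : q ≠ 0) (hs : s ^ 2 = p * q) {N n m : ℕ} {d c : ℂ}
    (H : RT p q s (N+1+2) (n+1) m d c) : RT p q s (N+1) n m d c := by
  intro t ht1 ht2 hprod
  have hs0 : s ≠ 0 := by rintro rfl; exact mul_ne_zero hp0 hq0 (by rw [← hs]; simp)
  have hs1 : ‖s‖ < 1 := (ht1 0).trans (ht2 0)
  obtain ⟨w, hw0, hw1, hw⟩ := exists_w (fun i : Fin (N+1) ⊕ (Unit ⊕ Unit) => Sum.elim (fun i => ‖t i‖) (Sum.elim (fun _ => ‖p‖) (fun _ => ‖q‖)) i) (by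
    rintro (i | i | i)
    · exact ht2 i
    · exact hp
    · exact hq)
  have hw42 : w ^ 4 ≤ w ^ 2 := pow_le_pow_of_le_one hw0.le hw1.le (by norm_num)
  have hwp : ‖p‖ ≤ w ^ 2 := (hw (Sum.inr (Sum.inl ()))).trans hw42
  have hwq : ‖q‖ ≤ w ^ 2 := (hw (Sum.inr (Sum.inr ()))).trans hw42
  have hwt : ∀ i, ‖t i‖ ≤ w ^ 4 := fun i => hw (Sum.inl i)
  have ht0 : ∀ i, t i ≠ 0 := fun i => norm_pos_iff.1 ((norm_nonneg s).trans_lt (ht1 i))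
  let T : Fin (N+1) → ℝ → ℂ := fun i ρ => t i / (if i = 0 then (ρ:ℂ)^2 else 1)
  have T1 : ∀ i, T i 1 = t i := fun i => by simp [T]
  have den0 : ∀ i : Fin (N+1), ∀ ρ : ℝ, 0 < ρ → (if i = 0 then (ρ:ℂ)^2 else 1) ≠ 0 := fun i ρ h => by
    split_ifs
    · exact pow_ne_zero _ (by exact_mod_cast h.ne')
    · exact one_ne_zero
  have hc : ∀ i, ∀ ρ : ℝ, 0 < ρ → ContinuousAt (T i) ρ := fun i ρ h => by
    refine continuousAt_const.div ?_ (den0 i ρ h)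
    by_cases h : i = 0
    · simp only [h, if_true]; fun_prop
    · simp only [h, if_false]; fun_prop
  have hc0 : ∀ i, ∀ ρ : ℝ, 0 < ρ → T i ρ ≠ 0 := fun i ρ h => div_ne_zero (ht0 i) (den0 i ρ h)
  have hden : ∀ i : Fin (N+1), ∀ ρ ∈ Ioc w 1, w ^ 2 ≤ ‖(if i = 0 then (ρ:ℂ)^2 else 1)‖ ∧ ‖(if i = 0 then (ρ:ℂ)^2 else 1)‖ ≤ 1 := fun i ρ h => by
    have hρp : 0 < ρ := hw0.trans h.1
    split_ifs
    · rw [norm_pow, Complex.norm_real, Real.norm_of_nonneg hρp.le]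
      exact ⟨pow_le_pow_left₀ hw0.le h.1.le 2, pow_le_one₀ hρp.le h.2⟩
    · simp only [norm_one, le_refl, and_true]
      exact pow_le_one₀ hw0.le hw1.le
  have hc1 : ∀ i, ∀ ρ ∈ Ioc w 1, ‖T i ρ‖ ≤ w ^ 2 := fun i ρ h => by
    simp only [T]
    rw [norm_div, div_le_iff₀ (norm_pos_iff.2 (den0 i ρ (hw0.trans h.1)))]
    calc ‖t i‖ ≤ w ^ 2 * w ^ 2 := by rw [← pow_add]; exact hwt i
      _ ≤ _ := by gcongr; exact (hden i ρ h).1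
  have hc2 : ∀ i, ∀ ρ ∈ Ioc w 1, ‖s‖ < ‖T i ρ‖ := fun i ρ h => by
    simp only [T]
    rw [norm_div, lt_div_iff₀ (norm_pos_iff.2 (den0 i ρ (hw0.trans h.1)))]
    exact (mul_le_of_le_one_right (norm_nonneg _) (hden i ρ h).2).trans_lt (ht1 i)
  have hr1 : w ^ 2 < 1 := pow_lt_one₀ hw0.le hw1 (by norm_num)
  have hm1 : (1:ℝ) ∈ Ioc w 1 := ⟨hw1, le_rfl⟩
  have L := pinch_DD hp0 hq0 (pow_pos hw0 2) hr1 hw0.le hw1 hwp hwq n T (fun i ρ h => hc i ρ (hw0.trans h.1)) (fun i ρ h => hc0 i ρ (hw0.trans h.1)) hc1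
  simp only [T1] at L
  have hT1' : ∀ i, ContinuousAt (T i) 1 := fun i => hc i 1 one_pos
  have R1 : Tendsto (fun ρ : ℝ => Gt p q ((ρ:ℂ)^2)) (𝓝[<] 1) (𝓝 (Gt p q 1)) := by
    have := Gt_continuousAt (p := p) (q := q) (a := fun ρ : ℝ => (ρ:ℂ)^2) (x := 1) hp hq (by fun_prop) (by simp) (by simpa using hp) (by simpa using hq)
    have h2 := this.tendsto.mono_left (nhdsWithin_le_nhds (s := Iio 1))
    simpa using h2
  have tI : ∀ u : ℂ, ‖u‖ = 1 → ∀ i, ContinuousAt (fun ρ : ℝ => Gm p q (u * ρ * T i ρ)) 1 := fun u hu i => by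
    refine Gm_continuousAt (a := fun ρ : ℝ => u * ρ * T i ρ) (p := fun _ => p) (q := fun _ => q) ?_ continuousAt_const continuousAt_const hp hq ?_ ?_
    · exact ContinuousAt.mul (by fun_prop) (hT1' i)
    · simp only [T1, Complex.ofReal_one, mul_one]
      exact mul_ne_zero (ne_zero_of_norm_one hu) (ht0 i)
    · simp only [T1, Complex.ofReal_one, mul_one]
      exact EE_ne_zero_of_lt hp hq (by rw [norm_mul, hu, one_mul]; exact ht2 i)
  have R2 : Tendsto (fun ρ : ℝ => ∏ i, Gm p q (Complex.I * ρ * T i ρ) * Gm p q (-Complex.I * ρ * T i ρ)) (𝓝[<] 1)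
      (𝓝 (∏ i, Gm p q (t i * Complex.I) * Gm p q (t i / Complex.I))) := by
    have : ContinuousAt (fun ρ : ℝ => ∏ i, Gm p q (Complex.I * ρ * T i ρ) * Gm p q (-Complex.I * ρ * T i ρ)) 1 :=
      tendsto_finsetProd _ (fun i _ => (tI Complex.I (by simp) i).mul (tI (-Complex.I) (by simp) i))
    have h2 := this.tendsto.mono_left (nhdsWithin_le_nhds (s := Iio 1))
    refine h2.trans (le_of_eq (congrArg 𝓝 (Finset.prod_congr rfl (fun i _ => ?_))))
    rw [T1, Complex.ofReal_one, mul_one, mul_one]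
    congr 2
    · ring
    · rw [div_eq_mul_inv, Complex.inv_I]; ring
  have R3 : Tendsto (fun ρ : ℝ => PP p q (fun i => T i ρ)) (𝓝[<] 1) (𝓝 (PP p q t)) := by
    have : ContinuousAt (fun ρ : ℝ => PP p q (fun i => T i ρ)) 1 := by
      unfold PP
      refine tendsto_finsetProd _ (fun i _ => tendsto_finsetProd _ (fun j _ => ?_))
      refine Gm_continuousAt (a := fun ρ : ℝ => T i ρ * T j ρ) (p := fun _ => p) (q := fun _ => q) ?_ continuousAt_const continuousAt_const hp hq ?_ ?_
      · exact (hT1' i).mul (hT1' j)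
      · simp only [T1]; exact mul_ne_zero (ht0 i) (ht0 j)
      · simp only [T1]
        refine EE_ne_zero_of_lt hp hq ?_
        rw [norm_mul]
        exact mul_lt_one_of_nonneg_of_lt_one_left (norm_nonneg _) (ht2 i) (ht2 j).le
    have h2 := this.tendsto.mono_left (nhdsWithin_le_nhds (s := Iio 1))
    simpa only [T1] using h2
  set w' := max w ‖s‖ with hw'
  have hw'1 : w' < 1 := max_lt hw1 hs1
  have a0 : ∀ ρ : ℝ, 0 < ρ → ∀ i, tc ρ (fun i => T i ρ) i ≠ 0 := fun ρ hρ i => by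
    have hρc : (ρ:ℂ) ≠ 0 := by exact_mod_cast hρ.ne'
    refine Fin.cases (mul_ne_zero Complex.I_ne_zero hρc) (fun j => Fin.cases (mul_ne_zero (neg_ne_zero.2 Complex.I_ne_zero) hρc) (fun k => hc0 k ρ hρ) j) i
  have alo : ∀ ρ ∈ Ioc w' 1, ∀ i, ‖s‖ < ‖tc ρ (fun i => T i ρ) i‖ := fun ρ hρ i => by
    have h1 : ‖s‖ < ρ := (le_max_right _ _).trans_lt hρ.1
    have h2 : w < ρ := (le_max_left _ _).trans_lt hρ.1
    have h3 : 0 < ρ := hw0.trans h2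
    have nI : ‖s‖ < ‖Complex.I * (ρ:ℂ)‖ := by simp [abs_of_pos h3, h1]
    have nI' : ‖s‖ < ‖-Complex.I * (ρ:ℂ)‖ := by simp [abs_of_pos h3, h1]
    refine Fin.cases nI (fun j => Fin.cases nI' (fun k => hc2 k ρ ⟨h2, hρ.2⟩) j) i
  have R4 : Tendsto (fun ρ : ℝ => DD p q m (fun i => s / tc ρ (fun i => T i ρ) i)) (𝓝[<] 1) (𝓝 (DD p q m (fun i => s / t i))) := by
    have hco : ContinuousOn (fun ρ : ℝ => DD p q m (fun i => s / tc ρ (fun i => T i ρ) i)) (Ioc w' 1) := by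
      refine DD_continuousOn (p := fun _ => p) (q := fun _ => q) (t := fun i (ρ : ℝ) => s / tc ρ (fun i => T i ρ) i) (fun _ _ => continuousAt_const) (fun _ _ => hp)
        (fun _ _ => continuousAt_const) (fun _ _ => hq) ?_ ?_ ?_
      · intro ρ hρ i
        have h3 : 0 < ρ := hw0.trans ((le_max_left _ _).trans_lt hρ.1)
        refine continuousAt_const.div ?_ (a0 ρ h3 i)
        have c1 : ContinuousAt (fun ρ : ℝ => Complex.I * (ρ:ℂ)) ρ := by fun_prop
        have c2 : ContinuousAt (fun ρ : ℝ => -Complex.I * (ρ:ℂ)) ρ := by fun_prop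
        exact Fin.cases c1 (fun j => Fin.cases c2 (fun k => hc k ρ h3) j) i
      · intro ρ hρ i
        rw [norm_div, div_lt_one ((norm_nonneg s).trans_lt (alo ρ hρ i))]
        exact alo ρ hρ i
      · intro ρ hρ i
        exact div_ne_zero hs0 (a0 ρ (hw0.trans ((le_max_left _ _).trans_lt hρ.1)) i)
    have hlim := (hco 1 ⟨hw'1, le_rfl⟩).tendsto
    have hlim2 := hlim.mono_left (nhdsWithin_mono 1 (Ioo_subset_Ioc_self : Ioo w' 1 ⊆ Ioc w' 1))
    rw [nhdsWithin_Ioo_eq_nhdsLT hw'1] at hlim2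
    simp only [T1, Complex.ofReal_one] at hlim2
    rwa [DD_dual_tc hp hq hp0 hq0 hs hs1] at hlim2
  set κ := Gt p q 1 with hκ
  set A := pochInf p p * pochInf q q with hA
  have hκA : κ * A = 1 := by
    rw [hκ, Gt_one hp hq]
    exact inv_mul_cancel₀ (mul_ne_zero (poch_ne_zero_of_lt hp hp) (poch_ne_zero_of_lt hq hq))
  have LL := (L.const_mul (d * (A ^ (n+1) / (2 ^ (n+1) * (n+1).factorial))))
  have RR := (((R1.mul R2).mul R3).mul R4).const_mul (c * (A ^ m / (2 ^ m * m.factorial)))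
  have hev2 : ∀ᶠ ρ : ℝ in 𝓝[<] 1, ρ ∈ Ioo w' 1 := Ioo_mem_nhdsLT hw'1
  have RR' := RR.congr' (f₂ := fun ρ : ℝ => d * (A ^ (n+1) / (2 ^ (n+1) * (n+1).factorial)) * ((1 - (ρ:ℂ)^2) * DD p q (n+1) (tc ρ (fun i => T i ρ)))) (by
    filter_upwards [hev2] with ρ hρ
    have h2 : w < ρ := (le_max_left _ _).trans_lt hρ.1
    have h3 : 0 < ρ := hw0.trans h2
    have hρc : (ρ:ℂ) ≠ 0 := by exact_mod_cast h3.ne'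
    have hne : 1 - (ρ:ℂ)^2 ≠ 0 := by
      have : ρ ^ 2 < 1 := pow_lt_one₀ h3.le hρ.2 (by norm_num)
      have h4 : (1 - ρ ^ 2 : ℝ) ≠ 0 := by linarith
      exact_mod_cast h4
    have ahi : ∀ i, ‖tc ρ (fun i => T i ρ) i‖ < 1 := fun i => by
      have nI : ‖Complex.I * (ρ:ℂ)‖ < 1 := by simp [abs_of_pos h3, hρ.2]
      have nI' : ‖-Complex.I * (ρ:ℂ)‖ < 1 := by simp [abs_of_pos h3, hρ.2]
      refine Fin.cases nI (fun j => Fin.cases nI' (fun k => (hc1 k ρ ⟨h2, hρ.2.le⟩).trans_lt hr1) j) i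
    have hpr : ∏ i, tc ρ (fun i => T i ρ) i = (p * q) ^ (m+1) := by
      rw [← hprod]
      unfold tc
      rw [Fin.prod_univ_succ, Fin.prod_univ_succ]
      simp only [Fin.cons_zero, Fin.cons_succ, T]
      rw [Finset.prod_div_distrib, Finset.prod_ite_eq' Finset.univ (0 : Fin (N+1)) (fun _ => (ρ:ℂ)^2), if_pos (Finset.mem_univ _)]
      generalize ∏ i, t i = X
      field_simp
      linear_combination (-X) * Complex.I_sq
    have h := H (tc ρ (fun i => T i ρ)) (alo ρ ⟨hρ.1, hρ.2.le⟩) ahi hpr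
    have hPP := PP_tc hp hq hne (fun i => T i ρ)
    unfold JJ at h
    rw [← hA] at h
    generalize DD p q (n+1) (tc ρ (fun i => T i ρ)) = X1 at *
    generalize DD p q m (fun i => s / tc ρ (fun i => T i ρ) i) = X2 at *
    generalize PP p q (fun i => T i ρ) = X3 at *
    generalize PP p q (tc ρ (fun i => T i ρ)) = X4 at *
    rw [← hPP]
    linear_combination (-(1 - (ρ:ℂ)^2)) * h)
  have E := tendsto_nhds_unique LL RR'
  have hG : ∏ i, Gm p q (t i * Complex.I) * Gm p q (t i / Complex.I) ≠ 0 := by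
    have hpq : ‖p * q‖ = ‖s‖ * ‖s‖ := by rw [← hs, norm_pow, sq]
    have key : ∀ z : ℂ, ‖s‖ < ‖z‖ → ‖z‖ < 1 → Gm p q z ≠ 0 := fun z h1 h2 => by
      refine Gm_ne_zero (EE_ne_zero_of_lt hp hq h2) (EE_ne_zero_of_lt hp hq ?_)
      rw [norm_div, hpq, div_lt_one ((norm_nonneg s).trans_lt h1)]
      nlinarith [norm_nonneg s]
    refine Finset.prod_ne_zero_iff.2 (fun i _ => mul_ne_zero (key _ ?_ ?_) (key _ ?_ ?_))
    all_goals simp [ht1, ht2]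
  have hκ0 : κ ≠ 0 := left_ne_zero_of_mul (hκA.trans_ne one_ne_zero)
  unfold JJ
  rw [← hA]
  have hf : ((n+1).factorial : ℂ) = (n+1) * n.factorial := by rw [Nat.factorial_succ]; push_cast; ring
  have hfn : (n.factorial : ℂ) ≠ 0 := by exact_mod_cast n.factorial_ne_zero
  have hfm : (m.factorial : ℂ) ≠ 0 := by exact_mod_cast m.factorial_ne_zero
  have hn1 : (n + 1 : ℂ) ≠ 0 := by exact_mod_cast n.succ_ne_zero
  rw [hf] at E
  generalize ∏ i, Gm p q (t i * Complex.I) * Gm p q (t i / Complex.I) = G at *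
  generalize DD p q n t = X1 at *
  generalize DD p q m (fun i => s / t i) = X2 at *
  generalize PP p q t = X3 at *
  have e1 : d * (A ^ (n + 1) / (2 ^ (n + 1) * ((n+1) * n.factorial))) * (2 * (n + 1) * κ ^ 2 * G * X1) = (κ * G) * (d * (A ^ n / (2 ^ n * n.factorial) * X1)) := by
    have : d * (A ^ (n + 1) / (2 ^ (n + 1) * ((n+1) * n.factorial))) * (2 * (n + 1) * κ ^ 2 * G * X1) = (κ * A) * ((κ * G) * (d * (A ^ n / (2 ^ n * n.factorial) * X1))) := by
      field_simp; ring
    rw [this, hκA, one_mul]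
  rw [e1] at E
  refine mul_left_cancel₀ (mul_ne_zero hκ0 hG) (E.trans ?_)
  ring
end Rains

namespace Rains
open Filter Topology Set

lemma PP_dual {p q s : ℂ} (hp : ‖p‖ < 1) (hq : ‖q‖ < 1) (hp0 : p ≠ 0) (hq0 : q ≠ 0) (hs : s ^ 2 = p * q) {N : ℕ} {t : Fin N → ℂ}
    (h1 : ∀ i, ‖s‖ < ‖t i‖) (h2 : ∀ i, ‖t i‖ < 1) : PP p q t * PP p q (fun i => s / t i) = 1 := by
  unfold PP
  rw [← Finset.prod_mul_distrib]
  refine Finset.prod_eq_one (fun i _ => ?_)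
  rw [← Finset.prod_mul_distrib]
  refine Finset.prod_eq_one (fun j _ => ?_)
  have hs' : ‖p * q‖ = ‖s‖ * ‖s‖ := by rw [← hs, norm_pow, sq]
  have e : s / t i * (s / t j) = p * q / (t i * t j) := by rw [← hs]; ring
  rw [e]
  have n1 : ‖t i * t j‖ < 1 := by
    rw [norm_mul]
    exact mul_lt_one_of_nonneg_of_lt_one_left (norm_nonneg _) (h2 i) (h2 j).le
  refine Gm_refl (mul_ne_zero hp0 hq0) (EE_ne_zero_of_lt hp hq n1) (EE_ne_zero_of_lt hp hq ?_)
  have hi := h1 i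
  have hj := h1 j
  rw [norm_div, hs', norm_mul, div_lt_one (mul_pos ((norm_nonneg s).trans_lt hi) ((norm_nonneg s).trans_lt hj))]
  exact mul_lt_mul'' hi hj (norm_nonneg _) (norm_nonneg _)

lemma RT_symm {p q s : ℂ} (hp : ‖p‖ < 1) (hq : ‖q‖ < 1) (hp0 : p ≠ 0) (hq0 : q ≠ 0) (hs : s ^ 2 = p * q) {N n m : ℕ} (hN : N = 2 * n + 2 * m + 4) {d c : ℂ}
    (H : RT p q s N n m d c) : RT p q s N m n c d := by
  intro t h1 h2 hprod
  have hs0 : s ≠ 0 := by rintro rfl; exact mul_ne_zero hp0 hq0 (by rw [← hs]; simp)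
  have ht0 : ∀ i, t i ≠ 0 := fun i => norm_pos_iff.1 ((norm_nonneg s).trans_lt (h1 i))
  have h := H (fun i => s / t i) (fun i => ?_) (fun i => ?_) ?_
  · have e : (fun i => s / (s / t i)) = t := by
      funext i; have := ht0 i; field_simp
    simp only [e] at h
    have hd := PP_dual hp hq hp0 hq0 hs h1 h2
    linear_combination (-PP p q t) * h - c * JJ p q m t * hd
  · rw [norm_div, lt_div_iff₀ (norm_pos_iff.2 (ht0 i))]
    exact mul_lt_of_lt_one_right (norm_pos_iff.2 hs0) (h2 i)
  · rw [norm_div, div_lt_one (norm_pos_iff.2 (ht0 i))]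
    exact h1 i
  · rw [Finset.prod_div_distrib, hprod, Finset.prod_const, Finset.card_univ, Fintype.card_fin]
    have : s ^ N = (p * q) ^ (m + 1) * (p * q) ^ (n + 1) := by
      rw [← pow_add, ← hs, ← pow_mul]; congr 1; omega
    rw [this, mul_div_cancel_right₀ _ (pow_ne_zero _ (mul_ne_zero hp0 hq0))]

lemma RT_zero {p q s : ℂ} (hp : ‖p‖ < 1) (hq : ‖q‖ < 1) (hp0 : p ≠ 0) (hq0 : q ≠ 0) (hs : s ^ 2 = p * q) {m : ℕ} {d c : ℂ} : ∀ n : ℕ,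
    (RT p q s (2 * n + 2 * m + 4) n m d c) → RT p q s (2 * m + 4) 0 m d c
  | 0, H => by simpa using H
  | n+1, H => by
    have e : 2 * (n+1) + 2 * m + 4 = (2 * n + 2 * m + 3) + 1 + 2 := by ring
    rw [e] at H
    exact RT_zero hp hq hp0 hq0 hs n (RT_descend hp hq hp0 hq0 hs H)

lemma RT_one {p q s : ℂ} (hp : ‖p‖ < 1) (hq : ‖q‖ < 1) (hp0 : p ≠ 0) (hq0 : q ≠ 0) (hs : s ^ 2 = p * q) {n m : ℕ} {d c : ℂ}
    (H : RT p q s (2 * n + 2 * m + 4) n m d c) : d = c := by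
  have H1 := RT_symm hp hq hp0 hq0 hs (by ring) (RT_zero hp hq hp0 hq0 hs n H)
  have H2 := RT_zero hp hq hp0 hq0 hs m (m := 0) (by simpa using H1)
  have hs0 : s ≠ 0 := by rintro rfl; exact mul_ne_zero hp0 hq0 (by rw [← hs]; simp)
  obtain ⟨τ, hτ⟩ := IsAlgClosed.exists_pow_nat_eq s (n := 2) (by norm_num)
  have hs1 : ‖s‖ < 1 := by
    have : ‖s‖ ^ 2 < 1 := by
      rw [← norm_pow, hs, norm_mul]
      exact mul_lt_one_of_nonneg_of_lt_one_left (norm_nonneg _) hp hq.le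
    nlinarith [norm_nonneg s]
  have hτs : ‖τ‖ ^ 2 = ‖s‖ := by rw [← norm_pow, hτ]
  have hτ0 : τ ≠ 0 := by rintro rfl; exact hs0 (by rw [← hτ]; simp)
  have hτp : 0 < ‖τ‖ := norm_pos_iff.2 hτ0
  have hτ1 : ‖τ‖ < 1 := by nlinarith
  have h := H2 (fun _ => τ) (fun _ => by nlinarith) (fun _ => hτ1) (by
    simp only [Finset.prod_const, Finset.card_univ, Fintype.card_fin]
    calc τ ^ (2*0+4) = (τ^2)^2 := by ring
      _ = _ := by rw [hτ, hs]; ring)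
  have j1 : ∀ {N : ℕ} (t : Fin N → ℂ), JJ p q 0 t = 1 := fun t => by
    unfold JJ DD
    simp [torusInt, VV]
  have hr := Gm_refl (p := p) (q := q) (z := s) (mul_ne_zero hp0 hq0) (EE_ne_zero_of_lt hp hq hs1)
    (by rw [← hs]; rw [sq, mul_div_cancel_right₀ _ hs0]; exact EE_ne_zero_of_lt hp hq hs1)
  have e : p * q / s = s := by rw [← hs, sq, mul_div_cancel_right₀ _ hs0]
  rw [e] at hr
  have hP : PP p q (fun _ : Fin (2*0+4) => τ) = 1 := by
    have e2 : τ * τ = s := by rw [← hτ, sq]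
    unfold PP
    simp only [e2, Finset.prod_const]
    have : ∏ i : Fin (2*0+4), Gm p q s ^ (Finset.univ.filter (i < ·)).card = (Gm p q s * Gm p q s) ^ 3 := by
      have : ∀ i : Fin 4, (Finset.univ.filter (i < ·)).card = 3 - i.val := by decide
      show ∏ i : Fin 4, Gm p q s ^ (Finset.univ.filter (i < ·)).card = _
      simp only [this, Fin.prod_univ_four]
      simp
      ring
    rw [this, hr, one_pow]
  rw [j1, j1, hP] at h
  simpa using h.symm

lemma RT_small {p q s : ℂ} (hp : ‖p‖ < 1) (hq : ‖q‖ < 1) (hp0 : p ≠ 0) (hq0 : q ≠ 0)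
    (hs : s ^ 2 = p * q) (hqp : ‖q‖ < ‖p‖) {n m N : ℕ} (hN : N = 2 * (n + 1) + 2 * (m + 1) + 4)
    {δ : ℝ} (hpδ : ‖p‖ < δ) (hδ : ∀ (p q : ℂ) (e t : Fin N → ℂ), ‖p‖ < δ → ‖q‖ < δ →
    (∀ i, ‖e i‖ < δ) → (∀ i, ‖t i‖ < δ) → DE p q (m+1) e t ≠ 0)
    (τ : ℂ) (h1 : ‖s‖ < ‖p‖ ^ 2 * ‖τ‖) (h2 : ‖τ‖ < ‖p‖ ^ 2) (hprod : τ ^ N = (p * q) ^ (m + 2)) :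
    RT p q s N (n+1) (m+1) 1 1 := by
  obtain ⟨c, hc⟩ := DD_const hp hq hp0 hq0 hs hqp hN hpδ hδ τ h1 h2 hprod
  have hA : pochInf p p * pochInf q q ≠ 0 := (mul_ne_zero (poch_ne_zero_of_lt hp hp) (poch_ne_zero_of_lt hq hq))
  have hf1 : ∀ k : ℕ, (pochInf p p * pochInf q q) ^ k / (2 ^ k * k.factorial : ℂ) ≠ 0 := fun k =>
    div_ne_zero (pow_ne_zero _ hA) (mul_ne_zero (pow_ne_zero _ two_ne_zero) (by exact_mod_cast k.factorial_ne_zero))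
  have H : RT p q s N (n+1) (m+1) 1 (c * ((pochInf p p * pochInf q q) ^ (n+1) / (2 ^ (n+1) * (n+1).factorial)) / ((pochInf p p * pochInf q q) ^ (m+1) / (2 ^ (m+1) * (m+1).factorial))) := by
    intro t ht1 ht2 hp'
    have := hc t ht1 ht2 hp'
    unfold JJ
    rw [this]
    have a := hf1 (m+1)
    generalize (pochInf p p * pochInf q q) ^ (m+1) / (2 ^ (m+1) * (m+1).factorial : ℂ) = X at *
    field_simp
  subst hN
  have := RT_one hp hq hp0 hq0 hs H
  rwa [← this] at H
end Rains

namespace Rains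
open Filter Topology Set

lemma main_JJ {p q s : ℂ} (hp : ‖p‖ < 1) (hq : ‖q‖ < 1) (hp0 : p ≠ 0) (hq0 : q ≠ 0)
    (hs : s ^ 2 = p * q) {n m N : ℕ} (hN : N = 2 * (n + 1) + 2 * (m + 1) + 4) (t : Fin N → ℂ)
    (ht1 : ∀ i, ‖s‖ < ‖t i‖) (ht2 : ∀ i, ‖t i‖ < 1) (hprod : ∏ i, t i = (p * q) ^ (m + 2)) :
    JJ p q (n+1) t = PP p q t * JJ p q (m+1) (fun i => s / t i) := by
  have hs0 : s ≠ 0 := by rintro rfl; exact mul_ne_zero hp0 hq0 (by rw [← hs]; simp)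
  have ht0 : ∀ i, t i ≠ 0 := fun i => norm_pos_iff.1 ((norm_nonneg s).trans_lt (ht1 i))
  obtain ⟨δ, hδ0, hδ⟩ := DE_ne_zero (m+1) (Fin N)
  have hNpos : 0 < N := by omega
  have hNR : (0:ℝ) < N := by exact_mod_cast hNpos
  have hNC : (N:ℂ) ≠ 0 := by exact_mod_cast hNpos.ne'
  set P1 := Complex.log p with hP1
  set S1 := Complex.log s with hS1
  have eP1 : Complex.exp P1 = p := Complex.exp_log hp0
  have eS1 : Complex.exp S1 = s := Complex.exp_log hs0
  set a : ℝ := 2 * (m + 2) / N with ha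
  have haN : (a:ℂ) * N = 2 * (m + 2) := by
    have : a * N = 2 * (m + 2) := by rw [ha]; field_simp
    exact_mod_cast this
  have ha0 : 0 < a := by positivity
  have ha1 : a < 1 := by
    rw [ha, div_lt_one hNR, hN]; push_cast; linarith
  have hτ1 : Complex.exp (a * S1) ^ N = (p * q) ^ (m + 2) := by
    rw [← Complex.exp_nat_mul, ← hs, ← eS1, ← Complex.exp_nat_mul, ← Complex.exp_nat_mul]
    congr 1
    push_cast
    linear_combination S1 * haN
  obtain ⟨w, hw0, hw⟩ := exists_logs hNpos (Complex.exp_ne_zero (a * S1)) ht0 (hprod.trans hτ1.symm)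
  obtain ⟨R, hR0, hRδ⟩ : ∃ R : ℝ, 0 < R ∧ Real.exp (-R) < δ := by
    have h1 : Tendsto (fun R : ℝ => Real.exp (-R)) atTop (𝓝 0) := Real.tendsto_exp_neg_atTop_nhds_zero
    obtain ⟨R, h2, h3⟩ := ((h1.eventually (gt_mem_nhds hδ0)).and (eventually_gt_atTop 0)).exists
    exact ⟨R, h3, h2⟩
  let P0 : ℂ := ((-R : ℝ) : ℂ)
  let S0 : ℂ := ((-(2 * N * R) : ℝ) : ℂ)
  let Q0 : ℂ := 2 * S0 - P0
  let Q1 : ℂ := 2 * S1 - P1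
  have eQ1 : Complex.exp Q1 = q := by
    simp only [Q1]
    rw [Complex.exp_sub, eP1, two_mul, Complex.exp_add, eS1, ← sq, hs]
    field_simp
  let A : (Unit ⊕ Unit) ⊕ (Fin N ⊕ Fin N) → ℂ := Sum.elim (Sum.elim (fun _ => P0) (fun _ => Q0)) (Sum.elim (fun _ => a * S0) (fun _ => S0 - a * S0))
  let B : (Unit ⊕ Unit) ⊕ (Fin N ⊕ Fin N) → ℂ := Sum.elim (Sum.elim (fun _ => P1 - P0) (fun _ => Q1 - Q0))
    (Sum.elim (fun i => a * (S1 - S0) + w i) (fun i => (S1 - S0) - (a * (S1 - S0) + w i)))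
  let pf : ℂ → ℂ := fun x => Complex.exp (P0 + x * (P1 - P0))
  let qf : ℂ → ℂ := fun x => Complex.exp (Q0 + x * (Q1 - Q0))
  let sf : ℂ → ℂ := fun x => Complex.exp (S0 + x * (S1 - S0))
  let tf : Fin N → ℂ → ℂ := fun i x => Complex.exp (a * S0 + x * (a * (S1 - S0) + w i))
  let uf : Fin N → ℂ → ℂ := fun i x => Complex.exp ((S0 - a * S0) + x * ((S1 - S0) - (a * (S1 - S0) + w i)))
  have huf : ∀ i x, sf x / tf i x = uf i x := fun i x => by
    simp only [sf, tf, uf]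
    rw [← Complex.exp_sub]; congr 1; ring
  let f : ℂ → ℂ := fun x => JJ (pf x) (qf x) (n+1) (fun i => tf i x) - PP (pf x) (qf x) (fun i => tf i x) * JJ (pf x) (qf x) (m+1) (fun i => uf i x)
  have p1 : pf 1 = p := by simp only [pf]; rw [← eP1]; congr 1; ring
  have q1 : qf 1 = q := by simp only [qf]; rw [← eQ1]; congr 1; ring
  have s1 : sf 1 = s := by simp only [sf]; rw [← eS1]; congr 1; ring
  have t1 : ∀ i, tf i 1 = t i := fun i => by
    simp only [tf]; rw [← hw i, ← Complex.exp_add]; congr 1; ring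
  have u1 : ∀ i, uf i 1 = s / t i := fun i => by rw [← huf, s1, t1]
  have nexp : ∀ z : ℂ, ‖Complex.exp z‖ < 1 ↔ z.re < 0 := fun z => by rw [Complex.norm_exp, Real.exp_lt_one_iff]
  set S : Set ℂ := {x | ∀ k, (A k + x * B k).re < 0} with hS
  have hSopen : IsOpen S := by
    rw [hS, Set.ofPred_forall]
    exact isOpen_iInter_of_finite (fun k => isOpen_lt (by fun_prop) continuous_const)
  have mp : ∀ x ∈ S, ‖pf x‖ < 1 := fun x hx => (nexp _).2 (hx (Sum.inl (Sum.inl ())))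
  have mq : ∀ x ∈ S, ‖qf x‖ < 1 := fun x hx => (nexp _).2 (hx (Sum.inl (Sum.inr ())))
  have mt : ∀ x ∈ S, ∀ i, ‖tf i x‖ < 1 := fun x hx i => (nexp _).2 (hx (Sum.inr (Sum.inl i)))
  have mu : ∀ x ∈ S, ∀ i, ‖uf i x‖ < 1 := fun x hx i => (nexp _).2 (hx (Sum.inr (Sum.inr i)))
  have an : ∀ (c d : ℂ) x, AnalyticAt ℂ (fun x : ℂ => Complex.exp (c + x * d)) x := fun c d x =>
    AnalyticAt.cexp (analyticAt_const.add (analyticAt_id.mul analyticAt_const))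
  have hA0 : ∀ k, (A k).re < 0 := by
    rintro ((k | k) | (k | k))
    · show P0.re < 0
      simp only [P0, Complex.ofReal_re]; linarith
    · show Q0.re < 0
      have : Q0 = ((2 * (-(2 * N * R)) - (-R) : ℝ) : ℂ) := by simp only [Q0, S0, P0]; push_cast; ring
      rw [this, Complex.ofReal_re]
      have : (1:ℝ) ≤ N := by exact_mod_cast hNpos
      nlinarith
    · show ((a:ℂ) * S0).re < 0
      have : (a:ℂ) * S0 = ((a * (-(2 * N * R)) : ℝ) : ℂ) := by simp only [S0]; push_cast; ring
      rw [this, Complex.ofReal_re]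
      have : 0 < a * (2 * N * R) := by positivity
      linarith
    · show (S0 - (a:ℂ) * S0).re < 0
      have : S0 - (a:ℂ) * S0 = ((-((1 - a) * (2 * N * R)) : ℝ) : ℂ) := by simp only [S0]; push_cast; ring
      rw [this, Complex.ofReal_re]
      have : 0 < (1 - a) * (2 * N * R) := mul_pos (by linarith) (by positivity)
      linarith
  have h1S : (1:ℂ) ∈ S := by
    rintro ((k | k) | (k | k))
    · exact (nexp _).1 (show ‖pf 1‖ < 1 by rw [p1]; exact hp)
    · exact (nexp _).1 (show ‖qf 1‖ < 1 by rw [q1]; exact hq)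
    · exact (nexp _).1 (show ‖tf k 1‖ < 1 by rw [t1]; exact ht2 k)
    · refine (nexp _).1 (show ‖uf k 1‖ < 1 from ?_)
      rw [u1, norm_div, div_lt_one (norm_pos_iff.2 (ht0 k))]; exact ht1 k
  have key : f 1 = 0 := by
    refine line_lemma A B hA0 (fun k => by simpa using h1S k) ?_ ?_
    · change DifferentiableOn ℂ f S
      have dpoch : ∀ k : ℕ, DifferentiableOn ℂ (fun x => (pochInf (pf x) (pf x) * pochInf (qf x) (qf x)) ^ k / (2 ^ k * k.factorial : ℂ)) S := fun k x hx => by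
        have b1 : AnalyticAt ℂ (fun x => pochInf (pf x) (pf x)) x := poch_analyticAt (an _ _ x) (an _ _ x) (mp x hx)
        have b2 : AnalyticAt ℂ (fun x => pochInf (qf x) (qf x)) x := poch_analyticAt (an _ _ x) (an _ _ x) (mq x hx)
        exact (((b1.mul b2).pow k).differentiableAt.div_const _).differentiableWithinAt
      have d1 : DifferentiableOn ℂ (fun x => DD (pf x) (qf x) (n+1) (fun i => tf i x)) S :=
        DD_differentiableOn hSopen (fun x _ => an _ _ x) mp (fun x _ => an _ _ x) mq (fun x _ i => an _ _ x) mt (fun x _ i => Complex.exp_ne_zero _)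
      have d2 : DifferentiableOn ℂ (fun x => DD (pf x) (qf x) (m+1) (fun i => uf i x)) S :=
        DD_differentiableOn hSopen (fun x _ => an _ _ x) mp (fun x _ => an _ _ x) mq (fun x _ i => an _ _ x) mu (fun x _ i => Complex.exp_ne_zero _)
      have d3 : DifferentiableOn ℂ (fun x => PP (pf x) (qf x) (fun i => tf i x)) S := fun x hx =>
        (PP_analyticAt (an _ _ x) (mp x hx) (an _ _ x) (mq x hx) (fun i => an _ _ x) (fun i => Complex.exp_ne_zero _) (mt x hx)).differentiableAt.differentiableWithinAt
      exact ((dpoch _).mul d1).sub (d3.mul ((dpoch _).mul d2))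
    · have h0S : (0:ℂ) ∈ S := fun k => by simpa using hA0 k
      let τf : ℂ → ℂ := fun x => Complex.exp (a * (S0 + x * (S1 - S0)))
      have cp : Continuous pf := by fun_prop
      have cq : Continuous qf := by fun_prop
      have cs : Continuous sf := by fun_prop
      have cτ : Continuous τf := by fun_prop
      have np : ‖pf 0‖ = Real.exp (-R) := by simp only [pf, P0]; rw [Complex.norm_exp]; simp
      have nq : ‖qf 0‖ = Real.exp (-((4 * N - 1) * R)) := by
        simp only [qf, Q0, P0, S0]; rw [Complex.norm_exp]; simp; ring
      have ns : ‖sf 0‖ = Real.exp (-(2 * N * R)) := by simp only [sf, S0]; rw [Complex.norm_exp]; simp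
      have nτ : ‖τf 0‖ = Real.exp (-(4 * (m + 2) * R)) := by
        simp only [τf, S0]; rw [Complex.norm_exp]
        have : (a:ℂ) * (((-(2 * N * R) : ℝ) : ℂ) + 0 * (S1 - ((-(2 * N * R) : ℝ) : ℂ))) = ((a * (-(2 * N * R)) : ℝ) : ℂ) := by push_cast; ring
        rw [this, Complex.ofReal_re]
        congr 1
        have : a * N = 2 * (m + 2) := by rw [ha]; field_simp
        linear_combination (-2 * R) * this
      have hNr : (N:ℝ) = 2 * (n + 1) + 2 * (m + 1) + 4 := by rw [hN]; push_cast; ring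
      have hnn : (0:ℝ) ≤ n := Nat.cast_nonneg n
      have hmm : (0:ℝ) ≤ m := Nat.cast_nonneg m
      have ev1 : ∀ᶠ x in 𝓝 (0:ℂ), ‖pf x‖ < δ := cp.norm.continuousAt.eventually_lt continuousAt_const (by rw [np]; exact hRδ)
      have ev2 : ∀ᶠ x in 𝓝 (0:ℂ), ‖qf x‖ < ‖pf x‖ := cq.norm.continuousAt.eventually_lt cp.norm.continuousAt (by
        rw [np, nq, Real.exp_lt_exp, hNr]; nlinarith)
      have ev3 : ∀ᶠ x in 𝓝 (0:ℂ), ‖sf x‖ < ‖pf x‖ ^ 2 * ‖τf x‖ := cs.norm.continuousAt.eventually_lt ((cp.norm.pow 2).mul cτ.norm).continuousAt (by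
        rw [np, ns, nτ, ← Real.exp_nat_mul, ← Real.exp_add, Real.exp_lt_exp, hNr]; push_cast; nlinarith)
      have ev4 : ∀ᶠ x in 𝓝 (0:ℂ), ‖τf x‖ < ‖pf x‖ ^ 2 := cτ.norm.continuousAt.eventually_lt (cp.norm.pow 2).continuousAt (by
        rw [np, nτ, ← Real.exp_nat_mul, Real.exp_lt_exp]; push_cast; nlinarith)
      filter_upwards [ev1, ev2, ev3, ev4, hSopen.mem_nhds h0S] with x e1 e2 e3 e4 hx
      have hs2 : sf x ^ 2 = pf x * qf x := by
        simp only [sf, pf, qf, Q0, Q1]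
        rw [← Complex.exp_nat_mul, ← Complex.exp_add]; congr 1; push_cast; ring
      have hpw : ∀ y : ℂ, Complex.exp (a * y) ^ N = (Complex.exp y ^ 2) ^ (m+2) := fun y => by
        rw [← Complex.exp_nat_mul, ← Complex.exp_nat_mul, ← Complex.exp_nat_mul]; congr 1
        push_cast
        linear_combination y * haN
      have hRT := RT_small (mp x hx) (mq x hx) (Complex.exp_ne_zero _) (Complex.exp_ne_zero _) hs2 e2 hN e1 hδ (τf x) e3 e4 (by rw [← hs2]; exact hpw _)
      have h := hRT (fun i => tf i x) (fun i => ?_) (mt x hx) ?_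
      · simp only [huf, one_mul] at h
        simp only [f]
        rw [h, sub_self]
      · have := mu x hx i
        rw [← huf, norm_div, div_lt_one (norm_pos_iff.2 (Complex.exp_ne_zero _))] at this
        exact this
      · rw [← hs2, show m + 1 + 1 = m + 2 from rfl]
        rw [show (sf x ^ 2) ^ (m+2) = τf x ^ N from (hpw _).symm]
        simp only [tf, τf]
        rw [← Complex.exp_sum, ← Complex.exp_nat_mul]
        congr 1
        simp only [Finset.sum_add_distrib, ← Finset.mul_sum, hw0, Finset.sum_const, Finset.card_univ, Fintype.card_fin, nsmul_eq_mul]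
        ring
  have : f 1 = JJ p q (n+1) t - PP p q t * JJ p q (m+1) (fun i => s / t i) := by
    simp only [f, p1, q1, t1, u1]
  rw [this] at key
  exact sub_eq_zero.1 key
end Rains

/-- Rains' symmetry transformation for the type I `BC_n` elliptic hypergeometric
integrals: `I_n^{(m)}(t₁,…,t_{2n+2m+4}) = ∏_{r<s'} Γ(t_r t_{s'};p,q) ·
I_m^{(n)}(√(pq)/t₁,…,√(pq)/t_{2n+2m+4})`. -/
theorem rains_transformation (n m : ℕ) (hn : 1 ≤ n) (hm : 1 ≤ m) (p q s : ℂ)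
    (hp0 : 0 < ‖p‖) (hp1 : ‖p‖ < 1)
    (hq0 : 0 < ‖q‖) (hq1 : ‖q‖ < 1)
    (hs : s ^ 2 = p * q)
    (t : Fin (2 * n + 2 * m + 4) → ℂ)
    (htlo : ∀ j, Real.sqrt ‖p * q‖ < ‖t j‖)
    (hthi : ∀ j, ‖t j‖ < 1)
    (hbal : ∏ j, t j = (p * q) ^ (m + 1)) :
    rainsI p q n t =
      (∏ ij ∈ Finset.univ.filter
          (fun ij : Fin (2 * n + 2 * m + 4) × Fin (2 * n + 2 * m + 4) => ij.1 < ij.2),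
          ellGamma (t ij.1 * t ij.2) p q) *
        rainsI p q m (fun j => s / t j) := by
  obtain ⟨n, rfl⟩ : ∃ k, n = k + 1 := ⟨n - 1, by omega⟩
  obtain ⟨m, rfl⟩ : ∃ k, m = k + 1 := ⟨m - 1, by omega⟩
  have hsn : Real.sqrt ‖p * q‖ = ‖s‖ := by
    rw [← hs, norm_pow, Real.sqrt_sq (norm_nonneg s)]
  have hJ : ∀ (k : ℕ) {L : ℕ} (u : Fin L → ℂ), rainsI p q k u = Rains.JJ p q k u := fun k L u => by
    unfold rainsI Rains.JJ
    rw [Rains.torusInt_deltaBC hp1 hq1, mul_pow]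
  have hP : (∏ ij ∈ Finset.univ.filter
          (fun ij : Fin (2 * (n+1) + 2 * (m+1) + 4) × Fin (2 * (n+1) + 2 * (m+1) + 4) => ij.1 < ij.2),
          ellGamma (t ij.1 * t ij.2) p q) = Rains.PP p q t := by
    unfold Rains.PP
    rw [Finset.prod_filter, Fintype.prod_prod_type]
    refine Finset.prod_congr rfl (fun i _ => ?_)
    rw [Finset.prod_filter]
    refine Finset.prod_congr rfl (fun j _ => ?_)
    simp only [Rains.ellGamma_eq hp1 hq1]
    rfl
  rw [hJ, hJ, hP]
  exact Rains.main_JJ hp1 hq1 (norm_pos_iff.1 hp0) (norm_pos_iff.1 hq0) hs rfl t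
    (fun i => hsn ▸ htlo i) hthi hbal
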